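/- Let π be a set of primes with 2 ∈ π, and let G be a finite π-separable group. Let χ ∈ Irr(G) be a lift of φ ∈ I_π(G). Suppose ψ is a π-factored irreducible character of some subgroup H of G with ψ^G = χ, and suppose there is a normal subgroup N of G such that all irreducible constituents of χ_N are π-factored and G = NH. Then χ is π-factored, and the π'-special factor of χ restricts irreducibly to the π'-special factor of ψ. -/

import Mathlib

open scoped Classical

noncomputable section

/-- All prime divisors of `n` belong to the set of primes `σ`. -/
def IsPiNumber (σ : Set ℕ) (n : ℕ) : Prop :=
  ∀ q : ℕ, q.Prime → q ∣ n → q ∈ σ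

/-- `g` is a `σ`-element: its order is a `σ`-number. -/
def IsPiElt (σ : Set ℕ) {G : Type} [Group G] (g : G) : Prop :=
  IsPiNumber σ (orderOf g)

/-- The `p`-part of a natural number. -/
def pPart (p n : ℕ) : ℕ := p ^ (n.factorization p)

/-- `χ` is the character of a finite-dimensional complex representation of `G`. -/
def IsCharacter (G : Type) [Group G] (χ : G → ℂ) : Prop :=
  ∃ V : FDRep ℂ G, ∀ g, χ g = V.character g

/-- `χ` is an irreducible (ordinary, complex) character of `G`: a nonzero character
which is not the sum of two nonzero characters. -/
def IsIrrChar (G : Type) [Group G] (χ : G → ℂ) : Prop :=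
  IsCharacter G χ ∧ χ ≠ 0 ∧
    ¬ ∃ χ₁ χ₂ : G → ℂ, IsCharacter G χ₁ ∧ χ₁ ≠ 0 ∧ IsCharacter G χ₂ ∧ χ₂ ≠ 0 ∧ χ = χ₁ + χ₂

/-- Restriction of a class function on `G` to a subgroup `H`. -/
def resChar {G : Type} [Group G] (H : Subgroup G) (χ : G → ℂ) : ↥H → ℂ :=
  fun h => χ (h : G)

/-- Restriction of a class function between nested subgroups. -/
def resCharLe {G : Type} [Group G] {K H : Subgroup G} (hKH : K ≤ H) (χ : ↥H → ℂ) : ↥K → ℂ :=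
  fun k => χ ⟨(k : G), hKH k.2⟩

/-- The induced class function from a subgroup `H` of `G`, given by the usual
induction formula. -/
def indChar {G : Type} [Group G] [Fintype G] (H : Subgroup G) (ψ : ↥H → ℂ) : G → ℂ :=
  fun g => (Nat.card ↥H : ℂ)⁻¹ *
    ∑ x : G, if h : x * g * x⁻¹ ∈ H then ψ ⟨x * g * x⁻¹, h⟩ else 0

/-- Induction of a class function between nested subgroups. -/
def indCharLe {G : Type} [Group G] [Fintype G] {K H : Subgroup G} (_ : K ≤ H)
    (ψ : ↥K → ℂ) : ↥H → ℂ :=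
  fun x => (Nat.card ↥K : ℂ)⁻¹ *
    ∑ y : ↥H, if h : (y : G) * (x : G) * (y : G)⁻¹ ∈ K then ψ ⟨(y : G) * (x : G) * (y : G)⁻¹, h⟩ else 0

/-- `θ` is an irreducible constituent of the class function `χ`. -/
def IsConstituent {G : Type} [Group G] (θ χ : G → ℂ) : Prop :=
  IsIrrChar G θ ∧ ∃ ξ : G → ℂ, (ξ = 0 ∨ IsCharacter G ξ) ∧ χ = θ + ξ

/-- The restriction `χ^o` of a class function to the `σ`-elements of `G`
(extended by zero elsewhere). -/
def piRestrict (σ : Set ℕ) {G : Type} [Group G] (χ : G → ℂ) : G → ℂ :=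
  fun g => if IsPiElt σ g then χ g else 0

/-- `φ` is a `σ`-partial character of `G`: the restriction to the `σ`-elements of an
ordinary character. -/
def IsPartialChar (σ : Set ℕ) (G : Type) [Group G] (φ : G → ℂ) : Prop :=
  ∃ χ : G → ℂ, IsCharacter G χ ∧ χ ≠ 0 ∧ φ = piRestrict σ χ

/-- `φ ∈ I_σ(G)`: an irreducible `σ`-partial character, i.e. one which is not the
sum of two `σ`-partial characters. -/
def IsIPiChar (σ : Set ℕ) (G : Type) [Group G] (φ : G → ℂ) : Prop :=
  IsPartialChar σ G φ ∧
    ¬ ∃ φ₁ φ₂ : G → ℂ, IsPartialChar σ G φ₁ ∧ IsPartialChar σ G φ₂ ∧ φ = φ₁ + φ₂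

/-- `φ ∈ IBr(G)` (at the prime `p`): irreducible Brauer characters are the irreducible
`p'`-partial characters, where the `p`-regular elements are the `{p}ᶜ`-elements. -/
def IsIBrChar (p : ℕ) (G : Type) [Group G] (φ : G → ℂ) : Prop :=
  IsIPiChar ({p}ᶜ) G φ

/-- The restriction `χ^o` of `χ` to the `p`-regular elements of `G`. -/
def brRestrict (p : ℕ) {G : Type} [Group G] (χ : G → ℂ) : G → ℂ :=
  piRestrict ({p}ᶜ) χ

/-- `χ` is a lift of the `σ`-partial character `φ`. -/
def IsLiftOfPi (σ : Set ℕ) (G : Type) [Group G] (χ φ : G → ℂ) : Prop :=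
  IsIrrChar G χ ∧ piRestrict σ χ = φ

/-- `χ` is a lift: `χ` is irreducible and `χ^o` is an irreducible `σ`-partial character. -/
def IsLiftPi (σ : Set ℕ) (G : Type) [Group G] (χ : G → ℂ) : Prop :=
  IsIrrChar G χ ∧ IsIPiChar σ G (piRestrict σ χ)

/-- `H` is a subnormal subgroup of `G`. -/
def IsSubnormalSubgroup {G : Type} [Group G] (H : Subgroup G) : Prop :=
  ∃ (n : ℕ) (c : Fin (n + 1) → Subgroup G),
    c 0 = H ∧ c (Fin.last n) = ⊤ ∧
    ∀ i : Fin n, c i.castSucc ≤ c i.succ ∧ ((c i.castSucc).subgroupOf (c i.succ)).Normal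

/-- The determinantal order `o(det θ)` of `θ` is a `σ`-number. -/
def HasPiDetOrder (σ : Set ℕ) (G : Type) [Group G] (θ : G → ℂ) : Prop :=
  ∃ V : FDRep ℂ G, (∀ g, θ g = V.character g) ∧
    IsPiNumber σ (orderOf (fun g : G => LinearMap.det (V.ρ g)))

/-- `χ` is a `σ`-special character of `G`: `χ` is irreducible, `χ(1)` is a `σ`-number,
and for every subnormal subgroup `M` of `G`, every irreducible constituent of `χ_M`
has determinantal order a `σ`-number. -/
def IsPiSpecial (σ : Set ℕ) (G : Type) [Group G] (χ : G → ℂ) : Prop :=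
  IsIrrChar G χ ∧ (∃ n : ℕ, χ 1 = (n : ℂ) ∧ IsPiNumber σ n) ∧
    ∀ M : Subgroup G, IsSubnormalSubgroup M →
      ∀ θ : ↥M → ℂ, IsConstituent θ (resChar M χ) → HasPiDetOrder σ ↥M θ

/-- `χ` is `σ`-factored: `χ = αβ` with `α` `σ`-special and `β` `σ'`-special. -/
def IsPiFactored (σ : Set ℕ) (G : Type) [Group G] (χ : G → ℂ) : Prop :=
  ∃ α β : G → ℂ, IsPiSpecial σ G α ∧ IsPiSpecial σᶜ G β ∧ χ = α * β

/-- `G` is `σ`-separable: it has a subnormal series each of whose factors is a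
`σ`-group or a `σ'`-group (equivalently, every composition factor is a `σ`-group or a
`σ'`-group). -/
def IsPiSeparable (σ : Set ℕ) (G : Type) [Group G] : Prop :=
  ∃ (n : ℕ) (c : Fin (n + 1) → Subgroup G),
    c 0 = ⊥ ∧ c (Fin.last n) = ⊤ ∧
    ∀ i : Fin n, c i.castSucc ≤ c i.succ ∧ ((c i.castSucc).subgroupOf (c i.succ)).Normal ∧
      (IsPiNumber σ (Nat.card (↥(c i.succ) ⧸ (c i.castSucc).subgroupOf (c i.succ))) ∨
        IsPiNumber σᶜ (Nat.card (↥(c i.succ) ⧸ (c i.castSucc).subgroupOf (c i.succ))))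

/-- `G` is `p`-solvable: every composition factor is a `p`-group or a `p'`-group. -/
def IsPSolvable (p : ℕ) (G : Type) [Group G] : Prop :=
  IsPiSeparable {p} G

/-- The character `δ` of the subgroup `Q` is invariant under (conjugation by the
elements of) the subgroup `S`. -/
def InvariantUnder {G : Type} [Group G] (Q : Subgroup G) (δ : ↥Q → ℂ) (S : Subgroup G) : Prop :=
  ∀ g ∈ S, ∀ x : ↥Q, ∀ h : g * (x : G) * g⁻¹ ∈ Q, δ ⟨g * (x : G) * g⁻¹, h⟩ = δ x

/-- `(Q, δ)` is a vertex pair for `χ ∈ Irr(G)` (at the prime `p`): `Q` is a `p`-subgroup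
of `G`, `δ ∈ Irr(Q)`, and there are a subgroup `U ≤ G` and an irreducible character
`ψ = αβ` of `U` with `α` `p'`-special and `β` `p`-special, such that `ψ^G = χ`, `Q` is a
Sylow `p`-subgroup of `U`, and `β_Q = δ`. -/
def IsVertexPair (p : ℕ) {G : Type} [Group G] [Fintype G] (χ : G → ℂ)
    (Q : Subgroup G) (δ : ↥Q → ℂ) : Prop :=
  IsPGroup p ↥Q ∧ IsIrrChar ↥Q δ ∧
    ∃ (U : Subgroup G) (hQU : Q ≤ U) (α β : ↥U → ℂ),
      IsPiSpecial ({p}ᶜ) ↥U α ∧ IsPiSpecial {p} ↥U β ∧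
      IsIrrChar ↥U (α * β) ∧ indChar U (α * β) = χ ∧
      ¬ p ∣ (Q.subgroupOf U).index ∧
      ∀ x : ↥Q, δ x = β ⟨(x : G), hQU x.2⟩

/-- `(Q, δ)` is a generalized `σ`-vertex for `χ ∈ Irr(G)`: there are `U ≤ G` and an
irreducible `ψ = αβ ∈ Irr(U)` with `α` `σ`-special and `β` `σ'`-special such that
`ψ^G = χ`, `Q` is a Hall `σ'`-subgroup of `U` and `δ = β_Q`. -/
def IsGenPiVertex (σ : Set ℕ) {G : Type} [Group G] [Fintype G] (χ : G → ℂ)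
    (Q : Subgroup G) (δ : ↥Q → ℂ) : Prop :=
  ∃ (U : Subgroup G) (hQU : Q ≤ U) (α β : ↥U → ℂ),
    IsPiSpecial σ ↥U α ∧ IsPiSpecial σᶜ ↥U β ∧
    IsIrrChar ↥U (α * β) ∧ indChar U (α * β) = χ ∧
    IsPiNumber σᶜ (Nat.card ↥Q) ∧ IsPiNumber σ ((Q.subgroupOf U).index) ∧
    ∀ x : ↥Q, δ x = β ⟨(x : G), hQU x.2⟩

/-- The pair `(Q₂, δ₂)` is the conjugate of the pair `(Q₁, δ₁)` by the element `g`. -/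
def IsConjPair {G : Type} [Group G] (g : G)
    (Q₁ : Subgroup G) (δ₁ : ↥Q₁ → ℂ) (Q₂ : Subgroup G) (δ₂ : ↥Q₂ → ℂ) : Prop :=
  Q₂ = Subgroup.map (MulAut.conj g).toMonoidHom Q₁ ∧
    ∀ x : ↥Q₁, ∀ h : g * (x : G) * g⁻¹ ∈ Q₂, δ₂ ⟨g * (x : G) * g⁻¹, h⟩ = δ₁ x

/-- `Q` is a vertex (subgroup) of the irreducible `σ`-partial character `φ` of `G`:
`Q` is a Hall `σ'`-subgroup of a subgroup `U ≤ G` possessing an irreducible `σ`-partial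
character `κ` of `σ`-degree with `κ^G = φ`. -/
def IsVertexSubgroup (σ : Set ℕ) {G : Type} [Group G] [Fintype G] (φ : G → ℂ)
    (Q : Subgroup G) : Prop :=
  ∃ (U : Subgroup G) (κ : ↥U → ℂ), Q ≤ U ∧
    IsPiNumber σᶜ (Nat.card ↥Q) ∧ IsPiNumber σ ((Q.subgroupOf U).index) ∧
    IsIPiChar σ ↥U κ ∧ (∃ n : ℕ, κ 1 = (n : ℂ) ∧ IsPiNumber σ n) ∧
    indChar U κ = φ

/-- `θ ∈ I_σ(M)` is an irreducible constituent of the restriction `φ_M`. -/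
def IsIPiConstituent (σ : Set ℕ) {G : Type} [Group G] (M : Subgroup G)
    (θ : ↥M → ℂ) (φ : G → ℂ) : Prop :=
  IsIPiChar σ ↥M θ ∧ ∃ ξ : ↥M → ℂ, (ξ = 0 ∨ IsPartialChar σ ↥M ξ) ∧ resChar M φ = θ + ξ

set_option linter.unusedSectionVars false

namespace PiSep
open Representation

section Base
variable {K : Type} [Group K]

theorem isCharacter_of_rep {V : Type} [AddCommGroup V] [Module ℂ V] [FiniteDimensional ℂ V]
    (ρ : Representation ℂ K V) : IsCharacter K ρ.character :=
  ⟨FDRep.of ρ, fun _ => rfl⟩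

theorem exists_rep {χ : K → ℂ} (h : IsCharacter K χ) :
    ∃ (V : Type) (_ : AddCommGroup V) (_ : Module ℂ V) (_ : FiniteDimensional ℂ V)
      (ρ : Representation ℂ K V), χ = ρ.character := by
  obtain ⟨V, hV⟩ := h
  exact ⟨V, inferInstance, inferInstance, inferInstance, V.ρ, funext hV⟩

theorem isCharacter_of_matrix {n : ℕ} (ρ : K →* Matrix (Fin n) (Fin n) ℂ) :
    IsCharacter K (fun x => (ρ x).trace) := by
  let σ : Representation ℂ K (Fin n → ℂ) :=
    (Matrix.toLinAlgEquiv' : Matrix (Fin n) (Fin n) ℂ ≃ₐ[ℂ] _).toAlgHom.toRingHom.toMonoidHom.comp ρ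
  convert isCharacter_of_rep σ using 1
  ext x
  simp only [Representation.character, σ]
  exact (Matrix.trace_toLin'_eq (ρ x)).symm

/-- `χ` is afforded by a matrix representation with determinant `d`. -/
def HasDetOn (K : Type) [Group K] (χ d : K → ℂ) : Prop :=
  ∃ (n : ℕ) (ρ : K →* Matrix (Fin n) (Fin n) ℂ),
    (∀ x, χ x = (ρ x).trace) ∧ ∀ x, d x = (ρ x).det

theorem hasDetOn_of_rep {V : Type} [AddCommGroup V] [Module ℂ V] [FiniteDimensional ℂ V]
    (ρ : Representation ℂ K V) :
    HasDetOn K ρ.character (fun x => LinearMap.det (ρ x)) := by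
  let b := Module.finBasis ℂ V
  refine ⟨_, (LinearMap.toMatrixAlgEquiv b).toAlgHom.toRingHom.toMonoidHom.comp ρ, ?_, ?_⟩
  · intro x
    exact LinearMap.trace_eq_matrix_trace ℂ b (ρ x)
  · intro x
    exact (LinearMap.det_toMatrix b (ρ x)).symm

theorem exists_matrix {χ : K → ℂ} (h : IsCharacter K χ) :
    ∃ (n : ℕ) (ρ : K →* Matrix (Fin n) (Fin n) ℂ), ∀ x, χ x = (ρ x).trace := by
  obtain ⟨V, _, _, _, ρ, rfl⟩ := exists_rep h
  obtain ⟨n, σ, h, -⟩ := hasDetOn_of_rep ρ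
  exact ⟨n, σ, h⟩

theorem rep_induction [Finite K]
    (P : ∀ (V : Type) [AddCommGroup V] [Module ℂ V] [FiniteDimensional ℂ V],
      Representation ℂ K V → Prop)
    (h0 : ∀ (V : Type) [AddCommGroup V] [Module ℂ V] [FiniteDimensional ℂ V]
      (ρ : Representation ℂ K V), Subsingleton V → P V ρ)
    (hirr : ∀ (V : Type) [AddCommGroup V] [Module ℂ V] [FiniteDimensional ℂ V]
      (ρ : Representation ℂ K V), IsIrreducible ρ → P V ρ)
    (hprod : ∀ (V W : Type) [AddCommGroup V] [Module ℂ V] [FiniteDimensional ℂ V]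
      [AddCommGroup W] [Module ℂ W] [FiniteDimensional ℂ W]
      (ρ : Representation ℂ K V) (σ : Representation ℂ K W), Nontrivial V → Nontrivial W →
      P V ρ → P W σ → P (V × W) (ρ.prod σ))
    (hequiv : ∀ (V W : Type) [AddCommGroup V] [Module ℂ V] [FiniteDimensional ℂ V]
      [AddCommGroup W] [Module ℂ W] [FiniteDimensional ℂ W]
      (ρ : Representation ℂ K V) (σ : Representation ℂ K W),
      ρ.Equiv σ → P V ρ → P W σ)
    (V : Type) [AddCommGroup V] [Module ℂ V] [FiniteDimensional ℂ V]
    (ρ : Representation ℂ K V) : P V ρ := by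
  induction hn : Module.finrank ℂ V using Nat.strong_induction_on generalizing V with
  | _ n ih =>
  rcases subsingleton_or_nontrivial V with hV | hV
  · exact h0 V ρ hV
  by_cases hs : IsIrreducible ρ
  · exact hirr V ρ hs
  have hnt : Nontrivial (Subrepresentation ρ) := by
    refine ⟨⊥, ⊤, fun h => ?_⟩
    obtain ⟨v, hv⟩ := exists_ne (0 : V)
    have h1 : (⊥ : Submodule ℂ V) = ⊤ := congrArg Subrepresentation.toSubmodule h
    have : v ∈ (⊥ : Submodule ℂ V) := h1 ▸ Submodule.mem_top
    exact hv (by simpa using this)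
  have : ∃ W : Subrepresentation ρ, W ≠ ⊥ ∧ W ≠ ⊤ := by
    by_contra hc
    push Not at hc
    exact hs ⟨fun a => or_iff_not_imp_left.2 (hc a)⟩
  obtain ⟨W, hWb, hWt⟩ := this
  have : NeZero (Nat.card K : ℂ) := ⟨by exact_mod_cast Nat.card_pos.ne'⟩
  obtain ⟨U, hU⟩ := exists_isCompl W
  have hc : IsCompl W.toSubmodule U.toSubmodule := by
    rw [isCompl_iff, disjoint_iff, codisjoint_iff] at hU ⊢
    exact ⟨congrArg Subrepresentation.toSubmodule hU.1,
      congrArg Subrepresentation.toSubmodule hU.2⟩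
  have hWb' : W.toSubmodule ≠ ⊥ := fun h =>
    hWb (Subrepresentation.toSubmodule_injective h)
  have hUb' : U.toSubmodule ≠ ⊥ := fun h => by
    apply hWt
    apply Subrepresentation.toSubmodule_injective
    have := hc.sup_eq_top
    rw [h, sup_bot_eq] at this
    exact this
  have hWn := Submodule.nontrivial_iff_ne_bot.2 hWb'
  have hUn := Submodule.nontrivial_iff_ne_bot.2 hUb'
  have hfr := Submodule.finrank_add_eq_of_isCompl hc
  have hW0 : 0 < Module.finrank ℂ W.toSubmodule := Module.finrank_pos
  have hU0 : 0 < Module.finrank ℂ U.toSubmodule := Module.finrank_pos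
  let e : (W.toRepresentation.prod U.toRepresentation).Equiv ρ :=
    Representation.Equiv.mk (Submodule.prodEquivOfIsCompl _ _ hc) (by
      intro g
      ext v <;> simp [Subrepresentation.toRepresentation])
  exact hequiv _ _ _ _ e (hprod _ _ _ _ hWn hUn (ih _ (by omega) _ _ rfl) (ih _ (by omega) _ _ rfl))
end Base
end PiSep

namespace PiSep
open Representation
open scoped ComplexOrder

section Base
variable {K : Type} [Group K]

theorem character_prod {V W : Type} [AddCommGroup V] [Module ℂ V] [FiniteDimensional ℂ V]
    [AddCommGroup W] [Module ℂ W] [FiniteDimensional ℂ W]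
    (ρ : Representation ℂ K V) (σ : Representation ℂ K W) :
    (ρ.prod σ).character = ρ.character + σ.character := by
  ext g
  simp [Representation.character, Representation.prod, LinearMap.trace_prodMap']

theorem det_prod {V W : Type} [AddCommGroup V] [Module ℂ V] [FiniteDimensional ℂ V]
    [AddCommGroup W] [Module ℂ W] [FiniteDimensional ℂ W]
    (ρ : Representation ℂ K V) (σ : Representation ℂ K W) (g : K) :
    LinearMap.det (ρ.prod σ g) = LinearMap.det (ρ g) * LinearMap.det (σ g) := by
  simp [Representation.prod, LinearMap.det_prodMap]

theorem isCharacter_add {χ ψ : K → ℂ} (h : IsCharacter K χ) (h' : IsCharacter K ψ) :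
    IsCharacter K (χ + ψ) := by
  obtain ⟨V, _, _, _, ρ, rfl⟩ := exists_rep h
  obtain ⟨W, _, _, _, σ, rfl⟩ := exists_rep h'
  exact character_prod ρ σ ▸ isCharacter_of_rep _

theorem isCharacter_mul {χ ψ : K → ℂ} (h : IsCharacter K χ) (h' : IsCharacter K ψ) :
    IsCharacter K (χ * ψ) := by
  obtain ⟨V, _, _, _, ρ, rfl⟩ := exists_rep h
  obtain ⟨W, _, _, _, σ, rfl⟩ := exists_rep h'
  exact char_tensor ρ σ ▸ isCharacter_of_rep _

theorem isCharacter_zero : IsCharacter K 0 := by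
  convert isCharacter_of_matrix (n := 0) (1 : K →* Matrix (Fin 0) (Fin 0) ℂ) using 1
  ext x
  simp

theorem hasDetOn_hom (l : K →* ℂ) : HasDetOn K l l :=
  ⟨1, (Matrix.scalar (Fin 1)).toMonoidHom.comp l, by intro x; simp, by intro x; simp⟩

theorem HasDetOn.isCharacter {χ d : K → ℂ} (h : HasDetOn K χ d) : IsCharacter K χ := by
  obtain ⟨n, ρ, h, -⟩ := h
  rw [show χ = _ from funext h]
  exact isCharacter_of_matrix ρ

theorem isCharacter_hom (l : K →* ℂ) : IsCharacter K l := (hasDetOn_hom l).isCharacter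

theorem isCharacter_one : IsCharacter K 1 := isCharacter_hom 1

theorem exists_hasDetOn {χ : K → ℂ} (h : IsCharacter K χ) : ∃ d, HasDetOn K χ d := by
  obtain ⟨n, ρ, h⟩ := exists_matrix h
  exact ⟨_, n, ρ, h, fun _ => rfl⟩

theorem HasDetOn.comap {L : Type} [Group L] (f : L →* K) {χ d : K → ℂ} (h : HasDetOn K χ d) :
    HasDetOn L (fun x => χ (f x)) (fun x => d (f x)) := by
  obtain ⟨n, ρ, h, h'⟩ := h
  exact ⟨n, ρ.comp f, fun x => h _, fun x => h' _⟩

theorem isCharacter_comap {L : Type} [Group L] (f : L →* K) {χ : K → ℂ} (h : IsCharacter K χ) :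
    IsCharacter L (fun x => χ (f x)) := by
  obtain ⟨d, h⟩ := exists_hasDetOn h
  exact (h.comap f).isCharacter

theorem HasDetOn.ringHom (τ : ℂ →+* ℂ) {χ d : K → ℂ} (h : HasDetOn K χ d) :
    HasDetOn K (fun x => τ (χ x)) (fun x => τ (d x)) := by
  obtain ⟨n, ρ, h, h'⟩ := h
  refine ⟨n, (τ.mapMatrix : Matrix (Fin n) (Fin n) ℂ →+* _).toMonoidHom.comp ρ, fun x => ?_, fun x => ?_⟩
  · simp [h, Matrix.trace, map_sum]
  · simp only [h']; exact RingHom.map_det τ _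

theorem isCharacter_ringHom (τ : ℂ →+* ℂ) {χ : K → ℂ} (h : IsCharacter K χ) :
    IsCharacter K (fun x => τ (χ x)) := by
  obtain ⟨d, h⟩ := exists_hasDetOn h
  exact (h.ringHom τ).isCharacter

theorem char_conj_apply {χ : K → ℂ} (h : IsCharacter K χ) (g x : K) :
    χ (g * x * g⁻¹) = χ x := by
  obtain ⟨V, _, _, _, ρ, rfl⟩ := exists_rep h
  exact char_conj ρ x g

theorem char_degree {χ : K → ℂ} (h : IsCharacter K χ) : ∃ n : ℕ, χ 1 = n ∧ (n = 0 → χ = 0) := by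
  obtain ⟨n, ρ, h⟩ := exists_matrix h
  refine ⟨n, by simp [h], ?_⟩
  rintro rfl
  ext x
  simp [h, Matrix.trace]

theorem isCharacter_inv {χ : K → ℂ} (h : IsCharacter K χ) : IsCharacter K (fun x => χ x⁻¹) := by
  obtain ⟨V, _, _, _, ρ, rfl⟩ := exists_rep h
  convert isCharacter_of_rep ρ.dual using 1
  ext g
  exact (char_dual ρ g).symm

variable [Fintype K]

theorem char_inv_apply {χ : K → ℂ} (h : IsCharacter K χ) (x : K) :
    χ x⁻¹ = starRingEnd ℂ (χ x) := by
  obtain ⟨n, ρ, h⟩ := exists_matrix h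
  open Matrix in
  let P : Matrix (Fin n) (Fin n) ℂ := ∑ g, (ρ g)ᴴ * ρ g
  have hP : ∀ x, (ρ x)ᴴ * P * ρ x = P := by
    intro x
    simp only [P, Finset.mul_sum, Finset.sum_mul]
    refine Fintype.sum_equiv (Equiv.mulRight x) _ _ fun g => ?_
    simp [Matrix.conjTranspose_mul, Matrix.mul_assoc]
  have hpd : P.PosDef := by
    have h1 : P = 1 + ∑ g ∈ Finset.univ.erase (1 : K), (ρ g)ᴴ * ρ g := by
      simp only [P]
      rw [← Finset.add_sum_erase _ _ (Finset.mem_univ (1 : K))]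
      simp
    rw [h1]
    exact Matrix.PosDef.one.add_posSemidef
      (Matrix.posSemidef_sum _ fun g _ => Matrix.posSemidef_conjTranspose_mul_self _)
  have hu : IsUnit P := hpd.isUnit
  have hx : ρ x * ρ x⁻¹ = 1 := by rw [← map_mul]; simp
  have h3 : (ρ x)ᴴ * P = P * ρ x⁻¹ := by
    conv_rhs => rw [← hP x]
    rw [Matrix.mul_assoc, hx, Matrix.mul_one]
  obtain ⟨Q, hQ⟩ := hu.exists_left_inv
  have hQ' : P * Q = 1 := mul_eq_one_comm.1 hQ
  have h4 : ρ x⁻¹ = Q * ((ρ x)ᴴ * P) := by rw [h3, ← Matrix.mul_assoc, hQ, Matrix.one_mul]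
  rw [h, h, h4, Matrix.trace_mul_comm, Matrix.mul_assoc, hQ', Matrix.mul_one,
    Matrix.trace_conjTranspose]
  rfl

/-- The inner product of class functions. -/
def bip (f g : K → ℂ) : ℂ := (Nat.card K : ℂ)⁻¹ * ∑ x, f x * g x⁻¹

theorem card_ne_zero' : (Nat.card K : ℂ) ≠ 0 := by exact_mod_cast Nat.card_pos.ne'

theorem bip_comm (f g : K → ℂ) : bip f g = bip g f := by
  unfold bip
  congr 1
  refine Fintype.sum_equiv (Equiv.inv K) _ _ fun x => ?_
  simp [mul_comm]

theorem bip_add_left (f f' g : K → ℂ) : bip (f + f') g = bip f g + bip f' g := by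
  simp [bip, add_mul, Finset.sum_add_distrib, mul_add]

theorem bip_rep {V W : Type} [AddCommGroup V] [Module ℂ V] [FiniteDimensional ℂ V]
    [AddCommGroup W] [Module ℂ W] [FiniteDimensional ℂ W]
    (ρ : Representation ℂ K V) (σ : Representation ℂ K W) :
    bip σ.character ρ.character = Module.finrank ℂ (IntertwiningMap ρ σ) := by
  have := invertibleOfNonzero (card_ne_zero' (K := K))
  exact card_inv_mul_sum_char_mul_char_eq_finrank ρ σ

theorem bip_nat {χ ψ : K → ℂ} (h : IsCharacter K χ) (h' : IsCharacter K ψ) :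
    ∃ n : ℕ, bip χ ψ = n := by
  obtain ⟨V, _, _, _, ρ, rfl⟩ := exists_rep h
  obtain ⟨W, _, _, _, σ, rfl⟩ := exists_rep h'
  exact ⟨_, bip_rep σ ρ⟩

theorem bip_self_re {χ : K → ℂ} (h : IsCharacter K χ) :
    bip χ χ = (Nat.card K : ℂ)⁻¹ * ∑ x, (Complex.normSq (χ x) : ℂ) := by
  unfold bip
  congr 1
  refine Finset.sum_congr rfl fun x _ => ?_
  rw [char_inv_apply h, Complex.mul_conj]

theorem bip_self_ne_zero {χ : K → ℂ} (h : IsCharacter K χ) (h0 : χ ≠ 0) : bip χ χ ≠ 0 := by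
  rw [bip_self_re h]
  refine mul_ne_zero (inv_ne_zero card_ne_zero') ?_
  obtain ⟨x, hx⟩ := Function.ne_iff.1 h0
  rw [← Complex.ofReal_sum]
  rw [Complex.ofReal_ne_zero]
  refine (Finset.sum_pos' (fun i _ => Complex.normSq_nonneg _) ⟨x, Finset.mem_univ _, ?_⟩).ne'
  exact Complex.normSq_pos.2 hx

end Base
end PiSep

namespace PiSep
open Representation
open scoped ComplexOrder

section Base
variable {K : Type} [Group K] [Fintype K]

theorem char_induction (P : (K → ℂ) → Prop) (h0 : P 0)
    (hadd : ∀ θ ξ, IsCharacter K θ → IsCharacter K ξ → P θ → P ξ → P (θ + ξ))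
    (hirr : ∀ (V : Type) [AddCommGroup V] [Module ℂ V] [FiniteDimensional ℂ V]
      (ρ : Representation ℂ K V), IsIrreducible ρ → P ρ.character)
    {χ : K → ℂ} (h : IsCharacter K χ) : P χ := by
  obtain ⟨V, _, _, _, ρ, rfl⟩ := exists_rep h
  refine rep_induction (fun V _ _ _ ρ => P ρ.character) ?_ ?_ ?_ ?_ V ρ
  · intro V _ _ _ ρ hV
    convert h0
    ext x
    simp [Representation.character, Subsingleton.elim (ρ x) 0]
  · intro V _ _ _ ρ hρ
    exact hirr V ρ hρ
  · intro V W _ _ _ _ _ _ ρ σ _ _ h h'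
    rw [character_prod]
    exact hadd _ _ (isCharacter_of_rep _) (isCharacter_of_rep _) h h'
  · intro V W _ _ _ _ _ _ ρ σ e h
    rwa [← char_iso e]

theorem irr_exists_rep {χ : K → ℂ} (h : IsIrrChar K χ) :
    ∃ (V : Type) (_ : AddCommGroup V) (_ : Module ℂ V) (_ : FiniteDimensional ℂ V)
      (ρ : Representation ℂ K V), IsIrreducible ρ ∧ χ = ρ.character := by
  refine char_induction (fun χ => IsIrrChar K χ → ∃ (V : Type) (_ : AddCommGroup V)
    (_ : Module ℂ V) (_ : FiniteDimensional ℂ V)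
      (ρ : Representation ℂ K V), IsIrreducible ρ ∧ χ = ρ.character) ?_ ?_ ?_ h.1 h
  · intro h; exact absurd rfl h.2.1
  · intro θ ξ hθ hξ h1 h2 h3
    by_cases h4 : θ = 0
    · rw [h4, zero_add] at h3 ⊢; exact h2 h3
    by_cases h5 : ξ = 0
    · rw [h5, add_zero] at h3 ⊢; exact h1 h3
    exact absurd ⟨θ, ξ, hθ, h4, hξ, h5, rfl⟩ h3.2.2
  · intro V _ _ _ ρ hρ _
    exact ⟨V, inferInstance, inferInstance, inferInstance, ρ, hρ, rfl⟩

theorem bip_irr {χ ψ : K → ℂ} (h : IsIrrChar K χ) (h' : IsIrrChar K ψ) :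
    bip χ ψ = if χ = ψ then 1 else 0 := by
  obtain ⟨V, _, _, _, ρ, hρ, rfl⟩ := irr_exists_rep h
  obtain ⟨W, _, _, _, σ, hσ, rfl⟩ := irr_exists_rep h'
  have := invertibleOfNonzero (card_ne_zero' (K := K))
  split_ifs with hc
  · rw [← hc, bip_rep, IsIrreducible.finrank_intertwiningMap_self]; simp
  · have := char_orthonormal ρ σ
    rw [if_neg (fun ⟨e⟩ => hc (char_iso e).symm)] at this
    exact this

theorem isIrrChar_iff {χ : K → ℂ} : IsIrrChar K χ ↔ IsCharacter K χ ∧ bip χ χ = 1 := by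
  constructor
  · intro h
    exact ⟨h.1, by rw [bip_irr h h, if_pos rfl]⟩
  · rintro ⟨h, h1⟩
    refine ⟨h, ?_, ?_⟩
    · rintro rfl
      simp [bip] at h1
    · rintro ⟨a, b, ha, ha0, hb, hb0, rfl⟩
      obtain ⟨m, hm⟩ := bip_nat ha ha
      obtain ⟨n, hn⟩ := bip_nat hb hb
      obtain ⟨k, hk⟩ := bip_nat ha hb
      have h2 := bip_self_ne_zero ha ha0
      have h3 := bip_self_ne_zero hb hb0
      rw [bip_add_left, bip_comm a, bip_comm b, bip_add_left, bip_add_left, bip_comm b a, hm, hn, hk] at h1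
      rw [hm] at h2
      rw [hn] at h3
      norm_cast at h1 h2 h3
      omega

/-- Class functions. -/
def IsClass (f : K → ℂ) : Prop := ∀ g x, f (g * x * g⁻¹) = f x

theorem class_op_zero {f : K → ℂ} (hf : IsClass f) (h : ∀ θ, IsIrrChar K θ → bip f θ = 0)
    (V : Type) [AddCommGroup V] [Module ℂ V] [FiniteDimensional ℂ V]
    (ρ : Representation ℂ K V) : ∑ x, f x • ρ x⁻¹ = 0 := by
  refine rep_induction (fun V _ _ _ ρ => ∑ x, f x • ρ x⁻¹ = 0) ?_ ?_ ?_ ?_ V ρ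
  · intro V _ _ _ ρ hV
    exact Subsingleton.elim _ _
  · intro V _ _ _ ρ hρ
    have hc : ∀ g, (∑ x, f x • ρ x⁻¹) ∘ₗ (ρ g) = (ρ g) ∘ₗ (∑ x, f x • ρ x⁻¹) := by
      intro g
      have : ∀ A B : Module.End ℂ V, A ∘ₗ B = A * B := fun _ _ => rfl
      rw [this, this, Finset.sum_mul, Finset.mul_sum]
      refine Fintype.sum_equiv (MulAut.conj g⁻¹).toEquiv.symm.symm _ _ fun x => ?_
      have h1 : (MulAut.conj g⁻¹).toEquiv.symm.symm x = g⁻¹ * x * g := by simp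
      rw [h1]
      have h2 : f (g⁻¹ * x * g) = f x := by simpa using hf g⁻¹ x
      rw [h2, smul_mul_assoc, mul_smul_comm, ← map_mul, ← map_mul]
      congr 2
      group
    let T : IntertwiningMap ρ ρ := ⟨∑ x, f x • ρ x⁻¹, hc⟩
    obtain ⟨c, hcT⟩ := (IsIrreducible.algebraMap_intertwiningMap_bijective_of_isAlgClosed (ρ := ρ)).2 T
    have hT : ∑ x, f x • ρ x⁻¹ = c • (1 : Module.End ℂ V) := by
      have := congrArg IntertwiningMap.toLinearMap hcT
      exact this.symm
    have hirr : IsIrrChar K ρ.character := by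
      rw [isIrrChar_iff, bip_rep, IsIrreducible.finrank_intertwiningMap_self]
      exact ⟨isCharacter_of_rep ρ, by simp⟩
    have htr := congrArg (LinearMap.trace ℂ V) hT
    have h0 := h _ hirr
    unfold bip at h0
    rw [mul_eq_zero, or_iff_right (inv_ne_zero card_ne_zero')] at h0
    have h3 : LinearMap.trace ℂ V (∑ x, f x • ρ x⁻¹) = 0 := by
      rw [← h0, map_sum]
      simp [Representation.character]
    rw [h3, map_smul, LinearMap.trace_one, smul_eq_mul] at htr
    have hnt : Nontrivial V := by
      rw [← not_subsingleton_iff_nontrivial]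
      intro hs
      obtain ⟨a, b, hab⟩ := hρ.toNontrivial
      apply hab
      apply Subrepresentation.toSubmodule_injective
      exact Subsingleton.elim _ _
    have : (Module.finrank ℂ V : ℂ) ≠ 0 := by exact_mod_cast (Module.finrank_pos (R := ℂ) (M := V)).ne'
    have hc0 : c = 0 := by
      rcases mul_eq_zero.1 htr.symm with h | h
      · exact h
      · exact absurd h this
    rw [hT, hc0, zero_smul]
  · intro V W _ _ _ _ _ _ ρ σ _ _ h h'
    ext v
    · have := congrArg (fun A => A v) h
      simpa [Representation.prod, LinearMap.sum_apply, Prod.fst_sum] using this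
    · simp [Representation.prod, Prod.snd_sum]
    · simp [Representation.prod, Prod.fst_sum]
    · have := congrArg (fun A => A v) h'
      simpa [Representation.prod, LinearMap.sum_apply, Prod.snd_sum] using this
  · intro V W _ _ _ _ _ _ ρ σ e h
    ext w
    have h1 := congrArg (fun A => e (A (e.symm w))) h
    have h2 : ∀ x v, e (ρ x v) = σ x (e v) := fun x v => by
      exact LinearMap.congr_fun (e.toIntertwiningMap.isIntertwining' x) v
    have h3 : e (e.symm w) = w := e.toLinearEquiv.apply_symm_apply w
    simp only [LinearMap.sum_apply, LinearMap.smul_apply, map_sum, map_smul, h2, h3] at h1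
    simpa using h1

theorem class_eq_zero {f : K → ℂ} (hf : IsClass f) (h : ∀ θ, IsIrrChar K θ → bip f θ = 0) :
    f = 0 := by
  have := class_op_zero hf h _ (leftRegular ℂ K)
  have h1 := congrArg (fun A => A (MonoidAlgebra.single (1 : K) (1 : ℂ))) this
  ext y
  have h2 := congrArg (fun v => v.coeff y⁻¹) h1
  simpa [Representation.coeff_ofMulAction, Finsupp.single_apply, Finsupp.finsetSum_apply] using h2
end Base
end PiSep

namespace PiSep

section Base
variable {K : Type} [Group K] [Fintype K]

theorem bip_smul_left (c : ℂ) (f g : K → ℂ) : bip (c • f) g = c * bip f g := by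
  simp only [bip, Pi.smul_apply, smul_eq_mul, Finset.mul_sum]
  exact Finset.sum_congr rfl fun x _ => by ring

theorem bip_sum_left {ι : Type*} (s : Finset ι) (f : ι → K → ℂ) (g : K → ℂ) :
    bip (∑ i ∈ s, f i) g = ∑ i ∈ s, bip (f i) g := by
  induction s using Finset.induction_on with
  | empty => simp [bip]
  | insert a s ha ih => rw [Finset.sum_insert ha, Finset.sum_insert ha, bip_add_left, ih]

theorem irr_linearIndependent :
    LinearIndependent ℂ (Subtype.val : {θ : K → ℂ // IsIrrChar K θ} → K → ℂ) := by
  rw [linearIndependent_iff']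
  intro s c hc i hi
  have h := congrArg (fun f => bip f i.1) hc
  simp only [bip_sum_left, bip_smul_left] at h
  rw [Finset.sum_eq_single i] at h
  · rw [bip_irr i.2 i.2, if_pos rfl, mul_one] at h
    simpa [bip] using h
  · intro j _ hj
    rw [bip_irr j.2 i.2, if_neg (fun h => hj (Subtype.ext h)), mul_zero]
  · exact fun h => absurd hi h

instance : Finite {θ : K → ℂ // IsIrrChar K θ} := irr_linearIndependent.finite

instance : Fintype {θ : K → ℂ // IsIrrChar K θ} := Fintype.ofFinite _

theorem class_expand {f : K → ℂ} (hf : IsClass f) :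
    f = ∑ θ : {θ : K → ℂ // IsIrrChar K θ}, bip f θ.1 • θ.1 := by
  rw [← sub_eq_zero]
  apply class_eq_zero
  · intro g x
    have h1 : ∀ θ : {θ : K → ℂ // IsIrrChar K θ}, θ.1 (g * x * g⁻¹) = θ.1 x :=
      fun θ => char_conj_apply θ.2.1 g x
    simp [hf g x, h1]
  · intro θ hθ
    rw [sub_eq_add_neg, ← neg_one_smul ℂ, bip_add_left, bip_smul_left, bip_sum_left]
    simp only [bip_smul_left]
    rw [Finset.sum_eq_single ⟨θ, hθ⟩]
    · rw [bip_irr hθ hθ, if_pos rfl]; ring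
    · intro j _ hj
      rw [bip_irr j.2 hθ, if_neg (fun h => hj (Subtype.ext h)), mul_zero]
    · simp

theorem isCharacter_sum {ι : Type*} (s : Finset ι) (f : ι → K → ℂ)
    (h : ∀ i ∈ s, IsCharacter K (f i)) : IsCharacter K (∑ i ∈ s, f i) := by
  induction s using Finset.induction_on with
  | empty => exact isCharacter_zero
  | insert a s ha ih =>
    rw [Finset.sum_insert ha]
    exact isCharacter_add (h a (by simp)) (ih fun i hi => h i (by simp [hi]))

theorem isCharacter_nsmul (n : ℕ) {f : K → ℂ} (h : IsCharacter K f) :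
    IsCharacter K ((n : ℂ) • f) := by
  induction n with
  | zero => simpa using isCharacter_zero
  | succ n ih =>
    rw [Nat.cast_succ, add_smul, one_smul]
    exact isCharacter_add ih h

theorem isCharacter_of_nat {f : K → ℂ} (hf : IsClass f)
    (h : ∀ θ, IsIrrChar K θ → ∃ n : ℕ, bip f θ = n) : IsCharacter K f := by
  rw [class_expand hf]
  refine isCharacter_sum _ _ fun θ _ => ?_
  obtain ⟨n, hn⟩ := h θ.1 θ.2
  rw [hn]
  exact isCharacter_nsmul n θ.2.1

end Base

variable {G : Type} [Group G]

/-- `f` restricts to a character of `J`. -/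
def Ch (J : Subgroup G) (f : G → ℂ) : Prop := IsCharacter J (fun x => f x)

/-- `f` restricts to a class function of `J`. -/
def Cls (J : Subgroup G) (f : G → ℂ) : Prop := ∀ g ∈ J, ∀ x ∈ J, f (g * x * g⁻¹) = f x

variable {J H N : Subgroup G} {f g f' g' χ ψ θ : G → ℂ}

theorem Ch.congr (h : Ch J f) (e : ∀ x ∈ J, f x = f' x) : Ch J f' := by
  have : (fun x : J => f' x) = fun x : J => f x := funext fun x => (e x x.2).symm
  rw [Ch, this]
  exact h

theorem Ch.cls (h : Ch J f) : Cls J f := fun g hg x hx =>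
  char_conj_apply h ⟨g, hg⟩ ⟨x, hx⟩

theorem Cls.isClass (h : Cls J f) : IsClass (fun x : J => f x) := fun g x =>
  h g g.2 x x.2

theorem Cls.mono (h : Cls J f) (hHJ : H ≤ J) : Cls H f := fun g hg x hx =>
  h g (hHJ hg) x (hHJ hx)

theorem Ch.mono (h : Ch J f) (hHJ : H ≤ J) : Ch H f :=
  isCharacter_comap (Subgroup.inclusion hHJ) h

theorem Ch.add (h : Ch J f) (h' : Ch J g) : Ch J (f + g) := isCharacter_add h h'

theorem Ch.mul (h : Ch J f) (h' : Ch J g) : Ch J (f * g) := isCharacter_mul h h'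

theorem Ch.zero : Ch J 0 := isCharacter_zero

theorem Ch.one : Ch J 1 := isCharacter_one

theorem Ch.ringHom (h : Ch J f) (τ : ℂ →+* ℂ) : Ch J (fun x => τ (f x)) :=
  isCharacter_ringHom τ h

theorem Ch.inv (h : Ch J f) : Ch J (fun x => f x⁻¹) := isCharacter_inv h

theorem Ch.degree (h : Ch J f) : ∃ n : ℕ, f 1 = n ∧ (n = 0 → ∀ x ∈ J, f x = 0) := by
  obtain ⟨n, h1, h2⟩ := char_degree h
  exact ⟨n, h1, fun hn x hx => congrFun (h2 hn) ⟨x, hx⟩⟩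

theorem Ch.comap {Γ : Type} [Group Γ] {p : Γ →* G} {L : Subgroup Γ} (h : Ch J f)
    (hp : L ≤ J.comap p) : Ch L (fun x => f (p x)) :=
  isCharacter_comap ((p.comp L.subtype).codRestrict J fun x => hp x.2) h

/-- Multiplicative functions on a subgroup. -/
def Lin (J : Subgroup G) (l : G → ℂ) : Prop :=
  l 1 = 1 ∧ ∀ x ∈ J, ∀ y ∈ J, l (x * y) = l x * l y

/-- The homomorphism attached to a multiplicative function. -/
def Lin.hom {l : G → ℂ} (h : Lin J l) : J →* ℂ where
  toFun x := l x
  map_one' := h.1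
  map_mul' x y := h.2 x x.2 y y.2

theorem Lin.ch {l : G → ℂ} (h : Lin J l) : Ch J l := isCharacter_hom h.hom

variable [Fintype G]

theorem Ch.inv_apply (h : Ch J f) {x : G} (hx : x ∈ J) : f x⁻¹ = starRingEnd ℂ (f x) :=
  char_inv_apply h ⟨x, hx⟩

/-- The inner product over `J`. -/
def ip (J : Subgroup G) (f g : G → ℂ) : ℂ := bip (fun x : J => f x) (fun x : J => g x)

theorem sum_subgroup (J : Subgroup G) (F : G → ℂ) :
    ∑ x : J, F x = ∑ x : G, if x ∈ J then F x else 0 := by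
  rw [← Finset.sum_filter]
  exact (Finset.sum_subtype _ (by simp) F).symm

theorem ip_eq (J : Subgroup G) (f g : G → ℂ) :
    ip J f g = (Nat.card J : ℂ)⁻¹ * ∑ x : G, if x ∈ J then f x * g x⁻¹ else 0 := by
  rw [← sum_subgroup J fun x => f x * g x⁻¹]
  rfl

theorem ip_congr (e : ∀ x ∈ J, f x = f' x) (e' : ∀ x ∈ J, g x = g' x) :
    ip J f g = ip J f' g' := by
  rw [ip_eq, ip_eq]
  congr 1
  refine Finset.sum_congr rfl fun x _ => ?_
  split_ifs with h
  · rw [e x h, e' x⁻¹ (J.inv_mem h)]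
  · rfl

theorem ip_comm (f g : G → ℂ) : ip J f g = ip J g f := bip_comm _ _

theorem ip_add_left : ip J (f + f') g = ip J f g + ip J f' g := bip_add_left _ _ _

theorem ip_smul_left (c : ℂ) : ip J (c • f) g = c * ip J f g := bip_smul_left _ _ _

theorem ip_smul_right (c : ℂ) : ip J f (c • g) = c * ip J f g := by
  rw [ip_comm, ip_smul_left, ip_comm]

theorem ip_sum_left {ι : Type*} (s : Finset ι) (F : ι → G → ℂ) (g : G → ℂ) :
    ip J (∑ i ∈ s, F i) g = ∑ i ∈ s, ip J (F i) g := by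
  induction s using Finset.induction_on with
  | empty => simp [ip_eq]
  | insert a s ha ih => rw [Finset.sum_insert ha, Finset.sum_insert ha, ip_add_left, ih]

theorem Ch.ip_nat (h : Ch J f) (h' : Ch J g) : ∃ n : ℕ, ip J f g = n := bip_nat h h'

/-- `f` restricts to an irreducible character of `J`. -/
def Irr (J : Subgroup G) (f : G → ℂ) : Prop := IsIrrChar J (fun x => f x)

theorem Irr.ch (h : Irr J f) : Ch J f := h.1

theorem irr_iff : Irr J f ↔ Ch J f ∧ ip J f f = 1 := isIrrChar_iff

theorem Irr.congr (h : Irr J f) (e : ∀ x ∈ J, f x = f' x) : Irr J f' := by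
  have : (fun x : J => f' x) = fun x : J => f x := funext fun x => (e x x.2).symm
  rw [Irr, this]
  exact h

theorem Irr.ip_self (h : Irr J f) : ip J f f = 1 := (irr_iff.1 h).2

theorem Irr.ip_eq_zero (h : Irr J f) (h' : Irr J g) (hne : ¬ ∀ x ∈ J, f x = g x) :
    ip J f g = 0 := by
  rw [ip, bip_irr h h', if_neg]
  exact fun e => hne fun x hx => congrFun e ⟨x, hx⟩

theorem Irr.eqOn (h : Irr J f) (h' : Irr J g) (hne : ip J f g ≠ 0) : ∀ x ∈ J, f x = g x := by
  by_contra hc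
  exact hne (h.ip_eq_zero h' hc)

theorem Irr.one_ne_zero (h : Irr J f) : f 1 ≠ 0 := by
  obtain ⟨n, h1, h2⟩ := h.ch.degree
  rw [h1]
  intro h0
  apply h.2.1
  ext x
  exact h2 (by exact_mod_cast h0) x x.2

/-- Extension by zero off `J`. -/
def trunc (J : Subgroup G) (f : G → ℂ) : G → ℂ := fun x => if x ∈ J then f x else 0

omit [Fintype G] in
theorem trunc_apply {x : G} (hx : x ∈ J) : trunc J f x = f x := if_pos hx

/-- The irreducible characters of `J`, extended by zero. -/
def irrs (J : Subgroup G) : Finset (G → ℂ) :=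
  Finset.univ.image fun θ : {θ : J → ℂ // IsIrrChar J θ} =>
    fun x => if h : x ∈ J then θ.1 ⟨x, h⟩ else 0

theorem mem_irrs : θ ∈ irrs J ↔ Irr J θ ∧ ∀ x ∉ J, θ x = 0 := by
  simp only [irrs, Finset.mem_image, Finset.mem_univ, true_and]
  constructor
  · rintro ⟨θ, rfl⟩
    refine ⟨?_, fun x hx => dif_neg hx⟩
    have : (fun x : J => (fun x : G => if h : x ∈ J then θ.1 ⟨x, h⟩ else 0) x) = θ.1 := by
      ext x; simp
    rw [Irr, this]
    exact θ.2
  · rintro ⟨h, h0⟩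
    refine ⟨⟨_, h⟩, ?_⟩
    ext x
    by_cases hx : x ∈ J
    · simp [hx]
    · simp [hx, h0 x hx]

theorem Irr.trunc_mem (h : Irr J f) : trunc J f ∈ irrs J :=
  mem_irrs.2 ⟨h.congr fun _ hx => (trunc_apply hx).symm, fun _ hx => if_neg hx⟩

theorem eq_of_mem_irrs (h : θ ∈ irrs J) (h' : ψ ∈ irrs J) (e : ip J θ ψ ≠ 0) : θ = ψ := by
  rw [mem_irrs] at h h'
  ext x
  by_cases hx : x ∈ J
  · exact h.1.eqOn h'.1 e x hx
  · rw [h.2 x hx, h'.2 x hx]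

theorem ip_irrs (h : θ ∈ irrs J) (h' : ψ ∈ irrs J) : ip J θ ψ = if θ = ψ then 1 else 0 := by
  split_ifs with e
  · rw [← e]; exact (mem_irrs.1 h).1.ip_self
  · by_contra hc
    exact e (eq_of_mem_irrs h h' hc)

theorem Cls.expand (h : Cls J f) : ∀ x ∈ J, f x = ∑ θ ∈ irrs J, ip J f θ * θ x := by
  intro x hx
  have := congrFun (class_expand h.isClass) ⟨x, hx⟩
  simp only [Finset.sum_apply, Pi.smul_apply, smul_eq_mul] at this
  rw [irrs, Finset.sum_image]
  · rw [this]
    refine Finset.sum_congr rfl fun θ _ => ?_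
    congr 1
    · unfold ip; congr 1; ext y; simp
    · simp [hx]
  · intro θ _ θ' _ e
    apply Subtype.ext
    ext y
    simpa using congrFun e y

theorem ch_of_nat (h : Cls J f) (h' : ∀ θ, Irr J θ → ∃ n : ℕ, ip J f θ = n) : Ch J f := by
  refine isCharacter_of_nat h.isClass fun θ hθ => ?_
  obtain ⟨n, hn⟩ := h' (fun x => if hx : x ∈ J then θ ⟨x, hx⟩ else 0) (by
    have e : (fun x : J => (fun x : G => if hx : x ∈ J then θ ⟨x, hx⟩ else 0) x) = θ := by
      ext x; simp
    rw [Irr, e]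
    exact hθ)
  refine ⟨n, ?_⟩
  rw [← hn, ip]
  congr 1
  ext x
  simp

theorem Cls.eq_of_ip (h : Cls J f) (h' : Cls J g) (e : ∀ θ ∈ irrs J, ip J f θ = ip J g θ) :
    ∀ x ∈ J, f x = g x := by
  intro x hx
  rw [h.expand x hx, h'.expand x hx]
  exact Finset.sum_congr rfl fun θ hθ => by rw [e θ hθ]

end PiSep

namespace PiSep

variable {G : Type} [Group G] [Fintype G] {J H K N : Subgroup G} {f g f' g' χ ψ θ : G → ℂ}

/-- The sum of a function over a subgroup. -/
def sm (J : Subgroup G) (F : G → ℂ) : ℂ := ∑ x : J, F x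

theorem sm_eq (J : Subgroup G) (F : G → ℂ) : sm J F = ∑ x : G, if x ∈ J then F x else 0 :=
  sum_subgroup J F

theorem ip_def (J : Subgroup G) (f g : G → ℂ) :
    ip J f g = (Nat.card J : ℂ)⁻¹ * sm J fun x => f x * g x⁻¹ := rfl

theorem sm_ip (J : Subgroup G) (f g : G → ℂ) :
    (sm J fun x => f x * g x⁻¹) = Nat.card J * ip J f g := by
  rw [ip_def, mul_inv_cancel_left₀ card_ne_zero']

theorem sm_congr {F F' : G → ℂ} (h : ∀ x ∈ J, F x = F' x) : sm J F = sm J F' :=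
  Finset.sum_congr rfl fun x _ => h x x.2

theorem sm_const (c : ℂ) : (sm J fun _ => c) = Nat.card J * c := by
  simp [sm]

theorem sm_mul_const (F : G → ℂ) (c : ℂ) : (sm J fun x => c * F x) = c * sm J F := by
  simp [sm, Finset.mul_sum]

theorem sm_const_mul (F : G → ℂ) (c : ℂ) : (sm J fun x => F x * c) = sm J F * c := by
  simp [sm, Finset.sum_mul]

theorem sm_add (F F' : G → ℂ) : (sm J fun x => F x + F' x) = sm J F + sm J F' :=
  Finset.sum_add_distrib

theorem sm_comm (F : G → G → ℂ) :
    (sm J fun x => sm H fun y => F x y) = sm H fun y => sm J fun x => F x y :=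
  Finset.sum_comm

/-- Reindexing a sum along a permutation of the ambient group. -/
theorem sm_equiv (e : G ≃ G) (F : G → ℂ) (h : ∀ x, x ∈ J ↔ e x ∈ H) :
    (sm J fun x => F (e x)) = sm H F := by
  rw [sm_eq, sm_eq]
  refine Fintype.sum_equiv e _ _ fun x => ?_
  simp only [h]

theorem sm_mul_left (F : G → ℂ) {y : G} (hy : y ∈ J) :
    (sm J fun x => F (y * x)) = sm J F :=
  sm_equiv (Equiv.mulLeft y) F fun _ => (J.mul_mem_cancel_left hy).symm

theorem sm_mul_right (F : G → ℂ) {y : G} (hy : y ∈ J) :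
    (sm J fun x => F (x * y)) = sm J F :=
  sm_equiv (Equiv.mulRight y) F fun _ => (J.mul_mem_cancel_right hy).symm

theorem sm_inv (F : G → ℂ) : (sm J fun x => F x⁻¹) = sm J F :=
  sm_equiv (Equiv.inv G) F fun _ => J.inv_mem_iff.symm

/-- `N` is a normal subgroup of `J`. -/
def NI (N J : Subgroup G) : Prop := N ≤ J ∧ ∀ g ∈ J, ∀ n ∈ N, g * n * g⁻¹ ∈ N

omit [Fintype G] in
theorem NI.conj_mem (h : NI N J) {y x : G} (hy : y ∈ J) : y * x * y⁻¹ ∈ N ↔ x ∈ N := by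
  refine ⟨fun hx => ?_, h.2 y hy x⟩
  simpa [mul_assoc] using h.2 y⁻¹ (J.inv_mem hy) _ hx

theorem NI.sm_conj (h : NI N J) (F : G → ℂ) {y : G} (hy : y ∈ J) :
    (sm N fun x => F (y * x * y⁻¹)) = sm N F :=
  sm_equiv (MulAut.conj y).toEquiv F fun _ => (h.conj_mem hy).symm

omit [Fintype G] in
theorem NI.refl : NI J J := ⟨le_rfl, fun _ hg _ hn => J.mul_mem (J.mul_mem hg hn) (J.inv_mem hg)⟩

omit [Fintype G] in
theorem NI.mono (h : NI N J) (hK : K ≤ J) (hN : N ≤ K) : NI N K :=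
  ⟨hN, fun g hg => h.2 g (hK hg)⟩

/-- The conjugate character `f ^ y`. -/
def cj (y : G) (f : G → ℂ) : G → ℂ := fun x => f (y * x * y⁻¹)

omit [Fintype G] in
theorem cj_cj (y z : G) (f : G → ℂ) : cj y (cj z f) = cj (z * y) f := by
  ext x; simp [cj, mul_assoc]

omit [Fintype G] in
@[simp] theorem cj_one (f : G → ℂ) : cj 1 f = f := by
  ext x; simp [cj]

omit [Fintype G] in
@[simp] theorem cj_apply_one (y : G) (f : G → ℂ) : cj y f 1 = f 1 := by
  simp [cj]

omit [Fintype G] in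
theorem Ch.cj {L : Subgroup G} (h : Ch J f) (y : G) (hL : ∀ x ∈ L, y * x * y⁻¹ ∈ J) :
    Ch L (cj y f) :=
  h.comap (p := (MulAut.conj y).toMonoidHom) (L := L) hL

theorem NI.ip_cj (h : NI N J) {y : G} (hy : y ∈ J) (f g : G → ℂ) :
    ip N (cj y f) (cj y g) = ip N f g := by
  rw [ip_def, ip_def, ← h.sm_conj (fun x => f x * g x⁻¹) hy]
  simp [cj, mul_assoc]

theorem NI.irr_cj (h : NI N J) {y : G} (hy : y ∈ J) (hf : Irr N f) : Irr N (cj y f) :=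
  irr_iff.2 ⟨hf.ch.cj y fun x hx => h.2 y hy x hx, by rw [h.ip_cj hy, hf.ip_self]⟩

theorem ip_cj_of_cls (h : NI N J) {y : G} (hy : y ∈ J) (hχ : Cls J χ) (f : G → ℂ) :
    ip N χ (cj y f) = ip N χ f := by
  rw [← h.ip_cj hy χ f]
  exact ip_congr (fun x hx => (hχ y hy x (h.1 hx)).symm) fun _ _ => rfl

/-- Induction from `H` to `J`. -/
def ind (J H : Subgroup G) (f : G → ℂ) : G → ℂ := fun x =>
  (Nat.card H : ℂ)⁻¹ * sm J fun y => if y * x * y⁻¹ ∈ H then f (y * x * y⁻¹) else 0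

theorem ind_congr (h : ∀ x ∈ H, f x = f' x) : ind J H f = ind J H f' := by
  ext x
  refine congrArg _ (sm_congr fun y _ => ?_)
  split_ifs with hy
  · exact h _ hy
  · rfl

theorem ind_cls (f : G → ℂ) : Cls J (ind J H f) := by
  intro z hz x _
  unfold ind
  congr 1
  rw [← sm_mul_right (fun y => if y * x * y⁻¹ ∈ H then f (y * x * y⁻¹) else 0) hz]
  simp [mul_assoc]

theorem ind_one (f : G → ℂ) : ind J H f 1 = Nat.card J / Nat.card H * f 1 := by
  simp only [ind, mul_one, mul_inv_cancel, one_mem, if_true, sm_const]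
  ring

/-- Frobenius reciprocity. -/
theorem ip_ind (hHJ : H ≤ J) (hg : Cls J g) (f : G → ℂ) : ip J (ind J H f) g = ip H f g := by
  have key : ∀ y ∈ J, (sm J fun x => (if y * x * y⁻¹ ∈ H then f (y * x * y⁻¹) else 0) * g x⁻¹)
      = sm H fun x => f x * g x⁻¹ := by
    intro y hy
    have := NI.refl.sm_conj (J := J)
      (fun x => (if x ∈ H then f x else 0) * g x⁻¹) hy
    calc _ = sm J fun x => (if y * x * y⁻¹ ∈ H then f (y * x * y⁻¹) else 0) * g (y * x * y⁻¹)⁻¹ := by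
          refine sm_congr fun x hx => ?_
          rw [← hg y hy x⁻¹ (J.inv_mem hx)]
          simp [mul_assoc]
      _ = _ := this.trans (by
          rw [sm_eq, sm_eq]
          refine Finset.sum_congr rfl fun x _ => ?_
          by_cases h : x ∈ H
          · simp [h, hHJ h]
          · simp [h])
  rw [ip_def, ip_def]
  calc _ = (Nat.card J : ℂ)⁻¹ * ((Nat.card H : ℂ)⁻¹ * sm J fun x => sm J fun y =>
        (if y * x * y⁻¹ ∈ H then f (y * x * y⁻¹) else 0) * g x⁻¹) := by
        congr 1
        rw [← sm_mul_const]
        refine sm_congr fun x _ => ?_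
        rw [ind, sm_const_mul, mul_assoc]
    _ = _ := by
        rw [sm_comm, sm_congr key, sm_const]
        field_simp [card_ne_zero' (K := J)]

theorem Ch.ind (h : Ch H f) (hHJ : H ≤ J) : Ch J (ind J H f) := by
  refine ch_of_nat (ind_cls f) fun θ hθ => ?_
  rw [ip_ind hHJ hθ.ch.cls]
  exact h.ip_nat (hθ.ch.mono hHJ)

theorem ind_trans (hHK : H ≤ K) (hKJ : K ≤ J) (f : G → ℂ) :
    ∀ x ∈ J, ind J K (ind K H f) x = ind J H f x := by
  refine (ind_cls _).eq_of_ip (ind_cls _) fun θ hθ => ?_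
  have h := (mem_irrs.1 hθ).1.ch.cls
  rw [ip_ind hKJ h, ip_ind hHK (h.mono hKJ), ip_ind (hHK.trans hKJ) h]

theorem ind_mul (hg : Cls J g) : ∀ x ∈ J, ind J H (f * g) x = ind J H f x * g x := by
  intro x hx
  rw [ind, ind, mul_assoc, ← sm_const_mul]
  congr 1
  refine sm_congr fun y hy => ?_
  simp [hg y hy x hx]

theorem ind_add (f f' : G → ℂ) : ind J H (f + f') = ind J H f + ind J H f' := by
  ext x
  simp only [ind, Pi.add_apply]
  rw [← mul_add, ← sm_add]
  refine congrArg _ (sm_congr fun y _ => ?_)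
  split_ifs <;> simp

theorem ind_self (hf : Cls J f) : ∀ x ∈ J, ind J J f x = f x := by
  refine (ind_cls _).eq_of_ip hf fun θ hθ => ?_
  rw [ip_ind le_rfl (mem_irrs.1 hθ).1.ch.cls]

/-- Every element of `J` is a product of one of `H` and one of `N`. -/
def Sup (J N H : Subgroup G) : Prop := ∀ y ∈ J, ∃ h ∈ H, h⁻¹ * y ∈ N

theorem sm_sup (hs : Sup J N H) (hN : N ≤ J) (hH : H ≤ J) (F : G → ℂ) :
    (sm H fun h => sm N fun n => F (h * n)) = Nat.card (N ⊓ H : Subgroup G) * sm J F := by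
  have h1 : ∀ h ∈ H, (sm N fun n => F (h * n)) = sm J fun y => if h⁻¹ * y ∈ N then F y else 0 := by
    intro h hh
    rw [sm_eq, sm_eq]
    refine Fintype.sum_equiv (Equiv.mulLeft h) _ _ fun x => ?_
    by_cases hx : x ∈ N
    · simp [hx, J.mul_mem (hH hh) (hN hx)]
    · simp [hx]
  rw [sm_congr h1, sm_comm, ← sm_mul_const]
  refine sm_congr fun y hy => ?_
  obtain ⟨h0, hh0, hn0⟩ := hs y hy
  rw [← sm_const, sm_eq, sm_eq]
  symm
  refine Fintype.sum_equiv ((Equiv.inv G).trans (Equiv.mulLeft h0)) _ _ fun x => ?_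
  simp only [Equiv.trans_apply, Equiv.inv_apply, Equiv.coe_mulLeft, mul_inv_rev, inv_inv,
    Subgroup.mem_inf]
  have e1 : h0 * x⁻¹ ∈ H ↔ x ∈ H := by
    rw [H.mul_mem_cancel_left hh0, H.inv_mem_iff]
  have e2 : x * h0⁻¹ * y ∈ N ↔ x ∈ N := by
    rw [mul_assoc, N.mul_mem_cancel_right hn0]
  rw [e1, e2]
  by_cases h1 : x ∈ N <;> by_cases h2 : x ∈ H <;> simp [h1, h2]

theorem mackey (hs : Sup J N H) (hN : NI N J) (hH : H ≤ J) (hψ : Cls H ψ) :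
    ∀ x ∈ N, ind J H ψ x = ind N (N ⊓ H) ψ x := by
  intro x hx
  have := sm_sup hs hN.1 hH fun y => if y * x * y⁻¹ ∈ H then ψ (y * x * y⁻¹) else 0
  rw [ind, ind]
  have h2 : ∀ h ∈ H, (sm N fun n => if h * n * x * (h * n)⁻¹ ∈ H then ψ (h * n * x * (h * n)⁻¹) else 0)
      = sm N fun n => if n * x * n⁻¹ ∈ N ⊓ H then ψ (n * x * n⁻¹) else 0 := by
    intro h hh
    refine sm_congr fun n hn => ?_
    have e : h * n * x * (h * n)⁻¹ = h * (n * x * n⁻¹) * h⁻¹ := by group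
    have e1 : n * x * n⁻¹ ∈ N := N.mul_mem (N.mul_mem hn hx) (N.inv_mem hn)
    rw [e, NI.refl.conj_mem hh, Subgroup.mem_inf]
    by_cases hc : n * x * n⁻¹ ∈ H
    · rw [if_pos hc, if_pos ⟨e1, hc⟩, hψ h hh _ hc]
    · rw [if_neg hc, if_neg fun h => hc h.2]
  rw [sm_congr h2, sm_const] at this
  have c1 := card_ne_zero' (K := H)
  have c2 := card_ne_zero' (K := (N ⊓ H : Subgroup G))
  field_simp
  linear_combination -this

end PiSep

namespace PiSep
open Representation

section Base
variable {K : Type} [Group K]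

theorem HasDetOn.exists_rep {χ d : K → ℂ} (h : HasDetOn K χ d) :
    ∃ (V : Type) (_ : AddCommGroup V) (_ : Module ℂ V) (_ : FiniteDimensional ℂ V)
      (ρ : Representation ℂ K V), χ = ρ.character ∧ d = fun x => LinearMap.det (ρ x) := by
  obtain ⟨n, ρ, h, h'⟩ := h
  let σ : Representation ℂ K (Fin n → ℂ) :=
    (Matrix.toLinAlgEquiv' : Matrix (Fin n) (Fin n) ℂ ≃ₐ[ℂ] _).toAlgHom.toRingHom.toMonoidHom.comp ρ
  refine ⟨_, _, _, inferInstance, σ, ?_, ?_⟩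
  · ext x
    rw [h]
    exact (Matrix.trace_toLin'_eq (ρ x)).symm
  · ext x
    rw [h']
    exact (LinearMap.det_toLin' (ρ x)).symm

theorem det_equiv {V W : Type} [AddCommGroup V] [Module ℂ V] [AddCommGroup W] [Module ℂ W]
    {ρ : Representation ℂ K V} {σ : Representation ℂ K W} (e : ρ.Equiv σ) (x : K) :
    LinearMap.det (σ x) = LinearMap.det (ρ x) := by
  rw [← Representation.Equiv.conj_apply_self x e]
  exact LinearMap.det_conj (ρ x) e.toLinearEquiv

theorem HasDetOn.add {χ d χ' d' : K → ℂ} (h : HasDetOn K χ d) (h' : HasDetOn K χ' d') :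
    HasDetOn K (χ + χ') (d * d') := by
  obtain ⟨V, _, _, _, ρ, rfl, rfl⟩ := h.exists_rep
  obtain ⟨W, _, _, _, σ, rfl, rfl⟩ := h'.exists_rep
  have := hasDetOn_of_rep (ρ.prod σ)
  rw [character_prod] at this
  convert this using 1
  ext x
  exact (det_prod ρ σ x).symm

theorem HasDetOn.mul_hom {χ d : K → ℂ} (h : HasDetOn K χ d) (l : K →* ℂ) {n : ℕ}
    (hn : χ 1 = n) : HasDetOn K (χ * l) (d * (l : K → ℂ) ^ n) := by
  obtain ⟨m, ρ, h, h'⟩ := h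
  have : m = n := by
    rw [h] at hn
    simpa using hn
  subst this
  refine ⟨m, ⟨⟨fun x => l x • ρ x, by simp⟩, fun x y => by simp [smul_smul, mul_comm]⟩, ?_, ?_⟩
  · intro x; simp [h, mul_comm]
  · intro x; simp [h', mul_comm]

theorem HasDetOn.exists_hom {χ d : K → ℂ} (h : HasDetOn K χ d) : ∃ l : K →* ℂ, ∀ x, d x = l x := by
  obtain ⟨n, ρ, -, h'⟩ := h
  exact ⟨Matrix.detMonoidHom.comp ρ, h'⟩

variable [Fintype K]

theorem exists_equiv {V W : Type} [AddCommGroup V] [Module ℂ V] [FiniteDimensional ℂ V]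
    [AddCommGroup W] [Module ℂ W] [FiniteDimensional ℂ W]
    {ρ : Representation ℂ K V} {σ : Representation ℂ K W} (hρ : IsIrreducible ρ)
    (hσ : IsIrreducible σ) (e : ρ.character = σ.character) : Nonempty (Equiv σ ρ) := by
  have := invertibleOfNonzero (card_ne_zero' (K := K))
  by_contra hc
  have h1 := char_orthonormal ρ σ
  rw [if_neg hc, ← e] at h1
  have h2 := char_orthonormal ρ ρ
  rw [if_pos ⟨Representation.Equiv.refl _⟩, h1] at h2
  simp at h2

theorem det_formula : ∃ D : {θ : K → ℂ // IsIrrChar K θ} → K → ℂ, ∀ (V : Type) [AddCommGroup V]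
    [Module ℂ V] [FiniteDimensional ℂ V] (ρ : Representation ℂ K V),
    ∃ m : {θ : K → ℂ // IsIrrChar K θ} → ℕ, (∀ θ, bip ρ.character θ.1 = m θ) ∧
      ∀ x, LinearMap.det (ρ x) = ∏ θ, D θ x ^ m θ := by
  have hD : ∀ θ : {θ : K → ℂ // IsIrrChar K θ}, ∃ D : K → ℂ, ∀ (V : Type) [AddCommGroup V]
      [Module ℂ V] [FiniteDimensional ℂ V] (ρ : Representation ℂ K V), IsIrreducible ρ →
      ρ.character = θ.1 → ∀ x, LinearMap.det (ρ x) = D x := by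
    intro θ
    obtain ⟨V, _, _, _, ρ, hρ, e⟩ := irr_exists_rep θ.2
    refine ⟨fun x => LinearMap.det (ρ x), fun W _ _ _ σ hσ e' x => ?_⟩
    obtain ⟨i⟩ := exists_equiv hσ hρ (e'.trans e)
    exact det_equiv i x
  choose D hD using hD
  refine ⟨D, fun V _ _ _ ρ => ?_⟩
  refine rep_induction (fun V _ _ _ ρ => ∃ m : {θ : K → ℂ // IsIrrChar K θ} → ℕ,
    (∀ θ, bip ρ.character θ.1 = m θ) ∧ ∀ x, LinearMap.det (ρ x) = ∏ θ, D θ x ^ m θ)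
    ?_ ?_ ?_ ?_ V ρ
  · intro V _ _ _ ρ hV
    have : ρ.character = 0 := by
      ext x
      simp [Representation.character, Subsingleton.elim (ρ x) 0]
    refine ⟨0, by simp [this, bip], fun x => ?_⟩
    rw [LinearMap.det_eq_one_of_subsingleton]
    simp
  · intro V _ _ _ ρ hρ
    have hirr : IsIrrChar K ρ.character := by
      refine isIrrChar_iff.2 ⟨isCharacter_of_rep ρ, ?_⟩
      rw [bip_rep, IsIrreducible.finrank_intertwiningMap_self]; simp
    refine ⟨fun θ => if θ = ⟨_, hirr⟩ then 1 else 0, fun θ => ?_, fun x => ?_⟩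
    · rw [bip_irr hirr θ.2]
      by_cases h : θ = ⟨_, hirr⟩
      · simp [h]
      · rw [if_neg fun e => h (Subtype.ext e.symm)]
        simp [h]
    · rw [Finset.prod_eq_single ⟨_, hirr⟩]
      · simpa using hD ⟨_, hirr⟩ V ρ hρ rfl x
      · intro θ _ h; simp [h]
      · simp
  · rintro V _ _ _ W _ _ _ ρ σ - - ⟨m, h1, h2⟩ ⟨m', h1', h2'⟩
    refine ⟨m + m', fun θ => ?_, fun x => ?_⟩
    · rw [character_prod, bip_add_left, h1, h1']; simp
    · rw [det_prod, h2, h2', ← Finset.prod_mul_distrib]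
      simp [pow_add]
  · rintro V W _ _ _ _ _ _ ρ σ e ⟨m, h1, h2⟩
    refine ⟨m, ?_, fun x => ?_⟩
    · rw [← char_iso e]; exact h1
    · rw [det_equiv e, h2]

theorem HasDetOn.unique {χ d d' : K → ℂ} (h : HasDetOn K χ d) (h' : HasDetOn K χ d') : d = d' := by
  obtain ⟨D, hD⟩ := det_formula (K := K)
  obtain ⟨V, _, _, _, ρ, e, rfl⟩ := h.exists_rep
  obtain ⟨W, _, _, _, σ, e', rfl⟩ := h'.exists_rep
  obtain ⟨m, h1, h2⟩ := hD V ρ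
  obtain ⟨m', h1', h2'⟩ := hD W σ
  have : m = m' := by
    ext θ
    have := (h1 θ).symm.trans ((by rw [← e, e'] : _ = _).trans (h1' θ))
    exact_mod_cast this
  ext x
  rw [h2, h2', this]

end Base

variable {G : Type} [Group G] {J H K N : Subgroup G} {f g f' g' χ ψ θ d d' : G → ℂ}

/-- `d` is the determinant of the character `χ` of `J`. -/
def HasDet (J : Subgroup G) (χ d : G → ℂ) : Prop := HasDetOn J (fun x => χ x) (fun x => d x)

theorem HasDet.congr (h : HasDet J χ d) (e : ∀ x ∈ J, χ x = f x) (e' : ∀ x ∈ J, d x = d' x) :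
    HasDet J f d' := by
  have h1 : (fun x : J => f x) = fun x : J => χ x := funext fun x => (e x x.2).symm
  have h2 : (fun x : J => d' x) = fun x : J => d x := funext fun x => (e' x x.2).symm
  rw [HasDet, h1, h2]
  exact h

theorem HasDet.ch (h : HasDet J χ d) : Ch J χ := h.isCharacter

theorem Ch.exists_det (h : Ch J χ) : ∃ d, HasDet J χ d := by
  obtain ⟨d, hd⟩ := exists_hasDetOn h
  refine ⟨fun x => if hx : x ∈ J then d ⟨x, hx⟩ else 0, ?_⟩
  simpa [HasDet] using hd

theorem HasDet.lin (h : HasDet J χ d) : Lin J d := by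
  obtain ⟨l, hl⟩ := h.exists_hom
  refine ⟨by simpa using hl 1, fun x hx y hy => ?_⟩
  have h1 := hl ⟨x, hx⟩
  have h2 := hl ⟨y, hy⟩
  have h3 := hl (⟨x, hx⟩ * ⟨y, hy⟩)
  rw [map_mul, ← h1, ← h2] at h3
  exact h3

theorem HasDet.mono (h : HasDet J χ d) (hHJ : H ≤ J) : HasDet H χ d :=
  HasDetOn.comap (Subgroup.inclusion hHJ) h

theorem HasDet.comap {Γ : Type} [Group Γ] {p : Γ →* G} {L : Subgroup Γ} (h : HasDet J χ d)
    (hp : L ≤ J.comap p) : HasDet L (fun x => χ (p x)) (fun x => d (p x)) :=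
  HasDetOn.comap ((p.comp L.subtype).codRestrict J fun x => hp x.2) h

theorem HasDet.cj {L : Subgroup G} (h : HasDet J χ d) (y : G) (hL : ∀ x ∈ L, y * x * y⁻¹ ∈ J) :
    HasDet L (cj y χ) (cj y d) :=
  h.comap (p := (MulAut.conj y).toMonoidHom) (L := L) hL

theorem HasDet.ringHom (h : HasDet J χ d) (τ : ℂ →+* ℂ) :
    HasDet J (fun x => τ (χ x)) (fun x => τ (d x)) := HasDetOn.ringHom τ h

theorem HasDet.add (h : HasDet J χ d) (h' : HasDet J f d') : HasDet J (χ + f) (d * d') :=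
  HasDetOn.add h h'

theorem Lin.hasDet (h : Lin J d) : HasDet J d d := hasDetOn_hom h.hom

theorem HasDet.mul_lin (h : HasDet J χ d) {l : G → ℂ} (hl : Lin J l) {n : ℕ} (hn : χ 1 = n) :
    HasDet J (χ * l) (d * l ^ n) := HasDetOn.mul_hom h hl.hom hn

theorem HasDet.zero : HasDet J 0 1 :=
  ⟨0, 1, by intro x; simp, by intro x; simp⟩

theorem HasDet.nsmul (h : HasDet J χ d) (n : ℕ) : HasDet J ((n : ℂ) • χ) (d ^ n) := by
  induction n with
  | zero => simpa using HasDet.zero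
  | succ n ih =>
    rw [Nat.cast_succ, add_smul, one_smul, pow_succ]
    exact ih.add h

theorem HasDet.sum {ι : Type*} (s : Finset ι) {F D : ι → G → ℂ} (h : ∀ i ∈ s, HasDet J (F i) (D i)) :
    HasDet J (∑ i ∈ s, F i) (∏ i ∈ s, D i) := by
  induction s using Finset.induction_on with
  | empty => simpa using HasDet.zero
  | insert a s ha ih =>
    rw [Finset.sum_insert ha, Finset.prod_insert ha]
    exact (h a (Finset.mem_insert_self _ _)).add (ih fun i hi => h i (Finset.mem_insert_of_mem hi))

theorem HasDet.unique [Fintype G] (h : HasDet J χ d) (h' : HasDet J χ d') : ∀ x ∈ J, d x = d' x :=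
  fun x hx => congrFun (HasDetOn.unique h h') ⟨x, hx⟩

section Lin
variable {l l' : G → ℂ}

theorem Lin.mono (h : Lin J l) (hHJ : H ≤ J) : Lin H l :=
  ⟨h.1, fun x hx y hy => h.2 x (hHJ hx) y (hHJ hy)⟩

theorem Lin.one : Lin J 1 := ⟨rfl, fun _ _ _ _ => by simp⟩

theorem Lin.mul (h : Lin J l) (h' : Lin J l') : Lin J (l * l') :=
  ⟨by simp [h.1, h'.1], fun x hx y hy => by
    simp only [Pi.mul_apply, h.2 x hx y hy, h'.2 x hx y hy]; ring⟩

theorem Lin.pow (h : Lin J l) (n : ℕ) : Lin J (l ^ n) :=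
  ⟨by simp [h.1], fun x hx y hy => by simp only [Pi.pow_apply, h.2 x hx y hy]; ring⟩

theorem Lin.inv (h : Lin J l) : Lin J l⁻¹ :=
  ⟨by simp [h.1], fun x hx y hy => by simp only [Pi.inv_apply, h.2 x hx y hy]; ring⟩

theorem Lin.ne_zero (h : Lin J l) {x : G} (hx : x ∈ J) : l x ≠ 0 := by
  intro h0
  have := h.2 x hx x⁻¹ (J.inv_mem hx)
  rw [mul_inv_cancel, h.1, h0, zero_mul] at this
  exact one_ne_zero this

theorem Lin.inv_apply (h : Lin J l) {x : G} (hx : x ∈ J) : l x⁻¹ = (l x)⁻¹ := by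
  have := h.2 x hx x⁻¹ (J.inv_mem hx)
  rw [mul_inv_cancel, h.1] at this
  exact eq_inv_of_mul_eq_one_right this.symm

theorem Lin.pow_apply (h : Lin J l) {x : G} (hx : x ∈ J) (n : ℕ) : l (x ^ n) = l x ^ n := by
  induction n with
  | zero => simp [h.1]
  | succ n ih => rw [pow_succ, h.2 _ (J.pow_mem hx n) x hx, ih, pow_succ]

theorem Lin.pow_card (h : Lin J l) {x : G} (hx : x ∈ J) : l x ^ Nat.card J = 1 := by
  rw [← h.pow_apply hx]
  have : (⟨x, hx⟩ : J) ^ Nat.card J = 1 := pow_card_eq_one'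
  rw [show x ^ Nat.card J = 1 from congrArg Subtype.val this, h.1]

theorem Lin.pow_orderOf (h : Lin J l) {x : G} (hx : x ∈ J) : l x ^ orderOf x = 1 := by
  rw [← h.pow_apply hx, pow_orderOf_eq_one, h.1]

theorem Lin.cls (h : Lin J l) : Cls J l := h.ch.cls

variable [Fintype G]

theorem Lin.irr (h : Lin J l) : Irr J l := by
  refine irr_iff.2 ⟨h.ch, ?_⟩
  rw [ip_def, sm_congr (F' := fun _ => 1), sm_const, mul_one, inv_mul_cancel₀ card_ne_zero']
  intro x hx
  rw [h.inv_apply hx, mul_inv_cancel₀ (h.ne_zero hx)]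

theorem ip_mul_lin (hl : Lin J l) (f g : G → ℂ) : ip J (f * l) (g * l) = ip J f g := by
  rw [ip_def, ip_def]
  congr 1
  refine sm_congr fun x hx => ?_
  simp only [Pi.mul_apply, hl.inv_apply hx]
  field_simp [hl.ne_zero hx]

theorem Irr.mul_lin (h : Irr J χ) (hl : Lin J l) : Irr J (χ * l) :=
  irr_iff.2 ⟨h.ch.mul hl.ch, by rw [ip_mul_lin hl, h.ip_self]⟩

omit [Fintype G] in
theorem Ch.lin_of_degree_one (h : Ch J χ) (h1 : χ 1 = 1) : Lin J χ := by
  obtain ⟨n, ρ, hρ⟩ := exists_matrix h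
  have hn : n = 1 := by
    have := hρ 1
    simp only [map_one, Matrix.trace_one, Fintype.card_fin, OneMemClass.coe_one, h1] at this
    exact_mod_cast this.symm
  subst hn
  refine ⟨h1, fun x hx y hy => ?_⟩
  have e1 := hρ ⟨x, hx⟩
  have e2 := hρ ⟨y, hy⟩
  have e3 := hρ (⟨x, hx⟩ * ⟨y, hy⟩)
  rw [map_mul] at e3
  simp only [Matrix.trace, Matrix.diag, Finset.univ_unique, Fin.default_eq_zero,
    Finset.sum_singleton, Matrix.mul_apply] at e1 e2 e3
  rw [e1, e2]
  exact e3

end Lin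
end PiSep

namespace PiSep

variable {G : Type} [Group G] {J H K N : Subgroup G} {f g f' g' χ ψ θ ρ d d' : G → ℂ}

/-- The degree of a character. -/
def deg (f : G → ℂ) : ℕ := ⌊(f 1).re⌋₊

theorem deg_of_eq {n : ℕ} (h : f 1 = n) : deg f = n := by
  rw [deg, h]; simp

theorem Ch.deg (h : Ch J f) : f 1 = deg f := by
  obtain ⟨n, h1, -⟩ := h.degree
  rw [deg_of_eq h1, h1]

theorem deg_congr (h : f 1 = g 1) : deg f = deg g := by
  rw [deg, h, deg]

@[simp] theorem deg_cj (y : G) : deg (cj y f) = deg f := deg_congr (cj_apply_one y f)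

theorem Ch.eq_zero_of_deg (h : Ch J f) (h0 : f 1 = 0) : ∀ x ∈ J, f x = 0 := by
  obtain ⟨n, h1, h2⟩ := h.degree
  exact h2 (by exact_mod_cast h1.symm.trans h0)

variable [Fintype G]

theorem Irr.deg_pos (h : Irr J f) : 0 < deg f := by
  refine Nat.pos_of_ne_zero fun h0 => h.one_ne_zero ?_
  rw [h.ch.deg, h0, Nat.cast_zero]

theorem Irr.cls (h : Irr J f) : Cls J f := h.ch.cls

theorem ip_sub_left : ip J (f - f') g = ip J f g - ip J f' g := by
  rw [sub_eq_add_neg, ip_add_left, show -f' = (-1 : ℂ) • f' by ext; simp, ip_smul_left]; ring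

omit [Fintype G] in
theorem Cls.sub (h : Cls J f) (h' : Cls J g) : Cls J (f - g) := fun y hy x hx => by
  simp only [Pi.sub_apply, h y hy x hx, h' y hy x hx]

theorem Ch.sub (hχ : Ch J χ) (hθ : Irr J θ) (h : ip J χ θ ≠ 0) : Ch J (χ - θ) := by
  refine ch_of_nat (hχ.cls.sub hθ.cls) fun ψ hψ => ?_
  rw [ip_sub_left]
  obtain ⟨n, hn⟩ := hχ.ip_nat hψ.ch
  by_cases hc : ip J θ ψ = 0
  · exact ⟨n, by rw [hn, hc, sub_zero]⟩
  · have e := hθ.eqOn hψ hc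
    have e1 : ip J χ ψ = ip J χ θ := ip_congr (fun _ _ => rfl) fun x hx => (e x hx).symm
    have e2 : ip J θ ψ = 1 := by
      rw [ip_congr (fun _ _ => rfl) fun x hx => (e x hx).symm, hθ.ip_self]
    rw [e1] at hn
    obtain ⟨m, rfl⟩ := Nat.exists_eq_succ_of_ne_zero (n := n)
      (by rintro rfl; exact h (by rw [hn, Nat.cast_zero]))
    refine ⟨m, ?_⟩
    rw [e1, e2, hn]
    push_cast
    ring

theorem Ch.exists_const (h : Ch J χ) (h1 : χ 1 ≠ 0) : ∃ θ, Irr J θ ∧ ip J χ θ ≠ 0 := by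
  rw [h.cls.expand 1 J.one_mem] at h1
  obtain ⟨θ, hθ, h2⟩ := Finset.exists_ne_zero_of_sum_ne_zero h1
  exact ⟨θ, (mem_irrs.1 hθ).1, left_ne_zero_of_mul h2⟩

theorem Irr.exists_const (h : Irr J χ) (hN : N ≤ J) : ∃ θ, Irr N θ ∧ ip N χ θ ≠ 0 :=
  (h.ch.mono hN).exists_const h.one_ne_zero

theorem ip_expand (h : Cls J χ) (hN : N ≤ J) (θ : G → ℂ) :
    ip N χ θ = ∑ ρ ∈ irrs J, ip J χ ρ * ip N ρ θ := by
  rw [ip_congr (f' := ∑ ρ ∈ irrs J, ip J χ ρ • ρ) (g' := θ), ip_sum_left]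
  · simp only [ip_smul_left]
  · intro x hx
    simpa using h.expand x (hN hx)
  · exact fun _ _ => rfl

theorem exists_over (h : Cls J χ) (hN : N ≤ J) (hθ : ip N χ θ ≠ 0) :
    ∃ ρ, Irr J ρ ∧ ip J χ ρ ≠ 0 ∧ ip N ρ θ ≠ 0 := by
  rw [ip_expand h hN] at hθ
  obtain ⟨ρ, hρ, h2⟩ := Finset.exists_ne_zero_of_sum_ne_zero hθ
  exact ⟨ρ, (mem_irrs.1 hρ).1, left_ne_zero_of_mul h2, right_ne_zero_of_mul h2⟩

theorem ip_add_ne_zero (h : Ch J χ) (h' : Ch J ψ) (hθ : Ch J θ) (hc : ip J χ θ ≠ 0) :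
    ip J (χ + ψ) θ ≠ 0 := by
  obtain ⟨m, hm⟩ := h.ip_nat hθ
  obtain ⟨n, hn⟩ := h'.ip_nat hθ
  rw [ip_add_left, hm, hn]
  rw [hm] at hc
  norm_cast at hc ⊢
  omega

theorem const_trans (hχ : Ch J χ) (hρ : Irr J ρ) (h : ip J χ ρ ≠ 0) (hN : N ≤ J) (hθ : Ch N θ)
    (h' : ip N ρ θ ≠ 0) : ip N χ θ ≠ 0 := by
  have := ip_add_ne_zero (hρ.ch.mono hN) ((hχ.sub hρ h).mono hN) hθ h'
  rwa [add_sub_cancel] at this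

theorem Ch.deg_le (hχ : Ch J χ) (hθ : Irr J θ) (h : ip J χ θ ≠ 0) :
    PiSep.deg θ ≤ PiSep.deg χ := by
  have h1 := (hχ.sub hθ h).deg
  rw [Pi.sub_apply, hχ.deg, hθ.ch.deg, sub_eq_iff_eq_add] at h1
  norm_cast at h1
  omega

theorem Ch.eq_of_degree (hχ : Ch J χ) (hθ : Irr J θ) (h : ip J χ θ ≠ 0) (h1 : χ 1 = θ 1) :
    ∀ x ∈ J, χ x = θ x := by
  intro x hx
  have := (hχ.sub hθ h).eq_zero_of_deg (by simp [h1]) x hx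
  simpa [sub_eq_zero] using this

theorem Irr.ip_self_eqOn (hχ : Irr J χ) (h : ∀ x ∈ J, χ x = θ x) : ip J χ θ = 1 := by
  rw [← ip_congr (fun _ _ => rfl) h, hχ.ip_self]

theorem Ch.irr_of_const (hχ : Ch J χ) (hθ : Irr J θ) (h : ip J χ θ ≠ 0) (h1 : χ 1 = θ 1) :
    Irr J χ := hθ.congr fun x hx => (hχ.eq_of_degree hθ h h1 x hx).symm

/-- A nonzero sub-character of an irreducible character is everything. -/
theorem Irr.eq_of_add (h : Irr J χ) (hf : Ch J f) (hg : Ch J g) (e : ∀ x ∈ J, χ x = f x + g x)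
    (hf1 : f 1 ≠ 0) : ∀ x ∈ J, g x = 0 := by
  obtain ⟨θ, hθ, h1⟩ := hf.exists_const hf1
  have h2 : ip J χ θ ≠ 0 := by
    rw [ip_congr (f' := f + g) (g' := θ) e fun _ _ => rfl]
    exact ip_add_ne_zero hf hg hθ.ch h1
  have h3 := h.eqOn hθ h2
  have h4 := hf.deg_le hθ h1
  refine hg.eq_zero_of_deg ?_
  have h5 := e 1 J.one_mem
  rw [h3 1 J.one_mem, hθ.ch.deg, hf.deg, hg.deg] at h5
  rw [hg.deg]
  norm_cast at h5 ⊢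
  omega

section Transport
variable {Γ : Type} [Group Γ] [Fintype Γ] {p : Γ →* G} {L : Subgroup Γ}

theorem sum_hom {A B : Type} [Group A] [Fintype A] [Group B] [Fintype B] (q : A →* B)
    (hq : Function.Surjective q) (F : B → ℂ) :
    (Nat.card A : ℂ)⁻¹ * ∑ a, F (q a) = (Nat.card B : ℂ)⁻¹ * ∑ b, F b := by
  have h1 : ∀ b, (Finset.univ.filter fun a => q a = b).card = Nat.card q.ker := by
    intro b
    have := MonoidHom.card_fiber_eq_of_mem_range q (hq b) (hq 1)
    rw [this, Nat.card_eq_fintype_card, Fintype.card_subtype]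
    simp only [MonoidHom.mem_ker]
  have h2 : ∑ a, F (q a) = Nat.card q.ker * ∑ b, F b := by
    rw [← Finset.sum_fiberwise_of_maps_to (s := Finset.univ) (t := Finset.univ) (g := q)
      (fun _ _ => Finset.mem_univ _), Finset.mul_sum]
    refine Finset.sum_congr rfl fun b _ => ?_
    rw [Finset.sum_congr rfl (g := fun _ => F b) fun a ha => by rw [(Finset.mem_filter.1 ha).2],
      Finset.sum_const, h1, nsmul_eq_mul]
  have h3 : Nat.card A = Nat.card B * Nat.card q.ker := by
    rw [← Subgroup.card_mul_index q.ker, Subgroup.index_ker, Nat.mul_comm,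
      MonoidHom.range_eq_top.2 hq, Nat.card_congr Subgroup.topEquiv.toEquiv]
  rw [h2, h3]
  have c1 := card_ne_zero' (K := B)
  have c2 := card_ne_zero' (K := q.ker)
  push_cast
  field_simp

theorem sm_map (F : G → ℂ) : (Nat.card L : ℂ)⁻¹ * (sm L fun x => F (p x)) =
    (Nat.card (L.map p) : ℂ)⁻¹ * sm (L.map p) F :=
  sum_hom (p.subgroupMap L) (p.subgroupMap_surjective L) fun x => F x

theorem ip_map (f g : G → ℂ) :
    ip (L.map p) f g = ip L (fun x => f (p x)) (fun x => g (p x)) := by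
  rw [ip_def, ← sm_map, ip_def]
  simp

omit [Fintype G] [Fintype Γ] in
theorem cls_map : Cls (L.map p) f ↔ Cls L fun x => f (p x) := by
  constructor
  · intro h y hy x hx
    simpa using h (p y) (Subgroup.mem_map_of_mem p hy) (p x) (Subgroup.mem_map_of_mem p hx)
  · rintro h _ ⟨y, hy, rfl⟩ _ ⟨x, hx, rfl⟩
    simpa using h y hy x hx

omit [Fintype Γ] [Fintype G] in
theorem Ch.of_map (h : Ch (L.map p) f) : Ch L fun x => f (p x) :=
  h.comap (L.le_comap_map p)

theorem ch_map : Ch (L.map p) f ↔ Ch L fun x => f (p x) := by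
  refine ⟨Ch.of_map, fun h => ch_of_nat (cls_map.2 h.cls) fun θ hθ => ?_⟩
  rw [ip_map]
  exact h.ip_nat hθ.ch.of_map

theorem irr_map : Irr (L.map p) f ↔ Irr L fun x => f (p x) := by
  rw [irr_iff, irr_iff, ch_map, ip_map]

omit [Fintype Γ] [Fintype G] in
theorem HasDet.of_map (h : HasDet (L.map p) f d) : HasDet L (fun x => f (p x)) fun x => d (p x) :=
  h.comap (L.le_comap_map p)

omit [Fintype G] [Fintype Γ] in
/-- A function constant on the fibres of `p` on `L` descends to `L.map p`. -/
theorem exists_descend (F : Γ → ℂ) (h : ∀ x ∈ L, ∀ y ∈ L, p x = p y → F x = F y) :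
    ∃ f : G → ℂ, ∀ x ∈ L, f (p x) = F x := by
  refine ⟨fun z => if hz : ∃ x ∈ L, p x = z then F hz.choose else 0, fun x hx => ?_⟩
  have hz : ∃ y ∈ L, p y = p x := ⟨x, hx, rfl⟩
  simp only [dif_pos hz]
  exact h _ hz.choose_spec.1 x hx hz.choose_spec.2

end Transport
end PiSep

namespace PiSep

section MatrixRoots
variable {n m : ℕ} {A : Matrix (Fin n) (Fin n) ℂ}

theorem pow_eq_one_of_mem_roots (hA : A ^ m = 1) {z : ℂ} (hz : z ∈ A.charpoly.roots) :
    z ^ m = 1 := by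
  have h1 : z ∈ spectrum ℂ A :=
    Matrix.mem_spectrum_iff_isRoot_charpoly.2 (Polynomial.isRoot_of_mem_roots hz)
  have h2 := spectrum.pow_mem_pow A m h1
  rw [hA] at h2
  rcases isEmpty_or_nonempty (Fin n) with h | h
  · simp [spectrum.of_subsingleton] at h2
  · simpa using h2

theorem eq_one_of_roots (hm : m ≠ 0) (hA : A ^ m = 1) (h : ∀ z ∈ A.charpoly.roots, z = 1) :
    A = 1 := by
  open Polynomial in
  have h1 : A.charpoly = (X - 1 : ℂ[X]) ^ Multiset.card A.charpoly.roots := by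
    conv_lhs => rw [(IsAlgClosed.splits A.charpoly).eq_prod_roots_of_monic A.charpoly_monic]
    rw [Multiset.eq_replicate_card.2 h]
    simp
  open Polynomial in
  let q : ℂ[X] := ∑ i ∈ Finset.range m, X ^ i
  open Polynomial in
  have h2 : IsCoprime q ((X - 1 : ℂ[X]) ^ Multiset.card A.charpoly.roots) := by
    refine IsCoprime.pow_right (IsCoprime.symm ?_)
    have hi : Irreducible (X - 1 : ℂ[X]) := by simpa using irreducible_X_sub_C (1 : ℂ)
    refine (hi.coprime_iff_not_dvd).2 fun hd => ?_
    rw [show (X - 1 : ℂ[X]) = X - C 1 by simp, dvd_iff_isRoot] at hd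
    simp [q, eval_finsetSum, hm] at hd
  obtain ⟨a, b, hab⟩ := h2
  have h3 := congrArg (Polynomial.aeval A) hab
  rw [← h1] at h3
  simp only [map_add, map_mul, Matrix.aeval_self_charpoly, mul_zero, add_zero, map_one] at h3
  have h4 : Polynomial.aeval A q * (A - 1) = 0 := by
    have : q * (Polynomial.X - 1) = Polynomial.X ^ m - 1 := by
      simp only [q]; exact geom_sum_mul _ _
    have := congrArg (Polynomial.aeval A) this
    simpa [hA] using this
  have h5 := congrArg (Polynomial.aeval A a * ·) h4
  simp only [← Matrix.mul_assoc, h3, Matrix.one_mul, Matrix.mul_zero] at h5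
  exact sub_eq_zero.1 h5

end MatrixRoots

theorem eq_one_of_sum_eq_card {s : Multiset ℂ} (h : ∀ z ∈ s, ‖z‖ = 1) (hs : s.sum = s.card) :
    ∀ z ∈ s, z = 1 := by
  have h1 : ∀ z ∈ s, 0 ≤ 1 - z.re := fun z hz => by
    have := Complex.re_le_norm z
    rw [h z hz] at this
    linarith
  have h2 : (s.map fun z : ℂ => 1 - z.re).sum = 0 := by
    rw [Multiset.sum_map_sub]
    have := congrArg Complex.re hs
    rw [show s.sum.re = (s.map Complex.re).sum from map_multiset_sum Complex.reAddGroupHom s] at this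
    simp only [Multiset.map_const', Multiset.sum_replicate, nsmul_eq_mul, mul_one]
    simp at this
    linarith
  intro z hz
  have h3 : 1 - z.re ≤ 0 := h2 ▸ Multiset.single_le_sum (by simpa using h1) _
    (Multiset.mem_map_of_mem (fun z : ℂ => 1 - z.re) hz)
  have h4 : z.re = 1 := by have := h1 z hz; linarith
  have h5 := h z hz
  have h6 : z.im = 0 := by
    have := Complex.sq_norm z
    rw [h5, Complex.normSq_apply, h4] at this
    nlinarith
  exact Complex.ext (by simp [h4]) (by simp [h6])

section Type'
variable {K : Type} [Group K] [Finite K]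

omit [Finite K] in
theorem char_roots {χ : K → ℂ} (h : IsCharacter K χ) (x : K) : ∃ s : Multiset ℂ,
    χ x = s.sum ∧ χ 1 = s.card ∧ ∀ z ∈ s, z ^ orderOf x = 1 := by
  obtain ⟨n, ρ, h⟩ := exists_matrix h
  refine ⟨(ρ x).charpoly.roots, ?_, ?_, ?_⟩
  · rw [h, Matrix.trace_eq_sum_roots_charpoly]
  · rw [h, IsAlgClosed.card_roots_eq_natDegree, Matrix.charpoly_natDegree_eq_dim]
    simp
  · intro z hz
    exact pow_eq_one_of_mem_roots (by rw [← map_pow, pow_orderOf_eq_one, map_one]) hz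

theorem char_kernel {χ : K → ℂ} (h : IsCharacter K χ) {g : K} (hg : χ g = χ 1) (x : K) :
    χ (g * x) = χ x := by
  obtain ⟨n, ρ, h⟩ := exists_matrix h
  have hp : ρ g ^ orderOf g = 1 := by rw [← map_pow, pow_orderOf_eq_one, map_one]
  have h1 : ρ g = 1 := by
    refine eq_one_of_roots (orderOf_pos g).ne' hp (eq_one_of_sum_eq_card ?_ ?_)
    · intro z hz
      exact Complex.norm_eq_one_of_pow_eq_one (pow_eq_one_of_mem_roots hp hz) (orderOf_pos g).ne'
    · rw [← Matrix.trace_eq_sum_roots_charpoly, ← h, hg, h,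
        IsAlgClosed.card_roots_eq_natDegree, Matrix.charpoly_natDegree_eq_dim]
      simp
  rw [h, h, map_mul, h1, one_mul]

end Type'

section Sub
variable {G : Type} [Group G] [Fintype G] {J H K N : Subgroup G} {f g χ ψ θ ρ : G → ℂ}

theorem Ch.roots (h : Ch J χ) {x : G} (hx : x ∈ J) : ∃ s : Multiset ℂ,
    χ x = s.sum ∧ χ 1 = s.card ∧ ∀ z ∈ s, z ^ orderOf x = 1 := by
  obtain ⟨s, h1, h2, h3⟩ := char_roots h ⟨x, hx⟩
  exact ⟨s, h1, h2, by simpa using h3⟩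

theorem Ch.kernel (h : Ch J χ) {y : G} (hy : y ∈ J) (h1 : χ y = χ 1) {x : G} (hx : x ∈ J) :
    χ (y * x) = χ x := char_kernel (g := ⟨y, hy⟩) h h1 ⟨x, hx⟩

theorem Ch.isIntegral (h : Ch J χ) {x : G} (hx : x ∈ J) : IsIntegral ℤ (χ x) := by
  obtain ⟨s, h1, -, h3⟩ := h.roots hx
  rw [h1]
  refine IsIntegral.multiset_sum fun z hz => ?_
  exact IsIntegral.of_pow (orderOf_pos x) (h3 z hz ▸ isIntegral_one)

end Sub
end PiSep

namespace PiSep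
open Representation

theorem schur {K : Type} [Group K] [Fintype K] {V : Type} [AddCommGroup V] [Module ℂ V]
    [FiniteDimensional ℂ V] (ρ : Representation ℂ K V) (h : bip ρ.character ρ.character = 1)
    (T : V →ₗ[ℂ] V) (hT : ∀ g, T ∘ₗ ρ g = ρ g ∘ₗ T) : ∃ c : ℂ, T = c • LinearMap.id := by
  rw [bip_rep] at h
  have h1 : Module.finrank ℂ (IntertwiningMap ρ ρ) = 1 := by exact_mod_cast h
  have h2 : (IntertwiningMap.id ρ) ≠ 0 := by
    intro h0
    have h3 : Subsingleton V := ⟨fun v w => by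
      have hv := congrArg (fun f : IntertwiningMap ρ ρ => f v) h0
      have hw := congrArg (fun f : IntertwiningMap ρ ρ => f w) h0
      exact hv.trans hw.symm⟩
    have h4 : Subsingleton (IntertwiningMap ρ ρ) := ⟨fun f g => by ext v; exact Subsingleton.elim _ _⟩
    rw [Module.finrank_zero_of_subsingleton] at h1
    exact zero_ne_one h1
  obtain ⟨c, hc⟩ := (finrank_eq_one_iff_of_nonzero' _ h2).1 h1 ⟨T, hT⟩
  refine ⟨c, ?_⟩
  ext v
  exact (congrArg (fun f : IntertwiningMap ρ ρ => f v) hc).symm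

variable {G : Type} [Group G] [Fintype G] {J H K N M : Subgroup G} {f g χ ψ θ ρ κ η : G → ℂ}

theorem schur_average (hη : Ch J η) (hM : M ≤ J) (h1 : Irr M η) {a b : G} (ha : a ∈ J)
    (hb : b ∈ J) :
    η 1 * sm M (fun m => η (a * (m * b * m⁻¹))) = Nat.card M * η a * η b := by
  obtain ⟨V, _, _, _, ρ, hρ⟩ := exists_rep hη
  let i : M →* J := Subgroup.inclusion hM
  have hχ : ∀ x : J, η x = ρ.character x := fun x => congrFun hρ x
  have h2 : bip (Representation.character (ρ.comp i)) (Representation.character (ρ.comp i)) = 1 := by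
    have := h1.ip_self
    rw [ip] at this
    convert this using 2 <;> exact funext fun x => (hχ (i x)).symm
  obtain ⟨c, hc⟩ := schur (ρ.comp i) h2 (∑ m : M, ρ (i m * ⟨b, hb⟩ * (i m)⁻¹)) (by
    intro g
    rw [← Module.End.mul_eq_comp, ← Module.End.mul_eq_comp, Finset.sum_mul, Finset.mul_sum]
    refine Fintype.sum_equiv (Equiv.mulLeft g⁻¹) _ _ fun m => ?_
    simp only [MonoidHom.comp_apply, ← map_mul, Equiv.coe_mulLeft]
    congr 1
    simp only [map_mul, map_inv]
    group)
  have key : ∀ y : J, (∑ m : M, η (y * ((m : G) * b * (m : G)⁻¹))) = c * η y := by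
    intro y
    have e : ∀ m : M, η (y * ((m : G) * b * (m : G)⁻¹)) =
        LinearMap.trace ℂ V (ρ y * ρ (i m * ⟨b, hb⟩ * (i m)⁻¹)) := fun m => by
      rw [← map_mul]
      exact hχ (y * (i m * ⟨b, hb⟩ * (i m)⁻¹))
    rw [Finset.sum_congr rfl fun m _ => e m, ← map_sum, ← Finset.mul_sum, hc, hχ y]
    change _ = c * LinearMap.trace ℂ V (ρ y)
    rw [← smul_eq_mul c, ← map_smul]
    congr 1
    ext v
    simp
  have k1 := key 1
  have k2 := key ⟨a, ha⟩
  have k3 : (∑ m : M, η ((1 : J) * ((m : G) * b * (m : G)⁻¹))) = Nat.card M * η b := by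
    rw [← sm_const]
    refine Finset.sum_congr rfl fun m _ => ?_
    rw [OneMemClass.coe_one, one_mul, hη.cls _ (hM m.2) _ hb]
  rw [k3] at k1
  change η 1 * (∑ m : M, η (a * ((m : G) * b * (m : G)⁻¹))) = _
  change (∑ m : M, η (a * ((m : G) * b * (m : G)⁻¹))) = c * η a at k2
  rw [k2]
  rw [OneMemClass.coe_one] at k1
  linear_combination -(η a) * k1

theorem Irr.convolution (h : Irr J κ) {y : G} (hy : y ∈ J) :
    κ 1 * sm J (fun b => κ (y * b) * κ b⁻¹) = Nat.card J * κ y := by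
  have h1 : ∀ b ∈ J, κ 1 * sm J (fun m => κ (y * (m * b * m⁻¹)) * κ b⁻¹) =
      Nat.card J * κ y * (κ b * κ b⁻¹) := fun b hb => by
    rw [sm_const_mul, ← mul_assoc, schur_average h.ch le_rfl h hy hb]
    ring
  have h2 : sm J (fun b => κ 1 * sm J (fun m => κ (y * (m * b * m⁻¹)) * κ b⁻¹)) =
      Nat.card J * (κ 1 * sm J (fun b => κ (y * b) * κ b⁻¹)) := by
    rw [sm_mul_const, sm_comm, sm_congr (F' := fun _ => sm J (fun b => κ (y * b) * κ b⁻¹)), sm_const]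
    · ring
    · intro m hm
      rw [← NI.refl.sm_conj (fun b => κ (y * b) * κ b⁻¹) hm]
      refine sm_congr fun b hb => ?_
      have := h.ch.inv.cls m hm b hb
      simp only [this]
  rw [sm_congr h1, sm_mul_const, sm_ip, h.ip_self, mul_one] at h2
  exact mul_left_cancel₀ (card_ne_zero' (K := J)) (by rw [← h2]; ring)

theorem Irr.posDef (h : Irr J κ) (S : Finset G) (hS : ∀ a ∈ S, a ∈ J) :
    ∃ r : ℝ, 0 ≤ r ∧ ∑ a ∈ S, ∑ b ∈ S, κ (a * b⁻¹) = r := by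
  have h1 : ∀ a ∈ S, ∀ b ∈ S, κ (a * b⁻¹) = (Nat.card J : ℂ)⁻¹ *
      (κ 1 * sm J fun x => κ (a * x) * starRingEnd ℂ (κ (b * x))) := by
    intro a ha b hb
    rw [eq_inv_mul_iff_mul_eq₀ (card_ne_zero' (K := J)),
      ← h.convolution (J.mul_mem (hS a ha) (J.inv_mem (hS b hb))), 
      ← sm_mul_left (fun x => κ (a * b⁻¹ * x) * κ x⁻¹) (hS b hb)]
    congr 1
    refine sm_congr fun x hx => ?_
    rw [← h.ch.inv_apply (J.mul_mem (hS b hb) hx)]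
    congr 2
    group
  refine ⟨(Nat.card J : ℝ)⁻¹ * (deg κ * ∑ x : J, Complex.normSq (∑ a ∈ S, κ (a * x))), by
    have : 0 ≤ ∑ x : J, Complex.normSq (∑ a ∈ S, κ (a * x)) :=
      Finset.sum_nonneg fun _ _ => Complex.normSq_nonneg _
    positivity, ?_⟩
  rw [Finset.sum_congr rfl fun a ha => Finset.sum_congr rfl fun b hb => h1 a ha b hb]
  simp only [← Finset.mul_sum, sm]
  push_cast
  rw [h.ch.deg]
  congr 2
  rw [Finset.sum_congr rfl fun a _ => Finset.sum_comm, Finset.sum_comm]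
  refine Finset.sum_congr rfl fun x _ => ?_
  rw [← Complex.mul_conj, map_sum, Finset.sum_mul_sum]

end PiSep

namespace PiSep

variable {G : Type} [Group G] [Fintype G] {J H K N M Z : Subgroup G} {f g χ ψ θ ρ κ η : G → ℂ}

theorem Irr.mul_central (h : Irr J χ) {a z : G} (ha : a ∈ J) (hz : z ∈ J)
    (hc : ∀ x ∈ J, x * z = z * x) : χ 1 * χ (a * z) = χ a * χ z := by
  have h1 := schur_average h.ch le_rfl h ha hz
  rw [sm_congr (F' := fun _ => χ (a * z)), sm_const] at h1
  · exact mul_left_cancel₀ (card_ne_zero' (K := J)) (by linear_combination h1)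
  · intro m hm
    simp only [hc m hm, mul_inv_cancel_right]

theorem Irr.deg_mul_card_dvd (h : Irr J χ) (hZ : Z ≤ J) (hc : ∀ z ∈ Z, ∀ x ∈ J, x * z = z * x) :
    deg χ * Nat.card Z ∣ Nat.card J := by
  obtain ⟨S, hS, -⟩ := Subgroup.exists_isComplement_left (Z.subgroupOf J) 1
  have hχ0 : χ 1 ≠ 0 := h.one_ne_zero
  have hZ0 : (Nat.card Z : ℂ) ≠ 0 := card_ne_zero'
  have hstab : ∀ y ∈ J, ∀ s ∈ J, ∀ z ∈ Z, χ (y * (s * z)) * χ (s * z)⁻¹ = χ (y * s) * χ s⁻¹ := by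
    intro y hy s hs z hz
    have e1 := h.mul_central (J.mul_mem hy hs) (hZ hz) (hc z hz)
    have hz' := Z.inv_mem hz
    have e2 := h.mul_central (J.inv_mem hs) (hZ hz') (hc _ hz')
    have e3 := h.mul_central (hZ hz) (hZ hz') (hc _ hz')
    rw [mul_inv_cancel] at e3
    rw [← mul_assoc, mul_inv_rev, ← hc z⁻¹ hz' s⁻¹ (J.inv_mem hs)] 
    refine mul_left_cancel₀ (mul_ne_zero hχ0 hχ0) ?_
    linear_combination χ 1 * χ (s⁻¹ * z⁻¹) * e1 + χ (y * s) * χ z * e2 - χ (y * s) * χ s⁻¹ * e3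
  have hsum : ∀ y ∈ J, χ 1 * Nat.card Z * ∑ s : S, χ (y * s) * χ (s : G)⁻¹ = Nat.card J * χ y := by
    intro y hy
    rw [← h.convolution hy, mul_assoc]
    congr 1
    rw [sm, ← (Equiv.ofBijective _ hS).sum_comp, Fintype.sum_prod_type, Finset.mul_sum]
    refine Finset.sum_congr rfl fun s _ => ?_
    have e : Nat.card Z = Nat.card (Z.subgroupOf J) := 
      (Nat.card_congr (Subgroup.subgroupOfEquivOfLe hZ).toEquiv).symm
    refine Eq.symm ?_
    refine (Finset.sum_congr rfl fun (z : ((Z.subgroupOf J : Subgroup J) : Set J)) _ =>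
      hstab y hy s s.1.2 z.1 (Subgroup.mem_subgroupOf.1 z.2)).trans ?_
    rw [Finset.sum_const, e,
      nsmul_eq_mul, Finset.card_univ, ← Nat.card_eq_fintype_card]
    rfl
  set c : ℂ := Nat.card J / (χ 1 * Nat.card Z) with hcdef
  have hcs : ∀ y ∈ J, c * χ y = ∑ s : S, χ (y * s) * χ (s : G)⁻¹ := by
    intro y hy
    rw [hcdef, div_mul_eq_mul_div, ← hsum y hy]
    field_simp
  let A := integralClosure ℤ ℂ
  let v : J → J → ℂ := fun y x => χ (x * y)
  have hInt : IsIntegral A c := by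
    refine isIntegral_of_smul_mem_submodule (Submodule.span A (Set.range v)) ?_
      (Submodule.fg_span (Set.finite_range v)) c ?_
    · intro h0
      have : v 1 ∈ Submodule.span A (Set.range v) := Submodule.subset_span ⟨1, rfl⟩
      rw [h0, Submodule.mem_bot] at this
      exact hχ0 (by simpa [v] using congrFun this 1)
    · intro n hn
      induction hn using Submodule.span_induction with
      | mem x hx =>
        obtain ⟨y, rfl⟩ := hx
        have : c • v y = ∑ s : S, (⟨χ (s : G)⁻¹, h.ch.isIntegral (J.inv_mem s.1.2)⟩ : A) • v (y * s) := by
          ext x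
          simp only [v, Pi.smul_apply, smul_eq_mul, Finset.sum_apply]
          rw [hcs _ (J.mul_mem x.2 y.2)]
          refine Finset.sum_congr rfl fun s _ => ?_
          change _ = χ (s : G)⁻¹ * _
          rw [mul_comm, Subgroup.coe_mul, mul_assoc]
        rw [this]
        exact Submodule.sum_mem _ fun s _ => Submodule.smul_mem _ _ (Submodule.subset_span ⟨_, rfl⟩)
      | zero => rw [smul_zero]; exact Submodule.zero_mem _
      | add x y _ _ hx hy => rw [smul_add]; exact Submodule.add_mem _ hx hy
      | smul a x _ hx => rw [smul_comm]; exact Submodule.smul_mem _ _ hx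
  have hintZ : IsIntegral ℤ c := isIntegral_trans (A := A) c hInt
  have hq : c = algebraMap ℚ ℂ (Nat.card J / (deg χ * Nat.card Z)) := by
    rw [hcdef, h.ch.deg]; simp
  rw [hq, isIntegral_algebraMap_iff (algebraMap ℚ ℂ).injective, IsIntegrallyClosed.isIntegral_iff] at hintZ
  obtain ⟨k, hk⟩ := hintZ
  have hd : (deg χ : ℚ) * Nat.card Z ≠ 0 :=
    mul_ne_zero (by exact_mod_cast h.deg_pos.ne') (by exact_mod_cast Nat.card_pos.ne')
  rw [eq_div_iff hd] at hk
  simp only [algebraMap_int_eq, eq_intCast] at hk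
  rw [← Int.natCast_dvd_natCast]
  refine ⟨k, ?_⟩
  push_cast
  rw [mul_comm]
  exact_mod_cast hk.symm

end PiSep

namespace PiSep

variable {G : Type} [Group G] {J H K N M Z T : Subgroup G} {f g χ ψ θ ρ κ η ζ ζ' : G → ℂ}

/-- The stabilizer in `J` of a function on `N`. -/
def stab (J N : Subgroup G) (θ : G → ℂ) : Subgroup G where
  carrier := {y | y ∈ J ∧ ∀ x, trunc N θ (y * x * y⁻¹) = trunc N θ x}
  one_mem' := ⟨J.one_mem, by simp⟩
  mul_mem' := by
    rintro a b ⟨ha, ha'⟩ ⟨hb, hb'⟩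
    refine ⟨J.mul_mem ha hb, fun x => ?_⟩
    rw [← hb' x, ← ha' (b * x * b⁻¹)]
    congr 1
    group
  inv_mem' := by
    rintro a ⟨ha, ha'⟩
    refine ⟨J.inv_mem ha, fun x => ?_⟩
    rw [← ha']
    congr 1
    group

theorem stab_le : stab J N θ ≤ J := fun _ h => h.1

theorem NI.mem_stab (h : NI N J) {y : G} :
    y ∈ stab J N θ ↔ y ∈ J ∧ ∀ x ∈ N, θ (y * x * y⁻¹) = θ x := by
  constructor
  · rintro ⟨hy, hy'⟩
    refine ⟨hy, fun x hx => ?_⟩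
    have := hy' x
    rwa [trunc_apply hx, trunc_apply ((h.conj_mem hy).2 hx)] at this
  · rintro ⟨hy, hy'⟩
    refine ⟨hy, fun x => ?_⟩
    by_cases hx : x ∈ N
    · rw [trunc_apply hx, trunc_apply ((h.conj_mem hy).2 hx), hy' x hx]
    · rw [trunc, trunc, if_neg hx, if_neg (mt (h.conj_mem hy).1 hx)]

theorem NI.le_stab (h : NI N J) (hθ : Cls N θ) : N ≤ stab J N θ := fun y hy =>
  h.mem_stab.2 ⟨h.1 hy, fun x hx => hθ y hy x hx⟩

theorem NI.stab_ni (h : NI N J) (hθ : Cls N θ) : NI N (stab J N θ) :=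
  h.mono stab_le (h.le_stab hθ)

theorem NI.stab_inv (h : NI N J) : ∀ y ∈ stab J N θ, ∀ x ∈ N, θ (y * x * y⁻¹) = θ x :=
  fun _ hy => (h.mem_stab.1 hy).2

variable [Fintype G]

theorem NI.ip_cj_self (h : NI N J) (hθ : Irr N θ) {y : G} (hy : y ∈ J) :
    ip N (cj y θ) θ = if y ∈ stab J N θ then 1 else 0 := by
  split_ifs with hs
  · exact (h.irr_cj hy hθ).ip_self_eqOn fun x hx => h.stab_inv y hs x hx
  · exact (h.irr_cj hy hθ).ip_eq_zero hθ fun hc => hs (h.mem_stab.2 ⟨hy, hc⟩)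

theorem NI.sm_ip_cj (h : NI N J) (hθ : Irr N θ) :
    sm J (fun y => ip N (cj y θ) θ) = Nat.card (stab J N θ) := by
  rw [sm_congr (F' := fun y => if y ∈ stab J N θ then 1 else 0) fun y hy => h.ip_cj_self hθ hy,
    sm_eq, ← mul_one (Nat.card (stab J N θ) : ℂ), ← sm_const, sm_eq]
  refine Finset.sum_congr rfl fun x _ => ?_
  by_cases hx : x ∈ stab J N θ
  · simp [hx, stab_le hx]
  · simp [hx]

theorem NI.ind_apply (h : NI N J) (θ : G → ℂ) : ∀ x ∈ N,
    ind J N θ x = (Nat.card N : ℂ)⁻¹ * sm J fun y => cj y θ x := by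
  intro x hx
  rw [ind]
  congr 1
  refine sm_congr fun y hy => ?_
  rw [if_pos ((h.conj_mem hy).2 hx)]
  rfl

theorem ip_sm_left (F : G → G → ℂ) (g : G → ℂ) :
    ip N (fun x => sm J fun y => F y x) g = sm J fun y => ip N (F y) g := by
  have := ip_sum_left (J := N) Finset.univ (fun y : J => F y) g
  rw [sm, ← this]
  congr 1
  ext x
  simp [sm]

theorem NI.ip_ind_restrict (h : NI N J) (θ ρ : G → ℂ) :
    ip N (ind J N θ) ρ = (Nat.card N : ℂ)⁻¹ * sm J fun y => ip N (cj y θ) ρ := by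
  rw [ip_congr (f' := (Nat.card N : ℂ)⁻¹ • fun x => sm J fun y => cj y θ x) (g' := ρ)
    (h.ind_apply θ) (fun _ _ => rfl), ip_smul_left, ip_sm_left]

/-- Constituents of the restriction to a normal subgroup are conjugate. -/
theorem NI.clifford_conj (h : NI N J) (hχ : Irr J χ) (hθ : Irr N θ) (hc : ip N χ θ ≠ 0)
    (hρ : Irr N ρ) (hc' : ip N χ ρ ≠ 0) : ∃ y ∈ J, ∀ x ∈ N, ρ x = cj y θ x := by
  have h1 : ip J (ind J N θ) χ ≠ 0 := by rwa [ip_ind h.1 hχ.cls, ip_comm]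
  have h2 := const_trans (hθ.ch.ind h.1) hχ h1 h.1 hρ.ch hc'
  rw [h.ip_ind_restrict] at h2
  obtain ⟨y, -, hy⟩ := Finset.exists_ne_zero_of_sum_ne_zero (right_ne_zero_of_mul h2)
  exact ⟨y, y.2, fun x hx => ((h.irr_cj y.2 hθ).eqOn hρ hy x hx).symm⟩

theorem NI.clifford_formula (h : NI N J) (hχ : Irr J χ) (hθ : Irr N θ) (hc : ip N χ θ ≠ 0) :
    ∀ x ∈ N, χ x * Nat.card (stab J N θ) = ip N χ θ * sm J fun y => cj y θ x := by
  have hcls : Cls N fun x => sm J fun y => cj y θ x := fun a ha x hx => by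
    change (sm J fun y => cj y θ (a * x * a⁻¹)) = sm J fun y => cj y θ x
    rw [← sm_mul_right (fun y => cj y θ x) (h.1 ha)]
    refine sm_congr fun y hy => ?_
    simp only [PiSep.cj]
    congr 1
    group
  have key : ∀ x ∈ N, ((Nat.card (stab J N θ) : ℂ) • χ) x =
      (ip N χ θ • fun x => sm J fun y => cj y θ x) x := by
    refine Cls.eq_of_ip (fun a ha x hx => ?_) (fun a ha x hx => ?_) fun ρ hρ => ?_
    · simp only [Pi.smul_apply, hχ.cls a (h.1 ha) x (h.1 hx)]
    · simp only [Pi.smul_apply, hcls a ha x hx]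
    · rw [ip_smul_left, ip_smul_left, ip_sm_left]
      have hρ' := (mem_irrs.1 hρ).1
      by_cases hcρ : ip N χ ρ = 0
      · rw [hcρ, mul_zero]
        rw [sm_congr (F' := fun _ => 0), sm_const, mul_zero, mul_zero]
        intro y hy
        refine (h.irr_cj hy hθ).ip_eq_zero hρ' fun e => hc ?_
        rw [← ip_cj_of_cls h hy hχ.cls, ip_congr (fun _ _ => rfl) e, hcρ]
      · obtain ⟨z, hz, e⟩ := h.clifford_conj hχ hθ hc hρ' hcρ
        rw [ip_congr (fun _ _ => rfl) e, ip_cj_of_cls h hz hχ.cls, mul_comm, ← h.sm_ip_cj hθ,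
          ← sm_mul_right (fun y => ip N (cj y θ) ρ) hz]
        congr 1
        refine sm_congr fun y hy => ?_
        rw [ip_congr (fun _ _ => rfl) e, ← cj_cj, h.ip_cj hz]
  intro x hx
  have := key x hx
  simp only [Pi.smul_apply, smul_eq_mul] at this
  rw [← this, mul_comm]

theorem NI.clifford_degree (h : NI N J) (hχ : Irr J χ) (hθ : Irr N θ) (hc : ip N χ θ ≠ 0) :
    χ 1 * Nat.card (stab J N θ) = ip N χ θ * (Nat.card J * θ 1) := by
  rw [h.clifford_formula hχ hθ hc 1 N.one_mem, ← sm_const]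
  simp only [cj_apply_one]

theorem NI.clifford_inv (h : NI N J) (hχ : Irr J χ) (hθ : Irr N θ) (hc : ip N χ θ ≠ 0)
    (hi : ∀ y ∈ J, ∀ x ∈ N, θ (y * x * y⁻¹) = θ x) : ∀ x ∈ N, χ x = ip N χ θ * θ x := by
  intro x hx
  have h1 : stab J N θ = J := le_antisymm stab_le fun y hy => h.mem_stab.2 ⟨hy, hi y hy⟩
  have h2 := h.clifford_formula hχ hθ hc x hx
  rw [h1, sm_congr (F := fun y => cj y θ x) (F' := fun _ => θ x) (fun y hy => hi y hy x hx), sm_const] at h2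
  exact mul_right_cancel₀ (card_ne_zero' (K := J)) (by rw [h2]; ring)

theorem NI.clifford_ind (h : NI N J) (hχ : Irr J χ) (hθ : Irr N θ)
    (hζ : Irr (stab J N θ) ζ) (hc : ip (stab J N θ) χ ζ ≠ 0) (hc' : ip N ζ θ ≠ 0) :
    (∀ x ∈ J, ind J (stab J N θ) ζ x = χ x) ∧ ip N ζ θ = ip N χ θ := by
  have hT := h.stab_ni hθ.cls
  have hcN : ip N χ θ ≠ 0 := const_trans (hχ.ch.mono stab_le) hζ hc hT.1 hθ.ch hc'
  have h1 : ip J (ind J (stab J N θ) ζ) χ ≠ 0 := by rwa [ip_ind stab_le hχ.cls, ip_comm]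
  have h2 := (hζ.ch.ind stab_le).deg_le hχ h1
  have h3 := h.clifford_degree hχ hθ hcN
  have h4 := hT.clifford_inv hζ hθ hc' h.stab_inv 1 N.one_mem
  have h5 := ind_one (J := J) (H := stab J N θ) ζ
  obtain ⟨a, ha⟩ := hζ.ch.mono hT.1 |>.ip_nat hθ.ch
  obtain ⟨b, hb⟩ := ((hχ.ch.mono stab_le).sub hζ hc).mono hT.1 |>.ip_nat hθ.ch
  rw [ip_sub_left, ha, sub_eq_iff_eq_add] at hb
  have hT0 : (Nat.card (stab J N θ) : ℂ) ≠ 0 := card_ne_zero'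
  rw [h4, ha] at h5
  rw [hb] at h3
  have h6 : ind J (stab J N θ) ζ 1 * Nat.card (stab J N θ) = a * (Nat.card J * θ 1) := by
    rw [h5]; field_simp
  have hb0 : b = 0 := by
    rw [(hζ.ch.ind stab_le).deg, hθ.ch.deg] at h6
    rw [hχ.ch.deg, hθ.ch.deg] at h3
    norm_cast at h3 h6
    have h7 : 0 < Nat.card J * deg θ := Nat.mul_pos Nat.card_pos hθ.deg_pos
    have h8 := Nat.mul_le_mul_right (Nat.card (stab J N θ)) h2
    rw [h3, h6, add_mul] at h8
    have : b * (Nat.card J * deg θ) = 0 := by omega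
    rcases Nat.mul_eq_zero.1 this with h | h <;> omega
  rw [hb0, Nat.cast_zero, zero_add] at hb h3
  refine ⟨(hζ.ch.ind stab_le).eq_of_degree hχ h1 ?_, by rw [ha, hb]⟩
  exact mul_right_cancel₀ hT0 (h6.trans h3.symm)

theorem NI.clifford_unique (h : NI N J) (hχ : Irr J χ) (hθ : Irr N θ)
    (hζ : Irr (stab J N θ) ζ) (hc : ip (stab J N θ) χ ζ ≠ 0) (hc' : ip N ζ θ ≠ 0)
    (hζ' : Irr (stab J N θ) ζ') (hd : ip (stab J N θ) χ ζ' ≠ 0) (hd' : ip N ζ' θ ≠ 0) :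
    ∀ x ∈ stab J N θ, ζ x = ζ' x := by
  refine hζ.eqOn hζ' fun h0 => ?_
  have hT := h.stab_ni hθ.cls
  have h1 := (hχ.ch.mono stab_le).sub hζ hc
  have h2 : ip (stab J N θ) (χ - ζ) ζ' ≠ 0 := by rwa [ip_sub_left, h0, sub_zero]
  have h3 := const_trans h1 hζ' h2 hT.1 hθ.ch hd'
  rw [ip_sub_left, (h.clifford_ind hχ hθ hζ hc hc').2, sub_self] at h3
  exact h3 rfl

theorem NI.clifford_exists (h : NI N J) (hχ : Irr J χ) (hθ : Irr N θ) (hc : ip N χ θ ≠ 0) :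
    ∃ ζ, Irr (stab J N θ) ζ ∧ ip (stab J N θ) χ ζ ≠ 0 ∧ ip N ζ θ ≠ 0 :=
  exists_over (hχ.cls.mono stab_le) (h.le_stab hθ.cls) hc

end PiSep

namespace PiSep

variable {G : Type} [Group G] [Fintype G] {J H K N M Z T : Subgroup G}
  {f g χ ψ θ ρ κ η ν ν' : G → ℂ}

theorem Irr.deg_dvd_card (h : Irr J χ) : deg χ ∣ Nat.card J :=
  (dvd_mul_right _ _).trans (h.deg_mul_card_dvd (bot_le : ⊥ ≤ J) (by simp))

theorem sm_coset_norm (hη : Ch J η) (hM : M ≤ J) (h1 : Irr M η) {x : G} (hx : x ∈ J) :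
    sm M (fun b => η (x * b) * η (x * b)⁻¹) = Nat.card M := by
  have hM0 : (Nat.card M : ℂ) ≠ 0 := card_ne_zero'
  have e1 : ∀ b ∈ M, Nat.card M * (η (x * b) * η (x * b)⁻¹) =
      sm M (fun m => η 1 * η ((x⁻¹ * m⁻¹ * x) * (b * m * b⁻¹))) := by
    intro b hb
    have hxb := J.mul_mem hx (hM hb)
    rw [← mul_assoc, ← schur_average hη hM h1 hxb (J.inv_mem hxb), ← sm_mul_const]
    refine sm_congr fun m hm => ?_
    have hc := hη.cls (x⁻¹ * m⁻¹) (J.mul_mem (J.inv_mem hx) (J.inv_mem (hM hm)))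
      (x * b * (m * (x * b)⁻¹ * m⁻¹)) (J.mul_mem hxb
        (J.mul_mem (J.mul_mem (hM hm) (J.inv_mem hxb)) (J.inv_mem (hM hm))))
    rw [← hc]
    congr 2
    group
  have e2 : ∀ m ∈ M, sm M (fun b => η 1 * η ((x⁻¹ * m⁻¹ * x) * (b * m * b⁻¹))) =
      Nat.card M * (η m * η m⁻¹) := by
    intro m hm
    have hm' := J.inv_mem (hM hm)
    have hx' : x⁻¹ * m⁻¹ * x ∈ J := J.mul_mem (J.mul_mem (J.inv_mem hx) hm') hx
    rw [sm_mul_const, schur_average hη hM h1 hx' (hM hm)]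
    have := hη.cls x⁻¹ (J.inv_mem hx) _ hm'
    rw [inv_inv] at this
    rw [this]
    ring
  refine mul_left_cancel₀ hM0 ?_
  rw [← sm_mul_const, sm_congr e1, sm_comm, sm_congr e2, sm_mul_const, sm_ip, h1.ip_self, mul_one]

theorem ip_mul_extension (hη : Ch J η) (hM : M ≤ J) (h1 : Irr M η)
    (hν : ∀ x ∈ J, ∀ m ∈ M, ν (x * m) = ν x) (hν' : ∀ x ∈ J, ∀ m ∈ M, ν' (m * x) = ν' x) :
    ip J (η * ν) (η * ν') = ip J ν ν' := by
  rw [ip_def, ip_def]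
  congr 1
  refine mul_left_cancel₀ (card_ne_zero' (K := M)) ?_
  have e : ∀ m ∈ M, sm J (fun x => (η * ν) x * (η * ν') x⁻¹) =
      sm J fun x => (ν x * ν' x⁻¹) * (η (x * m) * η (x * m)⁻¹) := by
    intro m hm
    rw [← sm_mul_right (fun x => (η * ν) x * (η * ν') x⁻¹) (hM hm)]
    refine sm_congr fun x hx => ?_
    simp only [Pi.mul_apply, hν x hx m hm]
    have := hν' x⁻¹ (J.inv_mem hx) m⁻¹ (M.inv_mem hm)
    rw [mul_inv_rev, this]
    ring
  rw [← sm_const, ← sm_mul_const, sm_congr (J := M) e, sm_comm]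
  refine sm_congr fun x hx => ?_
  rw [sm_mul_const, sm_coset_norm hη hM h1 hx]
  ring

/-- `ν` is constant on the cosets of `N` in `J`. -/
def TrivOn (J N : Subgroup G) (ν : G → ℂ) : Prop := ∀ n ∈ N, ∀ x ∈ J, ν (n * x) = ν x

theorem TrivOn.right (h : TrivOn J N ν) (hN : NI N J) : ∀ x ∈ J, ∀ m ∈ N, ν (x * m) = ν x := by
  intro x hx m hm
  rw [show x * m = (x * m * x⁻¹) * x by group, h _ (hN.2 x hx m hm) x hx]

theorem Ch.trivOn (h : Ch J ν) (hN : N ≤ J) (h1 : ∀ n ∈ N, ν n = ν 1) : TrivOn J N ν :=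
  fun n hn _ hx => h.kernel (hN hn) (h1 n hn) hx

theorem Irr.trivOn (h : Irr J ν) (hN : NI N J) (h1 : ip N ν 1 ≠ 0) : TrivOn J N ν := by
  refine h.ch.trivOn hN.1 ?_
  have := hN.clifford_inv h Lin.one.irr h1 (fun _ _ _ _ => rfl)
  exact fun n hn => (this n hn).trans (this 1 N.one_mem).symm

theorem Irr.mul_trivOn (hη : Ch J η) (hN : NI N J) (h1 : Irr N η) (hν : Irr J ν)
    (ht : TrivOn J N ν) : Irr J (η * ν) :=
  irr_iff.2 ⟨hη.mul hν.ch, by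
    rw [ip_mul_extension hη hN.1 h1 (ht.right hN) (fun x hx m hm => ht m hm x hx), hν.ip_self]⟩

/-- Gallagher's theorem. -/
theorem gallagher (hη : Ch J η) (hN : NI N J) (h1 : Irr N η) (hχ : Irr J χ) (hc : ip N χ η ≠ 0) :
    ∃ ν, Irr J ν ∧ TrivOn J N ν ∧ ∀ x ∈ J, χ x = η x * ν x := by
  have h2 : ip J (ind J N η) χ ≠ 0 := by rwa [ip_ind hN.1 hχ.cls, ip_comm]
  have h3 : ∀ x ∈ J, ind J N η x = (ind J N 1 * η) x := by
    intro x hx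
    have := ind_mul (H := N) (f := 1) hη.cls x hx
    rwa [one_mul] at this
  have hI : Ch J (ind J N (1 : G → ℂ)) := Ch.one.ind hN.1
  have hIe : ∀ x ∈ J, (ind J N 1 * η) x = (∑ ν ∈ irrs J, ip J (ind J N 1) ν • (η * ν)) x := by
    intro x hx
    simp only [Pi.mul_apply, Finset.sum_apply, Pi.smul_apply, smul_eq_mul]
    rw [hI.cls.expand x hx, Finset.sum_mul]
    exact Finset.sum_congr rfl fun _ _ => by ring
  rw [ip_congr (fun x hx => (h3 x hx).trans (hIe x hx)) fun _ _ => rfl, ip_sum_left] at h2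
  obtain ⟨ν, hν, h4⟩ := Finset.exists_ne_zero_of_sum_ne_zero h2
  rw [ip_smul_left] at h4
  have hν := (mem_irrs.1 hν).1
  have h5 := left_ne_zero_of_mul h4
  rw [ip_ind hN.1 hν.cls, ip_comm] at h5
  have ht := hν.trivOn hN h5
  refine ⟨ν, hν, ht, fun x hx => ?_⟩
  exact ((Irr.mul_trivOn hη hN h1 hν ht).eqOn hχ (right_ne_zero_of_mul h4) x hx).symm

end PiSep

namespace PiSep
open Representation

variable {G : Type} [Group G] [Fintype G] {J H K N M Z T : Subgroup G}
  {f g χ ψ θ ρ κ η ν ν' : G → ℂ}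

/-- Pairs `(g, u)` with `g ∈ J` and `u` an intertwiner from `R` to its `g`-conjugate. -/
def liftGroup {V : Type} [AddCommGroup V] [Module ℂ V] (J N : Subgroup G) (hN : NI N J)
    (R : G → (V →ₗ[ℂ] V)) : Subgroup (G × (V →ₗ[ℂ] V)ˣ) where
  carrier := {a | a.1 ∈ J ∧ (∀ n ∈ N, (a.2 : V →ₗ[ℂ] V) * R n = R (a.1 * n * a.1⁻¹) * a.2) ∧
    LinearMap.det (a.2 : V →ₗ[ℂ] V) ^ Nat.card N = 1}
  one_mem' := by simp [J.one_mem]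
  mul_mem' := by
    rintro a b ⟨h1, h2, h3⟩ ⟨h1', h2', h3'⟩
    refine ⟨J.mul_mem h1 h1', fun n hn => ?_, by
      simp [mul_pow, h3, h3', -Nat.card_eq_fintype_card]⟩
    simp only [Prod.fst_mul, Prod.snd_mul, Units.val_mul, mul_assoc]
    rw [h2' n hn, ← mul_assoc, h2 _ (hN.2 _ h1' n hn), mul_assoc]
    simp only [mul_inv_rev, mul_assoc]
  inv_mem' := by
    rintro a ⟨h1, h2, h3⟩
    refine ⟨J.inv_mem h1, fun n hn => ?_, ?_⟩
    · have := h2 (a.1⁻¹ * n * a.1) (by simpa using hN.2 _ (J.inv_mem h1) n hn)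
      rw [show a.1 * (a.1⁻¹ * n * a.1) * a.1⁻¹ = n by group] at this
      simp only [Prod.fst_inv, Prod.snd_inv, inv_inv]
      rw [Units.inv_mul_eq_iff_eq_mul, ← mul_assoc, this, mul_assoc, Units.mul_inv, mul_one]
    · have h4 := congrArg (fun T : V →ₗ[ℂ] V => LinearMap.det T ^ Nat.card N) (Units.mul_inv a.2)
      rw [map_mul, mul_pow, h3, one_mul] at h4
      simpa [-Nat.card_eq_fintype_card] using h4

theorem exists_intertwiner {V : Type} [AddCommGroup V] [Module ℂ V] [FiniteDimensional ℂ V]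
    (hN : NI N J) (ρ : Representation ℂ N V) (hρ : IsIrreducible ρ)
    (hθ : ∀ n : N, θ n = ρ.character n) (hs : ∀ y ∈ J, ∀ x ∈ N, θ (y * x * y⁻¹) = θ x)
    {y : G} (hy : y ∈ J) : ∃ u : (V →ₗ[ℂ] V)ˣ, ∀ n m : N, (m : G) = y * n * y⁻¹ →
      (u : V →ₗ[ℂ] V) * ρ n = ρ m * u := by
  let c : N ≃* N :=
    { toFun := fun n => ⟨y * n * y⁻¹, hN.2 y hy n n.2⟩
      invFun := fun n => ⟨y⁻¹ * n * y, by simpa using hN.2 y⁻¹ (J.inv_mem hy) n n.2⟩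
      left_inv := fun n => Subtype.ext (by simp; group)
      right_inv := fun n => Subtype.ext (by simp; group)
      map_mul' := fun a b => Subtype.ext (by simp) }
  let σ : Representation ℂ N V := ρ.comp c.toMonoidHom
  have hch : σ.character = ρ.character := by
    ext n
    have : σ.character n = ρ.character (c n) := rfl
    rw [this, ← hθ, ← hθ]
    exact hs y hy n n.2
  have h1 : Module.finrank ℂ (IntertwiningMap ρ σ) = 1 := by
    have h2 := bip_rep ρ σ
    have h3 := bip_rep ρ ρ
    rw [hch, h3, IsIrreducible.finrank_intertwiningMap_self] at h2
    exact_mod_cast h2.symm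
  obtain ⟨T, hT⟩ : ∃ T : IntertwiningMap ρ σ, T ≠ 0 := by
    have : Nontrivial (IntertwiningMap ρ σ) := Module.nontrivial_of_finrank_pos (R := ℂ) (by omega)
    exact exists_ne 0
  have hinj := (IsIrreducible.injective_or_eq_zero T).resolve_right hT
  let e : V ≃ₗ[ℂ] V := LinearEquiv.ofInjectiveEndo T.toLinearMap hinj
  refine ⟨LinearMap.GeneralLinearGroup.generalLinearEquiv ℂ V |>.symm e, fun n m hm => ?_⟩
  have hm' : m = c n := Subtype.ext hm
  subst hm'
  exact T.isIntertwining' n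

theorem exists_lift (hN : NI N J) (hθ : Irr N θ) (hs : ∀ y ∈ J, ∀ x ∈ N, θ (y * x * y⁻¹) = θ x) :
    ∃ (Γ : Type) (_ : Group Γ) (_ : Fintype Γ) (p : Γ →* G) (L : Subgroup Γ) (u : Γ → ℂ),
      p.range = J ∧ (∀ z, p z = 1 → (∀ x, x * z = z * x) ∧ z ^ (Nat.card N * Nat.card N) = 1) ∧
      NI L ⊤ ∧ L.map p = N ∧ (∀ x ∈ L, p x = 1 → x = 1) ∧ Ch ⊤ u ∧ ∀ x ∈ L, u x = θ (p x) := by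
  obtain ⟨V, _, _, _, ρ, hρ, hch⟩ := irr_exists_rep hθ
  have hθ' : ∀ n : N, θ n = ρ.character n := fun n => congrFun hch n
  let R : G → (V →ₗ[ℂ] V) := fun x => if hx : x ∈ N then ρ ⟨x, hx⟩ else 0
  have hR : ∀ n : N, R n = ρ n := fun n => dif_pos n.2
  let A := liftGroup J N hN R
  have hA : ∀ a : A, a.1.1 ∈ J ∧ (∀ n ∈ N, (a.1.2 : V →ₗ[ℂ] V) * R n =
      R (a.1.1 * n * a.1.1⁻¹) * a.1.2) ∧ LinearMap.det (a.1.2 : V →ₗ[ℂ] V) ^ Nat.card N = 1 :=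
    fun a => a.2
  let p : A →* G := (MonoidHom.fst _ _).comp A.subtype
  have hdim : (deg θ : ℂ) = Module.finrank ℂ V := by
    rw [← hθ.ch.deg]
    have := hθ' 1
    rw [Representation.char_one] at this
    exact this
  have hdim' : deg θ = Module.finrank ℂ V := by exact_mod_cast hdim
  have hN0 : 0 < Nat.card N := Nat.card_pos
  have hk : ∀ z : A, p z = 1 → ∃ c : ℂ, (z.1.2 : V →ₗ[ℂ] V) = c • LinearMap.id ∧
      c ^ (Nat.card N * Nat.card N) = 1 := by
    intro z hz
    have hz1 : z.1.1 = 1 := hz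
    obtain ⟨c, hc⟩ := schur ρ (by rw [bip_rep, IsIrreducible.finrank_intertwiningMap_self]; simp)
      (z.1.2 : V →ₗ[ℂ] V) fun n => by
        have := (hA z).2.1 n n.2
        rw [hz1] at this
        simp only [hR, one_mul, mul_one, inv_one] at this
        exact this
    refine ⟨c, hc, ?_⟩
    have h3 := (hA z).2.2
    rw [hc, LinearMap.det_smul, LinearMap.det_id, mul_one, ← hdim'] at h3
    obtain ⟨k, hk⟩ := hθ.deg_dvd_card
    rw [← pow_mul] at h3
    calc c ^ (Nat.card N * Nat.card N) = (c ^ (deg θ * Nat.card N)) ^ k := by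
          rw [← pow_mul]
          congr 1
          nth_rewrite 1 [hk]
          ring
      _ = 1 := by rw [h3, one_pow]
  have hext : ∀ z z' : A, p z = p z' → (z.1.2 : V →ₗ[ℂ] V) = z'.1.2 → z = z' :=
    fun z z' h h' => Subtype.ext (Prod.ext h (Units.ext h'))
  have hfin : Finite p.ker := by
    choose c hc hc' using hk
    refine Finite.of_injective (β := {c : ℂ // c ∈ Polynomial.nthRootsFinset
      (Nat.card N * Nat.card N) (1 : ℂ)}) (fun z => ⟨c z.1 z.2, ?_⟩) fun z z' h => ?_
    · rw [Polynomial.mem_nthRootsFinset (Nat.mul_pos hN0 hN0)]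
      exact hc' z.1 z.2
    · refine Subtype.ext (hext _ _ (Eq.trans z.2 (Eq.symm z'.2)) ?_)
      have h' : c z.1 z.2 = c z'.1 z'.2 := Subtype.ext_iff.1 h
      exact (hc z.1 z.2).trans (h' ▸ (hc z'.1 z'.2).symm)
  have := Fintype.ofFinite p.ker
  have hAfin : Fintype A := Group.fintypeOfKerOfCodom p
  have hmul : ∀ n m : N, ρ n * ρ m = ρ (n * m) := fun n m => (map_mul ρ n m).symm
  let i₀ : N →* (V →ₗ[ℂ] V)ˣ := MonoidHom.toHomUnits ρ
  have hi₀ : ∀ n, (i₀ n : V →ₗ[ℂ] V) = ρ n := fun n => rfl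
  let i : N →* A := (N.subtype.prod i₀).codRestrict A fun n => by
    refine ⟨hN.1 n.2, fun m hm => ?_, ?_⟩
    · have h1 := hR ⟨m, hm⟩
      have h2 := hR (n * ⟨m, hm⟩ * n⁻¹)
      simp only [Subgroup.coe_mul, Subgroup.coe_inv] at h1 h2
      simp only [MonoidHom.prod_apply, Subgroup.coe_subtype, hi₀, h1, h2, hmul]
      simp
    · change LinearMap.det (ρ n) ^ Nat.card N = 1
      rw [← map_pow, ← map_pow, pow_card_eq_one', map_one, map_one]
  have hpi : ∀ n, p (i n) = n := fun n => rfl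
  refine ⟨A, inferInstance, hAfin, p, i.range, fun a => LinearMap.trace ℂ V a.1.2, ?_, ?_, ?_, ?_,
    ?_, ?_, ?_⟩
  · ext y
    constructor
    · rintro ⟨a, rfl⟩
      exact (hA a).1
    · intro hy
      obtain ⟨T, hT⟩ := exists_intertwiner hN ρ hρ hθ' hs hy
      have hd : 0 < deg θ * Nat.card N := Nat.mul_pos hθ.deg_pos hN0
      obtain ⟨c, hc⟩ := IsAlgClosed.exists_pow_nat_eq
        ((LinearMap.det (T : V →ₗ[ℂ] V) ^ Nat.card N)⁻¹) hd
      have hT0 : LinearMap.det (T : V →ₗ[ℂ] V) ≠ 0 :=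
        ((T.isUnit).map (LinearMap.det (A := ℂ) (M := V))).ne_zero
      have hc0 : c ≠ 0 := by
        rintro rfl
        rw [zero_pow hd.ne'] at hc
        exact inv_ne_zero (pow_ne_zero _ hT0) hc.symm
      refine ⟨⟨(y, Units.mk0 c hc0 • T), hy, fun n hn => ?_, ?_⟩, rfl⟩
      · have h1 := hR ⟨n, hn⟩
        have h2 := hR ⟨y * n * y⁻¹, hN.2 y hy n hn⟩
        simp only at h1 h2
        rw [h1, h2]
        have := hT ⟨n, hn⟩ ⟨y * n * y⁻¹, hN.2 y hy n hn⟩ rfl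
        simp only [Units.val_smul, Units.smul_def, Units.val_mk0, smul_mul_assoc, mul_smul_comm,
          this]
      · simp only [Units.val_smul, Units.smul_def, Units.val_mk0, LinearMap.det_smul, ← hdim',
          mul_pow, ← pow_mul]
        rw [hc, inv_mul_cancel₀ (pow_ne_zero _ hT0)]
  · intro z hz
    obtain ⟨c, hc, hc'⟩ := hk z hz
    have hz1 : z.1.1 = 1 := hz
    refine ⟨fun x => hext _ _ (by simp [hz]) ?_, hext _ _ (by simp [hz]) ?_⟩
    · change (x.1.2 : V →ₗ[ℂ] V) * z.1.2 = z.1.2 * x.1.2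
      rw [hc]
      ext v
      simp
    · change ((z.1.2 : V →ₗ[ℂ] V)) ^ _ = 1
      have h1 : (c • LinearMap.id : V →ₗ[ℂ] V) = c • 1 := rfl
      rw [hc, h1, smul_pow, one_pow, hc', one_smul]
  · refine ⟨le_top, ?_⟩
    rintro a - _ ⟨n, rfl⟩
    refine ⟨⟨a.1.1 * n * a.1.1⁻¹, hN.2 _ (hA a).1 n n.2⟩, hext _ _ rfl ?_⟩
    have h1 := (hA a).2.1 n n.2
    have h2 := hR ⟨a.1.1 * n * a.1.1⁻¹, hN.2 _ (hA a).1 n n.2⟩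
    simp only at h2
    rw [hR, h2] at h1
    change ρ _ = ((a.1.2 * i₀ n * a.1.2⁻¹ : (V →ₗ[ℂ] V)ˣ) : V →ₗ[ℂ] V)
    rw [Units.val_mul, Units.val_mul, hi₀, h1]
    exact (Units.mul_inv_cancel_right _ _).symm
  · ext y
    constructor
    · rintro ⟨_, ⟨n, rfl⟩, rfl⟩
      exact n.2
    · exact fun hy => ⟨i ⟨y, hy⟩, ⟨_, rfl⟩, rfl⟩
  · rintro _ ⟨n, rfl⟩ hn
    have : n = 1 := Subtype.ext hn
    rw [this, map_one]
  · let r : Representation ℂ A V :=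
      (Units.coeHom _).comp ((MonoidHom.snd _ _).comp A.subtype)
    exact isCharacter_of_rep (r.comp (⊤ : Subgroup A).subtype)
  · rintro _ ⟨n, rfl⟩
    exact (hθ' n).symm

theorem card_map_of_injOn {Γ Δ : Type} [Group Γ] [Group Δ] (p : Γ →* Δ) (L : Subgroup Γ)
    (h : ∀ x ∈ L, p x = 1 → x = 1) : Nat.card (L.map p) = Nat.card L := by
  refine (Nat.card_congr (Equiv.ofBijective (p.subgroupMap L) ⟨?_, p.subgroupMap_surjective L⟩)).symm
  rw [injective_iff_map_eq_one]
  exact fun x hx => Subtype.ext (h x x.2 (congrArg Subtype.val hx))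

omit [Fintype G] in
theorem card_mul_relIndex (h : N ≤ J) : Nat.card N * N.relIndex J = Nat.card J := by
  rw [← Subgroup.relIndex_bot_left, ← Subgroup.relIndex_bot_left,
    Subgroup.relIndex_mul_relIndex _ _ _ bot_le h]

theorem card_range_mul_ker {Γ Δ : Type} [Group Γ] [Group Δ] (p : Γ →* Δ) :
    Nat.card p.range * Nat.card p.ker = Nat.card Γ := by
  rw [← Subgroup.card_mul_index p.ker, Subgroup.index_ker, Nat.mul_comm]

/-- The multiplicity of an invariant character of a normal subgroup divides the index. -/
theorem mult_dvd (hN : NI N J) (hθ : Irr N θ) (hs : ∀ y ∈ J, ∀ x ∈ N, θ (y * x * y⁻¹) = θ x)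
    (hχ : Irr J χ) (hc : ip N χ θ ≠ 0) : ∃ n : ℕ, ip N χ θ = n ∧ n ∣ N.relIndex J := by
  obtain ⟨Γ, _, _, p, L, u, hpJ, hZ, hL, hLN, hinj, hu, huθ⟩ := exists_lift hN hθ hs
  have hpJ' : (⊤ : Subgroup Γ).map p = J := by rw [← MonoidHom.range_eq_map, hpJ]
  have hχ' : Irr ⊤ fun x => χ (p x) := by rw [← irr_map, hpJ']; exact hχ
  have huL : Irr L u := by
    refine Irr.congr (f := fun x => θ (p x)) ?_ fun x hx => (huθ x hx).symm
    rw [← irr_map, hLN]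
    exact hθ
  have hip : ip L (fun x => χ (p x)) u = ip N χ θ := by
    rw [← hLN, ip_map]
    exact ip_congr (fun _ _ => rfl) huθ
  obtain ⟨ν, hν, hνL, hχν⟩ := gallagher hu hL huL hχ' (hip ▸ hc)
  have hLn : L.Normal := ⟨fun n hn g => hL.2 g trivial n hn⟩
  let q := QuotientGroup.mk' L
  have hqL : ∀ x, q x = 1 ↔ x ∈ L := fun x => QuotientGroup.eq_one_iff x
  obtain ⟨ν', hν'⟩ := exists_descend (p := q) (L := ⊤) ν fun x _ y _ hxy => by
    have h1 : x * y⁻¹ ∈ L := by rw [← hqL, map_mul, map_inv, hxy, mul_inv_cancel]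
    have := hνL _ h1 y trivial
    rwa [inv_mul_cancel_right] at this
  have hν1 : Irr ((⊤ : Subgroup Γ).map q) ν' := by
    rw [irr_map]
    exact hν.congr fun x hx => (hν' x hx).symm
  have hd := hν1.deg_mul_card_dvd (Z := p.ker.map q) (Subgroup.map_mono le_top) (by
    rintro _ ⟨z, hz, rfl⟩ _ ⟨x, -, rfl⟩
    rw [← map_mul, (hZ z hz).1 x, map_mul])
  rw [card_map_of_injOn q p.ker fun z hz hz' => hinj z ((hqL z).1 hz') hz] at hd
  have hdeg : deg ν' = deg ν := by
    have := hν' 1 trivial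
    rw [map_one, hν.ch.deg] at this
    exact deg_of_eq this
  refine ⟨deg ν, ?_, ?_⟩
  · rw [← hip, ip_congr (f' := (deg ν : ℂ) • u) (g' := u) _ fun _ _ => rfl, ip_smul_left,
      huL.ip_self, mul_one]
    intro x hx
    have := hνL x hx 1 trivial
    rw [mul_one, hν.ch.deg] at this
    rw [hχν x trivial, this, Pi.smul_apply, smul_eq_mul, mul_comm]
  · have h1 := card_range_mul_ker p
    have h2 := card_range_mul_ker q
    have h3 : q.ker = L := QuotientGroup.ker_mk' L
    have h4 : Nat.card L = Nat.card N := by rw [← hLN, card_map_of_injOn p L hinj]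
    have h5 : Nat.card N * N.relIndex J = Nat.card J := card_mul_relIndex hN.1
    rw [hpJ, ← h5] at h1
    rw [h3, h4, MonoidHom.range_eq_map, ← h1] at h2
    rw [hdeg] at hd
    have h6 : Nat.card ((⊤ : Subgroup Γ).map q) = N.relIndex J * Nat.card p.ker :=
      Nat.eq_of_mul_eq_mul_left (Nat.card_pos : 0 < Nat.card N) (by rw [mul_comm, h2]; ring)
    rw [h6] at hd
    exact Nat.dvd_of_mul_dvd_mul_right Nat.card_pos hd

end PiSep

namespace PiSep

variable {G : Type} [Group G] {J H K N M L Z T : Subgroup G}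
  {f g χ ψ θ ρ κ η ν ν' l d : G → ℂ} {σ : Set ℕ}

theorem _root_.IsPiNumber.one : IsPiNumber σ 1 := fun _ hq h => absurd (Nat.dvd_one.1 h) hq.ne_one

theorem _root_.IsPiNumber.mul {a b : ℕ} (ha : IsPiNumber σ a) (hb : IsPiNumber σ b) :
    IsPiNumber σ (a * b) := fun q hq h => (hq.dvd_mul.1 h).elim (ha q hq) (hb q hq)

theorem _root_.IsPiNumber.dvd {a b : ℕ} (hb : IsPiNumber σ b) (h : a ∣ b) : IsPiNumber σ a :=
  fun q hq hd => hb q hq (hd.trans h)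

theorem _root_.IsPiNumber.coprime {a b : ℕ} (ha : IsPiNumber σ a) (hb : IsPiNumber σᶜ b) :
    a.Coprime b := Nat.Coprime.symm <| Nat.coprime_of_dvd fun q hq h h' => hb q hq h (ha q hq h')

theorem exists_split {n : ℕ} (hn : n ≠ 0) :
    ∃ a b, n = a * b ∧ IsPiNumber σ a ∧ IsPiNumber σᶜ b := by
  induction n using Nat.recOnMul with
  | zero => exact absurd rfl hn
  | one => exact ⟨1, 1, rfl, .one, .one⟩
  | prime p hp =>
    by_cases h : p ∈ σ
    · exact ⟨p, 1, (mul_one p).symm, fun q hq hd => by rwa [(Nat.prime_dvd_prime_iff_eq hq hp).1 hd],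
        .one⟩
    · exact ⟨1, p, (one_mul p).symm, .one,
        fun q hq hd => by rwa [(Nat.prime_dvd_prime_iff_eq hq hp).1 hd]⟩
  | mul a b iha ihb =>
    obtain ⟨a1, a2, e1, h1, h2⟩ := iha (left_ne_zero_of_mul hn)
    obtain ⟨b1, b2, e2, h3, h4⟩ := ihb (right_ne_zero_of_mul hn)
    exact ⟨a1 * b1, a2 * b2, by rw [e1, e2]; ring, h1.mul h3, h2.mul h4⟩

theorem eq_one_of_coprime {A : Type*} [Monoid A] {z : A} {a b : ℕ} (hab : a.Coprime b)
    (ha : z ^ a = 1) (hb : z ^ b = 1) : z = 1 :=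
  orderOf_eq_one_iff.1 <| Nat.dvd_one.1 <| hab ▸
    Nat.dvd_gcd (orderOf_dvd_of_pow_eq_one ha) (orderOf_dvd_of_pow_eq_one hb)

/-- The function `l` on `J` has values of bounded `σ`-order. -/
def PiOrd (σ : Set ℕ) (J : Subgroup G) (l : G → ℂ) : Prop :=
  ∃ m ≠ 0, IsPiNumber σ m ∧ ∀ x ∈ J, l x ^ m = 1

/-- The determinantal order of the character `f` of `J` is a `σ`-number. -/
def PiDet (σ : Set ℕ) (J : Subgroup G) (f : G → ℂ) : Prop := ∃ d, HasDet J f d ∧ PiOrd σ J d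

theorem PiOrd.one : PiOrd σ J 1 := ⟨1, one_ne_zero, .one, fun _ _ => by simp⟩

theorem PiOrd.congr (h : PiOrd σ J f) (e : ∀ x ∈ J, f x = g x) : PiOrd σ J g := by
  obtain ⟨m, h0, hm, h⟩ := h
  exact ⟨m, h0, hm, fun x hx => e x hx ▸ h x hx⟩

theorem PiOrd.mono (h : PiOrd σ J f) (hH : H ≤ J) : PiOrd σ H f := by
  obtain ⟨m, h0, hm, h⟩ := h
  exact ⟨m, h0, hm, fun x hx => h x (hH hx)⟩

theorem PiOrd.mul (h : PiOrd σ J f) (h' : PiOrd σ J g) : PiOrd σ J (f * g) := by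
  obtain ⟨m, h0, hm, h⟩ := h
  obtain ⟨m', h0', hm', h'⟩ := h'
  refine ⟨m * m', mul_ne_zero h0 h0', hm.mul hm', fun x hx => ?_⟩
  rw [Pi.mul_apply, mul_pow, pow_mul, h x hx, mul_comm m, pow_mul, h' x hx, one_pow, one_pow, one_mul]

theorem PiOrd.inv (h : PiOrd σ J f) : PiOrd σ J f⁻¹ := by
  obtain ⟨m, h0, hm, h⟩ := h
  exact ⟨m, h0, hm, fun x hx => by rw [Pi.inv_apply, inv_pow, h x hx, inv_one]⟩

theorem PiOrd.eq_one (h : PiOrd σ J f) (h' : PiOrd σᶜ J f) : ∀ x ∈ J, f x = 1 := by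
  obtain ⟨m, -, hm, h⟩ := h
  obtain ⟨m', -, hm', h'⟩ := h'
  exact fun x hx => eq_one_of_coprime (hm.coprime hm') (h x hx) (h' x hx)

/-- A character whose `n`-th power has `σ`-order with `n` a `σ`-number has `σ`-order. -/
theorem PiOrd.of_pow {n : ℕ} (h0 : n ≠ 0) (hn : IsPiNumber σ n) (h : PiOrd σ J (f ^ n)) :
    PiOrd σ J f := by
  obtain ⟨m, h0', hm, h⟩ := h
  exact ⟨n * m, mul_ne_zero h0 h0', hn.mul hm, fun x hx => by rw [pow_mul]; exact h x hx⟩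

theorem exists_split_card (σ : Set ℕ) (J : Subgroup G) [Finite G] :
    ∃ a b, Nat.card J = a * b ∧ IsPiNumber σ a ∧ IsPiNumber σᶜ b := exists_split Nat.card_pos.ne'

theorem HasDet.pow_card (h : HasDet J f d) {x : G} (hx : x ∈ J) : d x ^ Nat.card J = 1 :=
  h.lin.pow_card hx

variable [Fintype G]

theorem PiOrd.pow_eq_one {a b : ℕ} (h : PiOrd σ J l) (hl : Lin J l) (e : Nat.card J = a * b)
    (hb : IsPiNumber σᶜ b) {x : G} (hx : x ∈ J) : l x ^ a = 1 := by
  obtain ⟨m, -, hm, h⟩ := h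
  refine eq_one_of_coprime (hm.coprime hb) ?_ ?_
  · rw [← pow_mul, mul_comm, pow_mul, h x hx, one_pow]
  · rw [← pow_mul, ← e, hl.pow_card hx]

theorem PiDet.ord (h : PiDet σ J f) (hd : HasDet J f d) : PiOrd σ J d := by
  obtain ⟨d', hd', h⟩ := h
  exact h.congr (hd'.unique hd)

theorem PiDet.congr (h : PiDet σ J f) (e : ∀ x ∈ J, f x = g x) : PiDet σ J g := by
  obtain ⟨d', hd', h⟩ := h
  exact ⟨d', hd'.congr e fun _ _ => rfl, h⟩

theorem PiDet.mono (h : PiDet σ J f) (hH : H ≤ J) : PiDet σ H f := by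
  obtain ⟨d', hd', h⟩ := h
  exact ⟨d', hd'.mono hH, h.mono hH⟩

theorem PiDet.of_consts (hχ : Ch J χ) (h : ∀ θ, Irr J θ → ip J χ θ ≠ 0 → PiDet σ J θ) :
    PiDet σ J χ := by
  obtain ⟨a, b, e, ha, hb⟩ := exists_split_card σ J
  have h1 : ∀ θ, ∃ d, θ ∈ irrs J → HasDet J θ d := fun θ => by
    by_cases hθ : θ ∈ irrs J
    · exact (mem_irrs.1 hθ).1.ch.exists_det.imp fun d hd _ => hd
    · exact ⟨0, fun h => absurd h hθ⟩
  choose D hD using h1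
  have h2 : ∀ θ, ∃ n : ℕ, θ ∈ irrs J → ip J χ θ = n := fun θ => by
    by_cases hθ : θ ∈ irrs J
    · exact (hχ.ip_nat (mem_irrs.1 hθ).1.ch).imp fun d hd _ => hd
    · exact ⟨0, fun h => absurd h hθ⟩
  choose n hn using h2
  refine ⟨_, (HasDet.sum (irrs J) fun θ hθ => (hD θ hθ).nsmul (n θ)).congr (f := χ)
    (fun x hx => ?_) fun _ _ => rfl, a, left_ne_zero_of_mul (e ▸ Nat.card_pos.ne'), ha,
    fun x hx => ?_⟩
  · rw [hχ.cls.expand x hx, Finset.sum_apply]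
    exact Finset.sum_congr rfl fun θ hθ => by rw [hn θ hθ]; rfl
  · rw [Finset.prod_apply, ← Finset.prod_pow]
    refine Finset.prod_eq_one fun θ hθ => ?_
    rw [Pi.pow_apply, ← pow_mul, mul_comm, pow_mul]
    by_cases h0 : ip J χ θ = 0
    · rw [hn θ hθ, Nat.cast_eq_zero] at h0
      rw [h0, pow_zero]
    · rw [((h θ (mem_irrs.1 hθ).1 h0).ord (hD θ hθ)).pow_eq_one (hD θ hθ).lin e hb hx, one_pow]

omit [Fintype G] in
theorem Lin.piDet (hl : Lin J l) (h : PiOrd σ J l) : PiDet σ J l := ⟨l, hl.hasDet, h⟩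

omit [Fintype G] in
/-- Subnormality inside the lattice of subgroups. -/
inductive SN : Subgroup G → Subgroup G → Prop
  | refl (J : Subgroup G) : SN J J
  | step {M K J : Subgroup G} : SN M K → NI K J → SN M J

end PiSep

namespace PiSep

variable {G : Type} [Group G] {J H K N M L Z T : Subgroup G}
  {f g χ ψ θ ρ κ η ν ν' l d α α' β β' : G → ℂ} {σ : Set ℕ}

theorem NI.normal (h : NI N J) : (N.subgroupOf J).Normal :=
  ⟨fun n hn g => Subgroup.mem_subgroupOf.2 (h.2 g g.2 n (Subgroup.mem_subgroupOf.1 hn))⟩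

theorem NI.inf (h : NI N J) (hH : H ≤ J) : NI (N ⊓ H) H :=
  ⟨inf_le_right, fun g hg n hn => ⟨h.2 g (hH hg) n hn.1,
    H.mul_mem (H.mul_mem hg hn.2) (H.inv_mem hg)⟩⟩

theorem NI.inf_ni (h : NI N J) (h' : NI M J) : NI (N ⊓ M) J :=
  ⟨inf_le_left.trans h.1, fun g hg n hn => ⟨h.2 g hg n hn.1, h'.2 g hg n hn.2⟩⟩

theorem NI.pow_mem (h : NI N J) {x : G} (hx : x ∈ J) : x ^ N.relIndex J ∈ N := by
  have := h.normal
  exact (N.subgroupOf J).pow_index_mem ⟨x, hx⟩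

theorem NI.relIndex_dvd (h : NI N J) (hH : H ≤ J) : (N ⊓ H).relIndex H ∣ N.relIndex J := by
  have := h.normal
  rw [Subgroup.inf_relIndex_right]
  have h1 := Subgroup.relIndex_dvd_index_of_normal (N.subgroupOf J) (H.subgroupOf J)
  rwa [Subgroup.relIndex_subgroupOf hH] at h1

theorem NI.sup_mem (h : NI N J) (hH : H ≤ J) : ∀ x ∈ N ⊔ H, ∃ y ∈ H, y⁻¹ * x ∈ N := by
  intro x hx
  let S : Subgroup G :=
    { carrier := {x | ∃ y ∈ H, y⁻¹ * x ∈ N}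
      one_mem' := ⟨1, H.one_mem, by simp⟩
      mul_mem' := by
        rintro a b ⟨y, hy, ha⟩ ⟨z, hz, hb⟩
        refine ⟨y * z, H.mul_mem hy hz, ?_⟩
        have := N.mul_mem (h.2 z⁻¹ (J.inv_mem (hH hz)) _ ha) hb
        convert this using 1
        group
      inv_mem' := by
        rintro a ⟨y, hy, ha⟩
        refine ⟨y⁻¹, H.inv_mem hy, ?_⟩
        have := h.2 y (hH hy) _ (N.inv_mem ha)
        convert this using 1
        group }
  have : N ⊔ H ≤ S := sup_le (fun n hn => ⟨1, H.one_mem, by simpa using hn⟩)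
    fun y hy => ⟨y, hy, by simp⟩
  exact this hx

theorem NI.sup_le (h : NI N J) (hH : H ≤ J) : N ⊔ H ≤ J := _root_.sup_le h.1 hH

theorem NI.ni_sup (h : NI N J) (hH : H ≤ J) : NI N (N ⊔ H) := h.mono (h.sup_le hH) le_sup_left

theorem NI.sup_sup (h : NI N J) (hH : H ≤ J) : Sup (N ⊔ H) N H := h.sup_mem hH

theorem NI.sup_ni (h : NI N J) (h' : NI M J) : NI (N ⊔ M) J := by
  refine ⟨h.sup_le h'.1, fun g hg x hx => ?_⟩
  obtain ⟨y, hy, hx⟩ := h.sup_mem h'.1 x hx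
  have h1 := h'.2 g hg y hy
  have h2 := h.2 g hg _ hx
  have := (N ⊔ M).mul_mem (Subgroup.mem_sup_right h1) (Subgroup.mem_sup_left h2)
  convert this using 1
  group

theorem SN.le (h : SN M J) : M ≤ J := by
  induction h with
  | refl => exact le_rfl
  | step _ h ih => exact ih.trans h.1

theorem SN.inter (h : SN M J) (hL : L ≤ J) : SN (M ⊓ L) L := by
  induction h generalizing L with
  | refl => rw [inf_eq_right.2 hL]; exact .refl L
  | @step K J h1 h ih =>
    have := ih (L := K ⊓ L) inf_le_left
    rw [← inf_assoc, inf_eq_left.2 h1.le] at this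
    exact .step this (h.inf hL)

variable [Fintype G]

/-- Special characters of a subgroup. -/
def Sp (σ : Set ℕ) (J : Subgroup G) (f : G → ℂ) : Prop :=
  Irr J f ∧ IsPiNumber σ (deg f) ∧ ∀ M, SN M J → ∀ θ, Irr M θ → ip M f θ ≠ 0 → PiDet σ M θ

theorem Sp.piDet (h : Sp σ J f) : PiDet σ J f :=
  h.2.2 J (.refl J) f h.1 (by rw [h.1.ip_self]; exact one_ne_zero)

theorem Sp.congr (h : Sp σ J f) (e : ∀ x ∈ J, f x = g x) : Sp σ J g :=
  ⟨h.1.congr e, deg_congr (e 1 J.one_mem) ▸ h.2.1, fun M hM θ hθ hc => h.2.2 M hM θ hθ <| by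
    rwa [ip_congr (fun x hx => e x (hM.le hx)) fun _ _ => rfl]⟩

theorem card_stab_mul (J N : Subgroup G) (θ : G → ℂ) :
    (Nat.card (stab J N θ) : ℂ) * (stab J N θ).relIndex J = Nat.card J := by
  exact_mod_cast card_mul_relIndex (stab_le (J := J) (N := N) (θ := θ))

theorem NI.clifford_mul (h : NI N J) (hχ : Irr J χ) (hθ : Irr N θ) (hc : ip N χ θ ≠ 0) :
    χ 1 = ip N χ θ * (stab J N θ).relIndex J * θ 1 := by
  have h1 := h.clifford_degree hχ hθ hc
  rw [← card_stab_mul J N θ] at h1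
  have h2 : (Nat.card (stab J N θ) : ℂ) ≠ 0 := card_ne_zero'
  refine mul_right_cancel₀ h2 (h1.trans ?_)
  ring

theorem NI.deg_eq (h : NI N J) (hχ : Irr J χ) (hθ : Irr N θ) (hc : ip N χ θ ≠ 0) :
    ∃ m : ℕ, ip N χ θ = m ∧ deg χ = m * (stab J N θ).relIndex J * deg θ := by
  obtain ⟨m, hm⟩ := (hχ.ch.mono h.1).ip_nat hθ.ch
  refine ⟨m, hm, deg_of_eq ?_⟩
  rw [h.clifford_mul hχ hθ hc, hm, hθ.ch.deg]
  push_cast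
  rfl

theorem NI.deg_dvd (h : NI N J) (hχ : Irr J χ) (hθ : Irr N θ) (hc : ip N χ θ ≠ 0) :
    deg θ ∣ deg χ := by
  obtain ⟨m, -, e⟩ := h.deg_eq hχ hθ hc
  exact e ▸ dvd_mul_left _ _

theorem NI.stab_relIndex_dvd (h : NI N J) (hθ : Cls N θ) :
    (stab J N θ).relIndex J ∣ N.relIndex J := by
  rw [← Subgroup.relIndex_mul_relIndex _ _ _ (h.le_stab hθ) stab_le]
  exact dvd_mul_left _ _

/-- Constituents of special characters on normal subgroups are special. -/
theorem Sp.const (hα : Sp σ J α) (h : NI N J) (hθ : Irr N θ) (hc : ip N α θ ≠ 0) : Sp σ N θ :=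
  ⟨hθ, hα.2.1.dvd (h.deg_dvd hα.1 hθ hc), fun M hM κ hκ hc' =>
    hα.2.2 M (.step hM h) κ hκ (const_trans (hα.1.ch.mono h.1) hθ hc hM.le hκ.ch hc')⟩

/-- A character of `σ`-degree restricts irreducibly to a normal subgroup of `σ'`-index. -/
theorem NI.irr_restrict (h : NI N J) (hα : Irr J α) (hd : IsPiNumber σ (deg α))
    (hi : IsPiNumber σᶜ (N.relIndex J)) : Irr N α := by
  obtain ⟨θ, hθ, hc⟩ := hα.exists_const h.1
  obtain ⟨m, hm, e⟩ := h.deg_eq hα hθ hc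
  have h1 : (stab J N θ).relIndex J = 1 := Nat.eq_one_of_dvd_coprimes (hd.coprime hi)
    (e ▸ (dvd_mul_left _ _).mul_right _) (h.stab_relIndex_dvd hθ.cls)
  have h2 : J ≤ stab J N θ := Subgroup.relIndex_eq_one.1 h1
  obtain ⟨m', hm', hdvd⟩ := mult_dvd h hθ (fun y hy => h.stab_inv y (h2 hy)) hα hc
  obtain rfl : m = m' := by exact_mod_cast hm.symm.trans hm'
  have h3 : m = 1 := Nat.eq_one_of_dvd_coprimes (hd.coprime hi)
    (e ▸ (dvd_mul_right _ _).mul_right _) hdvd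
  refine (hα.ch.mono h.1).irr_of_const hθ hc ?_
  rw [h.clifford_mul hα hθ hc, hm, h1, h3]
  simp

theorem PiOrd.of_trivOn (h : NI N J) (hl : Lin J l) (h1 : ∀ x ∈ N, l x = 1)
    (hi : IsPiNumber σ (N.relIndex J)) : PiOrd σ J l :=
  ⟨N.relIndex J, Subgroup.index_ne_zero_of_finite, hi, fun x hx => by
    rw [← hl.pow_apply hx, h1 _ (h.pow_mem hx)]⟩

/-- Uniqueness of extensions with given determinantal order. -/
theorem NI.ext_unique (h : NI N J) (hα : Irr J α) (hα' : Irr J α') (hi : IsPiNumber σᶜ (N.relIndex J))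
    (hN : Irr N α) (e : ∀ x ∈ N, α x = α' x) (hd : IsPiNumber σ (deg α)) (hp : PiDet σ J α)
    (hp' : PiDet σ J α') : ∀ x ∈ J, α x = α' x := by
  obtain ⟨ν, hν, ht, hm⟩ := gallagher hα.ch h hN hα'
    (by rw [ip_congr (fun x hx => (e x hx).symm) fun _ _ => rfl, hN.ip_self]; exact one_ne_zero)
  have h1 : ν 1 = 1 := by
    have := hm 1 J.one_mem
    rw [← e 1 N.one_mem] at this
    exact mul_left_cancel₀ hα.one_ne_zero (by rw [← this, mul_one])
  have hl := hν.ch.lin_of_degree_one h1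
  have hν1 : ∀ x ∈ N, ν x = 1 := fun x hx => by
    have := ht x hx 1 J.one_mem
    rwa [mul_one, h1] at this
  obtain ⟨d, hD, hd1⟩ := hp
  have h2 := hp'.ord ((hD.mul_lin hl hα.ch.deg).congr (fun x hx => (hm x hx).symm) fun _ _ => rfl)
  have h3 : PiOrd σ J ν := by
    refine PiOrd.of_pow hα.deg_pos.ne' hd ((h2.mul hd1.inv).congr fun x hx => ?_)
    have := hD.lin.ne_zero hx
    simp only [Pi.mul_apply, Pi.inv_apply]
    field_simp
  intro x hx
  rw [hm x hx, h3.eq_one (.of_trivOn h hl hν1 hi) x hx, mul_one]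

end PiSep

namespace PiSep

variable {G : Type} [Group G] [Fintype G] {J H K N M L Z T : Subgroup G}
  {f g χ ψ θ ρ κ η ν ν' l d D α α' β β' : G → ℂ} {σ : Set ℕ}

theorem Irr.of_restrict (h : Irr N α) (hα : Ch J α) (hN : N ≤ J) : Irr J α := by
  obtain ⟨θ, hθ, hc⟩ := hα.exists_const h.one_ne_zero
  refine hα.irr_of_const hθ hc ?_
  have := h.eq_of_add (hθ.ch.mono hN) ((hα.sub hθ hc).mono hN) (fun x _ => by simp) hθ.one_ne_zero
  exact sub_eq_zero.1 (this 1 N.one_mem)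

theorem PiOrd.pow_eq_one' {a b : ℕ} (h : PiOrd σ H l) (hl : Lin J l) (hH : H ≤ J)
    (e : Nat.card J = a * b) (hb : IsPiNumber σᶜ b) {x : G} (hx : x ∈ H) : l x ^ a = 1 := by
  obtain ⟨m, -, hm, h⟩ := h
  refine eq_one_of_coprime (hm.coprime hb) ?_ ?_
  · rw [← pow_mul, mul_comm, pow_mul, h x hx, one_pow]
  · rw [← pow_mul, ← e, hl.pow_card (hH hx)]

theorem det_pow_consts {a : ℕ} {c : ℂ} (hχ : Ch J χ) (hD : HasDet J χ D)
    (h : ∀ θ, Irr J θ → ip J χ θ ≠ 0 → θ 1 = c ∧ ∃ d, HasDet J θ d ∧ ∀ x ∈ J, d x ^ a = ν x) :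
    ∃ s : ℕ, χ 1 = s * c ∧ ∀ x ∈ J, D x ^ a = ν x ^ s := by
  have h1 : ∀ θ, ∃ d, θ ∈ irrs J → HasDet J θ d := fun θ => by
    by_cases hθ : θ ∈ irrs J
    · exact (mem_irrs.1 hθ).1.ch.exists_det.imp fun d hd _ => hd
    · exact ⟨0, fun h => absurd h hθ⟩
  choose E hE using h1
  have h2 : ∀ θ, ∃ n : ℕ, θ ∈ irrs J → ip J χ θ = n := fun θ => by
    by_cases hθ : θ ∈ irrs J
    · exact (hχ.ip_nat (mem_irrs.1 hθ).1.ch).imp fun d hd _ => hd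
    · exact ⟨0, fun h => absurd h hθ⟩
  choose n hn using h2
  have hdet := (HasDet.sum (irrs J) fun θ hθ => (hE θ hθ).nsmul (n θ)).congr (f := χ)
    (fun x hx => by
      rw [hχ.cls.expand x hx, Finset.sum_apply]
      exact Finset.sum_congr rfl fun θ hθ => by rw [hn θ hθ]; rfl) fun _ _ => rfl
  refine ⟨∑ θ ∈ irrs J, n θ, ?_, fun x hx => ?_⟩
  · rw [hχ.cls.expand 1 J.one_mem, Nat.cast_sum, Finset.sum_mul]
    refine Finset.sum_congr rfl fun θ hθ => ?_
    rw [hn θ hθ]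
    by_cases h0 : n θ = 0
    · simp [h0]
    · rw [(h θ (mem_irrs.1 hθ).1 (by rw [hn θ hθ]; exact_mod_cast h0)).1]
  · rw [hD.unique hdet x hx, Finset.prod_apply, ← Finset.prod_pow, ← Finset.prod_pow_eq_pow_sum]
    refine Finset.prod_congr rfl fun θ hθ => ?_
    rw [Pi.pow_apply, ← pow_mul, mul_comm, pow_mul]
    by_cases h0 : n θ = 0
    · simp [h0]
    · obtain ⟨-, d, hd, hd'⟩ := h θ (mem_irrs.1 hθ).1 (by rw [hn θ hθ]; exact_mod_cast h0)
      rw [(hE θ hθ).unique hd x hx, hd' x hx]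

theorem NI.piDet_const (hK : NI K J) (hN : NI N J) (hs : Sup J N K) (hα : Irr J α)
    (hd : IsPiNumber σ (deg α)) (hp : PiDet σ J α) (hl : Irr K κ) (hc : ip K α κ ≠ 0)
    (hp' : PiDet σ (N ⊓ K) κ) : PiDet σ K κ := by
  obtain ⟨a, b, e, ha, hb⟩ := exists_split_card σ K
  obtain ⟨d, hD⟩ := hl.ch.exists_det
  have h1 : ∀ x ∈ N ⊓ K, d x ^ a = 1 := fun x hx =>
    (hp'.ord (hD.mono inf_le_right)).pow_eq_one' hD.lin inf_le_right e hb hx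
  have hinv : ∀ y ∈ J, ∀ x ∈ K, d (y * x * y⁻¹) ^ a = d x ^ a := by
    intro y hy x hx
    obtain ⟨k, hk, hn⟩ := hs y hy
    have hyx : y * x * y⁻¹ = k * ((k⁻¹ * y) * x * (k⁻¹ * y)⁻¹) * k⁻¹ := by group
    set n := k⁻¹ * y with hn'
    have hnx : n * x * n⁻¹ ∈ K := hK.2 n (hN.1 hn) x hx
    have hnx' : n * x * n⁻¹ * x⁻¹ ∈ N ⊓ K := by
      refine Subgroup.mem_inf.2 ⟨?_, K.mul_mem hnx (K.inv_mem hx)⟩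
      have := N.mul_mem hn (hN.2 x (hK.1 hx) _ (N.inv_mem hn))
      simpa only [mul_assoc] using this
    rw [hyx, hD.lin.cls k hk _ hnx]
    have h2 := h1 _ hnx'
    rw [hD.lin.2 _ hnx _ (K.inv_mem hx), hD.lin.inv_apply hx, mul_pow, inv_pow] at h2
    have h3 := pow_ne_zero a (hD.lin.ne_zero hx)
    field_simp at h2
    exact h2
  obtain ⟨D, hDα, hDo⟩ := hp
  obtain ⟨s, hs1, hs2⟩ := det_pow_consts (a := a) (c := κ 1) (ν := fun x => d x ^ a)
    (hα.ch.mono hK.1) (hDα.mono hK.1) fun θ hθ hcθ => by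
      obtain ⟨y, hy, hyθ⟩ := hK.clifford_conj hα hl hc hθ hcθ
      refine ⟨by rw [hyθ 1 K.one_mem, cj_apply_one], cj y d,
        (hD.cj y fun x hx => hK.2 y hy x hx).congr (fun x hx => (hyθ x hx).symm) fun _ _ => rfl,
        hinv y hy⟩
  have hs3 : deg α = s * deg κ := deg_of_eq (by rw [hs1, hl.ch.deg]; push_cast; rfl)
  refine ⟨d, hD, a, left_ne_zero_of_mul (e ▸ Nat.card_pos.ne'), ha, fun x hx => ?_⟩
  refine eq_one_of_coprime ((hd.dvd (hs3 ▸ dvd_mul_right _ _)).coprime hb) ?_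
    (by rw [← pow_mul, ← e, hD.pow_card hx])
  rw [← hs2 x hx]
  exact (hDo.mono hK.1).pow_eq_one (hDα.mono hK.1).lin e hb hx

theorem SN.piDet_const (hM : SN M J) (hN : NI N J) (hs : Sup J N M) (hα : Irr J α)
    (hd : IsPiNumber σ (deg α)) (hp : PiDet σ J α)
    (hsp : ∀ θ, Irr N θ → ip N α θ ≠ 0 → Sp σ N θ) (hκ : Irr M κ) (hc : ip M α κ ≠ 0) :
    PiDet σ M κ := by
  induction hM generalizing N α with
  | refl => exact hp.congr (hα.eqOn hκ hc)
  | @step K J h1 h ih =>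
    obtain ⟨ξ, hξ, hαξ, hξκ⟩ := exists_over (hα.cls.mono h.1) h1.le hc
    have hsp' : ∀ θ, Irr (N ⊓ K) θ → ip (N ⊓ K) ξ θ ≠ 0 → Sp σ (N ⊓ K) θ := by
      intro θ hθ hcθ
      obtain ⟨ω, hω, hαω, hωθ⟩ := exists_over (hα.cls.mono hN.1) inf_le_left
        (const_trans (hα.ch.mono h.1) hξ hαξ inf_le_right hθ.ch hcθ)
      refine (hsp ω hω hαω).const ?_ hθ hωθ
      rw [inf_comm]
      exact h.inf hN.1
    refine ih (hN.inf h.1) (fun y hy => ?_) hξ (hd.dvd (h.deg_dvd hα hξ hαξ)) ?_ hsp' hξκ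
    · obtain ⟨k, hk, hn⟩ := hs y (h.1 hy)
      exact ⟨k, hk, hn, K.mul_mem (K.inv_mem (h1.le hk)) hy⟩
    · refine h.piDet_const hN (fun y hy => ?_) hα hd hp hξ hαξ
        (.of_consts (hξ.ch.mono inf_le_right) fun θ hθ hcθ => (hsp' θ hθ hcθ).piDet)
      obtain ⟨k, hk, hn⟩ := hs y hy
      exact ⟨k, h1.le hk, hn⟩

/-- An extension of a special character with determinant of `σ`-order is special. -/
theorem Sp.extend (hN : NI N J) (hsp : Sp σ N α) (hα : Ch J α) (hp : PiDet σ J α) : Sp σ J α := by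
  refine ⟨hsp.1.of_restrict hα hN.1, hsp.2.1, fun M hM κ hκ hc => ?_⟩
  have hle := hN.sup_le hM.le
  have hM' : SN M (N ⊔ M) := by
    have := hM.inter hle
    rwa [inf_eq_left.2 le_sup_right] at this
  exact hM'.piDet_const (hN.ni_sup hM.le) (hN.sup_sup hM.le)
    (hsp.1.of_restrict (hα.mono hle) le_sup_left) hsp.2.1 (hp.mono hle)
    (fun θ hθ hcθ => hsp.congr (hsp.1.eqOn hθ hcθ)) hκ hc

theorem Sp.lin (hl : Lin J l) (h : PiOrd σ J l) : Sp σ J l :=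
  ⟨hl.irr, by rw [deg_of_eq (n := 1) (by rw [hl.1, Nat.cast_one])]; exact .one,
    fun M hM θ hθ hc => (hl.mono hM.le |>.piDet (h.mono hM.le)).congr
      ((hl.mono hM.le).irr.eqOn hθ hc)⟩

section transport
variable {Γ : Type} [Group Γ] [Fintype Γ] {p : Γ →* G} {L M : Subgroup Γ}

theorem NI.map (h : NI M L) : NI (M.map p) (L.map p) := by
  refine ⟨Subgroup.map_mono h.1, ?_⟩
  rintro _ ⟨g, hg, rfl⟩ _ ⟨n, hn, rfl⟩
  exact ⟨g * n * g⁻¹, h.2 g hg n hn, by simp⟩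

theorem NI.comap_inf {K J : Subgroup G} (h : NI K J) (hL : L.map p ≤ J) : NI (K.comap p ⊓ L) L := by
  refine ⟨inf_le_right, fun g hg n hn => ⟨?_, L.mul_mem (L.mul_mem hg hn.2) (L.inv_mem hg)⟩⟩
  change p (g * n * g⁻¹) ∈ K
  rw [_root_.map_mul, _root_.map_mul, _root_.map_inv]
  exact h.2 _ (hL ⟨g, hg, rfl⟩) _ hn.1

theorem SN.map (h : SN M L) : SN (M.map p) (L.map p) := by
  induction h with
  | refl => exact .refl _
  | step _ h ih => exact .step ih h.map

theorem map_comap_inf {K : Subgroup G} (h : K ≤ L.map p) : (K.comap p ⊓ L).map p = K := by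
  refine le_antisymm ?_ fun x hx => ?_
  · rintro _ ⟨y, hy, rfl⟩
    exact hy.1
  · obtain ⟨y, hy, rfl⟩ := h hx
    exact ⟨y, ⟨hx, hy⟩, rfl⟩

theorem SN.comap_inf {M J : Subgroup G} (h : SN M J) (hL : L.map p = J) : SN (M.comap p ⊓ L) L := by
  induction h generalizing L with
  | refl => rw [inf_eq_right.2 (Subgroup.map_le_iff_le_comap.1 hL.le)]; exact .refl L
  | @step K J h1 h ih =>
    have := ih (L := K.comap p ⊓ L) (map_comap_inf (hL ▸ h.1))
    rw [← inf_assoc, inf_eq_left.2 (Subgroup.comap_mono h1.le)] at this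
    exact .step this (h.comap_inf hL.le)

theorem PiDet.of_map (h : PiDet σ (L.map p) f) : PiDet σ L fun x => f (p x) := by
  obtain ⟨d, hd, m, h0, hm, h⟩ := h
  exact ⟨_, hd.of_map, m, h0, hm, fun x hx => h _ ⟨x, hx, rfl⟩⟩

theorem PiDet.map (hf : Ch (L.map p) f) (h : PiDet σ L fun x => f (p x)) : PiDet σ (L.map p) f := by
  obtain ⟨d, hd⟩ := hf.exists_det
  obtain ⟨m, h0, hm, h⟩ := h.ord hd.of_map
  refine ⟨d, hd, m, h0, hm, ?_⟩
  rintro _ ⟨x, hx, rfl⟩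
  exact h x hx

theorem deg_comp : deg (fun x => f (p x)) = deg f := by
  simp [deg]

/-- Constituents of inflated characters are inflated. -/
theorem exists_descend_const (hM : Ch (M.map p) f) {θ : Γ → ℂ} (hθ : Irr M θ)
    (hc : ip M (fun x => f (p x)) θ ≠ 0) :
    ∃ θ', Irr (M.map p) θ' ∧ ip (M.map p) f θ' ≠ 0 ∧ ∀ x ∈ M, θ' (p x) = θ x := by
  have hK : NI (p.ker ⊓ M) M := ⟨inf_le_right, fun g hg n hn =>
    ⟨p.normal_ker.conj_mem n hn.1 g, M.mul_mem (M.mul_mem hg hn.2) (M.inv_mem hg)⟩⟩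
  obtain ⟨ω, hω, hcω⟩ := hθ.exists_const hK.1
  have h1 := const_trans hM.of_map hθ hc hK.1 hω.ch hcω
  rw [ip_congr (f' := f 1 • 1) (g' := ω) (fun x hx => by simp [MonoidHom.mem_ker.1 hx.1])
    fun _ _ => rfl, ip_smul_left] at h1
  have h2 := Lin.one.irr.eqOn hω (right_ne_zero_of_mul h1)
  have h3 := hθ.trivOn hK (by
    rwa [ip_congr (fun _ _ => rfl) fun x hx => h2 x hx])
  obtain ⟨θ', hθ'⟩ := exists_descend (L := M) (p := p) θ fun x hx y hy e => by
    have := h3 (x * y⁻¹) ⟨by simp [e], M.mul_mem hx (M.inv_mem hy)⟩ y hy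
    rwa [inv_mul_cancel_right] at this
  refine ⟨θ', ?_, ?_, hθ'⟩
  · rw [irr_map]
    exact hθ.congr fun x hx => (hθ' x hx).symm
  · rw [ip_map, ip_congr (fun _ _ => rfl) hθ']
    exact hc

theorem Sp.of_map (h : Sp σ (L.map p) f) : Sp σ L fun x => f (p x) := by
  refine ⟨(irr_map (p := p)).1 h.1, deg_comp (p := p) (f := f) ▸ h.2.1, fun M hM θ hθ hc => ?_⟩
  obtain ⟨θ', h1, h2, h3⟩ := exists_descend_const (h.1.ch.mono (Subgroup.map_mono hM.le)) hθ hc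
  exact (h.2.2 _ hM.map θ' h1 h2).of_map.congr h3

theorem Sp.map (h : Sp σ L fun x => f (p x)) : Sp σ (L.map p) f := by
  refine ⟨(irr_map (p := p)).2 h.1, by rw [← deg_comp (p := p) (f := f)]; exact h.2.1, fun M hM θ hθ hc => ?_⟩
  have e := map_comap_inf hM.le
  rw [← e] at hθ hc ⊢
  refine .map hθ.ch (h.2.2 _ (hM.comap_inf rfl) _ (irr_map.1 hθ) ?_)
  rwa [← ip_map]

end transport

theorem NI.map_conj (h : NI N J) {y : G} (hy : y ∈ J) : N.map (MulAut.conj y).toMonoidHom = N := by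
  ext x
  constructor
  · rintro ⟨n, hn, rfl⟩
    exact h.2 y hy n hn
  · intro hx
    exact ⟨y⁻¹ * x * y, by simpa using h.2 y⁻¹ (J.inv_mem hy) x hx, by simp [mul_assoc]⟩

theorem Sp.cj (hf : Sp σ N f) (h : NI N J) {y : G} (hy : y ∈ J) : Sp σ N (PiSep.cj y f) :=
  Sp.of_map (p := (MulAut.conj y).toMonoidHom) (by rwa [h.map_conj hy])

/-- Characters over a special character of a normal subgroup of `σ`-index are special. -/
theorem Sp.over (hN : NI N J) (hi : IsPiNumber σ (N.relIndex J)) (hθ : Sp σ N θ) (hχ : Irr J χ)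
    (hc : ip N χ θ ≠ 0) : Sp σ J χ := by
  have hdet : ∀ M, SN M J → ∀ κ, Irr M κ → ip M χ κ ≠ 0 → PiDet σ M κ := by
    intro M hM κ hκ hc'
    have h1 : PiDet σ (N ⊓ M) κ := .of_consts (hκ.ch.mono inf_le_right) fun ω hω hκω => by
      obtain ⟨θ', hθ', h2, h3⟩ := exists_over (hχ.cls.mono hN.1) inf_le_left
        (const_trans (hχ.ch.mono hM.le) hκ hc' inf_le_right hω.ch hκω)
      obtain ⟨y, hy, e⟩ := hN.clifford_conj hχ hθ.1 hc hθ' h2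
      have h4 := (hθ.cj hN hy).congr fun x hx => (e x hx).symm
      have h5 := hM.inter hN.1
      rw [inf_comm] at h5
      exact h4.2.2 _ h5 ω hω h3
    obtain ⟨d, hd⟩ := hκ.ch.exists_det
    obtain ⟨m, h0, hm, h⟩ := h1.ord (hd.mono inf_le_right)
    refine ⟨d, hd, (N ⊓ M).relIndex M * m, mul_ne_zero Subgroup.index_ne_zero_of_finite h0,
      (hi.dvd (hN.relIndex_dvd hM.le)).mul hm, fun x hx => ?_⟩
    rw [pow_mul, ← hd.lin.pow_apply hx, h _ ((hN.inf hM.le).pow_mem hx)]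
  refine ⟨hχ, ?_, hdet⟩
  obtain ⟨m, hm, e⟩ := hN.deg_eq hχ hθ.1 hc
  rw [e]
  refine (IsPiNumber.mul ?_ (hi.dvd (hN.stab_relIndex_dvd hθ.1.cls))).mul hθ.2.1
  obtain ⟨ζ, hζ, h1, h2⟩ := exists_over (hχ.cls.mono stab_le) (hN.le_stab hθ.1.cls) hc
  obtain ⟨-, h3⟩ := hN.clifford_ind hχ hθ.1 hζ h1 h2
  obtain ⟨n, hn, hn'⟩ := mult_dvd (hN.stab_ni hθ.1.cls) hθ.1 hN.stab_inv hζ h2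
  obtain rfl : m = n := by exact_mod_cast hm.symm.trans (h3.symm.trans hn)
  exact hi.dvd (hn'.trans (by
    rw [← Subgroup.relIndex_mul_relIndex _ _ _ (hN.le_stab hθ.1.cls) stab_le]
    exact dvd_mul_right _ _))

end PiSep

namespace PiSep

variable {G : Type} [Group G] [Fintype G] {J H K N M L Z T P : Subgroup G}
  {f g χ ψ θ ρ κ η ν ν' l d D A a ω α α' β β' : G → ℂ} {σ : Set ℕ}

theorem Ch.ip_self_ne_zero (h : Ch J f) (h1 : f 1 ≠ 0) : ip J f f ≠ 0 :=
  bip_self_ne_zero h fun e => h1 (congrFun e (1 : J))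

/-- If an `ip` computation on a smaller group matches, it matches termwise. -/
theorem norm_orth (hK : K ≤ J) (hA : Ch J A) (hβ : Ch K β) (hβ1 : β 1 ≠ 0)
    (h : ip K (A * β) (A * β) = ip J A A) (hα : Irr J α) (hα' : Irr J α') (hc : ip J A α ≠ 0)
    (hc' : ip J A α' ≠ 0) : ip K (α * β) (α' * β) = ip J α α' := by
  have h1 : ∀ θ θ', ∃ n : ℕ, θ ∈ irrs J → θ' ∈ irrs J → ip K (θ * β) (θ' * β) = n := by
    intro θ θ'
    by_cases hθ : θ ∈ irrs J ∧ θ' ∈ irrs J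
    · exact (((mem_irrs.1 hθ.1).1.ch.mono hK).mul hβ |>.ip_nat
        (((mem_irrs.1 hθ.2).1.ch.mono hK).mul hβ)).imp fun n hn _ _ => hn
    · exact ⟨0, fun h h' => absurd ⟨h, h'⟩ hθ⟩
  choose c hcc using h1
  have h2 : ∀ θ, ∃ n : ℕ, θ ∈ irrs J → ip J A θ = n := fun θ => by
    by_cases hθ : θ ∈ irrs J
    · exact (hA.ip_nat (mem_irrs.1 hθ).1.ch).imp fun d hd _ => hd
    · exact ⟨0, fun h => absurd h hθ⟩
  choose n hn using h2
  have h3 : ∀ g, ip K (A * β) g =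
      ∑ θ ∈ irrs J, n θ * ip K (θ * β) g := by
    intro g
    rw [ip_congr (f' := ∑ θ ∈ irrs J, (n θ : ℂ) • (θ * β)) (g' := g) (fun x hx => ?_)
      fun _ _ => rfl, ip_sum_left]
    · simp only [ip_smul_left]
    · rw [Pi.mul_apply, hA.cls.expand x (hK hx), Finset.sum_mul, Finset.sum_apply]
      refine Finset.sum_congr rfl fun θ hθ => ?_
      rw [hn θ hθ, Pi.smul_apply, Pi.mul_apply, smul_eq_mul, mul_assoc]
  have h4 : ∀ g, ip J A g = ∑ θ ∈ irrs J, n θ * ip J θ g := by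
    intro g
    rw [ip_congr (f' := ∑ θ ∈ irrs J, (n θ : ℂ) • θ) (g' := g) (fun x hx => ?_)
      fun _ _ => rfl, ip_sum_left]
    · simp only [ip_smul_left]
    · rw [hA.cls.expand x hx, Finset.sum_apply]
      exact Finset.sum_congr rfl fun θ hθ => by rw [hn θ hθ]; rfl
  have h5 : (∑ p ∈ irrs J ×ˢ irrs J, n p.1 * n p.2 * (if p.1 = p.2 then 1 else 0)) =
      ∑ p ∈ irrs J ×ˢ irrs J, n p.1 * n p.2 * c p.1 p.2 := by
    have e1 : ip K (A * β) (A * β) =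
        ((∑ p ∈ irrs J ×ˢ irrs J, n p.1 * n p.2 * c p.1 p.2 : ℕ) : ℂ) := by
      rw [h3, Finset.sum_product, Nat.cast_sum]
      refine Finset.sum_congr rfl fun θ hθ => ?_
      rw [ip_comm, h3, Nat.cast_sum, Finset.mul_sum]
      refine Finset.sum_congr rfl fun θ' hθ' => ?_
      rw [ip_comm, hcc θ θ' hθ hθ']
      push_cast
      ring
    have e2 : ip J A A = ((∑ p ∈ irrs J ×ˢ irrs J,
        n p.1 * n p.2 * (if p.1 = p.2 then 1 else 0) : ℕ) : ℂ) := by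
      rw [h4, Finset.sum_product, Nat.cast_sum]
      refine Finset.sum_congr rfl fun θ hθ => ?_
      rw [ip_comm, h4, Nat.cast_sum, Finset.mul_sum]
      refine Finset.sum_congr rfl fun θ' hθ' => ?_
      rw [ip_comm, ip_irrs hθ hθ']
      push_cast
      ring
    exact_mod_cast e2.symm.trans (h.symm.trans e1)
  have h6 : ∀ p ∈ irrs J ×ˢ irrs J,
      n p.1 * n p.2 * (if p.1 = p.2 then 1 else 0) ≤ n p.1 * n p.2 * c p.1 p.2 := by
    intro p hp
    refine Nat.mul_le_mul_left _ ?_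
    split_ifs with e
    · obtain ⟨hp1, hp2⟩ := Finset.mem_product.1 hp
      refine Nat.one_le_iff_ne_zero.2 fun h0 => ?_
      have h7 := hcc p.1 p.2 hp1 hp2
      rw [h0, ← e] at h7
      have hi := (mem_irrs.1 hp1).1
      exact ((hi.ch.mono hK).mul hβ).ip_self_ne_zero (mul_ne_zero hi.one_ne_zero hβ1)
        (by exact_mod_cast h7)
    · exact Nat.zero_le _
  have h7 := (Finset.sum_eq_sum_iff_of_le h6).1 h5
  have m1 := hα.trunc_mem
  have m2 := hα'.trunc_mem
  have h8 := h7 (trunc J α, trunc J α') (Finset.mem_product.2 ⟨m1, m2⟩)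
  have t1 : ∀ x ∈ J, trunc J α x = α x := fun x hx => trunc_apply hx
  have t2 : ∀ x ∈ J, trunc J α' x = α' x := fun x hx => trunc_apply hx
  have n1 : n (trunc J α) ≠ 0 := fun h0 => hc (by
    rw [← ip_congr (fun _ _ => rfl) t1, hn _ m1, h0, Nat.cast_zero])
  have n2 : n (trunc J α') ≠ 0 := fun h0 => hc' (by
    rw [← ip_congr (fun _ _ => rfl) t2, hn _ m2, h0, Nat.cast_zero])
  have h9 := Nat.eq_of_mul_eq_mul_left (Nat.pos_of_ne_zero (mul_ne_zero n1 n2)) h8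
  rw [ip_congr (J := K) (f' := trunc J α * β) (g' := trunc J α' * β)
    (fun x hx => by simp [t1 x (hK hx)]) (fun x hx => by simp [t2 x (hK hx)]), hcc _ _ m1 m2, ← h9,
    ← ip_congr t1 t2, ip_irrs m1 m2]
  split_ifs <;> simp

theorem ip_mul_expand (hα : Cls N α) (h : ip N (α * β) ω ≠ 0) :
    ∃ a, Irr N a ∧ ip N α a ≠ 0 ∧ ip N (a * β) ω ≠ 0 := by
  rw [ip_congr (f' := ∑ θ ∈ irrs N, ip N α θ • (θ * β)) (g' := ω) (fun x hx => ?_)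
      fun _ _ => rfl, ip_sum_left] at h
  · obtain ⟨a, ha, h0⟩ := Finset.exists_ne_zero_of_sum_ne_zero h
    rw [ip_smul_left] at h0
    exact ⟨a, (mem_irrs.1 ha).1, left_ne_zero_of_mul h0, right_ne_zero_of_mul h0⟩
  · rw [Pi.mul_apply, hα.expand x hx, Finset.sum_mul, Finset.sum_apply]
    refine Finset.sum_congr rfl fun θ hθ => ?_
    rw [Pi.smul_apply, Pi.mul_apply, smul_eq_mul, mul_assoc]

theorem exists_common (hf : Ch J f) (_ : Ch J g) (h : ip J f g ≠ 0) :
    ∃ ω, Irr J ω ∧ ip J f ω ≠ 0 ∧ ip J g ω ≠ 0 := by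
  obtain ⟨ω, h1, h2, h3⟩ := exists_over hf.cls le_rfl h
  exact ⟨ω, h1, h2, by rwa [ip_comm]⟩

theorem NI.ip_ind_mul (h : NI N J) (θ β g : G → ℂ) :
    ip N (ind J N θ * β) g = (Nat.card N : ℂ)⁻¹ * sm J fun y => ip N (cj y θ * β) g := by
  rw [ip_congr (f' := (Nat.card N : ℂ)⁻¹ • fun x => sm J fun y => (cj y θ * β) x) (g' := g)
    (fun x hx => by
      rw [Pi.mul_apply, h.ind_apply θ x hx, Pi.smul_apply, smul_eq_mul, mul_assoc, ← sm_const_mul]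
      rfl) (fun _ _ => rfl), ip_smul_left, ip_sm_left]

/-- Separability with respect to `σ` of subgroups of an ambient group. -/
inductive Sep (σ : Set ℕ) : Subgroup G → Prop
  | bot : Sep σ ⊥
  | step {N J : Subgroup G} : Sep σ N → NI N J →
      IsPiNumber σ (N.relIndex J) ∨ IsPiNumber σᶜ (N.relIndex J) → Sep σ J

theorem Sep.compl (h : Sep σ J) : Sep σᶜ J := by
  induction h with
  | bot => exact .bot
  | step _ h h' ih => exact .step ih h (by rw [compl_compl]; exact h'.symm)

/-- Inner products of products of special characters split. -/
def Orth (σ : Set ℕ) (J : Subgroup G) : Prop :=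
  ∀ α α' β β' : G → ℂ, Sp σ J α → Sp σ J α' → Sp σᶜ J β → Sp σᶜ J β' →
    ip J (α * β) (α' * β') = ip J α α' * ip J β β'

theorem Orth.compl (h : Orth σ J) : Orth σᶜ J := fun α α' β β' hα hα' hβ hβ' => by
  rw [compl_compl] at hβ hβ'
  rw [mul_comm α, mul_comm α', h β β' α α' hβ hβ' hα hα', mul_comm]

theorem Orth.irr (h : Orth σ J) (hα : Sp σ J α) (hβ : Sp σᶜ J β) : Irr J (α * β) :=
  irr_iff.2 ⟨hα.1.ch.mul hβ.1.ch, by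
    rw [h α α β β hα hα hβ hβ, hα.1.ip_self, hβ.1.ip_self, mul_one]⟩

theorem Orth.unique (h : Orth σ J) (hα : Sp σ J α) (hα' : Sp σ J α') (hβ : Sp σᶜ J β)
    (hβ' : Sp σᶜ J β') (hc : ip J (α * β) (α' * β') ≠ 0) :
    (∀ x ∈ J, α x = α' x) ∧ ∀ x ∈ J, β x = β' x := by
  rw [h α α' β β' hα hα' hβ hβ'] at hc
  exact ⟨hα.1.eqOn hα'.1 (left_ne_zero_of_mul hc), hβ.1.eqOn hβ'.1 (right_ne_zero_of_mul hc)⟩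

theorem Orth.step (h : Orth σ N) (hN : NI N J) (hi : IsPiNumber σ (N.relIndex J)) : Orth σ J := by
  intro α α' β β' hα hα' hβ hβ'
  have hi' : IsPiNumber σᶜᶜ (N.relIndex J) := by rwa [compl_compl]
  have hβN := hN.irr_restrict hβ.1 hβ.2.1 hi'
  have hβN' := hN.irr_restrict hβ'.1 hβ'.2.1 hi'
  have sβ := hβ.const hN hβN (by rw [hβN.ip_self]; exact one_ne_zero)
  have sβ' := hβ'.const hN hβN' (by rw [hβN'.ip_self]; exact one_ne_zero)
  by_cases h0 : ip J (α * β) (α' * β') = 0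
  · rw [h0]
    symm
    by_contra hc
    have e1 := hα.1.eqOn hα'.1 (left_ne_zero_of_mul hc)
    have e2 := hβ.1.eqOn hβ'.1 (right_ne_zero_of_mul hc)
    refine (hα.1.ch.mul hβ.1.ch).ip_self_ne_zero
      (mul_ne_zero hα.1.one_ne_zero hβ.1.one_ne_zero) ?_
    rw [← h0]
    exact ip_congr (fun _ _ => rfl) fun x hx => by simp [e1 x hx, e2 x hx]
  obtain ⟨χ, hχ, h1, h2⟩ := exists_common (hα.1.ch.mul hβ.1.ch) (hα'.1.ch.mul hβ'.1.ch) h0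
  obtain ⟨ω, hω, h3⟩ := hχ.exists_const hN.1
  obtain ⟨a, ha, h4, h5⟩ := ip_mul_expand (hα.1.cls.mono hN.1)
    (const_trans (hα.1.ch.mul hβ.1.ch) hχ h1 hN.1 hω.ch h3)
  obtain ⟨a', ha', h4', h5'⟩ := ip_mul_expand (hα'.1.cls.mono hN.1)
    (const_trans (hα'.1.ch.mul hβ'.1.ch) hχ h2 hN.1 hω.ch h3)
  have sa := hα.const hN ha h4
  have sa' := hα'.const hN ha' h4'
  have e1 := (h.irr sa sβ).eqOn hω h5
  have e1' := (h.irr sa' sβ').eqOn hω h5'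
  obtain ⟨e2, e3⟩ := h.unique sa sa' sβ sβ' (by
    rw [ip_congr e1 e1', hω.ip_self]; exact one_ne_zero)
  have e4 := hN.ext_unique hβ.1 hβ'.1 hi' hβN e3 hβ.2.1 hβ.piDet hβ'.piDet
  rw [ip_congr (J := J) (f := β) (f' := β) (g' := β) (fun _ _ => rfl) fun x hx => (e4 x hx).symm,
    hβ.1.ip_self, mul_one, ip_congr (J := J) (f' := α * β) (g' := α' * β) (fun _ _ => rfl)
      fun x hx => by simp [e4 x hx]]
  have hind : ∀ g, Cls J g → ip J (ind J N a) g = ip N a g := fun _ hg => ip_ind hN.1 hg a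
  refine norm_orth le_rfl (ha.ch.ind hN.1) hβ.1.ch hβ.1.one_ne_zero ?_ hα.1 hα'.1
    (by rwa [hind _ hα.1.cls, ip_comm])
    (by rwa [hind _ hα'.1.cls, ip_comm, ip_congr (fun _ _ => rfl) e2])
  have hcls : Cls J (ind J N a * β) := ((ha.ch.ind hN.1).mul hβ.1.ch).cls
  rw [hind _ (ind_cls a), ip_comm (J := N), hN.ip_ind_restrict,
    ip_congr (J := J) (f := ind J N a * β) (f' := ind J N (a * β)) (g' := ind J N a * β)
      (fun x hx => (ind_mul hβ.1.cls x hx).symm) (fun _ _ => rfl), ip_ind hN.1 hcls, ip_comm, hN.ip_ind_mul]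
  congr 1
  refine sm_congr fun y hy => ?_
  rw [h _ _ _ _ (sa.cj hN hy) sa sβ sβ, hβN.ip_self, mul_one]

theorem Sep.orth (h : Sep σ J) : Orth σ J := by
  induction h with
  | bot =>
    intro α α' β β' hα hα' hβ hβ'
    have h1 : ∀ f : G → ℂ, Irr ⊥ f → f 1 = 1 := fun f hf => by
      have := hf.ip_self
      rw [ip_def, sm_eq] at this
      simp only [Subgroup.mem_bot] at this
      simp at this
      have h2 : (f 1 - 1) * (f 1 + 1) = 0 := by linear_combination this
      rcases mul_eq_zero.1 h2 with h | h
      · exact sub_eq_zero.1 h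
      · exfalso
        have h3 := hf.ch.deg
        rw [eq_neg_of_add_eq_zero_left h] at h3
        have := congrArg Complex.re h3
        simp at this
        linarith [(Nat.cast_nonneg (deg f) : (0:ℝ) ≤ deg f)]
    rw [ip_def, ip_def, ip_def, sm_eq, sm_eq, sm_eq]
    simp [h1 _ hα.1, h1 _ hα'.1, h1 _ hβ.1, h1 _ hβ'.1]
  | step _ hN hi ih =>
    rcases hi with hi | hi
    · exact ih.step hN hi
    · have := ih.compl.step hN hi
      simpa using this.compl

theorem Sp.irr_mul (hJ : Sep σ J) (hα : Sp σ J α) (hβ : Sp σᶜ J β) : Irr J (α * β) :=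
  hJ.orth.irr hα hβ

end PiSep

namespace PiSep

variable {G : Type} [Group G] [Fintype G] {J H K N M L Z T P : Subgroup G}
  {f g χ ψ θ ρ κ η ν ν' l d D A a ω α α' β β' : G → ℂ} {σ : Set ℕ}

/-- The index of `N` in `J` is a number for `σ` or for its complement. -/
def OneType (σ : Set ℕ) (n : ℕ) : Prop := IsPiNumber σ n ∨ IsPiNumber σᶜ n

theorem OneType.dvd {m n : ℕ} (h : OneType σ n) (hm : m ∣ n) : OneType σ m :=
  h.imp (fun h => h.dvd hm) fun h => h.dvd hm

theorem Sep.mono (h : Sep σ J) (hH : H ≤ J) : Sep σ H := by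
  induction h generalizing H with
  | bot => rw [le_bot_iff.1 hH]; exact .bot
  | step _ h h' ih =>
    exact .step (ih inf_le_left) (h.inf hH) (OneType.dvd h' (h.relIndex_dvd hH))

section
variable {Γ : Type} [Group Γ] [Fintype Γ] {p : Γ →* G} {Λ : Subgroup Γ}

theorem relIndex_map_dvd {N J : Subgroup Γ} : (N.map p).relIndex (J.map p) ∣ N.relIndex J := by
  rw [← Subgroup.relIndex_comap]
  exact Subgroup.relIndex_dvd_of_le_left _ (Subgroup.le_comap_map _ _)

theorem Sep.map (h : Sep σ Λ) : Sep σ (Λ.map p) := by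
  induction h with
  | bot => rw [Subgroup.map_bot]; exact .bot
  | step _ h h' ih => exact .step ih h.map (OneType.dvd h' relIndex_map_dvd)

theorem Sep.comap (h : Sep σ J) (hJ : Λ.map p = J)
    (hk : OneType σ (Nat.card (p.ker ⊓ Λ : Subgroup Γ))) : Sep σ Λ := by
  induction h generalizing Λ with
  | bot =>
    have : Λ ≤ p.ker := fun x hx => by
      have : p x ∈ Λ.map p := ⟨x, hx, rfl⟩
      rw [hJ] at this
      exact this
    rw [inf_eq_right.2 this] at hk
    exact .step .bot ⟨bot_le, fun g _ n hn => by
      rw [Subgroup.mem_bot] at hn ⊢; rw [hn]; group⟩ (by rwa [Subgroup.relIndex_bot_left])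
  | @step N J _ h h' ih =>
    subst hJ
    refine .step (ih (map_comap_inf h.1) (hk.dvd (Subgroup.card_dvd_of_le
      (inf_le_inf_left _ inf_le_right)))) (h.comap_inf le_rfl) ?_
    rwa [Subgroup.inf_relIndex_right, Subgroup.relIndex_comap]
end

theorem NI.bot : NI ⊥ J := ⟨bot_le, fun g _ n hn => by
  rw [Subgroup.mem_bot] at hn ⊢; rw [hn]; group⟩

theorem Sep.exists_proper (h : Sep σ N) (hN : N ≠ ⊥) :
    ∃ M, NI M N ∧ M ≠ N ∧ OneType σ (M.relIndex N) := by
  induction h with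
  | bot => exact absurd rfl hN
  | @step M N _ h h' ih =>
    by_cases e : M = N
    · subst e; exact ih hN
    · exact ⟨M, h, e, h'⟩

theorem NI.conj_map (h : NI M N) (hN : NI N J) {g : G} (hg : g ∈ J) :
    NI (M.map (MulAut.conj g).toMonoidHom) N ∧
      (M.map (MulAut.conj g).toMonoidHom).relIndex N = M.relIndex N := by
  have e : N.map (MulAut.conj g).toMonoidHom = N := hN.map_conj hg
  have h1 := h.map (p := (MulAut.conj g).toMonoidHom)
  rw [e] at h1
  refine ⟨h1, ?_⟩
  conv_lhs => rw [← e]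
  exact Subgroup.relIndex_map_map_of_injective _ _ (MulAut.conj g).injective

/-- The smallest normal subgroup of `N` with a `τ`-index is invariant. -/
theorem exists_min_of_type {τ : Set ℕ} (hN : NI N J) (h : NI M N) (hM : M ≠ N)
    (hi : IsPiNumber τ (M.relIndex N)) :
    ∃ M, NI M J ∧ M ≤ N ∧ M ≠ N ∧ IsPiNumber τ (M.relIndex N) := by
  let S : Finset (Subgroup G) := Finset.univ.filter fun M => NI M N ∧ IsPiNumber τ (M.relIndex N)
  have hS : M ∈ S := by simp [S, h, hi]
  obtain ⟨Y, hY, hmin⟩ := S.exists_min_image (fun M => Nat.card M) ⟨M, hS⟩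
  have hY' : NI Y N ∧ IsPiNumber τ (Y.relIndex N) := by simpa [S] using hY
  have key : ∀ X, NI X N → IsPiNumber τ (X.relIndex N) → Y ≤ X := by
    intro X hX hXi
    have h1 : IsPiNumber τ ((X ⊓ Y).relIndex N) := by
      rw [← Subgroup.relIndex_inf_mul_relIndex (L := N)]
      rw [inf_eq_left.2 hY'.1.1]
      refine .mul ?_ hY'.2
      have := hX.relIndex_dvd hY'.1.1
      rw [Subgroup.inf_relIndex_right] at this
      exact hXi.dvd this
    have h2 := hmin (X ⊓ Y) (by simp only [S, Finset.mem_filter, Finset.mem_univ, true_and]; exact ⟨hX.inf_ni hY'.1, h1⟩)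
    have h3 := Subgroup.eq_of_le_of_card_ge inf_le_right h2
    exact inf_eq_right.1 h3
  refine ⟨Y, ⟨hY'.1.1.trans hN.1, fun g hg n hn => ?_⟩, hY'.1.1, ?_, hY'.2⟩
  · have h1 := hY'.1.conj_map hN (inv_mem hg)
    obtain ⟨m, hm, e⟩ := key _ h1.1 (by rw [h1.2]; exact hY'.2) hn
    have : g⁻¹ * m * g = n := by simpa using e
    rw [← this]
    have e2 : g * (g⁻¹ * m * g) * g⁻¹ = m := by group
    rw [e2]
    exact hm
  · rintro rfl
    exact hM (le_antisymm h.1 (key M h hi))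

theorem Sep.step_down (h : Sep σ N) (hN : N ≠ ⊥) (hNJ : NI N J) :
    ∃ M, NI M J ∧ M ≤ N ∧ M ≠ N ∧ OneType σ (M.relIndex N) := by
  obtain ⟨M, h1, h2, h3 | h3⟩ := h.exists_proper hN
  · obtain ⟨X, a, b, c, d⟩ := exists_min_of_type hNJ h1 h2 h3
    exact ⟨X, a, b, c, .inl d⟩
  · obtain ⟨X, a, b, c, d⟩ := exists_min_of_type hNJ h1 h2 h3
    exact ⟨X, a, b, c, .inr d⟩

theorem Sep.step_up (h : Sep σ J) (hN : NI N J) (hne : N ≠ J) :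
    ∃ K, NI K J ∧ N ≤ K ∧ N ≠ K ∧ OneType σ (N.relIndex K) := by
  let S : Finset (Subgroup G) := Finset.univ.filter fun M => NI M J ∧ ¬ M ≤ N
  have hS : J ∈ S := by
    simp only [S, Finset.mem_filter, Finset.mem_univ, true_and]
    exact ⟨.refl, fun h => hne (le_antisymm hN.1 h)⟩
  obtain ⟨X, hX, hmin⟩ := S.exists_min_image (fun M => Nat.card M) ⟨J, hS⟩
  have hX' : NI X J ∧ ¬ X ≤ N := by simpa [S] using hX
  obtain ⟨M, hM, h1, h2, h3⟩ := (h.mono hX'.1.1).step_down (by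
    rintro rfl; exact hX'.2 bot_le) hX'.1
  have hMN : M ≤ N := by
    by_contra h4
    exact h2 (Subgroup.eq_of_le_of_card_ge h1 (hmin M (by simp [S, hM, h4])))
  refine ⟨N ⊔ X, hN.sup_ni hX'.1, le_sup_left, fun e => hX'.2 (e ▸ le_sup_right), h3.dvd ?_⟩
  have h5 : N.relIndex (N ⊔ X) = N.relIndex X := by
    have h6 := (hN.ni_sup hX'.1.1)
    have := h6.normal
    have e : (N ⊔ X).subgroupOf (N ⊔ X) = N.subgroupOf (N ⊔ X) ⊔ X.subgroupOf (N ⊔ X) :=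
      Subgroup.subgroupOf_sup le_sup_left le_sup_right
    have := Subgroup.relIndex_sup_left (X.subgroupOf (N ⊔ X)) (N.subgroupOf (N ⊔ X))
    rw [← e, Subgroup.subgroupOf_self, Subgroup.relIndex_top_right,
      Subgroup.relIndex_subgroupOf le_sup_right] at this
    exact this
  rw [h5]
  exact Subgroup.relIndex_dvd_of_le_left X hMN

/-- Schur-Zassenhaus. -/
theorem NI.exists_complement (h : NI N J) (hc : (Nat.card N).Coprime (N.relIndex J)) :
    ∃ E, E ≤ J ∧ N ⊓ E = ⊥ ∧ N ⊔ E = J ∧ Nat.card E = N.relIndex J := by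
  have h1 := h.normal
  obtain ⟨Q, hQ⟩ := Subgroup.exists_right_complement'_of_coprime (N := N.subgroupOf J) (by
    rwa [Nat.card_congr (Subgroup.subgroupOfEquivOfLe h.1).toEquiv])
  have hJ : Q.map J.subtype ≤ J := by rintro _ ⟨x, _, rfl⟩; exact x.2
  have e1 : (N.subgroupOf J).map J.subtype = N := by
    rw [Subgroup.subgroupOf_map_subtype, inf_eq_left.2 h.1]
  refine ⟨Q.map J.subtype, hJ, ?_, ?_, ?_⟩
  · rw [← e1, ← Subgroup.map_inf _ _ _ J.subtype_injective, hQ.disjoint.eq_bot, Subgroup.map_bot]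
  · rw [← e1, ← Subgroup.map_sup, hQ.sup_eq_top, ← MonoidHom.range_eq_map, Subgroup.range_subtype]
  · rw [Subgroup.card_subtype, ← hQ.symm.index_eq_card]
    rfl

/-- `P` is a Hall `σ`-subgroup of `J`. -/
def Hall (σ : Set ℕ) (J P : Subgroup G) : Prop :=
  P ≤ J ∧ IsPiNumber σ (Nat.card P) ∧ IsPiNumber σᶜ (P.relIndex J)

theorem exists_hall_top (σ : Set ℕ) (n : ℕ) : ∀ (Γ : Type) [Group Γ] [Fintype Γ],
    Nat.card Γ = n → Sep σ (⊤ : Subgroup Γ) →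
      ∃ P : Subgroup Γ, IsPiNumber σ (Nat.card P) ∧ IsPiNumber σᶜ P.index := by
  induction n using Nat.strong_induction_on with
  | _ n ih =>
  intro Γ _ _ hn hs
  by_cases h1 : (⊥ : Subgroup Γ) = ⊤
  · refine ⟨⊤, ?_, ?_⟩
    · rw [← h1, Subgroup.card_bot]; exact .one
    · rw [Subgroup.index_top]; exact .one
  obtain ⟨K, hK, -, hK1, hKt⟩ := hs.step_up NI.bot h1
  rw [Subgroup.relIndex_bot_left] at hKt
  have : K.Normal := ⟨fun n hn g => hK.2 g trivial n hn⟩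
  have hs' := hs.map (p := QuotientGroup.mk' K)
  rw [← MonoidHom.range_eq_map, MonoidHom.range_eq_top.2 (QuotientGroup.mk'_surjective K)] at hs'
  have hcK : 1 < Nat.card K := by
    rw [Subgroup.one_lt_card_iff_ne_bot]; exact hK1.symm
  have hcard := Subgroup.card_mul_index K
  obtain ⟨P, hP1, hP2⟩ := ih (Nat.card (Γ ⧸ K)) (by
    rw [← hn, ← hcard, ← Subgroup.index_eq_card]
    exact lt_mul_of_one_lt_left (Nat.pos_of_ne_zero Subgroup.index_ne_zero_of_finite) hcK) (Γ ⧸ K) rfl hs'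
  set R := P.comap (QuotientGroup.mk' K) with hR
  have hRi : R.index = P.index := Subgroup.index_comap_of_surjective _ (QuotientGroup.mk'_surjective K)
  have hKR : K ≤ R := by
    intro x hx
    rw [hR, Subgroup.mem_comap, QuotientGroup.mk'_apply, (QuotientGroup.eq_one_iff x).2 hx]
    exact P.one_mem
  have hKRi : K.relIndex R = Nat.card P := by
    have := Subgroup.relIndex_ker (QuotientGroup.mk' K) (K := R)
    rwa [QuotientGroup.ker_mk', hR, Subgroup.map_comap_eq_self_of_surjective
      (QuotientGroup.mk'_surjective K)] at this
  have hRc := card_mul_relIndex hKR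
  rw [hKRi] at hRc
  rcases hKt with hKt | hKt
  · exact ⟨R, hRc ▸ hKt.mul hP1, hRi ▸ hP2⟩
  · have hni : NI K R := hK.mono le_top hKR
    obtain ⟨E, hE, -, -, hEc⟩ := hni.exists_complement (by
      rw [hKRi]; exact (hP1.coprime hKt).symm)
    refine ⟨E, by rw [hEc, hKRi]; exact hP1, ?_⟩
    rw [hKRi] at hEc
    have e := Subgroup.card_mul_index E
    rw [← Subgroup.card_mul_index R, ← hRc, hEc, mul_comm (Nat.card K), mul_assoc] at e
    rw [Nat.eq_of_mul_eq_mul_left Nat.card_pos e, hRi]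
    exact hKt.mul hP2

theorem Sep.exists_hall (h : Sep σ J) : ∃ P, Hall σ J P := by
  obtain ⟨P, h1, h2⟩ := exists_hall_top σ _ J rfl (h.comap (p := J.subtype) (Λ := ⊤) (by
    rw [← MonoidHom.range_eq_map, Subgroup.range_subtype]) (.inl (by simp [Subgroup.ker_subtype, IsPiNumber.one])))
  have hP : P.map J.subtype ≤ J := by rintro _ ⟨x, _, rfl⟩; exact x.2
  refine ⟨P.map J.subtype, hP, by rwa [Subgroup.card_subtype], ?_⟩
  have e := card_mul_relIndex hP
  rw [Subgroup.card_subtype, ← Subgroup.card_mul_index P] at e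
  rwa [Nat.eq_of_mul_eq_mul_left Nat.card_pos e]

end PiSep

namespace PiSep

variable {G : Type} [Group G] [Fintype G] {J H K N M L Z T P : Subgroup G}
  {f g χ ψ θ ρ κ η ν ν' l d D A a ω α α' β β' : G → ℂ} {σ : Set ℕ}

theorem mem_of_pow_coprime {x : G} {m n : ℕ} (h : m.Coprime n) (hm : x ^ m ∈ N) (hn : x ^ n ∈ N) :
    x ∈ N := by
  have h1 := Nat.gcd_eq_gcd_ab m n
  rw [h, Nat.cast_one] at h1
  have h2 : x = (x ^ m) ^ m.gcdA n * (x ^ n) ^ m.gcdB n := by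
    rw [← zpow_natCast, ← zpow_natCast, ← zpow_mul, ← zpow_mul, ← zpow_add, ← h1, zpow_one]
  rw [h2]
  exact N.mul_mem (N.zpow_mem hm _) (N.zpow_mem hn _)

theorem pow_card_of_mem {x : G} (hx : x ∈ P) : x ^ Nat.card P = 1 := by
  have := pow_card_eq_one' (x := (⟨x, hx⟩ : P))
  exact congrArg Subtype.val this

theorem NI.le_of_coprime (h : NI N J) (hP : P ≤ J) (hc : (N.relIndex J).Coprime (Nat.card P)) :
    P ≤ N := fun x hx => mem_of_pow_coprime hc (h.pow_mem (hP hx)) (by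
      rw [pow_card_of_mem hx]; exact N.one_mem)

theorem NI.sup_of_coprime (h : NI N J) (hP : P ≤ J) (hc : (N.relIndex J).Coprime (P.relIndex J)) :
    Sup J N P := by
  have h1 : (N ⊔ P).relIndex J = 1 := Nat.eq_one_of_dvd_coprimes hc
    (Subgroup.relIndex_dvd_of_le_left _ le_sup_left)
    (Subgroup.relIndex_dvd_of_le_left _ le_sup_right)
  exact fun y hy => h.sup_sup hP y (Subgroup.relIndex_eq_one.1 h1 hy)

theorem Sup.card_mul (hs : Sup J N P) (hN : N ≤ J) (hP : P ≤ J) :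
    Nat.card P * Nat.card N = Nat.card (N ⊓ P : Subgroup G) * Nat.card J := by
  have := sm_sup hs hN hP fun _ => 1
  simp only [sm_const, mul_one] at this
  exact_mod_cast this

theorem Sup.relIndex_eq (hs : Sup J N P) (hN : N ≤ J) (hP : P ≤ J) :
    (N ⊓ P).relIndex N = P.relIndex J := by
  have h1 := hs.card_mul hN hP
  rw [← card_mul_relIndex hP, ← card_mul_relIndex (inf_le_left : N ⊓ P ≤ N)] at h1
  have h2 : (Nat.card P * Nat.card (N ⊓ P : Subgroup G)) * (N ⊓ P).relIndex N =
    (Nat.card P * Nat.card (N ⊓ P : Subgroup G)) * P.relIndex J := by linarith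
  exact Nat.eq_of_mul_eq_mul_left (Nat.mul_pos Nat.card_pos Nat.card_pos) h2

theorem Hall.le_of_compl (hP : Hall σ J P) (h : NI N J) (hi : IsPiNumber σᶜ (N.relIndex J)) :
    Hall σ N P := by
  have h1 := h.le_of_coprime hP.1 (hP.2.1.coprime hi).symm
  refine ⟨h1, hP.2.1, hP.2.2.dvd ?_⟩
  rw [← Subgroup.relIndex_mul_relIndex _ _ _ h1 h.1]
  exact dvd_mul_right _ _

theorem Hall.inter (hP : Hall σ J P) (h : NI N J) (hi : IsPiNumber σ (N.relIndex J)) :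
    Sup J N P ∧ Hall σ N (N ⊓ P) := by
  have hs := h.sup_of_coprime hP.1 (hi.coprime hP.2.2)
  refine ⟨hs, inf_le_left, hP.2.1.dvd (Subgroup.card_dvd_of_le inf_le_right), ?_⟩
  rw [hs.relIndex_eq h.1 hP.1]
  exact hP.2.2

/-- Restriction to a supplement of a character induced from a normal subgroup. -/
theorem NI.ind_supplement (h : NI N J) (hs : Sup J N P) (hP : P ≤ J) (ha : Cls N a) :
    ∀ x ∈ P, ind J N a x = ind P (N ⊓ P) a x := by
  intro x hx
  set F : G → ℂ := fun y => if y * x * y⁻¹ ∈ N then a (y * x * y⁻¹) else 0 with hF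
  have hF1 : ∀ n ∈ N, ∀ y, F (n * y) = F y := by
    intro n hn y
    have e : n * y * x * (n * y)⁻¹ = n * (y * x * y⁻¹) * n⁻¹ := by group
    have e2 : n * (y * x * y⁻¹) * n⁻¹ ∈ N ↔ y * x * y⁻¹ ∈ N := by
      rw [N.mul_mem_cancel_right (N.inv_mem hn), N.mul_mem_cancel_left hn]
    simp only [hF, e, e2]
    split_ifs with hy
    · exact ha _ hn _ hy
    · rfl
  have h1 := sm_sup hs h.1 hP fun y => F y⁻¹
  have h2 : (sm P fun k => sm N fun n => F (k * n)⁻¹) = Nat.card N * sm P F := by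
    rw [← sm_inv (J := P) (F := F), ← sm_mul_const]
    refine sm_congr fun k _ => ?_
    rw [sm_congr (F' := fun _ => F k⁻¹) fun n hn => ?_, sm_const]
    rw [mul_inv_rev, hF1 _ (N.inv_mem hn)]
  rw [h2, sm_inv] at h1
  have h3 : sm P F = sm P fun y => if y * x * y⁻¹ ∈ N ⊓ P then a (y * x * y⁻¹) else 0 := by
    refine sm_congr fun y hy => ?_
    have : y * x * y⁻¹ ∈ P := P.mul_mem (P.mul_mem hy hx) (P.inv_mem hy)
    simp only [hF, Subgroup.mem_inf, this, and_true]
  rw [ind, ind, ← h3]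
  have n1 := card_ne_zero' (K := N)
  have n2 := card_ne_zero' (K := (N ⊓ P : Subgroup G))
  change (Nat.card N : ℂ)⁻¹ * sm J F = _
  field_simp
  linear_combination -h1

theorem Hall.ip_eq (hJ : Sep σ J) (hP : Hall σ J P) (hα : Sp σ J α) (hα' : Sp σ J α') :
    ip P α α' = ip J α α' := by
  induction hJ generalizing P α α' with
  | bot => rw [le_bot_iff.1 hP.1]
  | @step N J _ hN hi ih =>
  rcases hi with hi | hi
  · obtain ⟨hs, hH⟩ := hP.inter hN hi
    by_cases h0 : ip P α α' = 0
    · rw [h0]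
      symm
      by_contra hc
      have e1 := hα.1.eqOn hα'.1 hc
      refine (hα.1.ch.mono hP.1).ip_self_ne_zero hα.1.one_ne_zero ?_
      rw [← h0]
      exact ip_congr (fun _ _ => rfl) fun x hx => e1 x (hP.1 hx)
    obtain ⟨χ, hχ, h1, h2⟩ := exists_common (hα.1.ch.mono hP.1) (hα'.1.ch.mono hP.1) h0
    obtain ⟨ω, hω, h3⟩ := hχ.exists_const (inf_le_right : N ⊓ P ≤ P)
    obtain ⟨a, ha, h4, h5⟩ := exists_over (hα.1.cls.mono hN.1) inf_le_left
      (const_trans (hα.1.ch.mono hP.1) hχ h1 inf_le_right hω.ch h3)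
    obtain ⟨a', ha', h4', h5'⟩ := exists_over (hα'.1.cls.mono hN.1) inf_le_left
      (const_trans (hα'.1.ch.mono hP.1) hχ h2 inf_le_right hω.ch h3)
    have sa := hα.const hN ha h4
    have sa' := hα'.const hN ha' h4'
    have ir : ∀ b, Sp σ N b → Irr (N ⊓ P) b := fun b hb =>
      irr_iff.2 ⟨hb.1.ch.mono inf_le_left, by rw [ih hH hb hb, hb.1.ip_self]⟩
    have e1 := (ir a sa).eqOn hω h5
    have e1' := (ir a' sa').eqOn hω h5'
    have e2 : ∀ x ∈ N, a x = a' x := ha.eqOn ha' (by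
      rw [← ih hH sa sa', ip_congr e1 e1', hω.ip_self]; exact one_ne_zero)
    have hA := ha.ch.ind hN.1
    have hind : ∀ g, Cls J g → ip J (ind J N a) g = ip N a g := fun _ hg => ip_ind hN.1 hg a
    have hm : ∀ K : Subgroup G, K ≤ N → ip K (ind J N a) a =
        (Nat.card N : ℂ)⁻¹ * sm J fun y => ip K (cj y a) a := by
      intro K hK
      rw [ip_congr (f' := (Nat.card N : ℂ)⁻¹ • fun x => sm J fun y => cj y a x) (g' := a)
        (fun x hx => by
          rw [hN.ind_apply a x (hK hx), Pi.smul_apply, smul_eq_mul]) (fun _ _ => rfl), ip_smul_left, ip_sm_left]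
    have := norm_orth (β := 1) hP.1 hA .one one_ne_zero (by
      rw [mul_one, hind _ hA.cls, ip_comm (J := N), hm N le_rfl,
        ip_congr (J := P) (f' := ind P (N ⊓ P) a) (g' := ind J N a)
          (hN.ind_supplement hs hP.1 ha.cls) fun _ _ => rfl,
        ip_ind inf_le_right (hA.cls.mono hP.1), ip_comm, hm _ inf_le_left]
      congr 1
      exact sm_congr fun y hy => ih hH (sa.cj hN hy) sa) hα.1 hα'.1
      (by rwa [hind _ hα.1.cls, ip_comm])
      (by rwa [hind _ hα'.1.cls, ip_comm, ip_congr (fun _ _ => rfl) e2])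
    rwa [mul_one, mul_one] at this
  · have hαN := hN.irr_restrict hα.1 hα.2.1 hi
    have hαN' := hN.irr_restrict hα'.1 hα'.2.1 hi
    have sα := hα.const hN hαN (by rw [hαN.ip_self]; exact one_ne_zero)
    have sα' := hα'.const hN hαN' (by rw [hαN'.ip_self]; exact one_ne_zero)
    rw [ih (hP.le_of_compl hN hi) sα sα']
    by_cases h0 : ip N α α' = 0
    · rw [h0]
      symm
      by_contra hc
      have e1 := hα.1.eqOn hα'.1 hc
      have := ip_congr (J := N) (f := α) (f' := α) (g := α) (fun _ _ => rfl) fun x hx => e1 x (hN.1 hx)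
      rw [h0, hαN.ip_self] at this
      exact one_ne_zero this
    · have e1 := hαN.eqOn hαN' h0
      have e4 := hN.ext_unique hα.1 hα'.1 hi hαN e1 hα.2.1 hα.piDet hα'.piDet
      rw [ip_congr (J := N) (f' := α) (g' := α) (fun _ _ => rfl) fun x hx => (e1 x hx).symm,
        ip_congr (J := J) (f' := α) (g' := α) (fun _ _ => rfl) fun x hx => (e4 x hx).symm,
        hα.1.ip_self, hαN.ip_self]

/-- Special characters are determined by their values on `σ`-elements. -/
theorem Sp.eq_of_pi (hJ : Sep σ J) (hα : Sp σ J α) (hα' : Sp σ J α')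
    (h : ∀ x ∈ J, IsPiElt σ x → α x = α' x) : ∀ x ∈ J, α x = α' x := by
  obtain ⟨P, hP⟩ := hJ.exists_hall
  refine hα.1.eqOn hα'.1 ?_
  rw [← hP.ip_eq hJ hα hα', ip_congr (f' := α) (g' := α) (fun _ _ => rfl) fun x hx => ?_,
    hP.ip_eq hJ hα hα, hα.1.ip_self]
  · exact one_ne_zero
  · exact (h x (hP.1 hx) (hP.2.1.dvd (orderOf_dvd_of_pow_eq_one (pow_card_of_mem hx)))).symm

end PiSep

namespace PiSep

variable {G : Type} [Group G] [Fintype G] {J H K N M L Z T P S : Subgroup G}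
  {f g χ ψ θ ρ κ η ν ν' l d D A a ω α α' β β' : G → ℂ} {σ : Set ℕ}

theorem pow_eq_of_commute {y c : G} {e k n : ℕ} (h : Commute y c) (hy : y ^ n = 1)
    (hc : c ^ k = 1) (h1 : e ≡ 1 [MOD n]) (h0 : e ≡ 0 [MOD k]) : (y * c) ^ e = y := by
  rw [h.mul_pow, pow_eq_pow_iff_modEq.2 (h1.of_dvd (orderOf_dvd_of_pow_eq_one hy)),
    pow_eq_pow_iff_modEq.2 (h0.of_dvd (orderOf_dvd_of_pow_eq_one hc)), pow_one, pow_zero, mul_one]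

theorem eq_of_mul_eq_of_commute {y y' c c' : G} {k n : ℕ} (hk : n.Coprime k)
    (h : Commute y c) (h' : Commute y' c') (hy : y ^ n = 1) (hy' : y' ^ n = 1)
    (hc : c ^ k = 1) (hc' : c' ^ k = 1) (e : y * c = y' * c') : y = y' := by
  obtain ⟨m, h1, h0⟩ := Nat.chineseRemainder hk 1 0
  rw [← pow_eq_of_commute h hy hc h1 h0, e, pow_eq_of_commute h' hy' hc' h1 h0]

/-- Two `σ`-elements in the same coset of a normal `σᶜ`-subgroup are conjugate. -/
theorem NI.pi_conj (h : NI M J) (hM : IsPiNumber σᶜ (Nat.card M)) {x y : G} (hx : x ∈ J)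
    (hxσ : IsPiElt σ x) (hyσ : IsPiElt σ y) (hxy : x⁻¹ * y ∈ M) : ∃ m ∈ M, y = m * x * m⁻¹ := by
  set n := orderOf x * orderOf y with hn
  have hco : n.Coprime (Nat.card M) := (hxσ.mul hyσ).coprime hM
  have hxn : x ^ n = 1 := by rw [hn, pow_mul, pow_orderOf_eq_one, one_pow]
  have hyn : y ^ n = 1 := by rw [hn, mul_comm, pow_mul, pow_orderOf_eq_one, one_pow]
  let C : Subgroup G := M ⊓ Subgroup.centralizer {x}
  have hC : ∀ c ∈ C, Commute x c := fun c hc =>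
    Subgroup.mem_centralizer_iff.1 (Subgroup.mem_inf.1 hc).2 x rfl
  have hconj : ∀ m : G, (m * x * m⁻¹) ^ n = 1 := fun m => by rw [conj_pow, hxn]; group
  let F : M × C → G := fun q => q.1 * (x * q.2) * (q.1 : G)⁻¹
  have hF : ∀ q, x⁻¹ * F q ∈ M := by
    rintro ⟨m, c⟩
    have e : x⁻¹ * F (m, c) = (x⁻¹ * m * x) * c * (m : G)⁻¹ := by simp only [F]; group
    rw [e]
    refine M.mul_mem (M.mul_mem ?_ c.2.1) (M.inv_mem m.2)
    have := h.2 x⁻¹ (J.inv_mem hx) m m.2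
    rwa [inv_inv] at this
  have hfib : ∀ a ∈ Finset.univ.image F, (Finset.univ.filter fun q => F q = a).card ≤ Nat.card C := by
    intro a ha
    obtain ⟨q0, -, rfl⟩ := Finset.mem_image.1 ha
    rw [← Finset.card_univ.trans (Nat.card_eq_fintype_card (α := C)).symm]
    have key : ∀ q, F q = F q0 → (q0.1 : G) * x * (q0.1 : G)⁻¹ = q.1 * x * (q.1 : G)⁻¹ := by
      intro q hq
      have hcm : ∀ q : M × C, Commute ((q.1 : G) * x * (q.1 : G)⁻¹) (q.1 * q.2 * (q.1 : G)⁻¹) :=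
        fun q => by
          have := hC q.2 q.2.2
          have e := this.eq
          change _ * _ = _ * _
          calc _ = (q.1 : G) * (x * q.2) * (q.1 : G)⁻¹ := by group
            _ = _ := by rw [e]; group
      have hcp : ∀ q : M × C, ((q.1 : G) * q.2 * (q.1 : G)⁻¹) ^ Nat.card M = 1 := fun q => by
        rw [conj_pow, pow_card_of_mem q.2.2.1]; group
      refine eq_of_mul_eq_of_commute hco (hcm q0) (hcm q) (hconj _) (hconj _) (hcp _) (hcp _) ?_
      have e1 : ∀ q : M × C, (q.1 : G) * x * (q.1 : G)⁻¹ * (q.1 * q.2 * (q.1 : G)⁻¹) = F q :=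
        fun q => by simp only [F]; group
      rw [e1, e1, hq]
    refine Finset.card_le_card_of_injOn (fun q => if h : (q0.1 : G)⁻¹ * q.1 ∈ C then ⟨_, h⟩ else 1)
      (fun _ _ => Finset.mem_univ _) ?_
    intro q hq q' hq' e
    have hq := (Finset.mem_filter.1 hq).2
    have hq' := (Finset.mem_filter.1 hq').2
    have hm : ∀ q, F q = F q0 → (q0.1 : G)⁻¹ * q.1 ∈ C := fun q hq => by
      refine Subgroup.mem_inf.2 ⟨M.mul_mem (M.inv_mem q0.1.2) q.1.2, ?_⟩
      refine Subgroup.mem_centralizer_iff.2 fun z hz => ?_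
      rw [Set.mem_singleton_iff.1 hz]
      have := key q hq
      calc _ = (q0.1 : G)⁻¹ * (q0.1 * x * (q0.1 : G)⁻¹) * q.1 := by group
        _ = _ := by rw [this]; group
    simp only [dif_pos (hm q hq), dif_pos (hm q' hq'), Subtype.mk.injEq] at e
    have e1 : q.1 = q'.1 := Subtype.ext (mul_left_cancel e)
    have e2 := hq.trans hq'.symm
    simp only [F, e1] at e2
    exact Prod.ext e1 (Subtype.ext (mul_left_cancel (mul_left_cancel (mul_right_cancel e2))))
  have hle := Finset.card_le_mul_card_image _ _ hfib
  rw [Finset.card_univ, Fintype.card_prod, ← Nat.card_eq_fintype_card, ← Nat.card_eq_fintype_card,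
    mul_comm] at hle
  have hle' := Nat.le_of_mul_le_mul_left hle Nat.card_pos
  let X : Finset G := Finset.univ.filter fun z => x⁻¹ * z ∈ M
  have hX : X.card = Nat.card M := by
    rw [Nat.card_eq_fintype_card, ← Finset.card_univ]
    refine Finset.card_bij' (fun z hz => ⟨x⁻¹ * z, (Finset.mem_filter.1 hz).2⟩) (fun m _ => x * m)
      (fun _ _ => Finset.mem_univ _) (fun m _ => ?_) (fun _ _ => ?_) (fun _ _ => ?_)
    · simp [X]
    · simp
    · simp
  have hsub : Finset.univ.image F ⊆ X := by
    intro a ha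
    obtain ⟨q, -, rfl⟩ := Finset.mem_image.1 ha
    simp [X, hF q]
  have heq := Finset.eq_of_subset_of_card_le hsub (hX ▸ hle')
  have hyX : y ∈ Finset.univ.image F := by rw [heq]; simp [X, hxy]
  obtain ⟨⟨m, c⟩, -, e⟩ := Finset.mem_image.1 hyX
  refine ⟨m, m.2, ?_⟩
  have hcx := hC c c.2
  have h1 : (x * (c : G)) ^ n = 1 := by
    have e2 : x * (c : G) = (m : G)⁻¹ * y * ((m : G)⁻¹)⁻¹ := by rw [← e]; simp only [F]; group
    rw [e2, conj_pow, hyn]; group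
  have h2 := eq_of_mul_eq_of_commute hco hcx (Commute.one_right (x * (c : G))) hxn h1
    (pow_card_of_mem c.2.1) (one_pow _) (by rw [mul_one])
  rw [← e]
  simp only [F, ← h2]

/-- Class functions on `σ`-elements that restrict to characters of all `σ`-subgroups. -/
def Loc (σ : Set ℕ) (J : Subgroup G) (f : G → ℂ) : Prop :=
  (∀ g ∈ J, ∀ x ∈ J, IsPiElt σ x → f (g * x * g⁻¹) = f x) ∧
    ∀ S ≤ J, IsPiNumber σ (Nat.card S) → Ch S f

theorem Loc.mono (h : Loc σ J f) (hH : H ≤ J) : Loc σ H f :=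
  ⟨fun g hg x hx => h.1 g (hH hg) x (hH hx), fun S hS => h.2 S (hS.trans hH)⟩

theorem Ch.loc (h : Ch J f) : Loc σ J f :=
  ⟨fun g hg x hx _ => h.cls g hg x hx, fun _ hS _ => h.mono hS⟩

theorem isPiElt_of_mem {x : G} (hS : IsPiNumber σ (Nat.card S)) (hx : x ∈ S) : IsPiElt σ x :=
  hS.dvd (orderOf_dvd_of_pow_eq_one (pow_card_of_mem hx))

theorem isPiElt_of_pow {x : G} {n : ℕ} (hn : IsPiNumber σ n) (hx : x ^ n = 1) : IsPiElt σ x :=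
  hn.dvd (orderOf_dvd_of_pow_eq_one hx)

theorem isPiNumber_zpowers {x : G} (hx : IsPiElt σ x) : IsPiNumber σ (Nat.card (Subgroup.zpowers x)) := by
  rwa [Nat.card_zpowers]

theorem zpowers_le {x : G} (hx : x ∈ J) : Subgroup.zpowers x ≤ J := (Subgroup.zpowers_le).2 hx

theorem isPiElt_conj {g x : G} (hx : IsPiElt σ x) : IsPiElt σ (g * x * g⁻¹) :=
  isPiElt_of_pow hx (by rw [conj_pow, pow_orderOf_eq_one]; group)

section
variable {Γ : Type} [Group Γ] [Fintype Γ] {p : Γ →* G} {Λ : Subgroup Γ}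

theorem isPiElt_map {x : Γ} (hx : IsPiElt σ x) : IsPiElt σ (p x) :=
  isPiElt_of_pow hx (by rw [← map_pow, pow_orderOf_eq_one, map_one])

theorem ker_inf_ni : NI (p.ker ⊓ Λ) Λ := by
  have := (NI.bot (J := Λ.map p)).comap_inf (p := p) le_rfl
  exact this

theorem card_map_mul_ker : Nat.card (Λ.map p) * Nat.card (p.ker ⊓ Λ : Subgroup Γ) = Nat.card Λ := by
  rw [← card_mul_relIndex (inf_le_right : p.ker ⊓ Λ ≤ Λ), Subgroup.inf_relIndex_right,
    Subgroup.relIndex_ker, mul_comm]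

/-- Lifting `σ`-subgroups through a map with `σᶜ`-kernel. -/
theorem exists_lift_sub (hk : IsPiNumber σᶜ (Nat.card (p.ker ⊓ Λ : Subgroup Γ)))
    (hS : S ≤ Λ.map p) (hSσ : IsPiNumber σ (Nat.card S)) :
    ∃ E ≤ Λ, E.map p = S ∧ IsPiNumber σ (Nat.card E) := by
  set R := S.comap p ⊓ Λ with hR
  have hRm : R.map p = S := map_comap_inf hS
  have e : p.ker ⊓ R = p.ker ⊓ Λ := by
    refine le_antisymm (inf_le_inf_left _ inf_le_right) fun x hx => Subgroup.mem_inf.2 ⟨hx.1, ?_⟩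
    refine Subgroup.mem_inf.2 ⟨?_, hx.2⟩
    rw [Subgroup.mem_comap, show p x = 1 from hx.1]
    exact S.one_mem
  have hi : (p.ker ⊓ R).relIndex R = Nat.card S := by
    rw [Subgroup.inf_relIndex_right, Subgroup.relIndex_ker, hRm]
  obtain ⟨E, h1, h2, h3, h4⟩ := (ker_inf_ni (p := p) (Λ := R)).exists_complement (by
    rw [hi, e]; exact (hSσ.coprime hk).symm)
  rw [hi] at h4
  refine ⟨E, h1.trans inf_le_right, ?_, by rw [h4]; exact hSσ⟩
  refine Subgroup.eq_of_le_of_card_ge ((Subgroup.map_mono h1).trans hRm.le) ?_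
  rw [card_map_of_injOn p E fun x hx hx1 => ?_, h4]
  have : x ∈ (p.ker ⊓ R) ⊓ E := Subgroup.mem_inf.2 ⟨Subgroup.mem_inf.2 ⟨hx1, h1 hx⟩, hx⟩
  rwa [h2] at this

theorem exists_lift_elt (hk : IsPiNumber σᶜ (Nat.card (p.ker ⊓ Λ : Subgroup Γ))) {y : G}
    (hy : y ∈ Λ.map p) (hyσ : IsPiElt σ y) : ∃ x ∈ Λ, IsPiElt σ x ∧ p x = y := by
  obtain ⟨E, h1, h2, h3⟩ := exists_lift_sub hk (zpowers_le hy) (isPiNumber_zpowers hyσ)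
  have := Subgroup.mem_zpowers y
  rw [← h2] at this
  obtain ⟨x, hx, e⟩ := this
  exact ⟨x, h1 hx, isPiElt_of_mem h3 hx, e⟩

/-- Passing to a quotient by a normal `σᶜ`-subgroup. -/
theorem Loc.exists_quotient {F : Γ → ℂ} (hF : Loc σ Λ F)
    (hk : IsPiNumber σᶜ (Nat.card (p.ker ⊓ Λ : Subgroup Γ))) :
    ∃ f, Loc σ (Λ.map p) f ∧ ∀ x ∈ Λ, IsPiElt σ x → f (p x) = F x := by
  have hwd : ∀ x ∈ Λ, ∀ y ∈ Λ, IsPiElt σ x → IsPiElt σ y → p x = p y → F y = F x := by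
    intro x hx y hy hxσ hyσ e
    obtain ⟨m, hm, rfl⟩ := (ker_inf_ni (p := p) (Λ := Λ)).pi_conj hk hx hxσ hyσ
      (Subgroup.mem_inf.2 ⟨by rw [MonoidHom.mem_ker]; simp [e], Λ.mul_mem (Λ.inv_mem hx) hy⟩)
    exact hF.1 m (Subgroup.mem_inf.1 hm).2 x hx hxσ
  let f : G → ℂ := fun y => if h : ∃ x, x ∈ Λ ∧ IsPiElt σ x ∧ p x = y then F h.choose else 0
  have hf : ∀ x ∈ Λ, IsPiElt σ x → f (p x) = F x := by
    intro x hx hxσ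
    have h : ∃ z, z ∈ Λ ∧ IsPiElt σ z ∧ p z = p x := ⟨x, hx, hxσ, rfl⟩
    obtain ⟨h1, h2, h3⟩ := h.choose_spec
    simp only [f, dif_pos h]
    exact hwd x hx _ h1 hxσ h2 h3.symm
  refine ⟨f, ⟨?_, fun S hS hSσ => ?_⟩, hf⟩
  · rintro _ ⟨g, hg, rfl⟩ y hy hyσ
    obtain ⟨x, hx, hxσ, rfl⟩ := exists_lift_elt hk hy hyσ
    rw [← map_inv, ← map_mul, ← map_mul, hf x hx hxσ,
      hf _ (Λ.mul_mem (Λ.mul_mem hg hx) (Λ.inv_mem hg)) (isPiElt_conj hxσ), hF.1 g hg x hx hxσ]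
  · obtain ⟨E, h1, rfl, h3⟩ := exists_lift_sub hk hS hSσ
    exact ch_map.2 ((hF.2 E h1 h3).congr fun x hx => (hf x (h1 hx) (isPiElt_of_mem h3 hx)).symm)

/-- Passing to a quotient by a normal `σ`-subgroup on whose cosets `F` is constant. -/
theorem Loc.descend {F : Γ → ℂ} (hF : Loc σ Λ F)
    (hk : IsPiNumber σ (Nat.card (p.ker ⊓ Λ : Subgroup Γ)))
    (hc : ∀ x ∈ Λ, ∀ y ∈ Λ, p x = p y → F x = F y) :
    ∃ f, Loc σ (Λ.map p) f ∧ ∀ x ∈ Λ, f (p x) = F x := by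
  obtain ⟨f, hf⟩ := exists_descend F hc
  have hlift : ∀ x ∈ Λ, IsPiElt σ (p x) → IsPiElt σ x := fun x hx h => by
    refine isPiElt_of_pow (n := orderOf (p x) * Nat.card (p.ker ⊓ Λ : Subgroup Γ)) (h.mul hk) ?_
    rw [pow_mul]
    refine pow_card_of_mem (Subgroup.mem_inf.2 ⟨?_, Λ.pow_mem hx _⟩)
    rw [MonoidHom.mem_ker, map_pow, pow_orderOf_eq_one]
  refine ⟨f, ⟨?_, fun S hS hSσ => ?_⟩, hf⟩
  · rintro _ ⟨g, hg, rfl⟩ _ ⟨x, hx, rfl⟩ hxσ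
    rw [← map_inv, ← map_mul, ← map_mul, hf x hx,
      hf _ (Λ.mul_mem (Λ.mul_mem hg hx) (Λ.inv_mem hg)), hF.1 g hg x hx (hlift x hx hxσ)]
  · have h1 : (S.comap p ⊓ Λ).map p = S := map_comap_inf hS
    rw [← h1]
    refine ch_map.2 ((hF.2 _ inf_le_right ?_).congr fun x hx => (hf x hx.2).symm)
    rw [← card_map_mul_ker (p := p), h1]
    exact hSσ.mul (hk.dvd (Subgroup.card_dvd_of_le (inf_le_inf_left _ inf_le_right)))
end

end PiSep

namespace PiSep

variable {G : Type} [Group G] [Fintype G] {J H K N M L Z T P S : Subgroup G}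
  {f g χ ψ θ ρ κ η ν ν' l d D A a c ω α α' β β' : G → ℂ} {σ : Set ℕ}

/-- Convolution of `f` with a function on `L`. -/
def pr (L : Subgroup G) (c f : G → ℂ) : G → ℂ := fun g =>
  (Nat.card L : ℂ)⁻¹ * sm L fun y => c y⁻¹ * f (g * y)

theorem pr_scalar (h : NI L S) (hκ : Irr S κ) (hc : ∀ g ∈ S, ∀ x ∈ L, c (g * x * g⁻¹) = c x)
    {g : G} (hg : g ∈ S) : κ 1 * pr L c κ g = κ g * ip L κ c := by
  have h1 : ∀ m ∈ S, (sm L fun y => c y⁻¹ * κ (g * y)) =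
      sm L fun y => c y⁻¹ * κ (g * (m * y * m⁻¹)) := fun m hm => by
    rw [← h.sm_conj _ hm]
    refine sm_congr fun y hy => ?_
    rw [← hc m hm y⁻¹ (L.inv_mem hy)]
    simp only [mul_inv_rev, inv_inv, mul_assoc]
  have h2 : (Nat.card S : ℂ) * (κ 1 * sm L fun y => c y⁻¹ * κ (g * y)) =
      Nat.card S * (κ g * sm L fun y => κ y * c y⁻¹) := by
    rw [← sm_const, sm_congr (F := fun _ => _) (F' := fun m => sm L fun y =>
      c y⁻¹ * (κ 1 * κ (g * (m * y * m⁻¹)))) (J := S), sm_comm,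
      sm_congr (F' := fun y => Nat.card S * κ g * (κ y * c y⁻¹)) (J := L), sm_mul_const, mul_assoc]
    · intro y hy
      rw [sm_mul_const, sm_mul_const, schur_average hκ.ch le_rfl hκ hg (h.1 hy)]
      ring
    · intro m hm
      rw [h1 m hm, ← sm_mul_const]
      exact sm_congr fun y _ => by ring
  have h3 := mul_left_cancel₀ card_ne_zero' h2
  rw [pr, ip_def]
  linear_combination (Nat.card L : ℂ)⁻¹ * h3

theorem pr_sum {ι : Type*} (s : Finset ι) (a : ι → ℂ) (F : ι → G → ℂ) (c : G → ℂ) (x : G) :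
    pr L c (fun x => ∑ i ∈ s, a i * F i x) x = ∑ i ∈ s, a i * pr L c (F i) x := by
  simp only [pr, sm, Finset.mul_sum]
  rw [Finset.sum_comm]
  exact Finset.sum_congr rfl fun i _ => Finset.sum_congr rfl fun y _ => by ring

/-- The character of `L` belonging to the `J`-orbit of `θ`. -/
def orb (J L : Subgroup G) (θ : G → ℂ) : G → ℂ := fun y =>
  (Nat.card (stab J L θ) : ℂ)⁻¹ * (θ 1 * sm J fun x => cj x θ y)

/-- `κ` has a constituent on `L` that is `J`-conjugate to `θ`. -/
def Over (J L : Subgroup G) (θ κ : G → ℂ) : Prop := ∃ x ∈ J, ip L κ (cj x θ) ≠ 0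

theorem orb_conj (θ : G → ℂ) {g : G} (hg : g ∈ J) (x : G) :
    orb J L θ (g * x * g⁻¹) = orb J L θ x := by
  simp only [orb]
  rw [← sm_mul_right (fun y => cj y θ x) hg]
  simp only [cj, mul_inv_rev, mul_assoc]

theorem NI.ip_orb (h : NI L J) (hθ : Irr L θ) (hS : S ≤ J) (hLS : L ≤ S) (hκ : Irr S κ) :
    ip L κ (orb J L θ) = if Over J L θ κ then κ 1 else 0 := by
  have h1 : ip L κ (orb J L θ) =
      (Nat.card (stab J L θ) : ℂ)⁻¹ * (θ 1 * sm J fun x => ip L κ (cj x θ)) := by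
    have e : orb J L θ = ((Nat.card (stab J L θ) : ℂ)⁻¹ * θ 1) • fun y => sm J fun x => cj x θ y := by
      ext y; simp [orb, mul_assoc]
    rw [e, ip_smul_right, ip_comm, ip_sm_left, mul_assoc]
    simp only [ip_comm κ]
  split_ifs with ho
  · obtain ⟨x0, hx0, h0⟩ := ho
    have hLSn := h.mono hS hLS
    have hθ0 := h.irr_cj hx0 hθ
    have h2 := hLSn.clifford_formula hκ hθ0 h0
    have h3 := hLSn.clifford_degree hκ hθ0 h0
    set t := (Nat.card (stab S L (cj x0 θ)) : ℂ) with ht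
    set e := ip L κ (cj x0 θ) with he
    have ht0 : t ≠ 0 := card_ne_zero'
    have h4 : ∀ x, ip L κ (cj x θ) = t⁻¹ * e * sm S fun y => ip L (cj y (cj x0 θ)) (cj x θ) := by
      intro x
      rw [ip_congr (f' := (t⁻¹ * e) • fun z => sm S fun y => cj y (cj x0 θ) z) (g' := cj x θ)
        (fun z hz => ?_) (fun _ _ => rfl), ip_smul_left, ip_sm_left]
      simp only [Pi.smul_apply, smul_eq_mul]
      rw [mul_assoc, ← h2 z hz]
      field_simp
    have h5 : ∀ y ∈ S, (sm J fun x => ip L (cj y (cj x0 θ)) (cj x θ)) =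
        Nat.card (stab J L θ) := by
      intro y hy
      have hy' : x0 * y ∈ J := J.mul_mem hx0 (hS hy)
      rw [← h.sm_ip_cj hθ, ← sm_mul_right _ hy']
      refine sm_congr fun x _ => ?_
      rw [cj_cj, ip_comm, ← cj_cj, h.ip_cj hy']
    have h6 : (sm J fun x => ip L κ (cj x θ)) = t⁻¹ * e * (Nat.card S * Nat.card (stab J L θ)) := by
      rw [sm_congr (fun x _ => h4 x), sm_mul_const, sm_comm, sm_congr h5, sm_const]
    rw [h1, h6, cj_apply_one] at *
    have hT : (Nat.card (stab J L θ) : ℂ) ≠ 0 := card_ne_zero'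
    field_simp
    linear_combination -h3
  · rw [h1, sm_congr (F' := fun _ => 0), sm_const, mul_zero, mul_zero, mul_zero]
    intro x hx
    by_contra h0
    exact ho ⟨x, hx, h0⟩

theorem NI.pr_orb (h : NI L J) (hθ : Irr L θ) (hS : S ≤ J) (hLS : L ≤ S) (hκ : Irr S κ) :
    ∀ g ∈ S, pr L (orb J L θ) κ g = if Over J L θ κ then κ g else 0 := by
  intro g hg
  have h1 := pr_scalar (h.mono hS hLS) hκ (c := orb J L θ)
    (fun m hm x _ => orb_conj θ (hS hm) x) hg
  rw [h.ip_orb hθ hS hLS hκ] at h1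
  refine mul_left_cancel₀ hκ.one_ne_zero (h1.trans ?_)
  split_ifs <;> ring

theorem NI.pr_orb_expand (h : NI L J) (hθ : Irr L θ) (hS : S ≤ J) (hLS : L ≤ S) (hf : Cls S f) :
    ∀ g ∈ S, pr L (orb J L θ) f g =
      ∑ κ ∈ irrs S, (if Over J L θ κ then ip S f κ else 0) * κ g := by
  intro g hg
  have e : pr L (orb J L θ) f g =
      pr L (orb J L θ) (fun x => ∑ κ ∈ irrs S, ip S f κ * κ x) g := by
    simp only [pr]
    congr 1
    exact sm_congr fun y hy => by rw [hf.expand _ (S.mul_mem hg (hLS hy))]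
  rw [e, pr_sum]
  refine Finset.sum_congr rfl fun κ hκ => ?_
  rw [h.pr_orb hθ hS hLS (mem_irrs.1 hκ).1 g hg]
  split_ifs <;> ring

theorem ip_expand_coeff (a : (G → ℂ) → ℂ) (hf : ∀ g ∈ S, f g = ∑ κ ∈ irrs S, a κ * κ g)
    (hκ : κ ∈ irrs S) : ip S f κ = a κ := by
  rw [ip_congr (f' := ∑ κ ∈ irrs S, a κ • κ) (g' := κ) (fun g hg => by
    rw [hf g hg, Finset.sum_apply]; rfl) (fun _ _ => rfl), ip_sum_left]
  rw [Finset.sum_eq_single κ]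
  · rw [ip_smul_left, ip_irrs hκ hκ, if_pos rfl, mul_one]
  · intro b hb hne
    rw [ip_smul_left, ip_irrs hb hκ, if_neg hne, mul_zero]
  · exact fun h => absurd hκ h

theorem NI.ip_pr_orb (h : NI L J) (hθ : Irr L θ) (hS : S ≤ J) (hLS : L ≤ S) (hf : Cls S f)
    (hκ : Irr S κ) : ip S (pr L (orb J L θ) f) κ = if Over J L θ κ then ip S f κ else 0 := by
  have e : ∀ x ∈ S, κ x = trunc S κ x := fun x hx => by simp [trunc, hx]
  have hO : Over J L θ κ ↔ Over J L θ (trunc S κ) := by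
    simp only [Over]
    refine exists_congr fun x => and_congr_right fun _ => ?_
    rw [ip_congr (f' := trunc S κ) (g' := cj x θ) (fun y hy => e y (hLS hy)) fun _ _ => rfl]
  rw [ip_congr (f' := pr L (orb J L θ) f) (g' := trunc S κ) (fun _ _ => rfl) e,
    ip_congr (f := f) (f' := f) (g' := trunc S κ) (fun _ _ => rfl) e, hO]
  exact ip_expand_coeff (fun κ => if Over J L θ κ then ip S f κ else 0)
    (h.pr_orb_expand hθ hS hLS hf) hκ.trunc_mem

theorem NI.card_sup (h : NI L J) (hLσ : IsPiNumber σ (Nat.card L)) (hS : S ≤ J)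
    (hSσ : IsPiNumber σ (Nat.card S)) : IsPiNumber σ (Nat.card (L ⊔ S : Subgroup G)) := by
  have h1 := (h.sup_sup hS).card_mul le_sup_left le_sup_right
  exact (hSσ.mul hLσ).dvd ⟨_, h1.trans (mul_comm _ _)⟩

theorem NI.mul_isPiElt (h : NI L J) (hLσ : IsPiNumber σ (Nat.card L)) {x y : G} (hx : x ∈ J)
    (hxσ : IsPiElt σ x) (hy : y ∈ L) : IsPiElt σ (x * y) := by
  refine isPiElt_of_mem (h.card_sup hLσ (zpowers_le hx) (isPiNumber_zpowers hxσ)) ?_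
  exact mul_mem (le_sup_right (a := L) (Subgroup.mem_zpowers x)) (le_sup_left (b := Subgroup.zpowers x) hy)

theorem NI.pr_loc_conj (h : NI L J) (hLσ : IsPiNumber σ (Nat.card L)) (hf : Loc σ J f)
    (hc : ∀ g ∈ J, ∀ x ∈ L, c (g * x * g⁻¹) = c x) :
    ∀ g ∈ J, ∀ x ∈ J, IsPiElt σ x → pr L c f (g * x * g⁻¹) = pr L c f x := by
  intro g hg x hx hxσ
  simp only [pr]
  rw [← h.sm_conj _ hg]
  congr 1
  refine sm_congr fun y hy => ?_
  rw [← hc g hg y⁻¹ (L.inv_mem hy), ← hf.1 g hg (x * y) (J.mul_mem hx (h.1 hy))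
    (h.mul_isPiElt hLσ hx hxσ hy)]
  simp only [mul_inv_rev, inv_inv, mul_assoc, inv_mul_cancel_left]

theorem NI.pr_loc (h : NI L J) (hLσ : IsPiNumber σ (Nat.card L)) (hθ : Irr L θ)
    (hf : Loc σ J f) : Loc σ J (pr L (orb J L θ) f) ∧ Loc σ J (f - pr L (orb J L θ) f) := by
  have h1 := h.pr_loc_conj hLσ hf (c := orb J L θ) fun g hg x _ => orb_conj θ hg x
  have h2 : ∀ g ∈ J, ∀ x ∈ J, IsPiElt σ x →
      (f - pr L (orb J L θ) f) (g * x * g⁻¹) = (f - pr L (orb J L θ) f) x := fun g hg x hx hxσ => by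
    simp only [Pi.sub_apply]
    rw [hf.1 g hg x hx hxσ, h1 g hg x hx hxσ]
  have key : ∀ S ≤ J, IsPiNumber σ (Nat.card S) →
      Ch (L ⊔ S) (pr L (orb J L θ) f) ∧ Ch (L ⊔ S) (f - pr L (orb J L θ) f) := by
    intro S hS hSσ
    have hc := h.card_sup hLσ hS hSσ
    have hle := h.sup_le hS
    have hR := hf.2 _ hle hc
    have hi : ∀ κ, Irr (L ⊔ S) κ → _ := fun κ hκ =>
      h.ip_pr_orb hθ hle le_sup_left hR.cls hκ
    constructor
    · refine ch_of_nat (fun g hg x hx => h1 g (hle hg) x (hle hx) (isPiElt_of_mem hc hx))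
        fun κ hκ => ?_
      rw [hi κ hκ]
      split_ifs
      · exact hR.ip_nat hκ.ch
      · exact ⟨0, by simp⟩
    · refine ch_of_nat (fun g hg x hx => h2 g (hle hg) x (hle hx) (isPiElt_of_mem hc hx))
        fun κ hκ => ?_
      rw [ip_sub_left, hi κ hκ]
      split_ifs
      · exact ⟨0, by simp⟩
      · simpa using hR.ip_nat hκ.ch
  exact ⟨⟨h1, fun S hS hSσ => (key S hS hSσ).1.mono le_sup_right⟩,
    ⟨h2, fun S hS hSσ => (key S hS hSσ).2.mono le_sup_right⟩⟩

theorem NI.pr_vanish (h : NI L J) (hLσ : IsPiNumber σ (Nat.card L)) (hθ : Irr L θ)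
    (hf : ∀ g ∈ J, ∀ x ∈ J, IsPiElt σ x → f (g * x * g⁻¹) = f x) {g : G} (hg : g ∈ J)
    (hgσ : IsPiElt σ g) (hgs : g ∉ stab J L θ) : (sm L fun y => θ y⁻¹ * f (g * y)) = 0 := by
  have hθ1 := hθ.one_ne_zero
  have h1 : ∀ y ∈ L, (Nat.card L : ℂ) * θ y⁻¹ = θ 1 * sm L fun b => θ (y⁻¹ * b) * θ b⁻¹ :=
    fun y hy => (hθ.convolution (L.inv_mem hy)).symm
  have h2 : (Nat.card L : ℂ) * (sm L fun y => θ y⁻¹ * f (g * y)) = θ 1 * sm L fun b =>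
      sm L fun w => f (g * w) * (θ b⁻¹ * cj g θ (w⁻¹ * b)) := by
    rw [← sm_mul_const, sm_congr (F' := fun y => θ 1 * sm L fun b =>
      θ (y⁻¹ * b) * θ b⁻¹ * f (g * y)) (J := L), sm_mul_const, sm_comm]
    · congr 1
      refine sm_congr fun b hb => ?_
      rw [← sm_mul_left _ hb, ← h.sm_conj _ hg, ← sm_mul_right _ (L.inv_mem hb)]
      refine sm_congr fun w hw => ?_
      have e1 : f (g * (b * (g * (w * b⁻¹) * g⁻¹))) = f (g * w) := by
        have hz : g * (w * b⁻¹) * g⁻¹ ∈ L := h.2 g hg _ (L.mul_mem hw (L.inv_mem hb))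
        have hgw : g * w ∈ J := J.mul_mem hg (h.1 hw)
        have hgs' : IsPiElt σ (g * w) := h.mul_isPiElt hLσ hg hgσ hw
        have := hf (g * (w * b⁻¹) * g⁻¹)⁻¹ (J.inv_mem (h.1 hz)) _ hgw hgs'
        rw [← this]
        congr 1
        group
      rw [e1]
      simp only [cj]
      have e2 : (b * (g * (w * b⁻¹) * g⁻¹))⁻¹ * b = g * (b * w⁻¹) * g⁻¹ := by group
      have e3 : cj g θ (b * w⁻¹) = cj g θ (w⁻¹ * b) := by
        have := (h.irr_cj hg hθ).cls w⁻¹ (L.inv_mem hw) (b * w⁻¹) (L.mul_mem hb (L.inv_mem hw))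
        rw [← this]; congr 1; group
      simp only [cj] at e3
      rw [e2, e3]
      ring
    · intro y hy
      rw [← mul_assoc, h1 y hy, mul_assoc, ← sm_const_mul]
  have h3 : ∀ w ∈ L, (sm L fun b => θ b⁻¹ * cj g θ (w⁻¹ * b)) = 0 := by
    intro w hw
    have h4 := pr_scalar NI.refl (h.irr_cj hg hθ) (fun x hx y hy => hθ.cls x hx y hy) (L.inv_mem hw)
    rw [h.ip_cj_self hθ hg, if_neg hgs, mul_zero, cj_apply_one, pr] at h4
    simpa [hθ1, card_ne_zero'] using h4
  have h5 : (Nat.card L : ℂ) * (sm L fun y => θ y⁻¹ * f (g * y)) = 0 := by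
    rw [h2, sm_comm, sm_congr (F' := fun _ => 0), sm_const, mul_zero, mul_zero]
    intro w hw
    rw [sm_mul_const, h3 w hw, mul_zero]
  exact (mul_eq_zero.1 h5).resolve_left card_ne_zero'

theorem NI.stab_stab (h : NI L J) (hθ : Cls L θ) :
    stab (stab J L θ) L θ = stab J L θ :=
  le_antisymm stab_le fun y hy => (h.stab_ni hθ).mem_stab.2 ⟨hy, h.stab_inv y hy⟩

theorem NI.orb_stab (h : NI L J) (hθ : Irr L θ) : ∀ y ∈ L, orb (stab J L θ) L θ y = θ 1 * θ y := by
  intro y hy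
  rw [orb, h.stab_stab hθ.cls, sm_congr (F := fun x => cj x θ y) (F' := fun _ => θ y)
    (fun x hx => h.stab_inv x hx y hy),
    sm_const]
  have : (Nat.card (stab J L θ) : ℂ) ≠ 0 := card_ne_zero'
  field_simp

theorem NI.ind_pr (h : NI L J) (hLσ : IsPiNumber σ (Nat.card L)) (hθ : Irr L θ)
    (hf : Loc σ J f) (hx : ∀ y ∈ stab J L θ, IsPiElt σ y → χ y = pr L (orb (stab J L θ) L θ) f y)
    {g : G} (hg : g ∈ J) (hgσ : IsPiElt σ g) :
    ind J (stab J L θ) χ g = pr L (orb J L θ) f g := by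
  set T := stab J L θ with hT
  have h0 : ∀ x, pr L (orb T L θ) f x =
      (Nat.card L : ℂ)⁻¹ * (θ 1 * sm L fun z => θ z⁻¹ * f (x * z)) := fun x => by
    have e : (sm L fun z => orb T L θ z⁻¹ * f (x * z)) = sm L fun z => θ 1 * (θ z⁻¹ * f (x * z)) :=
      sm_congr fun z hz => by rw [h.orb_stab hθ _ (L.inv_mem hz)]; ring
    rw [pr, e, sm_mul_const]
  have h1 : ∀ y ∈ J, (if y * g * y⁻¹ ∈ T then χ (y * g * y⁻¹) else 0) =
      (Nat.card L : ℂ)⁻¹ * (θ 1 * sm L fun z => cj y θ z⁻¹ * f (g * z)) := by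
    intro y hy
    have hyg : y * g * y⁻¹ ∈ J := NI.refl.2 y hy g hg
    have hygσ : IsPiElt σ (y * g * y⁻¹) := isPiElt_conj hgσ
    have e : (sm L fun z => cj y θ z⁻¹ * f (g * z)) =
        sm L fun z => θ z⁻¹ * f (y * g * y⁻¹ * z) := by
      rw [← h.sm_conj (fun z => θ z⁻¹ * f (y * g * y⁻¹ * z)) hy]
      refine sm_congr fun z hz => ?_
      rw [← hf.1 y hy (g * z) (J.mul_mem hg (h.1 hz)) (h.mul_isPiElt hLσ hg hgσ hz)]
      simp only [cj, mul_inv_rev, inv_inv, mul_assoc, inv_mul_cancel_left]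
    rw [e]
    split_ifs with hm
    · rw [hx _ hm hygσ, h0]
    · rw [h.pr_vanish hLσ hθ hf.1 hyg hygσ hm, mul_zero, mul_zero]
  rw [ind, sm_congr h1, sm_mul_const, sm_mul_const, sm_comm, pr]
  rw [sm_congr (F := fun y => orb J L θ y⁻¹ * f (g * y)) (F' := fun y =>
    (Nat.card T : ℂ)⁻¹ * θ 1 * ((sm J fun x => cj x θ y⁻¹) * f (g * y))) (fun y _ => by
      rw [orb]; ring), sm_mul_const]
  simp only [sm_const_mul]
  ring

end PiSep

namespace PiSep

variable {G : Type} [Group G] [Fintype G] {J H K N M L Z T P S R : Subgroup G}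
  {f g χ ψ θ ρ κ η ν ν' l d D A a c ω α α' β β' : G → ℂ} {σ : Set ℕ}

/-- Gallagher's theorem for characters lying over a single invariant irreducible character. -/
theorem Ch.gallagher (hη : Ch R η) (hN : NI L R) (h1 : Irr L η) (hf : Ch R f) {m : ℂ}
    (hm : ∀ x ∈ L, f x = m * η x) : ∃ ν, Ch R ν ∧ TrivOn R L ν ∧ ∀ x ∈ R, f x = η x * ν x := by
  have h2 : ∀ κ ∈ irrs R, ip R f κ ≠ 0 →
      ∃ ν, Irr R ν ∧ TrivOn R L ν ∧ ∀ x ∈ R, κ x = η x * ν x := by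
    intro κ hκ hc
    have hκ' := (mem_irrs.1 hκ).1
    refine PiSep.gallagher hη hN h1 hκ' ?_
    obtain ⟨ω, hω, hcω⟩ := hκ'.exists_const hN.1
    have h3 := const_trans hf hκ' hc hN.1 hω.ch hcω
    rw [ip_congr (f' := m • η) (g' := ω) hm fun _ _ => rfl, ip_smul_left] at h3
    have h4 := h1.eqOn hω (right_ne_zero_of_mul h3)
    rwa [ip_congr (f := κ) (f' := κ) (g' := ω) (fun _ _ => rfl) h4]
  choose! V hV using h2
  have hchV : ∀ κ ∈ irrs R, Ch R fun x => ip R f κ * V κ x := by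
    intro κ hκ
    obtain ⟨n, hn⟩ := hf.ip_nat (mem_irrs.1 hκ).1.ch
    by_cases hc : ip R f κ = 0
    · simp only [hc, zero_mul]; exact Ch.zero
    · rw [hn]
      refine ch_of_nat (fun g hg x hx => ?_) fun θ hθ => ?_
      · exact congrArg _ ((hV κ hκ hc).1.cls g hg x hx)
      · obtain ⟨k, hk⟩ := (hV κ hκ hc).1.ch.ip_nat hθ.ch
        refine ⟨n * k, ?_⟩
        have := ip_smul_left (J := R) (f := V κ) (g := θ) n
        rw [hk] at this
        push_cast
        exact this
  refine ⟨fun x => ∑ κ ∈ irrs R, ip R f κ * V κ x, ?_, ?_, ?_⟩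
  · refine ch_of_nat (fun g hg x hx => ?_) fun θ hθ => ?_
    · exact Finset.sum_congr rfl fun κ hκ => (hchV κ hκ).cls g hg x hx
    · have e : (fun x => ∑ κ ∈ irrs R, ip R f κ * V κ x) =
          ∑ κ ∈ irrs R, fun x => ip R f κ * V κ x := by ext x; simp
      rw [e, ip_sum_left]
      have : ∀ κ, ∃ n : ℕ, κ ∈ irrs R → ip R (fun x => ip R f κ * V κ x) θ = n := fun κ => by
        by_cases hκ : κ ∈ irrs R
        · obtain ⟨n, hn⟩ := (hchV κ hκ).ip_nat hθ.ch
          exact ⟨n, fun _ => hn⟩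
        · exact ⟨0, fun h => absurd h hκ⟩
      choose n hn using this
      exact ⟨∑ κ ∈ irrs R, n κ, by rw [Finset.sum_congr rfl hn]; push_cast; rfl⟩
  · intro n hn x hx
    refine Finset.sum_congr rfl fun κ hκ => ?_
    by_cases hc : ip R f κ = 0
    · rw [hc, zero_mul, zero_mul]
    · rw [(hV κ hκ hc).2.1 n hn x hx]
  · intro x hx
    rw [hf.cls.expand x hx, Finset.mul_sum]
    refine Finset.sum_congr rfl fun κ hκ => ?_
    by_cases hc : ip R f κ = 0
    · rw [hc, zero_mul, zero_mul, mul_zero]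
    · rw [(hV κ hκ hc).2.2 x hx]; ring

theorem isPiNumber_card_of_pow {n : ℕ} (hn : IsPiNumber σ n) (h : ∀ z ∈ Z, z ^ n = 1) :
    IsPiNumber σ (Nat.card Z) := by
  intro q hq hd
  have := Fact.mk hq
  obtain ⟨z, hz⟩ := exists_prime_orderOf_dvd_card' (G := Z) q hd
  refine hn q hq ?_
  rw [← hz]
  exact orderOf_dvd_of_pow_eq_one (Subtype.ext (by simpa using h z z.2))

/-- Dividing a local character by an extension `u` of its unique constituent on `L`. -/
theorem Loc.divide (hf : Loc σ J f) (hL : NI L J) (hLσ : IsPiNumber σ (Nat.card L))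
    (hu : Ch J η) (h1 : Irr L η) {m : ℂ} (hm : ∀ x ∈ L, f x = m * η x) :
    ∃ g, Loc σ J g ∧ (∀ x ∈ J, ∀ l ∈ L, g (x * l) = g x) ∧
      ∀ x ∈ J, IsPiElt σ x → f x = η x * g x := by
  let g : G → ℂ := fun x => (Nat.card L : ℂ)⁻¹ * sm L fun y => f (x * y) * η (x * y)⁻¹
  have hloc : ∀ S ≤ J, IsPiNumber σ (Nat.card S) → Ch (L ⊔ S) g ∧
      ∀ x ∈ L ⊔ S, f x = η x * g x := by
    intro S hS hSσ
    have hle := hL.sup_le hS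
    have hR := hf.2 _ hle (hL.card_sup hLσ hS hSσ)
    have hLR := hL.ni_sup hS
    obtain ⟨ν, hν, hνt, he⟩ := (hu.mono hle).gallagher hLR h1 hR hm
    have hg : ∀ x ∈ L ⊔ S, g x = ν x := by
      intro x hx
      have : (sm L fun y => f (x * y) * η (x * y)⁻¹) = Nat.card L * ν x := by
        rw [← sm_coset_norm hu hL.1 h1 (hle hx), ← sm_const_mul]
        refine sm_congr fun y hy => ?_
        rw [he _ (mul_mem hx (hLR.1 hy)), hνt.right hLR x hx y hy]
        ring
      simp only [g]
      rw [this, inv_mul_cancel_left₀ card_ne_zero']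
    exact ⟨hν.congr fun x hx => (hg x hx).symm, fun x hx => by rw [hg x hx, he x hx]⟩
  refine ⟨g, ⟨fun y hy x hx hxσ => ?_, fun S hS hSσ => (hloc S hS hSσ).1.mono le_sup_right⟩, ?_, ?_⟩
  · simp only [g]
    rw [← hL.sm_conj _ hy]
    congr 1
    refine sm_congr fun z hz => ?_
    have hxz := J.mul_mem hx (hL.1 hz)
    have e : y * x * y⁻¹ * (y * z * y⁻¹) = y * (x * z) * y⁻¹ := by group
    rw [e, hf.1 y hy _ hxz (hL.mul_isPiElt hLσ hx hxσ hz), conj_inv,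
      hu.cls y hy _ (J.inv_mem hxz)]
  · intro x _ l hl
    simp only [g, mul_assoc]
    rw [sm_mul_left (fun y => f (x * y) * η (x * y)⁻¹) hl]
  · intro x hx hxσ
    exact (hloc _ (zpowers_le hx) (isPiNumber_zpowers hxσ)).2 x
      (le_sup_right (a := L) (Subgroup.mem_zpowers x))

theorem Loc.of_map {Γ : Type} [Group Γ] [Fintype Γ] {p : Γ →* G} {Λ : Subgroup Γ}
    (h : Loc σ (Λ.map p) f) : Loc σ Λ fun x => f (p x) := by
  refine ⟨fun g hg x hx hxσ => ?_, fun S hS hSσ => ?_⟩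
  · simp only [_root_.map_mul, _root_.map_inv]
    exact h.1 _ ⟨g, hg, rfl⟩ _ ⟨x, hx, rfl⟩ (isPiElt_map hxσ)
  · refine (h.2 (S.map p) (Subgroup.map_mono hS) (hSσ.dvd ?_)).of_map
    exact ⟨_, (card_map_mul_ker (p := p) (Λ := S)).symm⟩

theorem relIndex_lt {A : Subgroup G} (h : L ≤ A) (hne : L ≠ A) (hA : A ≤ J) :
    A.relIndex J < L.relIndex J := by
  have h1 := card_mul_relIndex hA
  have h2 := card_mul_relIndex (h.trans hA)
  have h3 : Nat.card L < Nat.card A := by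
    refine lt_of_le_of_ne (Subgroup.card_le_of_le h) fun e => hne ?_
    exact Subgroup.eq_of_le_of_card_ge h e.ge
  by_contra hc
  push Not at hc
  have h4 : 0 < L.relIndex J := by
    rcases Nat.eq_zero_or_pos (L.relIndex J) with h0 | h0
    · rw [h0, mul_zero] at h2
      exact absurd h2 (Nat.card_pos (α := J)).ne
    · exact h0
  have := Nat.mul_lt_mul_of_lt_of_le h3 hc (h4.trans_le hc)
  omega

/-- The extension property for local characters, at index `n`. -/
def ExtAt (σ : Set ℕ) (n : ℕ) : Prop :=
  ∀ (G : Type) [Group G] [Fintype G] (J L : Subgroup G) (f : G → ℂ), L.relIndex J = n →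
    NI L J → IsPiNumber σ (Nat.card L) → Sep σ J → Loc σ J f →
    ∃ x, Ch J x ∧ ∀ y ∈ J, IsPiElt σ y → x y = f y

theorem NI.central_complement {A : Subgroup G} (hA : NI A J) (hZ : Z ≤ A)
    (hc : ∀ z ∈ Z, ∀ x ∈ A, x * z = z * x)
    (hZσ : IsPiNumber σ (Nat.card Z)) (hi : IsPiNumber σᶜ (Z.relIndex A)) :
    ∃ E, NI E J ∧ IsPiNumber σᶜ (Nat.card E) ∧ Z ⊔ E = A := by
  have hZA : NI Z A := ⟨hZ, fun g hg n hn => by rwa [hc n hn g hg, mul_inv_cancel_right]⟩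
  obtain ⟨E, hE, hinf, hsup, hcard⟩ := hZA.exists_complement (hZσ.coprime hi)
  have hEA : NI E A := by
    refine ⟨hE, fun g hg n hn => ?_⟩
    rw [← hsup] at hg
    obtain ⟨e, he, hz⟩ := hZA.sup_mem hE g hg
    have hzA := hZ hz
    have e1 : g = e * (e⁻¹ * g) := by group
    have e2 : (e⁻¹ * g) * n * (e⁻¹ * g)⁻¹ = n := by
      rw [← hc _ hz n (hE hn), mul_inv_cancel_right]
    have e3 : g * n * g⁻¹ = e * ((e⁻¹ * g) * n * (e⁻¹ * g)⁻¹) * e⁻¹ := by group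
    rw [e3, e2]
    exact E.mul_mem (E.mul_mem he hn) (E.inv_mem he)
  have hEi : Nat.card Z = E.relIndex A := by
    have h1 := card_mul_relIndex hE
    have h2 := card_mul_relIndex hZ
    rw [hcard] at h1
    have : 0 < Z.relIndex A := by rw [← hcard]; exact Nat.card_pos
    exact Nat.eq_of_mul_eq_mul_left this (by rw [h1, ← h2, mul_comm])
  refine ⟨E, ⟨hE.trans hA.1, fun g hg n hn => ?_⟩, hcard ▸ hi, hsup⟩
  have hn' : (g * n * g⁻¹) ^ Nat.card E = 1 := by rw [conj_pow, pow_card_of_mem hn]; group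
  refine mem_of_pow_coprime (m := E.relIndex A) (n := Nat.card E) ?_
    (hEA.pow_mem (hA.2 g hg n (hE hn))) (by rw [hn']; exact E.one_mem)
  rw [← hEi, hcard]
  exact hZσ.coprime hi

end PiSep

namespace PiSep

variable {G : Type} [Group G] [Fintype G] {J H K N M L Z T P S R : Subgroup G}
  {f g χ ψ θ ρ κ η ν ν' l d D a c ω α α' β β' : G → ℂ} {σ : Set ℕ}

theorem isPiElt_of_map {Γ : Type} [Group Γ] [Fintype Γ] {p : Γ →* G} {n : ℕ} (hn : IsPiNumber σ n)
    (hk : ∀ z, p z = 1 → z ^ n = 1) {x : Γ} (hx : IsPiElt σ (p x)) : IsPiElt σ x := by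
  refine isPiElt_of_pow (hx.mul hn) ?_
  rw [pow_mul]
  exact hk _ (by rw [_root_.map_pow, pow_orderOf_eq_one])

theorem ExtAt.inert {A : Subgroup G} (ih : ∀ m < L.relIndex J, ExtAt σ m) (h : NI L J)
    (hLσ : IsPiNumber σ (Nat.card L)) (hJ : Sep σ J) (hf : Loc σ J f) (hA : NI A J) (hLA : L ≤ A)
    (hne : L ≠ A) (hi : IsPiNumber σᶜ (L.relIndex A)) (hθ : Irr L θ)
    (hs : ∀ y ∈ J, ∀ x ∈ L, θ (y * x * y⁻¹) = θ x) {m : ℂ} (hm : ∀ x ∈ L, f x = m * θ x) :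
    ∃ x, Ch J x ∧ ∀ y ∈ J, IsPiElt σ y → x y = f y := by
  obtain ⟨Γ, _, _, p, Λ, u, hpJ, hZ, hΛ, hΛL, hinj, hu, huθ⟩ := exists_lift h hθ hs
  have hpJ' : (⊤ : Subgroup Γ).map p = J := by rw [← MonoidHom.range_eq_map, hpJ]
  have hΛσ : IsPiNumber σ (Nat.card Λ) := by rwa [← card_map_of_injOn p Λ hinj, hΛL]
  have hLL := hLσ.mul hLσ
  have hkσ : IsPiNumber σ (Nat.card p.ker) := isPiNumber_card_of_pow hLL fun z hz => (hZ z hz).2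
  have huΛ : Irr Λ u := by
    refine Irr.congr (f := fun x => θ (p x)) ?_ fun x hx => (huθ x hx).symm
    rw [← irr_map, hΛL]
    exact hθ
  have hfp : Loc σ (⊤ : Subgroup Γ) fun x => f (p x) := Loc.of_map (by rwa [hpJ'])
  obtain ⟨g, hg, hgΛ, hge⟩ := hfp.divide hΛ hΛσ hu huΛ (m := m) fun x hx => by
    rw [huθ x hx]; exact hm _ (hΛL ▸ ⟨x, hx, rfl⟩)
  have hΛn : Λ.Normal := ⟨fun n hn g => hΛ.2 g trivial n hn⟩
  let q := QuotientGroup.mk' Λ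
  have hqL : ∀ x, q x = 1 ↔ x ∈ Λ := fun x => QuotientGroup.eq_one_iff x
  have hqk : q.ker ⊓ ⊤ = Λ := by rw [inf_top_eq]; exact QuotientGroup.ker_mk' Λ
  obtain ⟨f1, hf1, hf1e⟩ := hg.descend (p := q) (by rw [hqk]; exact hΛσ) fun x _ y _ e => by
    have : x⁻¹ * y ∈ Λ := by rw [← hqL, _root_.map_mul, _root_.map_inv, e, inv_mul_cancel]
    have h2 := hgΛ x trivial _ this
    rwa [mul_inv_cancel_left, eq_comm] at h2
  have hqt : (⊤ : Subgroup Γ).map q = ⊤ := by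
    rw [← MonoidHom.range_eq_map]
    exact MonoidHom.range_eq_top.2 (QuotientGroup.mk'_surjective Λ)
  rw [hqt] at hf1
  let B : Subgroup Γ := A.comap p
  have hB : NI B ⊤ := by
    have := hA.comap_inf (p := p) (L := ⊤) hpJ'.le
    rwa [inf_top_eq] at this
  have hBA : B.map p = A := by
    have := map_comap_inf (p := p) (L := ⊤) (K := A) (hpJ'.symm ▸ hA.1)
    rwa [inf_top_eq] at this
  have hBq : NI (B.map q) ⊤ := hqt ▸ hB.map (p := q)
  have hkΛ : L.comap p ≤ p.ker ⊔ Λ := fun x hx => by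
    have : p x ∈ Λ.map p := hΛL ▸ hx
    obtain ⟨y, hy, e⟩ := this
    have h1 : x * y⁻¹ ∈ p.ker := by
      rw [MonoidHom.mem_ker, _root_.map_mul, _root_.map_inv, e, mul_inv_cancel]
    have h2 := mul_mem (le_sup_left (b := Λ) h1) (le_sup_right (a := p.ker) hy)
    rwa [inv_mul_cancel_right] at h2
  have hkq : (p.ker ⊔ Λ).map q = p.ker.map q := by
    rw [Subgroup.map_sup, (Subgroup.map_eq_bot_iff Λ).2 (QuotientGroup.ker_mk' Λ).ge, sup_bot_eq]
  have hZq : IsPiNumber σ (Nat.card (p.ker.map q)) :=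
    hkσ.dvd ⟨_, (card_map_mul_ker (p := q) (Λ := p.ker)).symm⟩
  obtain ⟨E, hE, hEσ, hZE⟩ := hBq.central_complement (Z := p.ker.map q) (σ := σ)
    (Subgroup.map_mono fun z hz => by
      change p z ∈ A
      rw [MonoidHom.mem_ker.1 hz]; exact A.one_mem)
    (by
      rintro _ ⟨z, hz, rfl⟩ _ ⟨x, -, rfl⟩
      rw [← _root_.map_mul, (hZ z hz).1 x, _root_.map_mul]) hZq (by
      rw [← hkq]
      refine IsPiNumber.dvd ?_ relIndex_map_dvd
      refine IsPiNumber.dvd ?_ (Subgroup.relIndex_dvd_of_le_left _ hkΛ)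
      rwa [Subgroup.relIndex_comap, hBA])
  have hEn : E.Normal := ⟨fun n hn g => hE.2 g trivial n hn⟩
  let r := QuotientGroup.mk' E
  have hrk : r.ker ⊓ ⊤ = E := by rw [inf_top_eq]; exact QuotientGroup.ker_mk' E
  have hrt : (⊤ : Subgroup (Γ ⧸ Λ)).map r = ⊤ := by
    rw [← MonoidHom.range_eq_map]
    exact MonoidHom.range_eq_top.2 (QuotientGroup.mk'_surjective E)
  obtain ⟨f2, hf2, hf2e⟩ := hf1.exists_quotient (p := r) (by rw [hrk]; exact hEσ)
  rw [hrt] at hf2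
  have hidx : ((B.map q).map r).relIndex ⊤ < L.relIndex J := by
    refine lt_of_le_of_lt (Nat.le_of_dvd ?_ ?_) (relIndex_lt hLA hne hA.1)
    · rcases Nat.eq_zero_or_pos (A.relIndex J) with h0 | h0
      · have := card_mul_relIndex hA.1
        rw [h0, mul_zero] at this
        exact absurd this (Nat.card_pos (α := J)).ne
      · exact h0
    · have h1 : (A.comap p).relIndex ⊤ = A.relIndex J := by rw [Subgroup.relIndex_comap, hpJ']
      rw [← h1, ← hrt]
      refine relIndex_map_dvd.trans ?_
      rw [← hqt]
      exact relIndex_map_dvd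
  have hσ : IsPiNumber σ (Nat.card ((B.map q).map r)) := by
    rw [← hZE, Subgroup.map_sup, (Subgroup.map_eq_bot_iff E).2 (QuotientGroup.ker_mk' E).ge,
      sup_bot_eq]
    exact hZq.dvd ⟨_, (card_map_mul_ker (p := r) (Λ := p.ker.map q)).symm⟩
  have hSep : Sep σ (⊤ : Subgroup ((Γ ⧸ Λ) ⧸ E)) := by
    rw [← hrt, ← hqt]
    refine (Sep.comap hJ hpJ' (Or.inl ?_)).map.map
    rwa [inf_top_eq]
  obtain ⟨x2, hx2, hx2e⟩ := ih _ hidx ((Γ ⧸ Λ) ⧸ E) ⊤ _ f2 rfl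
    (hrt ▸ hBq.map (p := r)) hσ hSep hf2
  have hx3 : Ch (⊤ : Subgroup Γ) fun x => x2 ((r.comp q) x) := hx2.comap fun _ _ => trivial
  have hx4 := hu.mul hx3
  have hval : ∀ x, IsPiElt σ x → (u * fun x => x2 ((r.comp q) x)) x = f (p x) := by
    intro x hx
    rw [hge x trivial hx, Pi.mul_apply, MonoidHom.comp_apply,
      hx2e _ trivial (isPiElt_map (isPiElt_map hx)), hf2e _ trivial (isPiElt_map hx),
      hf1e x trivial]
  have hkelt : ∀ z, p z = 1 → IsPiElt σ z := fun z hz => isPiElt_of_pow hLL (hZ z hz).2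
  obtain ⟨x, hx⟩ := exists_descend (p := p) (L := ⊤) (u * fun x => x2 ((r.comp q) x))
    fun y _ z _ e => by
      have h1 : p (y * z⁻¹) = 1 := by rw [_root_.map_mul, _root_.map_inv, e, mul_inv_cancel]
      have h2 := hx4.kernel (y := y * z⁻¹) trivial (by
        rw [hval _ (hkelt _ h1), hval _ (hkelt _ (_root_.map_one p)), h1, _root_.map_one])
        (x := z) trivial
      rwa [inv_mul_cancel_right] at h2
  refine ⟨x, ?_, ?_⟩
  · rw [← hpJ', ch_map]
    exact hx4.congr fun y hy => (hx y hy).symm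
  · intro y hy hyσ
    rw [← hpJ'] at hy
    obtain ⟨z, -, rfl⟩ := hy
    rw [hx z trivial, hval z (isPiElt_of_map hLL (fun z hz => (hZ z hz).2) hyσ)]

theorem Loc.exists_deg (hf : Loc σ J f) :
    ∃ n : ℕ, f 1 = n ∧ (n = 0 → ∀ x ∈ J, IsPiElt σ x → f x = 0) := by
  have h1 : ∀ x ∈ J, IsPiElt σ x → Ch (Subgroup.zpowers x) f := fun x hx hxσ =>
    hf.2 _ (zpowers_le hx) (isPiNumber_zpowers hxσ)
  have h2 : IsPiElt σ (1 : G) := isPiElt_of_pow .one (pow_one 1)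
  obtain ⟨n, hn, -⟩ := (h1 1 J.one_mem h2).degree
  refine ⟨n, hn, fun h0 x hx hxσ => ?_⟩
  refine (h1 x hx hxσ).eq_zero_of_deg ?_ x (Subgroup.mem_zpowers x)
  rw [hn, h0, Nat.cast_zero]

/-- A class function on `σ`-elements which is a character on every `σ`-subgroup extends to a
character. -/
theorem extAt (σ : Set ℕ) (n : ℕ) : ExtAt σ n := by
  induction n using Nat.strong_induction_on with
  | _ n ih =>
  intro G _ _ J L f hn h hLσ hJ hf
  obtain ⟨k, hk, -⟩ := hf.exists_deg
  induction k using Nat.strong_induction_on generalizing f with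
  | _ k ihk =>
  by_cases hLJ : L = J
  · subst hLJ
    exact ⟨f, hf.2 L le_rfl hLσ, fun _ _ _ => rfl⟩
  obtain ⟨A, hA, hLA, hne, ht⟩ := hJ.step_up h hLJ
  have hlt := relIndex_lt hLA hne hA.1
  rcases ht with ht | ht
  · refine ih _ (hn ▸ hlt) G J A f rfl hA ?_ hJ hf
    rw [← card_mul_relIndex hLA]
    exact hLσ.mul ht
  by_cases h0 : f 1 = 0
  · obtain ⟨k', hk', h1⟩ := hf.exists_deg
    exact ⟨0, Ch.zero, fun y hy hyσ => (h1 (by exact_mod_cast hk'.symm.trans h0) y hy hyσ).symm⟩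
  have hfL := hf.2 L h.1 hLσ
  obtain ⟨θ, hθ, hc⟩ := hfL.exists_const h0
  obtain ⟨hp1, hp2⟩ := h.pr_loc hLσ hθ hf
  set f1 := pr L (orb J L θ) f with hf1
  obtain ⟨k1, hk1, hk1'⟩ := hp1.exists_deg
  obtain ⟨k2, hk2, hk2'⟩ := hp2.exists_deg
  have hip : ∀ μ, Irr L μ → ip L f1 μ = if Over J L θ μ then ip L f μ else 0 := fun μ hμ =>
    h.ip_pr_orb hθ h.1 le_rfl hfL.cls hμ
  have hsum : k1 + k2 = k := by
    have : f 1 = f1 1 + (f - f1) 1 := by simp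
    rw [hk, hk1, hk2] at this
    exact_mod_cast this.symm
  by_cases hk20 : k2 = 0
  · have hff : ∀ x ∈ J, IsPiElt σ x → f1 x = f x := fun x hx hxσ => by
      have := hk2' hk20 x hx hxσ
      rw [Pi.sub_apply, sub_eq_zero] at this
      exact this.symm
    by_cases hT : stab J L θ = J
    · refine ExtAt.inert (fun m hm => ih m (hn ▸ hm)) h hLσ hJ hf hA hLA hne ht hθ
        (fun y hy => h.stab_inv y (hT.symm ▸ hy)) (m := ip L f θ) ?_
      intro x hx
      have hLe : ∀ x ∈ L, f1 x = f x := fun x hx => hff x (h.1 hx) (isPiElt_of_mem hLσ hx)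
      refine Cls.eq_of_ip (g := fun x => ip L f θ * θ x) hfL.cls
        (fun a ha x hx => congrArg _ (hθ.cls a ha x hx)) (fun μ hμ => ?_) x hx
      have e2 : ip L (fun x => ip L f θ * θ x) μ = ip L f θ * ip L θ μ := ip_smul_left _
      rw [e2]
      by_cases hμθ : ip L θ μ = 0
      · rw [hμθ, mul_zero, ← ip_congr (f' := f) (g := μ) (g' := μ) hLe (fun _ _ => rfl), hip μ (mem_irrs.1 hμ).1,
          if_neg]
        rintro ⟨y, hy, hcy⟩
        apply hcy
        rw [ip_comm, ip_congr (f := cj y θ) (f' := θ) (g := μ) (g' := μ) (fun x hx =>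
          h.stab_inv y (hT.symm ▸ hy) x hx) fun _ _ => rfl, hμθ]
      · have h3 := hθ.eqOn (mem_irrs.1 hμ).1 hμθ
        rw [← ip_congr (f := f) (f' := f) (g := θ) (g' := μ) (fun _ _ => rfl) h3,
          ← ip_congr (f := θ) (f' := θ) (g := θ) (g' := μ) (fun _ _ => rfl) h3, hθ.ip_self, mul_one]
    · have hTJ : stab J L θ ≤ J := stab_le
      have hTn := h.stab_ni hθ.cls
      have hlt2 : L.relIndex (stab J L θ) < L.relIndex J := by
        have h1 := card_mul_relIndex hTn.1
        have h2 := card_mul_relIndex h.1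
        have h3 : Nat.card (stab J L θ) < Nat.card J := by
          refine lt_of_le_of_ne (Subgroup.card_le_of_le hTJ) fun e => hT ?_
          exact Subgroup.eq_of_le_of_card_ge hTJ e.ge
        rw [← h1, ← h2] at h3
        exact lt_of_mul_lt_mul_left h3 (Nat.zero_le _)
      have hfT := (hTn.pr_loc hLσ hθ (hf.mono hTJ)).1
      obtain ⟨x1, hx1, hx1e⟩ := ih _ (hn ▸ hlt2) G _ L _ rfl hTn hLσ (hJ.mono hTJ) hfT
      refine ⟨ind J (stab J L θ) x1, hx1.ind hTJ, fun y hy hyσ => ?_⟩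
      rw [h.ind_pr hLσ hθ hf hx1e hy hyσ]
      exact hff y hy hyσ
  · have hk10 : k1 ≠ 0 := by
      intro hk10
      have h1 : ip L f1 θ ≠ 0 := by
        rw [hip θ hθ, if_pos ⟨1, J.one_mem, by rw [cj_one, hθ.ip_self]; exact one_ne_zero⟩]
        exact hc
      apply h1
      rw [ip_congr (f' := 0) (g' := θ) (fun x hx => hk1' hk10 x (h.1 hx) (isPiElt_of_mem hLσ hx))
        fun _ _ => rfl, ip_eq]
      simp
    obtain ⟨x1, hx1, hx1e⟩ := ihk k1 (by omega) f1 hp1 hk1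
    obtain ⟨x2, hx2, hx2e⟩ := ihk k2 (by omega) _ hp2 hk2
    refine ⟨x1 + x2, hx1.add hx2, fun y hy hyσ => ?_⟩
    rw [Pi.add_apply, hx1e y hy hyσ, hx2e y hy hyσ]
    simp

theorem Loc.exists_ch (hJ : Sep σ J) (hf : Loc σ J f) :
    ∃ x, Ch J x ∧ ∀ y ∈ J, IsPiElt σ y → x y = f y := by
  refine extAt σ _ G J ⊥ f rfl NI.bot ?_ hJ hf
  rw [Subgroup.card_bot]
  exact .one

/-- A character whose restriction to a normal `σ`-subgroup meets two orbits splits on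
`σ`-elements. -/
theorem Loc.exists_split (hJ : Sep σ J) (hf : Loc σ J f) (h : NI L J)
    (hLσ : IsPiNumber σ (Nat.card L)) (hθ : Irr L θ) (hc : ip L f θ ≠ 0) (hκ : Irr L κ)
    (hc' : ip L f κ ≠ 0) (ho : ∀ y ∈ J, ip L κ (cj y θ) = 0) :
    ∃ x1 x2, Ch J x1 ∧ Ch J x2 ∧ x1 1 ≠ 0 ∧ x2 1 ≠ 0 ∧
      ∀ y ∈ J, IsPiElt σ y → f y = x1 y + x2 y := by
  obtain ⟨hp1, hp2⟩ := h.pr_loc hLσ hθ hf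
  have hfL := hf.2 L h.1 hLσ
  have hip : ∀ μ, Irr L μ → ip L (pr L (orb J L θ) f) μ = if Over J L θ μ then ip L f μ else 0 :=
    fun μ hμ => h.ip_pr_orb hθ h.1 le_rfl hfL.cls hμ
  have h1 : IsPiElt σ (1 : G) := isPiElt_of_pow .one (pow_one 1)
  have key : ∀ F, Loc σ J F → (∃ μ, ip L F μ ≠ 0) → F 1 ≠ 0 := by
    rintro F hF ⟨μ, hμ⟩ h0
    obtain ⟨k', hk', h2⟩ := hF.exists_deg
    apply hμ
    rw [ip_congr (f' := 0) (g' := μ) (fun x hx => h2 (by exact_mod_cast hk'.symm.trans h0) x (h.1 hx)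
      (isPiElt_of_mem hLσ hx)) fun _ _ => rfl, ip_eq]
    simp
  obtain ⟨x1, hx1, hx1e⟩ := hp1.exists_ch hJ
  obtain ⟨x2, hx2, hx2e⟩ := hp2.exists_ch hJ
  refine ⟨x1, x2, hx1, hx2, ?_, ?_, fun y hy hyσ => ?_⟩
  · rw [hx1e 1 J.one_mem h1]
    refine key _ hp1 ⟨θ, ?_⟩
    rw [hip θ hθ, if_pos ⟨1, J.one_mem, by rw [cj_one, hθ.ip_self]; exact one_ne_zero⟩]
    exact hc
  · rw [hx2e 1 J.one_mem h1]
    refine key _ hp2 ⟨κ, ?_⟩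
    rw [ip_sub_left, hip κ hκ, if_neg, sub_zero]
    · exact hc'
    · rintro ⟨y, hy, hcy⟩
      exact hcy (ho y hy)
  · rw [hx1e y hy hyσ, hx2e y hy hyσ]
    simp

end PiSep

namespace PiSep

variable {G : Type} [Group G] [Fintype G] {J H K N M L Z T P S R : Subgroup G}
  {f g χ ψ θ ρ κ η ν ν' l d D a c ω α α' β β' : G → ℂ} {σ : Set ℕ}

/-- Every automorphism of a subfield of `ℂ` extends to `ℂ`. -/
theorem exists_ringHom_extend {F : Type} [Field F] [Algebra F ℂ] (s : F ≃+* F) :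
    ∃ τ : ℂ →+* ℂ, ∀ x : F, τ (algebraMap F ℂ x) = algebraMap F ℂ (s x) := by
  obtain ⟨v, hv⟩ := exists_isTranscendenceBasis F ℂ
  have := IsAlgClosed.isAlgClosure_of_transcendence_basis _ hv
  let e := hv.1.aevalEquiv
  let E : Algebra.adjoin F (Set.range (Subtype.val : v → ℂ)) ≃+*
      Algebra.adjoin F (Set.range (Subtype.val : v → ℂ)) :=
    (e.symm.toRingEquiv.trans (MvPolynomial.mapEquiv _ s)).trans e.toRingEquiv
  refine ⟨(IsAlgClosure.equivOfEquiv ℂ ℂ E : ℂ ≃+* ℂ), fun x => ?_⟩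
  have h1 : algebraMap F ℂ x = algebraMap (Algebra.adjoin F (Set.range (Subtype.val : v → ℂ))) ℂ
    (algebraMap F _ x) := rfl
  have hE : E (algebraMap F _ x) = algebraMap F _ (s x) := by
    change e (MvPolynomial.mapEquiv _ s (e.symm (algebraMap F _ x))) = _
    rw [AlgEquiv.commutes]
    change e (MvPolynomial.map (s : F →+* F) (MvPolynomial.C x)) = _
    rw [MvPolynomial.map_C]
    exact AlgEquiv.commutes e _
  change IsAlgClosure.equivOfEquiv ℂ ℂ E _ = _
  rw [h1, IsAlgClosure.equivOfEquiv_algebraMap, hE]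
  rfl

theorem exists_ringHom_pow_of_cyclotomic {n k : ℕ} (hn : n ≠ 0) (hk : k.Coprime n) {F : Type}
    [Field F] [Algebra ℚ F] [IsCyclotomicExtension {n} ℚ F] :
    ∃ τ : ℂ →+* ℂ, ∀ z : ℂ, z ^ n = 1 → τ z = z ^ k := by
  have : NeZero n := ⟨hn⟩
  have : Algebra.IsIntegral ℚ F := IsCyclotomicExtension.integral {n} ℚ F
  let ι : F →ₐ[ℚ] ℂ := IsAlgClosed.lift
  let _ : Algebra F ℂ := ι.toRingHom.toAlgebra
  have hζ := IsCyclotomicExtension.zeta_spec n ℚ F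
  have hirr := Polynomial.cyclotomic.irreducible_rat (NeZero.pos n)
  let s := IsCyclotomicExtension.fromZetaAut (hζ.pow_of_coprime k hk) hirr
  have hs : s (IsCyclotomicExtension.zeta n ℚ F) = _ :=
    IsCyclotomicExtension.fromZetaAut_spec (hζ.pow_of_coprime k hk) hirr
  obtain ⟨τ, hτ⟩ := exists_ringHom_extend s.toRingEquiv
  refine ⟨τ, fun z hz => ?_⟩
  have hι : IsPrimitiveRoot (ι (IsCyclotomicExtension.zeta n ℚ F)) n :=
    hζ.map_of_injective ι.toRingHom.injective
  obtain ⟨i, _, rfl⟩ := hι.eq_pow_of_pow_eq_one hz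
  have h1 : τ (ι (IsCyclotomicExtension.zeta n ℚ F)) =
      ι (s (IsCyclotomicExtension.zeta n ℚ F)) := hτ _
  rw [_root_.map_pow, h1, hs, _root_.map_pow, ← pow_mul, ← pow_mul, mul_comm]

theorem exists_ringHom_pow {n k : ℕ} (hn : n ≠ 0) (hk : k.Coprime n) :
    ∃ τ : ℂ →+* ℂ, ∀ z : ℂ, z ^ n = 1 → τ z = z ^ k := by
  have : NeZero n := ⟨hn⟩
  have : NeZero ((n : ℕ) : ℚ) := ⟨Nat.cast_ne_zero.2 hn⟩
  exact @exists_ringHom_pow_of_cyclotomic n k hn hk (CyclotomicField n ℚ) _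
    (CyclotomicField.algebra n ℚ) (CyclotomicField.isCyclotomicExtension n ℚ)

theorem exists_twist {a b : ℕ} (ha : a ≠ 0) (hb : b ≠ 0) (hab : a.Coprime b) :
    ∃ τ : ℂ →+* ℂ, (∀ z : ℂ, z ^ a = 1 → τ z = z) ∧ ∀ z : ℂ, z ^ b = 1 → τ z = z⁻¹ := by
  obtain ⟨k, hka, hkb⟩ := Nat.chineseRemainder hab 1 (b - 1)
  have hk : k.Coprime (a * b) := by
    refine Nat.Coprime.mul_right ?_ ?_
    · have := hka.gcd_eq
      simpa [Nat.Coprime] using this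
    · have := hkb.gcd_eq
      rw [Nat.Coprime, this]
      obtain ⟨c, rfl⟩ := Nat.exists_eq_succ_of_ne_zero hb
      simp
  obtain ⟨τ, hτ⟩ := exists_ringHom_pow (mul_ne_zero ha hb) hk
  refine ⟨τ, fun z hz => ?_, fun z hz => ?_⟩
  · rw [hτ z (by rw [pow_mul, hz, one_pow])]
    have := pow_eq_pow_of_modEq hka hz
    rwa [pow_one] at this
  · rw [hτ z (by rw [mul_comm a, pow_mul, hz, one_pow]), pow_eq_pow_of_modEq hkb hz]
    refine eq_inv_of_mul_eq_one_left ?_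
    rw [← pow_succ, Nat.sub_add_cancel (Nat.pos_of_ne_zero hb), hz]

end PiSep

namespace PiSep

variable {G : Type} [Group G] [Fintype G] {J H K N M L Z T P S R : Subgroup G}
  {f g χ ψ θ ρ κ η ν ν' l d D a c ω α α' β β' : G → ℂ} {σ : Set ℕ}

theorem ip_ringHom (τ : ℂ →+* ℂ) (f g : G → ℂ) :
    ip J (fun x => τ (f x)) (fun x => τ (g x)) = τ (ip J f g) := by
  rw [ip_def, ip_def, _root_.map_mul, map_inv₀, map_natCast, sm, sm, map_sum]
  simp [_root_.map_mul]

theorem Irr.ringHom (h : Irr J f) (τ : ℂ →+* ℂ) : Irr J fun x => τ (f x) :=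
  irr_iff.2 ⟨h.ch.ringHom τ, by rw [ip_ringHom, h.ip_self, _root_.map_one]⟩

theorem Ch.exists_const_ringHom (hf : Ch J f) (τ : ℂ →+* ℂ) (hθ : Irr J θ)
    (hc : ip J (fun x => τ (f x)) θ ≠ 0) :
    ∃ κ, Irr J κ ∧ ip J f κ ≠ 0 ∧ ∀ x ∈ J, τ (κ x) = θ x := by
  have h1 : ip J (fun x => τ (f x)) θ =
      ∑ κ ∈ irrs J, τ (ip J f κ) * ip J (fun x => τ (κ x)) θ := by
    rw [ip_congr (f' := ∑ κ ∈ irrs J, τ (ip J f κ) • fun x => τ (κ x)) (g' := θ)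
      (fun x hx => ?_) fun _ _ => rfl, ip_sum_left]
    · exact Finset.sum_congr rfl fun κ _ => ip_smul_left _
    · rw [hf.cls.expand x hx, map_sum, Finset.sum_apply]
      exact Finset.sum_congr rfl fun κ _ => _root_.map_mul _ _ _
  rw [h1] at hc
  obtain ⟨κ, hκ, h2⟩ := Finset.exists_ne_zero_of_sum_ne_zero hc
  have hκi := (mem_irrs.1 hκ).1
  exact ⟨κ, hκi, fun h0 => h2 (by rw [h0, _root_.map_zero, zero_mul]),
    (hκi.ringHom τ).eqOn hθ (right_ne_zero_of_mul h2)⟩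

theorem PiDet.ringHom (h : PiDet σ J f) (τ : ℂ →+* ℂ) : PiDet σ J fun x => τ (f x) := by
  obtain ⟨d, hd, m, h0, hm, h1⟩ := h
  exact ⟨_, hd.ringHom τ, m, h0, hm, fun x hx => by rw [← _root_.map_pow, h1 x hx, _root_.map_one]⟩

theorem Ch.deg_ringHom (h : Ch J f) (τ : ℂ →+* ℂ) : PiSep.deg (fun x => τ (f x)) = PiSep.deg f :=
  deg_of_eq (by rw [h.deg, map_natCast])

theorem Sp.ringHom (h : Sp σ J f) (τ : ℂ →+* ℂ) : Sp σ J fun x => τ (f x) := by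
  refine ⟨h.1.ringHom τ, by rw [h.1.ch.deg_ringHom]; exact h.2.1, fun M hM θ hθ hc => ?_⟩
  obtain ⟨κ, hκ, hk, e⟩ := (h.1.ch.mono hM.le).exists_const_ringHom τ hθ hc
  exact ((h.2.2 M hM κ hκ hk).ringHom τ).congr e

/-- `τ` fixes `m`-th roots of unity of `σ`-order and inverts those of `σ'`-order. -/
def Twist (σ : Set ℕ) (m : ℕ) (τ : ℂ →+* ℂ) : Prop :=
  (∀ z : ℂ, ∀ k, IsPiNumber σ k → z ^ k = 1 → z ^ m = 1 → τ z = z) ∧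
    ∀ z : ℂ, ∀ k, IsPiNumber σᶜ k → z ^ k = 1 → z ^ m = 1 → τ z = z⁻¹

theorem exists_isTwist (σ : Set ℕ) {m : ℕ} (hm : m ≠ 0) : ∃ τ, Twist σ m τ := by
  obtain ⟨a, b, rfl, ha, hb⟩ := exists_split (σ := σ) hm
  obtain ⟨τ, h1, h2⟩ := exists_twist (left_ne_zero_of_mul hm) (right_ne_zero_of_mul hm)
    (ha.coprime hb)
  refine ⟨τ, fun z k hk hz hz' => h1 z ?_, fun z k hk hz hz' => h2 z ?_⟩
  · rw [pow_mul] at hz'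
    exact eq_one_of_coprime (hk.coprime hb) (by rw [pow_right_comm, hz, one_pow]) hz'
  · rw [mul_comm, pow_mul] at hz'
    exact eq_one_of_coprime (ha.coprime hk).symm (by rw [pow_right_comm, hz, one_pow]) hz'

theorem Twist.fix {τ : ℂ →+* ℂ} (hτ : Twist σ (Nat.card G) τ) (h : Ch J f) {x : G} (hx : x ∈ J)
    (hxσ : IsPiElt σ x) : τ (f x) = f x := by
  obtain ⟨s, h1, -, h2⟩ := h.roots hx
  rw [h1, map_multiset_sum]
  congr 1
  conv_rhs => rw [← Multiset.map_id s]
  refine Multiset.map_congr rfl fun z hz => hτ.1 z _ hxσ (h2 z hz) ?_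
  obtain ⟨k, hk⟩ := orderOf_dvd_natCard x
  rw [hk, pow_mul, h2 z hz, one_pow]

theorem Twist.inv {τ : ℂ →+* ℂ} (hτ : Twist σ (Nat.card G) τ) (h : Ch J f) {x : G} (hx : x ∈ J)
    (hxσ : IsPiElt σᶜ x) : τ (f x) = f x⁻¹ := by
  obtain ⟨s, h1, -, h2⟩ := h.roots hx
  rw [h.inv_apply hx, h1, map_multiset_sum, map_multiset_sum]
  congr 1
  refine Multiset.map_congr rfl fun z hz => ?_
  obtain ⟨k, hk⟩ := orderOf_dvd_natCard x
  rw [hτ.2 z _ hxσ (h2 z hz) (by rw [hk, pow_mul, h2 z hz, one_pow])]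
  exact Complex.inv_eq_conj (Complex.norm_eq_one_of_pow_eq_one (h2 z hz) (orderOf_pos x).ne')

theorem Sp.twist_eq {τ : ℂ →+* ℂ} (hτ : Twist σ (Nat.card G) τ) (hJ : Sep σ J) (h : Sp σ J α) :
    ∀ x ∈ J, τ (α x) = α x :=
  (h.ringHom τ).eq_of_pi hJ h fun _ hx hxσ => hτ.fix h.1.ch hx hxσ

/-- A `σ'`-special character is real on `σ`-elements. -/
theorem Sp.real (hJ : Sep σ J) (h : Sp σᶜ J β) {x : G} (hx : x ∈ J) (hxσ : IsPiElt σ x) :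
    β x⁻¹ = β x := by
  obtain ⟨τ, hτ⟩ := exists_isTwist σᶜ (m := Nat.card G) Nat.card_pos.ne'
  rw [← hτ.inv h.1.ch hx (by rwa [compl_compl]), h.twist_eq hτ hJ.compl x hx]

end PiSep

namespace PiSep

variable {G : Type} [Group G] [Fintype G] {J H K N M L Z T P S R : Subgroup G}
  {f g χ ψ θ ρ κ η ν ν' l d D a c ω α α' β β' : G → ℂ} {σ : Set ℕ}

theorem Ch.int_of_sq (h : Ch J χ) {x : G} (hx : x ∈ J) (hx2 : x * x = 1) :
    ∃ k : ℤ, χ x = k ∧ (2 : ℤ) ∣ k - PiSep.deg χ := by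
  obtain ⟨s, h1, h2, h3⟩ := h.roots hx
  have h4 : ∀ z ∈ s, z = 1 ∨ z = -1 := fun z hz => by
    have : z ^ 2 = 1 := by
      obtain ⟨k, hk⟩ := orderOf_dvd_of_pow_eq_one (show x ^ 2 = 1 by rw [pow_two, hx2])
      rw [hk, pow_mul, h3 z hz, one_pow]
    rwa [pow_two, mul_self_eq_one_iff] at this
  rw [h1]
  have h5 : PiSep.deg χ = s.card := by
    rw [h.deg] at h2
    exact_mod_cast h2
  rw [h5]
  clear h1 h2 h3 h5
  induction s using Multiset.induction_on with
  | empty => exact ⟨0, by simp⟩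
  | cons a s ih =>
    obtain ⟨k, hk, hd⟩ := ih fun z hz => h4 z (Multiset.mem_cons_of_mem hz)
    rw [Multiset.sum_cons, hk, Multiset.card_cons]
    push_cast
    rcases h4 a (Multiset.mem_cons_self a s) with rfl | rfl
    · exact ⟨k + 1, by push_cast; ring, by omega⟩
    · exact ⟨k - 1, by push_cast; ring, by omega⟩

theorem Cls.irr_or_neg (h : Cls J f) (hInt : ∀ θ, Irr J θ → ∃ k : ℤ, ip J f θ = k)
    (h1 : ip J f f = 1) :
    ∃ κ, Irr J κ ∧ ((∀ x ∈ J, f x = κ x) ∨ ∀ x ∈ J, f x = -κ x) := by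
  have hk : ∀ θ ∈ irrs J, ∃ k : ℤ, ip J f θ = k := fun θ hθ => hInt θ (mem_irrs.1 hθ).1
  choose! k hk using hk
  have h2 : ip J f f = ∑ θ ∈ irrs J, ip J f θ * ip J θ f := ip_expand h le_rfl f
  have h3 : ∑ θ ∈ irrs J, k θ * k θ = 1 := by
    rw [h1] at h2
    have h4 : ∑ θ ∈ irrs J, ip J f θ * ip J θ f = ∑ θ ∈ irrs J, ((k θ * k θ : ℤ) : ℂ) :=
      Finset.sum_congr rfl fun θ hθ => by rw [ip_comm θ f, hk θ hθ]; push_cast; rfl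
    rw [h4] at h2
    exact_mod_cast h2.symm
  have h0 : ∃ κ ∈ irrs J, k κ ≠ 0 := by
    by_contra! h0
    rw [Finset.sum_eq_zero fun θ hθ => by rw [h0 θ hθ, mul_zero]] at h3
    exact one_ne_zero h3.symm
  obtain ⟨κ, hκ, hk0⟩ := h0
  rw [← Finset.add_sum_erase _ _ hκ] at h3
  have h4 : 0 ≤ ∑ θ ∈ (irrs J).erase κ, k θ * k θ :=
    Finset.sum_nonneg fun θ _ => mul_self_nonneg _
  have h5 : 0 < k κ * k κ := mul_self_pos.2 hk0
  have h6 : ∑ θ ∈ (irrs J).erase κ, k θ * k θ = 0 := by omega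
  have h7 : k κ * k κ = 1 := by omega
  have h8 : ∀ θ ∈ irrs J, θ ≠ κ → k θ = 0 := fun θ hθ hne =>
    mul_self_eq_zero.1 ((Finset.sum_eq_zero_iff_of_nonneg fun θ _ => mul_self_nonneg _).1 h6 θ
      (Finset.mem_erase.2 ⟨hne, hθ⟩))
  have h9 : ∀ x ∈ J, f x = k κ * κ x := fun x hx => by
    rw [h.expand x hx, Finset.sum_eq_single κ, hk κ hκ]
    · intro θ hθ hne
      rw [hk θ hθ, h8 θ hθ hne]
      simp
    · exact fun h => absurd hκ h
  refine ⟨κ, (mem_irrs.1 hκ).1, (mul_self_eq_one_iff.1 h7).imp (fun e x hx => ?_) fun e x hx => ?_⟩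
  · rw [h9 x hx, e]; simp
  · rw [h9 x hx, e]; simp

/-- Translation by a central involution turns a character into a virtual character. -/
theorem Ch.ip_translate_int (h : Ch J χ) {z : G} (hz : z ∈ J) (hc : ∀ x ∈ J, x * z = z * x)
    (hz2 : z * z = 1) (hK : K ≤ J) (hθ : Ch K θ) :
    ∃ k : ℤ, ip K (fun x => χ (z * x)) θ = k := by
  have h1 : ∀ δ ∈ irrs J, ∃ e : ℤ, ∀ x ∈ J, δ (z * x) = e * δ x := by
    intro δ hδ
    have hδi := (mem_irrs.1 hδ).1
    have h2 := hδi.mul_central hz hz hc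
    rw [hz2] at h2
    have h3 : ∀ x ∈ J, δ 1 * δ (z * x) = δ x * δ z := fun x hx => by
      rw [← hc x hx]; exact hδi.mul_central hx hz hc
    rcases mul_self_eq_mul_self_iff.1 h2 with e | e
    · exact ⟨1, fun x hx => mul_left_cancel₀ hδi.one_ne_zero (by rw [h3 x hx, ← e]; push_cast; ring)⟩
    · refine ⟨-1, fun x hx => mul_left_cancel₀ hδi.one_ne_zero ?_⟩
      rw [h3 x hx, e]; push_cast; ring
  choose! e he using h1
  have h4 : ∀ δ ∈ irrs J, ∃ n : ℕ, ip J χ δ * ip K δ θ = n := fun δ hδ => by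
    obtain ⟨n, hn⟩ := h.ip_nat (mem_irrs.1 hδ).1.ch
    obtain ⟨m, hm⟩ := ((mem_irrs.1 hδ).1.ch.mono hK).ip_nat hθ
    exact ⟨n * m, by rw [hn, hm]; push_cast; rfl⟩
  choose! n hn using h4
  refine ⟨∑ δ ∈ irrs J, e δ * n δ, ?_⟩
  rw [ip_congr (f' := ∑ δ ∈ irrs J, (ip J χ δ * e δ) • δ) (g' := θ) (fun x hx => ?_) fun _ _ => rfl,
    ip_sum_left, Int.cast_sum]
  · refine Finset.sum_congr rfl fun δ hδ => ?_
    rw [ip_smul_left]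
    push_cast
    rw [← hn δ hδ]
    ring
  · rw [h.cls.expand _ (J.mul_mem hz (hK hx)), Finset.sum_apply]
    refine Finset.sum_congr rfl fun δ hδ => ?_
    rw [he δ hδ x (hK hx), Pi.smul_apply, smul_eq_mul, mul_assoc]

end PiSep

namespace PiSep

variable {G : Type} [Group G] [Fintype G] {J H K N M L Z T P S R : Subgroup G}
  {f g χ ψ θ ρ κ η ν ν' l d D a c ω α α' β β' : G → ℂ} {σ : Set ℕ}

/-- The elements of the coset `e * M` whose square is trivial. -/
def inv2 (M : Subgroup G) (e : G) : Finset G :=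
  Finset.univ.filter fun x => e⁻¹ * x ∈ M ∧ x * x = 1

theorem mem_inv2 {e x : G} : x ∈ inv2 M e ↔ e⁻¹ * x ∈ M ∧ x * x = 1 := by simp [inv2]

theorem mem_inf_centralizer {e x : G} :
    x ∈ (M ⊓ Subgroup.centralizer {e} : Subgroup G) ↔ x ∈ M ∧ x * e = e * x := by
  rw [Subgroup.mem_inf, Subgroup.mem_centralizer_iff]
  simp [eq_comm]

theorem isPiElt_two {x : G} (h : x * x = 1) : IsPiElt {2} x := fun q hq hd =>
  (Nat.prime_dvd_prime_iff_eq hq Nat.prime_two).1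
    (hd.trans (orderOf_dvd_of_pow_eq_one (by rw [pow_two, h])))

theorem NI.inv2_conj (h : NI M J) (hM : Odd (Nat.card M)) {e x : G} (he : e ∈ J) (he2 : e * e = 1)
    (hx : x ∈ inv2 M e) : ∃ m ∈ M, x = m * e * m⁻¹ := by
  obtain ⟨h1, h2⟩ := mem_inv2.1 hx
  refine h.pi_conj (σ := {2}) (fun q _ hd h2 => ?_) he (isPiElt_two he2) (isPiElt_two h2) h1
  rw [Set.mem_singleton_iff] at h2
  subst h2
  exact (Nat.not_even_iff_odd.2 hM) (even_iff_two_dvd.2 hd)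

theorem NI.conj_mem_inv2 (h : NI M J) {e m : G} (he : e ∈ J) (he2 : e * e = 1) (hm : m ∈ M) :
    m * e * m⁻¹ ∈ inv2 M e := by
  refine mem_inv2.2 ⟨?_, ?_⟩
  · have := M.mul_mem (h.2 _ (J.inv_mem he) m hm) (M.inv_mem hm)
    simpa [mul_assoc] using this
  · calc m * e * m⁻¹ * (m * e * m⁻¹) = m * (e * e) * m⁻¹ := by group
      _ = 1 := by rw [he2]; group

theorem sm_if_le (hK : K ≤ M) (F : G → ℂ) : (sm M fun x => if x ∈ K then F x else 0) = sm K F := by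
  rw [sm_eq, sm_eq]
  refine Finset.sum_congr rfl fun x _ => ?_
  by_cases hx : x ∈ K
  · simp [hx, hK hx]
  · simp [hx]

theorem sm_conj_count {e x m : G} (hm : m ∈ M) (hx : x = m * e * m⁻¹) (c : ℂ) :
    (sm M fun y => if y * e * y⁻¹ = x then c else 0) =
      Nat.card (M ⊓ Subgroup.centralizer {e} : Subgroup G) * c := by
  rw [← sm_mul_left _ hm, ← sm_const, ← sm_if_le (inf_le_left : M ⊓ Subgroup.centralizer {e} ≤ M)]
  refine sm_congr fun y hy => ?_
  have : m * y * e * (m * y)⁻¹ = x ↔ y ∈ (M ⊓ Subgroup.centralizer {e} : Subgroup G) := by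
    rw [mem_inf_centralizer, hx]
    simp only [hy, true_and, mul_inv_rev, mul_assoc, mul_right_inj]
    constructor
    · intro e1
      have e2 : y * (e * (y⁻¹ * m⁻¹)) * (m * y) = e * m⁻¹ * (m * y) := by rw [e1]
      simpa [mul_assoc] using e2
    · intro e1
      rw [← mul_assoc y, e1]; group
  simp only [this]

theorem NI.sum_inv2 (h : NI M J) (hM : Odd (Nat.card M)) {e : G} (he : e ∈ J) (he2 : e * e = 1)
    (F : G → ℂ) : (sm M fun m => F (m * e * m⁻¹)) =
      Nat.card (M ⊓ Subgroup.centralizer {e} : Subgroup G) * ∑ x ∈ inv2 M e, F x := by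
  have h1 : ∀ m ∈ M, F (m * e * m⁻¹) = ∑ x ∈ inv2 M e, if m * e * m⁻¹ = x then F x else 0 :=
    fun m hm => by rw [Finset.sum_ite_eq, if_pos (h.conj_mem_inv2 he he2 hm)]
  rw [sm_congr h1, sm, Finset.sum_comm, Finset.mul_sum]
  refine Finset.sum_congr rfl fun x hx => ?_
  obtain ⟨m, hm, e1⟩ := h.inv2_conj hM he he2 hx
  exact sm_conj_count hm e1 (F x)

theorem NI.pow_coset (h : NI M J) {e y : G} (he : e ∈ J) (hy : e⁻¹ * y ∈ M) (k : ℕ) :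
    (e ^ k)⁻¹ * y ^ k ∈ M := by
  induction k with
  | zero => simp
  | succ k ih =>
    have h1 := M.mul_mem (h.2 _ (J.inv_mem he) _ ih) hy
    have e1 : (e ^ (k + 1))⁻¹ * y ^ (k + 1) =
        e⁻¹ * ((e ^ k)⁻¹ * y ^ k) * e⁻¹⁻¹ * (e⁻¹ * y) := by
      rw [pow_succ, pow_succ]; group
    rwa [e1]

theorem pow_odd_of_sq {e : G} (he2 : e * e = 1) {n : ℕ} (hn : Odd n) : e ^ n = e := by
  obtain ⟨k, rfl⟩ := hn
  rw [pow_succ, pow_mul, pow_two, he2, one_pow, one_mul]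

theorem NI.pow_mem_inv2 (h : NI M J) (hM : Odd (Nat.card M)) {e y : G} (he : e ∈ J)
    (he2 : e * e = 1) (hy : e⁻¹ * y ∈ M) : y ^ Nat.card M ∈ inv2 M e := by
  refine mem_inv2.2 ⟨?_, ?_⟩
  · have := h.pow_coset he hy (Nat.card M)
    rwa [pow_odd_of_sq he2 hM] at this
  · have := h.pow_coset he hy 2
    rw [pow_two, he2, inv_one, one_mul] at this
    rw [← pow_two, pow_right_comm]
    exact pow_card_of_mem this

theorem pow_coset_eq_iff (hM : Odd (Nat.card M)) {f b : G} (hf : f * f = 1) (hb : b ∈ M) :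
    (f * b) ^ Nat.card M = f ↔ b ∈ (M ⊓ Subgroup.centralizer {f} : Subgroup G) := by
  rw [mem_inf_centralizer]
  refine ⟨fun e => ⟨hb, ?_⟩, fun ⟨_, e⟩ => ?_⟩
  · have h1 : Commute (f * b) f := by
      have := Commute.pow_right (Commute.refl (f * b)) (Nat.card M)
      rwa [e] at this
    have h2 : f * b * f = f * (f * b) := h1
    rw [mul_assoc] at h2
    exact mul_left_cancel h2
  · have : Commute f b := e.symm
    rw [this.mul_pow, pow_odd_of_sq hf hM, pow_card_of_mem hb, mul_one]

theorem NI.centralizer_norm (h : NI M J) (hM : Odd (Nat.card M)) {f : G} (hf : f ∈ J)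
    (hf2 : f * f = 1) {F : G → ℂ} (hF : Cls J F) :
    Nat.card M * sm (M ⊓ Subgroup.centralizer {f}) (fun c => F (f * c)) =
      Nat.card (M ⊓ Subgroup.centralizer {f} : Subgroup G) * sm M fun b => F (f * b) := by
  have h1 : ∀ m ∈ M, (sm M fun b => if m * f * m⁻¹ = (f * b) ^ Nat.card M then F (f * b) else 0) =
      sm (M ⊓ Subgroup.centralizer {f}) fun c => F (f * c) := by
    intro m hm
    have hm1 : f⁻¹ * m * f ∈ M := by simpa using h.2 _ (J.inv_mem hf) m hm
    rw [← sm_mul_left _ hm1, ← sm_mul_right _ (M.inv_mem hm), ← sm_if_le inf_le_left]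
    refine sm_congr fun b hb => ?_
    have e1 : f * (f⁻¹ * m * f * (b * m⁻¹)) = m * (f * b) * m⁻¹ := by group
    rw [e1, conj_pow, hF m (h.1 hm) _ (J.mul_mem hf (h.1 hb))]
    have e2 : m * f * m⁻¹ = m * (f * b) ^ Nat.card M * m⁻¹ ↔
        b ∈ (M ⊓ Subgroup.centralizer {f} : Subgroup G) := by
      rw [← pow_coset_eq_iff hM hf2 hb, mul_left_inj, mul_right_inj, eq_comm]
    simp only [e2]
  rw [← sm_const, ← sm_congr h1, sm_comm, ← sm_mul_const]
  refine sm_congr fun b hb => ?_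
  obtain ⟨m, hm, e⟩ := h.inv2_conj hM hf hf2
    (h.pow_mem_inv2 hM hf hf2 (y := f * b) (by rwa [inv_mul_cancel_left]))
  exact sm_conj_count hm e _

/-- On the centralizer of an involution `f` the function `c ↦ η (f * c)` is irreducible up to
sign. -/
theorem NI.centralizer_irr (h : NI M J) (hM : Odd (Nat.card M)) (hη : Ch J η) (h1 : Irr M η) {f : G}
    (hf : f ∈ J) (hf2 : f * f = 1) : ∃ κ, Irr (M ⊓ Subgroup.centralizer {f}) κ ∧
      ((∀ c ∈ M ⊓ Subgroup.centralizer {f}, η (f * c) = κ c) ∨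
        ∀ c ∈ M ⊓ Subgroup.centralizer {f}, η (f * c) = -κ c) := by
  set C := M ⊓ Subgroup.centralizer {f} with hC
  have hCf : ∀ c ∈ C, c * f = f * c := fun c hc => (mem_inf_centralizer.1 hc).2
  have hCJ : C ≤ J := inf_le_left.trans h.1
  refine Cls.irr_or_neg (fun g hg x hx => ?_) (fun θ hθ => ?_) ?_
  · rw [← hη.cls g (hCJ hg) (f * x) (J.mul_mem hf (hCJ hx))]
    congr 1
    rw [← mul_assoc, ← mul_assoc, ← mul_assoc, hCf g hg]
  · refine (hη.mono (inf_le_left : J ⊓ Subgroup.centralizer {f} ≤ J)).ip_translate_int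
      (mem_inf_centralizer.2 ⟨hf, rfl⟩) (fun x hx => (mem_inf_centralizer.1 hx).2) hf2
      (inf_le_inf_right _ h.1) hθ.ch
  · have h2 := h.centralizer_norm hM hf hf2 (F := fun x => η x * η x⁻¹) fun g hg x hx => by
      show η (g * x * g⁻¹) * η (g * x * g⁻¹)⁻¹ = η x * η x⁻¹
      rw [hη.cls g hg x hx, conj_inv, hη.cls g hg _ (J.inv_mem hx)]
    rw [sm_coset_norm hη h.1 h1 hf, mul_comm] at h2
    have h3 := mul_right_cancel₀ (card_ne_zero' (K := M)) h2
    rw [ip_def, sm_congr (F' := fun c => η (f * c) * η (f * c)⁻¹), h3,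
      inv_mul_cancel₀ card_ne_zero']
    intro c hc
    have : f⁻¹ = f := inv_eq_of_mul_eq_one_left hf2
    rw [mul_inv_rev, this, hCf _ (C.inv_mem hc)]

end PiSep

namespace PiSep

variable {G : Type} [Group G] [Fintype G] {J H K N M L Z T P S R : Subgroup G}
  {f g χ ψ θ ρ κ η ν ν' l d D a c ω α α' β β' : G → ℂ} {σ : Set ℕ}

theorem NI.coset_mul (h : NI M J) {e f x y : G} (hf : f ∈ J) (hx : e⁻¹ * x ∈ M)
    (hy : f⁻¹ * y ∈ M) : (e * f)⁻¹ * (x * y) ∈ M := by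
  have h1 := M.mul_mem (h.2 _ (J.inv_mem hf) _ hx) hy
  have e1 : (e * f)⁻¹ * (x * y) = f⁻¹ * (e⁻¹ * x) * f⁻¹⁻¹ * (f⁻¹ * y) := by group
  rwa [e1]

theorem NI.mem_of_inv2 (h : NI M J) {e x : G} (he : e ∈ J) (hx : x ∈ inv2 M e) : x ∈ J := by
  have := J.mul_mem he (h.1 (mem_inv2.1 hx).1)
  rwa [mul_inv_cancel_left] at this

/-- The members of `inv2 M e` that commute with `f`. -/
def inv2c (M : Subgroup G) (e f : G) : Finset G := (inv2 M e).filter fun x => x * f = f * x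

theorem mem_inv2c {e f x : G} : x ∈ inv2c M e f ↔ x ∈ inv2 M e ∧ x * f = f * x := by
  simp [inv2c]

theorem inv2_symm_mul {e x y : G} (hx : x ∈ inv2 M e) (hy : y ∈ inv2 M e) :
    x * y ∈ M := by
  obtain ⟨h1, h2⟩ := mem_inv2.1 hx
  have h3 := M.mul_mem (M.inv_mem h1) (mem_inv2.1 hy).1
  have e1 : (e⁻¹ * x)⁻¹ * (e⁻¹ * y) = x⁻¹ * y := by group
  rwa [e1, inv_eq_of_mul_eq_one_left h2] at h3

theorem inv2c_mul_mem {e f x y : G} (hx : x ∈ inv2c M e f)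
    (hy : y ∈ inv2c M e f) : x * y ∈ (M ⊓ Subgroup.centralizer {f} : Subgroup G) := by
  obtain ⟨h1, h2⟩ := mem_inv2c.1 hx
  obtain ⟨h3, h4⟩ := mem_inv2c.1 hy
  refine mem_inf_centralizer.2 ⟨inv2_symm_mul h1 h3, ?_⟩
  rw [mul_assoc, h4, ← mul_assoc, h2, mul_assoc]

/-- The pairs of involutions with a prescribed odd power of their product. -/
theorem NI.sum_fiber (h : NI M J) (hM : Odd (Nat.card M)) {e₁ e₂ f : G} (h1 : e₁ ∈ J) (h2 : e₂ ∈ J)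
    (h11 : e₁ * e₁ = 1) (h22 : e₂ * e₂ = 1) (h12 : e₁ * e₂ = e₂ * e₁)
    (hf : f ∈ inv2 M (e₁ * e₂)) (F : G → ℂ) :
    (∑ x ∈ inv2 M e₁, ∑ y ∈ inv2 M e₂, if (x * y) ^ Nat.card M = f then F (x * y) else 0) =
      ∑ x ∈ inv2c M e₁ f, ∑ y ∈ inv2c M e₁ f, F (f * (x * y)) := by
  obtain ⟨hf1, hf2⟩ := mem_inv2.1 hf
  rw [show inv2c M e₁ f = (inv2 M e₁).filter fun x => x * f = f * x from rfl, Finset.sum_filter]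
  refine Finset.sum_congr rfl fun x hx => ?_
  obtain ⟨hx1, hx2⟩ := mem_inv2.1 hx
  have hxi : x⁻¹ = x := inv_eq_of_mul_eq_one_left hx2
  have hfi : f⁻¹ = f := inv_eq_of_mul_eq_one_left hf2
  have key : ∀ y ∈ inv2 M e₂, (x * y) ^ Nat.card M = f → x * f = f * x ∧ y * f = f * y := by
    intro y hy e
    have hyi : y⁻¹ = y := inv_eq_of_mul_eq_one_left (mem_inv2.1 hy).2
    have e1 : x * f * x⁻¹ = f := by
      rw [← e, ← conj_pow, e, show x * (x * y) * x⁻¹ = (x * y)⁻¹ by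
        rw [← mul_assoc, hx2, one_mul, mul_inv_rev, hyi], inv_pow, e, hfi]
    have e2 : x * f = f * x := mul_inv_eq_iff_eq_mul.1 e1
    have e3 : x * y * f = f * (x * y) := by
      have := Commute.pow_right (Commute.refl (x * y)) (Nat.card M)
      rw [e] at this
      exact this
    refine ⟨e2, mul_left_cancel (a := x) ?_⟩
    rw [← mul_assoc, e3, ← mul_assoc, ← e2, mul_assoc]
  by_cases hxf : x * f = f * x
  · rw [if_pos hxf, ← Finset.sum_filter]
    have hx' : x ∈ inv2c M e₁ f := mem_inv2c.2 ⟨hx, hxf⟩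
    refine Finset.sum_nbij' (fun y => f * y) (fun y => f * y) ?_ ?_ ?_ ?_ ?_
    · intro y hy
      obtain ⟨hy1, hy2⟩ := Finset.mem_filter.1 hy
      obtain ⟨hy3, hy4⟩ := mem_inv2.1 hy1
      have hyf := (key y hy1 hy2).2
      refine Finset.mem_filter.2 ⟨mem_inv2.2 ⟨?_, ?_⟩, ?_⟩
      · have := h.coset_mul h2 hf1 hy3
        rwa [mul_assoc, h22, mul_one] at this
      · calc f * y * (f * y) = f * (y * f) * y := by group
          _ = f * f * (y * y) := by rw [hyf]; group
          _ = 1 := by rw [hf2, hy4, one_mul]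
      · rw [mul_assoc, hyf]
    · intro y hy
      have hy' : y ∈ inv2c M e₁ f := hy
      obtain ⟨hy1, hyf⟩ := Finset.mem_filter.1 hy
      obtain ⟨hy3, hy4⟩ := mem_inv2.1 hy1
      refine Finset.mem_filter.2 ⟨mem_inv2.2 ⟨?_, ?_⟩, ?_⟩
      · have := h.coset_mul h1 hf1 hy3
        rwa [h12, mul_assoc, h11, mul_one] at this
      · calc f * y * (f * y) = f * (y * f) * y := by group
          _ = f * f * (y * y) := by rw [hyf]; group
          _ = 1 := by rw [hf2, hy4, one_mul]
      · rw [← mul_assoc, hxf, mul_assoc]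
        exact (pow_coset_eq_iff hM hf2 (inv2_symm_mul hx hy1)).2 (inv2c_mul_mem hx' hy')
    · intro y _
      rw [← mul_assoc, hf2, one_mul]
    · intro y _
      rw [← mul_assoc, hf2, one_mul]
    · intro y _
      congr 1
      rw [← mul_assoc x, hxf, mul_assoc, ← mul_assoc f f, hf2, one_mul]
  · rw [if_neg hxf]
    exact Finset.sum_eq_zero fun y hy => if_neg fun e => hxf (key y hy e).1

theorem Irr.sum_inv2c {e f : G} (h : Irr (M ⊓ Subgroup.centralizer {f}) κ) :
    ∃ r : ℝ, 0 ≤ r ∧ ∑ x ∈ inv2c M e f, ∑ y ∈ inv2c M e f, κ (x * y) = r := by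
  rcases (inv2c M e f).eq_empty_or_nonempty with h0 | ⟨z, hz⟩
  · exact ⟨0, le_rfl, by simp [h0]⟩
  have hz2 := (mem_inv2.1 (mem_inv2c.1 hz).1).2
  obtain ⟨r, hr, e1⟩ := h.posDef ((inv2c M e f).image fun x => x * z) fun a ha => by
    obtain ⟨x, hx, rfl⟩ := Finset.mem_image.1 ha
    exact inv2c_mul_mem hx hz
  refine ⟨r, hr, e1 ▸ ?_⟩
  have hi : Function.Injective fun x => x * z := fun x y e => mul_right_cancel e
  rw [Finset.sum_image fun x _ y _ e => hi e]
  refine Finset.sum_congr rfl fun x _ => ?_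
  rw [Finset.sum_image fun x _ y _ e => hi e]
  refine Finset.sum_congr rfl fun y hy => ?_
  congr 1
  have : y⁻¹ = y := inv_eq_of_mul_eq_one_left (mem_inv2.1 (mem_inv2c.1 hy).1).2
  rw [mul_inv_rev, this]
  group

/-- The sign of an invariant character on involutions in commuting cosets is multiplicative. -/
theorem NI.sign_mul (h : NI M J) (hM : Odd (Nat.card M)) (hη : Ch J η) (hi : Irr M η) {e₁ e₂ : G}
    (h1 : e₁ ∈ J) (h2 : e₂ ∈ J) (h11 : e₁ * e₁ = 1) (h22 : e₂ * e₂ = 1)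
    (h12 : e₁ * e₂ = e₂ * e₁) : ∃ r : ℝ, 0 < r ∧ η e₁ * η e₂ * η (e₁ * e₂) = r := by
  have h3 : e₁ * e₂ ∈ J := J.mul_mem h1 h2
  have h33 : e₁ * e₂ * (e₁ * e₂) = 1 := by
    rw [mul_assoc, ← mul_assoc e₂, ← h12, mul_assoc e₁, h22, mul_one, h11]
  have hd : Odd (deg η) := by
    rw [← Nat.not_even_iff_odd, even_iff_two_dvd]
    exact fun hd => Nat.not_even_iff_odd.2 hM (even_iff_two_dvd.2 (hd.trans hi.deg_dvd_card))
  have hInt : ∀ x ∈ J, x * x = 1 → ∃ k : ℤ, η x = k ∧ k ≠ 0 := by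
    intro x hx hx2
    obtain ⟨k, hk, hk2⟩ := hη.int_of_sq hx hx2
    refine ⟨k, hk, ?_⟩
    rintro rfl
    rw [zero_sub, dvd_neg] at hk2
    exact Nat.not_even_iff_odd.2 hd (even_iff_two_dvd.2 (by exact_mod_cast hk2))
  obtain ⟨k1, hk1, hn1⟩ := hInt _ h1 h11
  obtain ⟨k2, hk2, hn2⟩ := hInt _ h2 h22
  obtain ⟨k3, hk3, hn3⟩ := hInt _ h3 h33
  set C := fun e : G => (Nat.card (M ⊓ Subgroup.centralizer {e} : Subgroup G) : ℝ) with hC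
  have hCp : ∀ e, 0 < C e := fun e => Nat.cast_pos.2 Nat.card_pos
  have hfib : ∀ f ∈ inv2 M (e₁ * e₂), ∃ r : ℝ, 0 ≤ r ∧
      η (e₁ * e₂) * (∑ x ∈ inv2c M e₁ f, ∑ y ∈ inv2c M e₁ f, η (f * (x * y))) = r := by
    intro f hf
    have hfJ := h.mem_of_inv2 h3 hf
    have hf2 := (mem_inv2.1 hf).2
    obtain ⟨m, hm, e⟩ := h.inv2_conj hM h3 h33 hf
    have e3 : η (e₁ * e₂) = η f := by rw [e, hη.cls m (h.1 hm) _ h3]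
    obtain ⟨κ, hκ, hκ'⟩ := h.centralizer_irr hM hη hi hfJ hf2
    obtain ⟨r, hr, e4⟩ := hκ.sum_inv2c (e := e₁)
    have e5 : κ 1 = deg κ := hκ.ch.deg
    have e6 : η f = η (f * 1) := by rw [mul_one]
    refine ⟨deg κ * r, by positivity, ?_⟩
    push_cast
    rw [e3, ← e4, ← e5, e6]
    rcases hκ' with hκ' | hκ'
    · rw [hκ' 1 (one_mem _)]
      congr 1
      exact Finset.sum_congr rfl fun x hx => Finset.sum_congr rfl fun y hy =>
        hκ' _ (inv2c_mul_mem hx hy)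
    · rw [hκ' 1 (one_mem _), neg_mul, ← mul_neg, ← Finset.sum_neg_distrib]
      congr 1
      refine Finset.sum_congr rfl fun x hx => ?_
      rw [← Finset.sum_neg_distrib]
      refine Finset.sum_congr rfl fun y hy => ?_
      rw [hκ' _ (inv2c_mul_mem hx hy), neg_neg]
  choose! r hr0 hr using hfib
  have hsum : η 1 * (C e₁ * (C e₂ * ∑ x ∈ inv2 M e₁, ∑ y ∈ inv2 M e₂, η (x * y))) =
      Nat.card M * (Nat.card M * η e₁ * η e₂) := by
    have e4 : ∀ a ∈ M, (η 1 * sm M fun m => η (a * e₁ * a⁻¹ * (m * e₂ * m⁻¹))) =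
        Nat.card M * η e₁ * η e₂ := fun a ha => by
      rw [schur_average hη h.1 hi (J.mul_mem (J.mul_mem (h.1 ha) h1) (J.inv_mem (h.1 ha))) h2,
        hη.cls a (h.1 ha) _ h1]
    rw [← sm_const, ← sm_congr e4, sm_mul_const]
    congr 1
    have e5 : ∀ x, (sm M fun m => η (x * (m * e₂ * m⁻¹))) = C e₂ * ∑ y ∈ inv2 M e₂, η (x * y) :=
      fun x => by rw [h.sum_inv2 hM h2 h22 fun y => η (x * y)]; simp [hC]
    rw [Finset.mul_sum, sm_congr fun a _ => e5 (a * e₁ * a⁻¹),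
      h.sum_inv2 hM h1 h11 fun x => (C e₂ : ℂ) * ∑ y ∈ inv2 M e₂, η (x * y)]
    simp [hC]
  have hS : η (e₁ * e₂) * ∑ x ∈ inv2 M e₁, ∑ y ∈ inv2 M e₂, η (x * y) =
      (∑ f ∈ inv2 M (e₁ * e₂), r f : ℝ) := by
    have e4 : ∀ x ∈ inv2 M e₁, ∀ y ∈ inv2 M e₂, η (x * y) =
        ∑ f ∈ inv2 M (e₁ * e₂), if (x * y) ^ Nat.card M = f then η (x * y) else 0 := by
      intro x hx y hy
      rw [Finset.sum_ite_eq, if_pos (h.pow_mem_inv2 hM h3 h33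
        (h.coset_mul h2 (mem_inv2.1 hx).1 (mem_inv2.1 hy).1))]
    rw [Finset.sum_congr rfl fun x hx => Finset.sum_congr rfl fun y hy => e4 x hx y hy]
    have e5 : ∀ x ∈ inv2 M e₁, (∑ y ∈ inv2 M e₂, ∑ f ∈ inv2 M (e₁ * e₂),
        if (x * y) ^ Nat.card M = f then η (x * y) else 0) = ∑ f ∈ inv2 M (e₁ * e₂),
        ∑ y ∈ inv2 M e₂, if (x * y) ^ Nat.card M = f then η (x * y) else 0 :=
      fun x _ => Finset.sum_comm
    rw [Finset.sum_congr rfl e5, Finset.sum_comm, Finset.mul_sum]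
    push_cast
    refine Finset.sum_congr rfl fun f hf => ?_
    rw [h.sum_fiber hM h1 h2 h11 h22 h12 hf, hr f hf]
  refine ⟨k1 * k2 * k3, lt_of_le_of_ne ?_ ?_, ?_⟩
  · have e4 : (deg η : ℝ) * (C e₁ * (C e₂ * ∑ f ∈ inv2 M (e₁ * e₂), r f)) =
        (Nat.card M : ℝ) * Nat.card M * (k1 * k2 * k3) := by
      have e5 : (k3 : ℂ) * (η 1 * (C e₁ * (C e₂ *
          ∑ x ∈ inv2 M e₁, ∑ y ∈ inv2 M e₂, η (x * y)))) =
          k3 * (Nat.card M * (Nat.card M * η e₁ * η e₂)) := by rw [hsum]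
      rw [hk1, hk2, hη.deg] at e5
      rw [hk3] at hS
      apply Complex.ofReal_injective
      push_cast at hS ⊢
      rw [← hS]
      linear_combination e5
    have h5 : 0 ≤ (Nat.card M : ℝ) * Nat.card M * (k1 * k2 * k3) := by
      rw [← e4]
      exact mul_nonneg (Nat.cast_nonneg _) (mul_nonneg (hCp _).le (mul_nonneg (hCp _).le
        (Finset.sum_nonneg hr0)))
    have h6 : (0 : ℝ) < (Nat.card M : ℝ) * Nat.card M :=
      mul_pos (Nat.cast_pos.2 Nat.card_pos) (Nat.cast_pos.2 Nat.card_pos)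
    exact nonneg_of_mul_nonneg_right h5 h6
  · have : (k1 * k2 * k3 : ℤ) ≠ 0 := mul_ne_zero (mul_ne_zero hn1 hn2) hn3
    exact_mod_cast this.symm
  · rw [hk1, hk2, hk3]
    push_cast
    rfl

end PiSep

namespace PiSep

variable {G : Type} [Group G] [Fintype G] {J H K N M L Z T P S R : Subgroup G}
  {f g χ ψ θ ρ κ η ν ν' l d D a c ω α α' β β' : G → ℂ} {σ : Set ℕ}

/-- On the `σ`-elements of `J`, `f` is not the sum of two characters. -/
def IPi (σ : Set ℕ) (J : Subgroup G) (f : G → ℂ) : Prop :=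
  ∀ x₁ x₂, Ch J x₁ → Ch J x₂ → x₁ 1 ≠ 0 → x₂ 1 ≠ 0 →
    ¬ ∀ y ∈ J, IsPiElt σ y → f y = x₁ y + x₂ y

theorem IPi.congr (h : IPi σ J f) (e : ∀ y ∈ J, IsPiElt σ y → f y = g y) : IPi σ J g :=
  fun x₁ x₂ h1 h2 h3 h4 h5 => h x₁ x₂ h1 h2 h3 h4 fun y hy hyσ => (e y hy hyσ).trans (h5 y hy hyσ)

theorem ind_congr_pi (e : ∀ y ∈ T, IsPiElt σ y → f y = g y) {x : G} (hx : IsPiElt σ x) :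
    ind J T f x = ind J T g x := by
  rw [ind, ind]
  refine congrArg _ (sm_congr fun y _ => ?_)
  split_ifs with hy
  · exact e _ hy (isPiElt_conj hx)
  · rfl

theorem ind_one_ne_zero (h : f 1 ≠ 0) : ind J T f 1 ≠ 0 := by
  rw [ind_one]
  exact mul_ne_zero (div_ne_zero card_ne_zero' card_ne_zero') h

theorem IPi.of_ind (h : IPi σ J (ind J T f)) (hT : T ≤ J) : IPi σ T f := by
  intro x₁ x₂ h1 h2 h3 h4 h5
  refine h _ _ (h1.ind hT) (h2.ind hT) (ind_one_ne_zero h3) (ind_one_ne_zero h4) fun y _ hyσ => ?_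
  rw [ind_congr_pi (g := x₁ + x₂) h5 hyσ, ind_add]
  rfl

theorem IPi.irr (h : IPi σ J χ) (hχ : Ch J χ) (h1 : χ 1 ≠ 0) : Irr J χ := by
  obtain ⟨θ, hθ, hc⟩ := hχ.exists_const h1
  refine hχ.irr_of_const hθ hc (by_contra fun hne => ?_)
  exact h θ (χ - θ) hθ.ch (hχ.sub hθ hc) hθ.one_ne_zero (by simpa [sub_eq_zero] using hne)
    fun y _ _ => by simp

theorem Irr.inv (h : Irr J θ) : Irr J fun x => θ x⁻¹ := by
  refine irr_iff.2 ⟨h.ch.inv, ?_⟩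
  rw [← h.ip_self, ip_def, ip_def, ← sm_inv fun x => θ x * θ x⁻¹]

theorem IPi.exists_conj (hi : IPi σ J f) (hJ : Sep σ J) (hf : Loc σ J f) (h : NI L J)
    (hLσ : IsPiNumber σ (Nat.card L)) (hθ : Irr L θ) (hc : ip L f θ ≠ 0) (hκ : Irr L κ)
    (hc' : ip L f κ ≠ 0) : ∃ y ∈ J, ∀ x ∈ L, κ x = cj y θ x := by
  by_contra! hn
  obtain ⟨x1, x2, h1, h2, h3, h4, h5⟩ := hf.exists_split hJ h hLσ hθ hc hκ hc' fun y hy =>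
    hκ.ip_eq_zero (h.irr_cj hy hθ) fun e => by
      obtain ⟨x, hx, hne⟩ := hn y hy
      exact hne (e x hx)
  exact hi x1 x2 h1 h2 h3 h4 h5

theorem IPi.sq_eq (hi : IPi σ J f) (h2 : 2 ∈ σ) (hJ : Sep σ J) (hf : Loc σ J f) (h : NI L J)
    (hLσ : IsPiNumber σ (Nat.card L)) {n : ℕ} (hn : f 1 = n) (hnσ : IsPiNumber σᶜ n)
    (hr : ∀ y ∈ L, f y⁻¹ = f y) : ∀ y ∈ L, f (y * y) = f 1 := by
  have hfL : Ch L f := hf.2 L h.1 hLσ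
  have hm : ∀ θ ∈ irrs L, ∃ m : ℕ, ip L f θ = m := fun θ hθ => hfL.ip_nat (mem_irrs.1 hθ).1.ch
  choose! m hm using hm
  have hsum : n = ∑ θ ∈ irrs L, m θ * deg θ := by
    have := hfL.cls.expand 1 L.one_mem
    rw [hn] at this
    have e : (n : ℂ) = ((∑ θ ∈ irrs L, m θ * deg θ : ℕ) : ℂ) := by
      rw [this, Nat.cast_sum]
      refine Finset.sum_congr rfl fun θ hθ => ?_
      rw [Nat.cast_mul, ← hm θ hθ, (mem_irrs.1 hθ).1.ch.deg]
    exact_mod_cast e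
  have hinv : ∀ θ ∈ irrs L, (fun x => θ x⁻¹) ∈ irrs L := fun θ hθ =>
    mem_irrs.2 ⟨(mem_irrs.1 hθ).1.inv, fun x hx =>
      (mem_irrs.1 hθ).2 _ fun hx' => hx (L.inv_mem_iff.1 hx')⟩
  have hminv : ∀ θ ∈ irrs L, m (fun x => θ x⁻¹) = m θ := by
    intro θ hθ
    have : ip L f (fun x => θ x⁻¹) = ip L f θ := by
      rw [ip_def, ip_def, ← sm_inv fun x => f x * θ x⁻¹]
      refine congrArg _ (sm_congr fun x hx => ?_)
      rw [hr x hx]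
    rw [hm θ hθ, hm _ (hinv θ hθ)] at this
    exact_mod_cast this
  have hdinv : ∀ θ : G → ℂ, deg (fun x => θ x⁻¹) = deg θ := fun θ => by simp [deg]
  obtain ⟨θ, hθ, hθr, hθm⟩ : ∃ θ ∈ irrs L, (fun x => θ x⁻¹) = θ ∧ m θ ≠ 0 := by
    by_contra! hc
    have e : ((∑ θ ∈ irrs L, m θ * deg θ : ℕ) : ZMod 2) = 0 := by
      rw [Nat.cast_sum]
      refine Finset.sum_involution (fun θ _ => fun x => θ x⁻¹) ?_ ?_ hinv ?_
      · intro θ hθ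
        rw [hminv θ hθ, hdinv]
        exact CharTwo.add_self_eq_zero _
      · intro θ hθ hne e
        exact hne (by rw [hc θ hθ e, zero_mul, Nat.cast_zero])
      · intro θ _
        simp
    rw [← hsum, ZMod.natCast_eq_zero_iff] at e
    exact hnσ 2 Nat.prime_two e h2
  have hθ1 := (mem_irrs.1 hθ).1
  have hne : ip L f θ ≠ 0 := by rw [hm θ hθ]; exact_mod_cast hθm
  have hconj : ∀ κ ∈ irrs L, ip L f κ ≠ 0 → ∃ y ∈ J, ∀ x ∈ L, κ x = cj y θ x := fun κ hκ hc =>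
    hi.exists_conj hJ hf h hLσ hθ1 hne (mem_irrs.1 hκ).1 hc
  have hdvd : deg θ ∣ n := by
    rw [hsum]
    refine Finset.dvd_sum fun κ hκ => ?_
    by_cases hc : ip L f κ = 0
    · rw [hm κ hκ, Nat.cast_eq_zero] at hc
      rw [hc, zero_mul]
      exact dvd_zero _
    · obtain ⟨y, _, e⟩ := hconj κ hκ hc
      rw [deg_congr (e 1 L.one_mem), deg_cj]
      exact dvd_mul_left _ _
  have hd1 : deg θ = 1 :=
    Nat.eq_one_of_dvd_coprimes (hLσ.coprime hnσ) hθ1.deg_dvd_card hdvd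
  have hlin : Lin L θ := hθ1.ch.lin_of_degree_one (by rw [hθ1.ch.deg, hd1, Nat.cast_one])
  have hsq : ∀ y ∈ L, θ (y * y) = 1 := fun y hy => by
    have e : θ y⁻¹ = θ y := congrFun hθr y
    rw [hlin.2 y hy y hy]
    nth_rw 2 [← e]
    rw [← hlin.2 y hy _ (L.inv_mem hy), mul_inv_cancel, hlin.1]
  intro y hy
  rw [hfL.cls.expand _ (L.mul_mem hy hy), hfL.cls.expand 1 L.one_mem]
  refine Finset.sum_congr rfl fun κ hκ => ?_
  by_cases hc : ip L f κ = 0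
  · rw [hc, zero_mul, zero_mul]
  · obtain ⟨z, hz, e⟩ := hconj κ hκ hc
    rw [e _ (L.mul_mem hy hy), e 1 L.one_mem, cj_apply_one, hlin.1, cj,
      show z * (y * y) * z⁻¹ = z * y * z⁻¹ * (z * y * z⁻¹) by group, hsq _ (h.2 z hz y hy)]

theorem IPi.exists_sign (hi : IPi σ J f) (hJ : Sep σ J) (hf : Loc σ J f) (h : NI L J)
    (hLσ : IsPiNumber σ (Nat.card L))
    (hs : ∀ y ∈ L, ∀ z ∈ L, ∃ r : ℝ, 0 < r ∧ f y * f z * f (y * z) = r) :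
    ∃ μ, Lin L μ ∧ (∀ y ∈ L, μ y * μ y = 1) ∧ ∀ y ∈ L, f y = f 1 * μ y := by
  have hfL : Ch L f := hf.2 L h.1 hLσ
  have h1 : f 1 = deg f := hfL.deg
  obtain ⟨r1, hr1, e1⟩ := hs 1 L.one_mem 1 L.one_mem
  have hd : (0 : ℝ) < deg f := by
    rw [Nat.cast_pos, Nat.pos_iff_ne_zero]
    intro e
    rw [h1, e, Nat.cast_zero, zero_mul, zero_mul] at e1
    exact hr1.ne (Complex.ofReal_injective (by simpa using e1))
  have hre : ∀ y ∈ L, ∃ s : ℝ, f y = s := by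
    intro y hy
    obtain ⟨r, hr, e⟩ := hs y hy 1 L.one_mem
    rw [mul_one, h1] at e
    have e2 : f y ^ 2 = ((r / deg f : ℝ) : ℂ) := by
      have : (deg f : ℂ) ≠ 0 := by exact_mod_cast hd.ne'
      push_cast
      rw [eq_div_iff this]
      linear_combination e
    have hp : 0 ≤ r / deg f := (div_pos hr hd).le
    rw [← Real.sq_sqrt hp, Complex.ofReal_pow, sq_eq_sq_iff_eq_or_eq_neg] at e2
    rcases e2 with e2 | e2
    · exact ⟨_, e2⟩
    · exact ⟨-√(r / deg f), by rw [e2, Complex.ofReal_neg]⟩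
  choose! s hsr using hre
  have hpos : ∀ y ∈ L, ∀ z ∈ L, 0 < s y * s z * s (y * z) := by
    intro y hy z hz
    obtain ⟨r, hr, e⟩ := hs y hy z hz
    rw [hsr y hy, hsr z hz, hsr _ (L.mul_mem hy hz)] at e
    have : s y * s z * s (y * z) = r := by exact_mod_cast e
    rwa [this]
  have hs1 : 0 < s 1 := by
    have := hsr 1 L.one_mem
    rw [h1] at this
    have : (deg f : ℝ) = s 1 := by exact_mod_cast this
    rwa [← this]
  have hs0 : ∀ y ∈ L, s y ≠ 0 := fun y hy e => by
    have := hpos y hy y hy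
    rw [e, zero_mul, zero_mul] at this
    exact this.ne rfl
  have hsig : ∀ y ∈ L, (SignType.sign (s y) : ℝ) * SignType.sign (s y) = 1 := fun y hy => by
    rcases lt_or_gt_of_ne (hs0 y hy) with h0 | h0
    · simp [sign_neg h0]
    · simp [sign_pos h0]
  set μ : G → ℂ := fun y => ((SignType.sign (s y) : ℝ) : ℂ) with hμ
  have hμ2 : ∀ y ∈ L, μ y * μ y = 1 := fun y hy => by
    simp only [hμ]
    rw [← Complex.ofReal_mul, hsig y hy, Complex.ofReal_one]
  have hlin : Lin L μ := by
    refine ⟨by simp [hμ, sign_pos hs1], fun y hy z hz => ?_⟩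
    have e := sign_pos (hpos y hy z hz)
    rw [sign_mul, sign_mul] at e
    have e2 : μ y * μ z * μ (y * z) = 1 := by
      have := congrArg (fun t : SignType => ((t : ℝ) : ℂ)) e
      simpa [hμ] using this
    calc μ (y * z) = μ y * μ y * (μ z * μ z) * μ (y * z) := by
          rw [hμ2 y hy, hμ2 z hz, one_mul, one_mul]
      _ = μ y * μ z * (μ y * μ z * μ (y * z)) := by ring
      _ = μ y * μ z := by rw [e2, mul_one]
  have hinv : ∀ y ∈ L, μ y⁻¹ = μ y := fun y hy => by
    rw [hlin.inv_apply hy]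
    exact inv_eq_of_mul_eq_one_left (hμ2 y hy)
  have hne : ip L f μ ≠ 0 := by
    have e : ∀ y ∈ L, f y * μ y⁻¹ = ((|s y| : ℝ) : ℂ) := fun y hy => by
      rw [hinv y hy, hsr y hy, ← Complex.ofReal_mul, mul_comm, sign_mul_self]
    rw [ip_def, sm_congr e, sm, ← Complex.ofReal_sum]
    refine mul_ne_zero (inv_ne_zero card_ne_zero') (Complex.ofReal_ne_zero.2 (ne_of_gt ?_))
    exact Finset.sum_pos (fun y _ => abs_pos.2 (hs0 y y.2)) ⟨1, Finset.mem_univ _⟩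
  have hμi : Irr L μ := hlin.irr
  have hcj : ∀ g ∈ J, ∀ y ∈ L, cj g μ y = μ y := by
    intro g hg y hy
    have e := hf.1 g hg y (h.1 hy) (isPiElt_of_mem hLσ hy)
    rw [hsr y hy, hsr _ (h.2 g hg y hy)] at e
    simp only [hμ, cj, Complex.ofReal_injective e]
  refine ⟨μ, hlin, hμ2, ?_⟩
  have key : ∀ y ∈ L, f y = ip L f μ * μ y := by
    intro y hy
    rw [hfL.cls.expand y hy, Finset.sum_eq_single (trunc L μ),
      ip_congr (fun _ _ => rfl) fun x hx => trunc_apply hx, trunc_apply hy]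
    · intro κ hκ hne'
      by_contra hc'
      have hc := left_ne_zero_of_mul hc'
      refine hne' ?_
      obtain ⟨g, hg, e⟩ := hi.exists_conj hJ hf h hLσ hμi hne (mem_irrs.1 hκ).1 hc
      ext x
      by_cases hx : x ∈ L
      · rw [e x hx, hcj g hg x hx, trunc_apply hx]
      · rw [(mem_irrs.1 hκ).2 x hx, (mem_irrs.1 hμi.trunc_mem).2 x hx]
    · exact fun hn => (hn hμi.trunc_mem).elim
  intro y hy
  have e1 := key 1 L.one_mem
  rw [hlin.1, mul_one] at e1
  rw [key y hy, ← e1]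

end PiSep

namespace PiSep

variable {G : Type} [Group G] [Fintype G] {J H K N M L Z T P S R : Subgroup G}
  {f g χ ψ θ ρ κ η ν ν' l d D a c ω α α' β β' : G → ℂ} {σ : Set ℕ}

theorem layer_setup [M.Normal] (h : NI L J) (hML : M ≤ L) (hM : IsPiNumber σᶜ (Nat.card M))
    (hi : IsPiNumber σ (M.relIndex L)) (hJ : Sep σ J) (hβ : Sp σᶜ J β) (hI : IPi σ J β)
    (hη : Irr L η) (hc : ip L β η ≠ 0) :
    ∃ (k : ℕ) (f : G ⧸ M → ℂ) (T : Subgroup (G ⧸ M)) (n : ℕ), k ≠ 0 ∧ Sep σ T ∧ Loc σ T f ∧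
      IPi σ T f ∧ NI (L.map (QuotientGroup.mk' M)) T ∧
      IsPiNumber σ (Nat.card (L.map (QuotientGroup.mk' M))) ∧ f 1 = n ∧ IsPiNumber σᶜ n ∧
      ∀ x ∈ L, IsPiElt σ x → f (QuotientGroup.mk' M x) = k * η x := by
  obtain ⟨ζ, hζ, hc1, hc2⟩ := h.clifford_exists hβ.1 hη hc
  have hind := (h.clifford_ind hβ.1 hη hζ hc1 hc2).1
  have hT := h.stab_ni hη.cls
  have hIζ : IPi σ (stab J L η) ζ :=
    (hI.congr (g := ind J (stab J L η) ζ) fun y hy _ => (hind y hy).symm).of_ind stab_le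
  obtain ⟨k, hk⟩ := (hζ.ch.mono hT.1).ip_nat hη.ch
  have hζL : ∀ x ∈ L, ζ x = k * η x := fun x hx => by
    rw [← hk]; exact hT.clifford_inv hζ hη hc2 h.stab_inv x hx
  obtain ⟨f, hf, hfζ⟩ := (hζ.ch.loc (σ := σ)).exists_quotient (p := QuotientGroup.mk' M)
    (by rw [QuotientGroup.ker_mk']; exact hM.dvd (Subgroup.card_dvd_of_le inf_le_left))
  have hfζ1 : f 1 = ζ 1 := by
    rw [← hfζ 1 (one_mem _) (by simp [IsPiElt, IsPiNumber.one]), map_one]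
  refine ⟨k, f, (stab J L η).map (QuotientGroup.mk' M), deg ζ, ?_, (hJ.mono stab_le).map, hf,
    fun x1 x2 h1 h2 h3 h4 h5 => ?_, hT.map, ?_, by rw [hfζ1, hζ.ch.deg], ?_, ?_⟩
  · rintro rfl
    exact hc2 (by rw [hk, Nat.cast_zero])
  · exact hIζ _ _ h1.of_map h2.of_map (by simpa using h3) (by simpa using h4) fun y hy hyσ => by
      rw [← hfζ y hy hyσ, h5 _ (Subgroup.mem_map_of_mem _ hy) (isPiElt_map hyσ)]
  · have h1 := card_map_mul_ker (p := QuotientGroup.mk' M) (Λ := L)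
    rw [QuotientGroup.ker_mk', inf_eq_left.2 hML, ← card_mul_relIndex hML, mul_comm] at h1
    rw [Nat.eq_of_mul_eq_mul_left Nat.card_pos h1]
    exact hi
  · refine hβ.2.1.dvd ⟨(stab J L η).relIndex J, ?_⟩
    have h1 := hind 1 J.one_mem
    rw [ind_one, ← card_mul_relIndex (stab_le : stab J L η ≤ J), hβ.1.ch.deg, hζ.ch.deg,
      Nat.cast_mul, mul_div_cancel_left₀ _ card_ne_zero'] at h1
    rw [mul_comm]
    exact_mod_cast h1.symm
  · intro x hx hxσ
    rw [hfζ x (hT.1 hx) hxσ, hζL x hx]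

theorem exists_mem_complement [M.Normal] {E : Subgroup G} (hE : M ⊔ E = L) {y : G ⧸ M}
    (hy : y ∈ L.map (QuotientGroup.mk' M)) : ∃ x ∈ E, QuotientGroup.mk' M x = y := by
  rw [← hE, Subgroup.map_sup, (Subgroup.map_eq_bot_iff M).2 (by rw [QuotientGroup.ker_mk']),
    bot_sup_eq] at hy
  exact hy

theorem layer_sq [M.Normal] (h2 : 2 ∈ σ) (h : NI L J) (hML : M ≤ L)
    (hM : IsPiNumber σᶜ (Nat.card M)) (hi : IsPiNumber σ (M.relIndex L)) (hJ : Sep σ J)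
    (hβ : Sp σᶜ J β) (hI : IPi σ J β) (hη : Irr L η) (hc : ip L β η ≠ 0) {E : Subgroup G}
    (hE : M ⊔ E = L) (hEσ : IsPiNumber σ (Nat.card E)) : ∀ x ∈ E, η (x * x) = η 1 := by
  obtain ⟨k, f, T, n, hk, hT, hf, hIf, hLT, hLσ, hn, hnσ, hfη⟩ :=
    layer_setup h hML hM hi hJ hβ hI hη hc
  have hEL : E ≤ L := hE ▸ le_sup_right
  have hη' := hβ.const h hη hc
  have hk' : (k : ℂ) ≠ 0 := Nat.cast_ne_zero.2 hk
  have hfE : ∀ x ∈ E, f (QuotientGroup.mk' M x) = k * η x := fun x hx =>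
    hfη x (hEL hx) (isPiElt_of_mem hEσ hx)
  have h1 := hIf.sq_eq h2 hT hf hLT hLσ hn hnσ fun y hy => by
    obtain ⟨x, hx, rfl⟩ := exists_mem_complement hE hy
    rw [← map_inv, hfE _ (E.inv_mem hx), hfE x hx,
      hη'.real (hJ.mono h.1) (hEL hx) (isPiElt_of_mem hEσ hx)]
  intro x hx
  have h3 := h1 _ (Subgroup.mem_map_of_mem _ (hEL hx))
  have h4 : f 1 = k * η 1 := by rw [← hfE 1 E.one_mem, map_one]
  rw [← map_mul, hfE _ (E.mul_mem hx hx), h4] at h3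
  exact mul_left_cancel₀ hk' h3

theorem odd_of_isPiNumber_compl (h2 : 2 ∈ σ) {n : ℕ} (h : IsPiNumber σᶜ n) : Odd n := by
  rw [← Nat.not_even_iff_odd, even_iff_two_dvd]
  exact fun hd => h 2 Nat.prime_two hd h2

theorem layer_eq_one [M.Normal] (h2 : 2 ∈ σ) (h : NI L J) (hML : M ≤ L)
    (hM : IsPiNumber σᶜ (Nat.card M)) (hi : IsPiNumber σ (M.relIndex L)) (hJ : Sep σ J)
    (hβ : Sp σᶜ J β) (hI : IPi σ J β) (hη : Irr L η) (hc : ip L β η ≠ 0) {E : Subgroup G}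
    (hE : M ⊔ E = L) (hEσ : IsPiNumber σ (Nat.card E)) (hsq : ∀ x ∈ E, x * x = 1) :
    ∀ x ∈ E, η x = η 1 := by
  obtain ⟨k, f, T, n, hk, hT, hf, hIf, hLT, hLσ, hn, hnσ, hfη⟩ :=
    layer_setup h hML hM hi hJ hβ hI hη hc
  have hEL : E ≤ L := hE ▸ le_sup_right
  have hη' := hβ.const h hη hc
  have hk' : (k : ℂ) ≠ 0 := Nat.cast_ne_zero.2 hk
  have hfE : ∀ x ∈ E, f (QuotientGroup.mk' M x) = k * η x := fun x hx =>
    hfη x (hEL hx) (isPiElt_of_mem hEσ hx)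
  have hNI : NI M L := ⟨hML, fun g _ n hn => ‹M.Normal›.conj_mem n hn g⟩
  have hηM : Irr M η := hNI.irr_restrict hη hη'.2.1 (by rwa [compl_compl])
  have hcomm : ∀ x ∈ E, ∀ y ∈ E, x * y = y * x := fun x hx y hy => by
    have e1 : x⁻¹ = x := inv_eq_of_mul_eq_one_left (hsq x hx)
    have e2 : y⁻¹ = y := inv_eq_of_mul_eq_one_left (hsq y hy)
    have e3 : (x * y)⁻¹ = x * y := inv_eq_of_mul_eq_one_left (hsq _ (E.mul_mem hx hy))
    rw [← e3, mul_inv_rev, e1, e2]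
  obtain ⟨μ, hμ, hμ2, hfμ⟩ := hIf.exists_sign hT hf hLT hLσ fun y hy z hz => by
    obtain ⟨x, hx, rfl⟩ := exists_mem_complement hE hy
    obtain ⟨w, hw, rfl⟩ := exists_mem_complement hE hz
    obtain ⟨r, hr, e⟩ := hNI.sign_mul (odd_of_isPiNumber_compl h2 hM) hη.ch hηM (hEL hx) (hEL hw)
      (hsq x hx) (hsq w hw) (hcomm x hx w hw)
    refine ⟨k ^ 3 * r, mul_pos (pow_pos (Nat.cast_pos.2 (Nat.pos_of_ne_zero hk)) 3) hr, ?_⟩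
    rw [← map_mul, hfE x hx, hfE w hw, hfE _ (E.mul_mem hx hw)]
    push_cast
    rw [← e]
    ring
  set m : G → ℂ := fun x => μ (QuotientGroup.mk' M x) with hm
  have hmE : Lin E m := ⟨by simp [hm, hμ.1], fun x hx y hy => by
    simp only [hm]
    rw [map_mul, hμ.2 _ (Subgroup.mem_map_of_mem _ (hEL hx)) _
      (Subgroup.mem_map_of_mem _ (hEL hy))]⟩
  have hm2 : ∀ x ∈ E, m x * m x = 1 := fun x hx => hμ2 _ (Subgroup.mem_map_of_mem _ (hEL hx))
  have hmodd : ∀ x ∈ E, ∀ j, Odd j → m x ^ j = m x := by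
    rintro x hx _ ⟨j, rfl⟩
    rw [pow_succ, pow_mul, pow_two, hm2 x hx, one_pow, one_mul]
  have hηm : ∀ x ∈ E, η x = deg η * m x := by
    intro x hx
    have e1 := hfμ _ (Subgroup.mem_map_of_mem _ (hEL hx))
    have e2 : f 1 = k * η 1 := by rw [← hfE 1 E.one_mem, map_one]
    rw [hfE x hx, e2, mul_assoc] at e1
    rw [mul_left_cancel₀ hk' e1, hη.ch.deg]
  obtain ⟨d, hd, j, hj0, hj, hdj⟩ := hη'.piDet
  have hd' : ∀ x ∈ E, d x = m x := fun x hx => by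
    rw [HasDet.unique (hd.mono hEL) ((hmE.hasDet.nsmul (PiSep.deg η)).congr
      (fun y hy => (hηm y hy).symm) fun _ _ => rfl) x hx]
    exact hmodd x hx _ (odd_of_isPiNumber_compl h2 hη'.2.1)
  intro x hx
  have e : m x = 1 := by
    rw [← hmodd x hx j (odd_of_isPiNumber_compl h2 hj), ← hd' x hx, hdj x (hEL hx)]
  rw [hηm x hx, e, mul_one, hη.ch.deg]

/-- The kernel of a character. -/
def kerSub (h : Ch (⊤ : Subgroup G) χ) : Subgroup G where
  carrier := {x | χ x = χ 1}
  one_mem' := rfl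
  mul_mem' {x y} hx hy := (h.kernel trivial hx trivial).trans hy
  inv_mem' {x} hx := by
    have := h.kernel trivial hx (x := x⁻¹) trivial
    rw [mul_inv_cancel] at this
    exact this.symm

theorem mem_kerSub (h : Ch (⊤ : Subgroup G) χ) {x : G} : x ∈ kerSub h ↔ χ x = χ 1 := Iff.rfl

theorem kerSub_normal (h : Ch (⊤ : Subgroup G) χ) : (kerSub h).Normal :=
  ⟨fun x hx g => by rw [mem_kerSub, h.cls g trivial x trivial]; exact hx⟩

theorem eq_of_consts (hχ : Cls J χ) (hL : L ≤ J) {x y : G} (hx : x ∈ L) (hy : y ∈ L)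
    (h : ∀ η, Irr L η → ip L χ η ≠ 0 → η x = η y) : χ x = χ y := by
  rw [(hχ.mono hL).expand x hx, (hχ.mono hL).expand y hy]
  refine Finset.sum_congr rfl fun η hη => ?_
  by_cases hc : ip L χ η = 0
  · rw [hc, zero_mul, zero_mul]
  · rw [h η (mem_irrs.1 hη).1 hc]

theorem exists_max_compl (σ : Set ℕ) (J : Subgroup G) : ∃ M, NI M J ∧ IsPiNumber σ (Nat.card M) ∧
    ∀ L, NI L J → IsPiNumber σ (Nat.card L) → Nat.card L ≤ Nat.card M := by
  obtain ⟨M, hM, h⟩ := Finset.exists_max_image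
    (Finset.univ.filter fun M : Subgroup G => NI M J ∧ IsPiNumber σ (Nat.card M))
    (fun M => Nat.card M) ⟨⊥, by simp [NI.bot, IsPiNumber.one]⟩
  simp only [Finset.mem_filter, Finset.mem_univ, true_and] at hM h
  exact ⟨M, hM.1, hM.2, fun L h1 h2 => h L ⟨h1, h2⟩⟩

theorem deg_eq_one_aux (h2 : 2 ∈ σ) (n : ℕ) : ∀ (G : Type) [Group G] [Fintype G] (β : G → ℂ),
    Nat.card G = n → Sep σ (⊤ : Subgroup G) → Sp σᶜ (⊤ : Subgroup G) β → IPi σ ⊤ β →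
      deg β = 1 := by
  induction n using Nat.strong_induction_on with
  | _ n ih =>
  intro G _ _ β hn hJ hβ hI
  by_cases hK : kerSub hβ.1.ch = ⊥
  · obtain ⟨M, hMN, hM, hmax⟩ := exists_max_compl σᶜ (⊤ : Subgroup G)
    by_cases hMT : M = ⊤
    · subst hMT
      by_contra hd
      have hd0 := hβ.1.deg_pos
      obtain ⟨j, hj⟩ : ∃ j, deg β = j + 2 := ⟨deg β - 2, by omega⟩
      have h1 : Ch (⊤ : Subgroup G) 1 := Ch.one
      have h3 : Ch (⊤ : Subgroup G) fun _ => ((j + 1 : ℕ) : ℂ) := by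
        have := (Lin.one (J := (⊤ : Subgroup G))).hasDet.nsmul (j + 1)
        refine this.ch.congr fun x _ => by simp
      refine hI _ _ h1 h3 (by simp) (Nat.cast_ne_zero.2 (by omega)) fun y hy hyσ => ?_
      have : y = 1 := by
        rw [← orderOf_eq_one_iff]
        exact Nat.eq_one_of_dvd_coprimes (IsPiNumber.coprime hyσ hM) dvd_rfl
          (orderOf_dvd_of_pow_eq_one (pow_card_of_mem hy))
      rw [this, hβ.1.ch.deg, hj]
      push_cast
      simp only [Pi.one_apply]
      ring
    · obtain ⟨L, hL, hML, hne, ht⟩ := hJ.step_up hMN hMT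
      have hi : IsPiNumber σ (M.relIndex L) := ht.resolve_right fun ht => hne <|
        Subgroup.eq_of_le_of_card_ge hML <| hmax L hL <| by
          rw [← card_mul_relIndex hML]; exact hM.mul ht
      have hMn : M.Normal := ⟨fun n hn g => hMN.2 g trivial n hn⟩
      obtain ⟨E, hEL, -, hE, hEc⟩ := (hMN.mono hL.1 hML).exists_complement
        (hi.coprime hM).symm
      have hEσ : IsPiNumber σ (Nat.card E) := hEc ▸ hi
      have hsq : ∀ x ∈ E, x * x = 1 := fun x hx => by
        have : x * x ∈ kerSub hβ.1.ch := eq_of_consts hβ.1.cls hL.1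
          (L.mul_mem (hEL hx) (hEL hx)) L.one_mem fun η hη hc =>
            layer_sq h2 hL hML hM hi hJ hβ hI hη hc hE hEσ x hx
        rwa [hK, Subgroup.mem_bot] at this
      have hE1 : E = ⊥ := le_bot_iff.1 fun x hx => by
        rw [← hK]
        exact eq_of_consts hβ.1.cls hL.1 (hEL hx) L.one_mem fun η hη hc =>
          layer_eq_one h2 hL hML hM hi hJ hβ hI hη hc hE hEσ hsq x hx
      exact (hne (by rw [← hE, hE1, sup_bot_eq])).elim
  · have := kerSub_normal hβ.1.ch
    set K := kerSub hβ.1.ch with hKdef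
    obtain ⟨f, hf⟩ := exists_descend (p := QuotientGroup.mk' K) (L := ⊤) β fun x _ y _ e => by
      have h1 : y * x⁻¹ ∈ K := by
        have := QuotientGroup.eq.1 e
        have h3 := ‹K.Normal›.conj_mem _ this x
        rwa [← mul_assoc, mul_inv_cancel, one_mul] at h3
      rw [← hβ.1.ch.kernel trivial h1 (x := x) trivial, inv_mul_cancel_right]
    have hf' : β = fun x => f (QuotientGroup.mk' K x) := funext fun x => (hf x trivial).symm
    have ht : (⊤ : Subgroup G).map (QuotientGroup.mk' K) = ⊤ :=
      Subgroup.map_top_of_surjective _ (QuotientGroup.mk'_surjective K)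
    rw [hf', deg_comp (p := QuotientGroup.mk' K)]
    refine ih (Nat.card (G ⧸ K)) ?_ (G ⧸ K) f rfl (ht ▸ hJ.map) (ht ▸ Sp.map (hf' ▸ hβ)) ?_
    · rw [← hn, K.card_eq_card_quotient_mul_card_subgroup]
      refine lt_mul_of_one_lt_right Nat.card_pos ?_
      exact Subgroup.one_lt_card_iff_ne_bot K |>.2 hK
    · intro x1 x2 h1 h3 h4 h5 h6
      rw [← ht] at h1 h3
      exact hI _ _ h1.of_map h3.of_map (by simpa using h4) (by simpa using h5) fun y _ hyσ => by
        rw [← hf y trivial, h6 _ trivial (isPiElt_map hyσ)]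

/-- When `2 ∈ σ`, a `σᶜ`-special character with irreducible restriction to the `σ`-elements is
linear. -/
theorem IPi.deg_eq_one (hI : IPi σ J β) (h2 : 2 ∈ σ) (hJ : Sep σ J) (hβ : Sp σᶜ J β) :
    deg β = 1 := by
  have e : (⊤ : Subgroup J).map J.subtype = J := by
    rw [← MonoidHom.range_eq_map, Subgroup.range_subtype]
  rw [← deg_comp (p := J.subtype)]
  refine deg_eq_one_aux h2 _ J _ rfl (hJ.comap e (Or.inl ?_)) (Sp.of_map (e.symm ▸ hβ)) ?_
  · rw [Subgroup.ker_subtype, bot_inf_eq, Subgroup.card_bot]; exact .one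
  · intro x1 x2 h1 h3 h4 h5 h6
    obtain ⟨f1, hf1⟩ := exists_descend (p := J.subtype) (L := ⊤) x1 fun x _ y _ e => by
      rw [Subtype.ext e]
    obtain ⟨f2, hf2⟩ := exists_descend (p := J.subtype) (L := ⊤) x2 fun x _ y _ e => by
      rw [Subtype.ext e]
    have h7 : Ch J f1 := e ▸ ch_map.2 (h1.congr fun x hx => (hf1 x hx).symm)
    have h8 : Ch J f2 := e ▸ ch_map.2 (h3.congr fun x hx => (hf2 x hx).symm)
    refine hI f1 f2 h7 h8 ?_ ?_ fun y hy hyσ => ?_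
    · rwa [← _root_.map_one J.subtype, hf1 1 trivial]
    · rwa [← _root_.map_one J.subtype, hf2 1 trivial]
    · have h9 := h6 ⟨y, hy⟩ trivial (by rwa [IsPiElt, Subgroup.orderOf_mk])
      rw [← hf1 _ trivial, ← hf2 _ trivial] at h9
      exact h9

end PiSep

namespace PiSep

variable {G : Type} [Group G] [Fintype G] {J H K N M L Z T P S R : Subgroup G}
  {f g χ ψ θ ρ κ η ν ν' l d D a c ω α α' β β' : G → ℂ} {σ : Set ℕ}

/-- The determinant of a character of `σ`-degree can be made a `σ`-number by a linear twist. -/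
theorem Ch.exists_twist (h : Ch J ρ) (hn : IsPiNumber σ (PiSep.deg ρ)) :
    ∃ l, Lin J l ∧ PiOrd σᶜ J l ∧ PiDet σ J (ρ * l⁻¹) := by
  obtain ⟨d, hd⟩ := h.exists_det
  obtain ⟨a, b, hab, ha, hb⟩ := exists_split_card σ J
  have h0 : a * b ≠ 0 := hab ▸ Nat.card_pos.ne'
  obtain ⟨k, hk0, hk1⟩ := Nat.chineseRemainder ((ha.mul hn).coprime hb) 0 1
  obtain ⟨m, rfl⟩ := (Nat.modEq_zero_iff_dvd).1 hk0
  have hz : ∀ x ∈ J, (d x ^ a) ^ b = 1 := fun x hx => by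
    rw [← pow_mul, ← hab]; exact hd.pow_card hx
  have hl := hd.lin.pow (a * m)
  refine ⟨d ^ (a * m), hl, ⟨b, right_ne_zero_of_mul h0, hb, fun x hx => ?_⟩, _,
    hd.mul_lin hl.inv h.deg, a, left_ne_zero_of_mul h0, ha, fun x hx => ?_⟩
  · rw [Pi.pow_apply, ← pow_mul, mul_right_comm, pow_mul, pow_mul, hz x hx, one_pow]
  · have h2 := pow_eq_pow_of_modEq hk1 (hz x hx)
    have h3 : d x ^ a ≠ 0 := pow_ne_zero _ (hd.lin.ne_zero hx)
    simp only [Pi.mul_apply, Pi.pow_apply, Pi.inv_apply]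
    rw [mul_pow, inv_pow, inv_pow, ← pow_mul, ← pow_mul,
      show a * m * (PiSep.deg ρ * a) = a * (a * PiSep.deg ρ * m) by ring, pow_mul (d x) a, h2, pow_one,
      mul_inv_cancel₀ h3]

theorem PiOrd.of_mul (h : PiOrd σ J (f * g)) (hl : Lin J f) (hf : PiOrd σ J f) : PiOrd σ J g :=
  (hf.inv.mul h).congr fun x hx => by
    simp only [Pi.mul_apply, Pi.inv_apply]
    rw [inv_mul_cancel_left₀ (hl.ne_zero hx)]

/-- A linear twist preserving the `σ`-part of determinants is trivial. -/
theorem PiDet.twist_eq_one (h : PiDet σ J (f * l)) (hf : PiDet σ J f) (h1 : f 1 ≠ 0)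
    (hn : IsPiNumber σ (PiSep.deg f)) (hl : Lin J l) (hlo : PiOrd σᶜ J l) : ∀ x ∈ J, l x = 1 := by
  obtain ⟨d, hd, hdo⟩ := hf
  have h3 := PiOrd.of_mul (h.ord (hd.mul_lin hl hd.ch.deg)) hd.lin hdo
  refine (PiOrd.of_pow (fun e => h1 ?_) hn h3).eq_one hlo
  rw [hd.ch.deg, e, Nat.cast_zero]

theorem NI.exists_clifford_twist (hN : NI N J) (hK : NI K J) (hNK : N ≤ K)
    (hi : IsPiNumber σᶜ (N.relIndex K)) (hα : Irr J α) (hd : IsPiNumber σ (PiSep.deg α))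
    (hc : ∀ θ, Irr N θ → ip N α θ ≠ 0 → Sp σ N θ) :
    ∃ ρ ζ l, Irr K ρ ∧ ip K α ρ ≠ 0 ∧ Irr (stab J K ρ) ζ ∧ ip (stab J K ρ) α ζ ≠ 0 ∧
      ip K ζ ρ ≠ 0 ∧ Lin (stab J K ρ) l ∧ PiOrd σᶜ (stab J K ρ) l ∧ Sp σ K (ρ * l⁻¹) := by
  obtain ⟨ρ, hρ, hcρ⟩ := (hα.ch.mono hK.1).exists_const hα.one_ne_zero
  obtain ⟨ζ, hζ, hcζ, hζρ⟩ := hK.clifford_exists hα hρ hcρ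
  have hKS : K ≤ stab J K ρ := hK.le_stab hρ.cls
  have hζd : IsPiNumber σ (PiSep.deg ζ) := by
    have e := (hK.clifford_ind hα hρ hζ hcζ hζρ).1 1 J.one_mem
    rw [ind_one, ← card_mul_relIndex (stab_le (J := J) (N := K) (θ := ρ)), Nat.cast_mul,
      mul_div_cancel_left₀ _ card_ne_zero', hα.ch.deg, hζ.ch.deg] at e
    exact hd.dvd ⟨(stab J K ρ).relIndex J, by rw [mul_comm]; exact_mod_cast e.symm⟩
  obtain ⟨l, hl, hlo, hζl⟩ := hζ.ch.exists_twist hζd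
  refine ⟨ρ, ζ, l, hρ, hcρ, hζ, hcζ, hζρ, hl, hlo, ?_⟩
  have hlK := hl.mono hKS
  have hρl : Irr K (ρ * l⁻¹) := hρ.mul_lin hlK.inv
  have hρd : IsPiNumber σ (PiSep.deg ρ) := hd.dvd (hK.deg_dvd hα hρ hcρ)
  have hρN : Irr N ρ := (hNK |> hN.mono hK.1).irr_restrict hρ hρd hi
  have hsp : Sp σ N ρ := hc ρ hρN (const_trans (hα.ch.mono hK.1) hρ hcρ hNK hρN.ch (by
    rw [hρN.ip_self]; exact one_ne_zero))
  have hcl := (hK.mono stab_le hKS).clifford_inv hζ hρ hζρ hK.stab_inv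
  obtain ⟨e, he⟩ := (hζ.ch.mono hKS).ip_nat hρ.ch
  rw [he] at hcl
  have he0 : e ≠ 0 := fun h => hζρ (by rw [he, h, Nat.cast_zero])
  have heσ : IsPiNumber σ e := hζd.dvd ⟨PiSep.deg ρ, by
    have := hcl 1 K.one_mem
    rw [hζ.ch.deg, hρ.ch.deg] at this
    exact_mod_cast this⟩
  obtain ⟨d, hd'⟩ := hρl.ch.exists_det
  have hpd : PiDet σ K (ρ * l⁻¹) := by
    have h2 : HasDet K (ζ * l⁻¹) (d ^ e) := (hd'.nsmul e).congr (fun x hx => by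
      simp only [Pi.mul_apply, Pi.smul_apply, smul_eq_mul, hcl x hx, mul_assoc]) fun _ _ => rfl
    exact ⟨d, hd', PiOrd.of_pow he0 heσ ((hζl.mono hKS).ord h2)⟩
  have hl1 := (hpd.mono hNK).twist_eq_one hsp.piDet hρ.one_ne_zero hρd (hlK.mono hNK).inv
    ((hlo.mono (hNK.trans hKS)).inv)
  exact (hsp.congr fun x hx => by rw [Pi.mul_apply, hl1 x hx, mul_one]).extend
    (hN.mono hK.1 hNK) hρl.ch hpd

theorem PiOrd.eq_one_of_pi (h : PiOrd σᶜ J l) (hl : Lin J l) {x : G} (hx : x ∈ J)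
    (hxσ : IsPiElt σ x) : l x = 1 := by
  obtain ⟨m, -, hm, h⟩ := h
  exact eq_one_of_coprime (hxσ.coprime hm) (hl.pow_orderOf hx) (h x hx)

theorem Sp.of_conj (h : NI K J) (hα : Irr J α) (hρ : Sp σ K ρ) (hc : ip K α ρ ≠ 0) :
    ∀ θ, Irr K θ → ip K α θ ≠ 0 → Sp σ K θ := fun θ hθ hc' => by
  obtain ⟨y, hy, e⟩ := h.clifford_conj hα hρ.1 hc hθ hc'
  exact (hρ.cj h hy).congr fun x hx => (e x hx).symm

end PiSep

namespace PiSep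

variable {G : Type} [Group G] [Fintype G] {J H K N M L Z T P S R : Subgroup G}
  {f g χ ψ θ ρ κ η ν ν' l d D a c ω α α' β β' : G → ℂ} {σ : Set ℕ}

theorem IPi.exists_sp_aux (hJ : Sep σ J) (n : ℕ) : ∀ (N : Subgroup G) (α : G → ℂ),
    Nat.card J - Nat.card N = n → NI N J → Irr J α → IPi σ J α → IsPiNumber σ (deg α) →
    (∀ θ, Irr N θ → ip N α θ ≠ 0 → Sp σ N θ) →
      ∃ α0, Sp σ J α0 ∧ ∀ x ∈ J, IsPiElt σ x → α x = α0 x := by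
  induction n using Nat.strong_induction_on with
  | _ n ih =>
  intro N α hn hN hα hI hd hc
  by_cases hNJ : N = J
  · subst hNJ
    exact ⟨α, hc α hα (by rw [hα.ip_self]; exact one_ne_zero), fun _ _ _ => rfl⟩
  obtain ⟨K, hK, hNK, hne, ht⟩ := hJ.step_up hN hNJ
  have hlt : Nat.card J - Nat.card K < n := by
    have h1 : Nat.card N < Nat.card K :=
      lt_of_le_of_ne (Subgroup.card_le_of_le hNK) fun e =>
        hne (Subgroup.eq_of_le_of_card_ge hNK e.ge)
    have h2 := Subgroup.card_le_of_le hK.1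
    omega
  rcases ht with ht | ht
  · refine ih _ hlt K α rfl hK hα hI hd fun ρ hρ hcρ => ?_
    obtain ⟨θ, hθ, hcθ⟩ := (hρ.ch.mono hNK).exists_const hρ.one_ne_zero
    exact Sp.over (hN.mono hK.1 hNK) ht
      (hc θ hθ (const_trans (hα.ch.mono hK.1) hρ hcρ hNK hθ.ch hcθ)) hρ hcθ
  · obtain ⟨ρ, ζ, l, hρ, hcρ, hζ, hcζ, hζρ, hl, hlo, hsp⟩ :=
      hN.exists_clifford_twist hK hNK ht hα hd hc
    have hind := (hK.clifford_ind hα hρ hζ hcζ hζρ).1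
    set S := stab J K ρ with hS
    have hSJ : S ≤ J := stab_le
    have hKS : K ≤ S := hK.le_stab hρ.cls
    have hag : ∀ x ∈ J, IsPiElt σ x → α x = ind J S (ζ * l⁻¹) x := fun x hx hxσ => by
      rw [← hind x hx]
      refine ind_congr_pi (fun y hy hyσ => ?_) hxσ
      rw [Pi.mul_apply, Pi.inv_apply, hlo.eq_one_of_pi hl hy hyσ, inv_one, mul_one]
    have hζl : Irr S (ζ * l⁻¹) := hζ.mul_lin hl.inv
    have hI1 := hI.congr hag
    have hα1 : Irr J (ind J S (ζ * l⁻¹)) :=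
      hI1.irr (hζl.ch.ind hSJ) (ind_one_ne_zero hζl.one_ne_zero)
    have h1 := hag 1 J.one_mem (by rw [IsPiElt, orderOf_one]; exact .one)
    obtain ⟨α0, hα0, e⟩ := ih _ hlt K _ rfl hK hα1 hI1 (deg_congr h1 ▸ hd)
      (hsp.of_conj hK hα1 (const_trans (hα1.ch.mono hSJ) hζl (by
        rw [ip_comm, ← ip_ind hSJ hα1.cls, hα1.ip_self]
        exact one_ne_zero) hKS hsp.1.ch (by
        rw [ip_mul_lin (hl.inv.mono hKS)]; exact hζρ)))
    exact ⟨α0, hα0, fun x hx hxσ => (hag x hx hxσ).trans (e x hx hxσ)⟩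

/-- A `σ`-lift of `σ`-degree lying over `σ`-special characters agrees with a `σ`-special character
on `σ`-elements. -/
theorem IPi.exists_sp (hI : IPi σ J α) (hJ : Sep σ J) (hN : NI N J) (hα : Irr J α)
    (hd : IsPiNumber σ (deg α)) (hc : ∀ θ, Irr N θ → ip N α θ ≠ 0 → Sp σ N θ) :
    ∃ α0, Sp σ J α0 ∧ ∀ x ∈ J, IsPiElt σ x → α x = α0 x :=
  IPi.exists_sp_aux hJ _ N α rfl hN hα hI hd hc

/-- An invariant character extending to an irreducible induced character has no proper
inertia overgroup. -/
theorem NI.eq_of_irr_ind {ζ : G → ℂ} (h : NI S R) (hζ : Irr S ζ) (hi : ∀ y ∈ R, ∀ x ∈ S, ζ (y * x * y⁻¹) = ζ x)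
    (hr : Irr R (ind R S ζ)) : R = S := by
  have h1 := hr.ip_self
  have e : ∀ x ∈ S, ind R S ζ x = ((Nat.card S : ℂ)⁻¹ * Nat.card R) * ζ x := fun x hx => by
    rw [h.ind_apply ζ x hx, sm_congr (F := fun y => cj y ζ x) (F' := fun _ => ζ x) fun y hy => hi y hy x hx, sm_const,
      mul_assoc]
  rw [ip_ind h.1 hr.cls, ip_congr (fun _ _ => rfl) (g' := ((Nat.card S : ℂ)⁻¹ * Nat.card R) • ζ) e,
    ip_smul_right, hζ.ip_self, mul_one, inv_mul_eq_one₀ card_ne_zero'] at h1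
  exact (Subgroup.eq_of_le_of_card_ge h.1 (Nat.cast_injective h1).ge).symm

theorem ip_ringHom_ne_zero {τ : ℂ →+* ℂ} (hτ : ∀ x ∈ J, τ (α x) = α x) (h : ip J α ρ ≠ 0) :
    ip J α (fun x => τ (ρ x)) ≠ 0 := by
  rw [← ip_congr hτ fun _ _ => rfl, ip_ringHom]
  exact (map_ne_zero τ).2 h

end PiSep

namespace PiSep

variable {G : Type} [Group G] [Fintype G] {J H K N M L Z T P S R : Subgroup G}
  {f g χ ψ θ ρ κ η ν ν' l d D a c ω α α' β β' : G → ℂ} {σ : Set ℕ}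

/-- An element moving `ρ` to a Galois conjugate normalizes the inertia group of `ρ`. -/
theorem NI.stab_normalizer (h : NI K J) {τ : ℂ →+* ℂ} {y : G} (hy : y ∈ J)
    (e : ∀ x ∈ K, τ (ρ x) = ρ (y * x * y⁻¹)) :
    y ∈ Subgroup.normalizer (stab J K ρ : Set G) := by
  rw [Subgroup.mem_normalizer_iff]
  intro z
  have key : ∀ x ∈ K, z ∈ J → ρ (y * z * y⁻¹ * (y * x * y⁻¹) * (y * z * y⁻¹)⁻¹) =
      τ (ρ (z * x * z⁻¹)) := fun x hx hz => by
    rw [e _ (h.2 z hz x hx)]; congr 1; group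
  rw [h.mem_stab, h.mem_stab]
  refine ⟨fun ⟨h1, h2⟩ => ⟨J.mul_mem (J.mul_mem hy h1) (J.inv_mem hy), fun x hx => ?_⟩,
    fun ⟨h1, h2⟩ => ?_⟩
  · have h3 := key (y⁻¹ * x * y⁻¹⁻¹) (h.2 _ (J.inv_mem hy) x hx) h1
    have h4 : y * (y⁻¹ * x * y⁻¹⁻¹) * y⁻¹ = x := by group
    rw [h2 _ (h.2 _ (J.inv_mem hy) x hx), e _ (h.2 _ (J.inv_mem hy) x hx), h4] at h3
    exact h3
  · have hz : z ∈ J := by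
      have := J.mul_mem (J.mul_mem (J.inv_mem hy) h1) hy
      rwa [show y⁻¹ * (y * z * y⁻¹) * y = z by group] at this
    refine ⟨hz, fun x hx => τ.injective ?_⟩
    rw [← key x hx hz, h2 _ (h.2 y hy x hx), e x hx]

theorem IPi.twist_mem_stab (hI : IPi σ J α) (hJ : Sep σ J) (hα : Irr J α) (hK : NI K J)
    {τ : ℂ →+* ℂ} (hτ : Twist σ (Nat.card G) τ) (hατ : ∀ x ∈ J, τ (α x) = α x) {ζ ζ₁ : G → ℂ}
    (hρ : Irr K ρ) (hζ : Irr (stab J K ρ) ζ) (hcζ : ip (stab J K ρ) α ζ ≠ 0) (hζρ : ip K ζ ρ ≠ 0)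
    (hζ₁ : Sp σ (stab J K ρ) ζ₁) (hag : ∀ x ∈ stab J K ρ, IsPiElt σ x → ζ x = ζ₁ x)
    {y : G} (hy : y ∈ J) (e : ∀ x ∈ K, τ (ρ x) = ρ (y * x * y⁻¹)) : y ∈ stab J K ρ := by
  have hyN := hK.stab_normalizer hy e
  have hind := (hK.clifford_ind (hχ := hα) hρ hζ hcζ hζρ).1
  have hu := fun ζ' hζ' hd hd' => hK.clifford_unique hα hρ hζ hcζ hζρ (ζ' := ζ') hζ' hd hd'
  have hKS : K ≤ stab J K ρ := hK.le_stab hρ.cls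
  set S := stab J K ρ with hS
  have hSJ : S ≤ J := stab_le
  let E : Subgroup G := J ⊓ Subgroup.normalizer (S : Set G)
  have hSE : NI S E := ⟨le_inf hSJ Subgroup.le_normalizer, fun z hz x hx =>
    (Subgroup.mem_normalizer_iff.1 (Subgroup.mem_inf.1 hz).2 x).1 hx⟩
  have hy' : y⁻¹ ∈ E := E.inv_mem (Subgroup.mem_inf.2 ⟨hy, hyN⟩)
  have hEJ : E ≤ J := inf_le_left
  have h1 : ∀ x ∈ S, ζ x = cj y⁻¹ (fun x => τ (ζ x)) x := by
    refine hu _ (hSE.irr_cj hy' (hζ.ringHom τ)) ?_ ?_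
    · rw [ip_cj_of_cls hSE hy' (hα.cls.mono hEJ)]
      exact ip_ringHom_ne_zero (fun x hx => hατ x (hSJ hx)) hcζ
    · have e2 : ∀ x ∈ K, cj y⁻¹ (fun x => τ (ρ x)) x = ρ x := fun x hx => by
        rw [cj, e _ (hK.2 _ (J.inv_mem hy) x hx)]
        congr 1; group
      rw [← ip_congr (fun _ _ => rfl) e2, hK.ip_cj (J.inv_mem hy), ip_ringHom]
      exact (map_ne_zero τ).2 hζρ
  have h2 : ∀ x ∈ S, ζ₁ (y⁻¹ * x * y⁻¹⁻¹) = ζ₁ x := by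
    refine (hζ₁.cj hSE hy').eq_of_pi (hJ.mono hSJ) hζ₁ fun x hx hxσ => ?_
    have hx' := hSE.2 _ hy' x hx
    have hxσ' : IsPiElt σ (y⁻¹ * x * y⁻¹⁻¹) := isPiElt_conj hxσ
    show ζ₁ (y⁻¹ * x * y⁻¹⁻¹) = ζ₁ x
    rw [← hag _ hx' hxσ', ← hag x hx hxσ, h1 x hx]
    exact (hτ.fix hζ.ch hx' hxσ').symm
  have hR := hSE.stab_ni hζ₁.1.cls
  have hRJ : stab E S ζ₁ ≤ J := stab_le.trans hEJ
  have hIR : IPi σ (stab E S ζ₁) (ind (stab E S ζ₁) S ζ₁) :=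
    ((hI.congr fun x hx _ => by rw [← hind x hx, ind_trans hR.1 hRJ ζ x hx]).of_ind hRJ).congr
      fun x _ hxσ => ind_congr_pi hag hxσ
  have := hR.eq_of_irr_ind hζ₁.1 hSE.stab_inv
    (hIR.irr (hζ₁.1.ch.ind hR.1) (ind_one_ne_zero hζ₁.1.one_ne_zero))
  rw [← S.inv_mem_iff, ← this, hSE.mem_stab]
  exact ⟨hy', h2⟩

theorem IPi.sp_aux (h2σ : 2 ∈ σ) (hJ : Sep σ J) {τ : ℂ →+* ℂ} (hτ : Twist σ (Nat.card G) τ)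
    (hI : IPi σ J α) (hα : Irr J α) (hd : IsPiNumber σ (deg α)) (hατ : ∀ x ∈ J, τ (α x) = α x)
    (n : ℕ) : ∀ N : Subgroup G, Nat.card J - Nat.card N = n → NI N J →
    (∀ θ, Irr N θ → ip N α θ ≠ 0 → Sp σ N θ) → Sp σ J α := by
  induction n using Nat.strong_induction_on with
  | _ n ih =>
  intro N hn hN hc
  by_cases hNJ : N = J
  · subst hNJ
    exact hc α hα (by rw [hα.ip_self]; exact one_ne_zero)
  obtain ⟨K, hK, hNK, hne, ht⟩ := hJ.step_up hN hNJ
  have hlt : Nat.card J - Nat.card K < n := by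
    have h1 : Nat.card N < Nat.card K :=
      lt_of_le_of_ne (Subgroup.card_le_of_le hNK) fun e =>
        hne (Subgroup.eq_of_le_of_card_ge hNK e.ge)
    have h2 := Subgroup.card_le_of_le hK.1
    omega
  refine ih _ hlt K rfl hK ?_
  rcases ht with ht | ht
  · intro ρ hρ hcρ
    obtain ⟨θ, hθ, hcθ⟩ := (hρ.ch.mono hNK).exists_const hρ.one_ne_zero
    exact Sp.over (hN.mono hK.1 hNK) ht
      (hc θ hθ (const_trans (hα.ch.mono hK.1) hρ hcρ hNK hθ.ch hcθ)) hρ hcθ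
  · obtain ⟨ρ, ζ, l, hρ, hcρ, hζ, hcζ, hζρ, hl, hlo, hsp⟩ :=
      hN.exists_clifford_twist hK hNK ht hα hd hc
    have hind := (hK.clifford_ind hα hρ hζ hcζ hζρ).1
    have hSJ : stab J K ρ ≤ J := stab_le
    have hKS : K ≤ stab J K ρ := hK.le_stab hρ.cls
    have hζl : Irr (stab J K ρ) (ζ * l⁻¹) := hζ.mul_lin hl.inv
    have hag : ∀ x ∈ stab J K ρ, IsPiElt σ x → ζ x = (ζ * l⁻¹) x := fun x hx hxσ => by
      rw [Pi.mul_apply, Pi.inv_apply, hlo.eq_one_of_pi hl hx hxσ, inv_one, mul_one]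
    have hd' : IsPiNumber σ (deg (ζ * l⁻¹)) := by
      have e := hind 1 J.one_mem
      rw [ind_one, ← card_mul_relIndex hSJ, Nat.cast_mul,
        mul_div_cancel_left₀ _ card_ne_zero', hα.ch.deg, hζ.ch.deg] at e
      rw [← deg_congr (hag 1 (Subgroup.one_mem _) (by rw [IsPiElt, orderOf_one]; exact .one))]
      exact hd.dvd ⟨(stab J K ρ).relIndex J, by rw [mul_comm]; exact_mod_cast e.symm⟩
    have hIS : IPi σ (stab J K ρ) (ζ * l⁻¹) :=
      ((hI.congr fun x hx _ => (hind x hx).symm).of_ind hSJ).congr hag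
    obtain ⟨ζ₁, hζ₁, h1⟩ := hIS.exists_sp (hJ.mono hSJ) (hK.mono hSJ hKS) hζl hd'
      (hsp.of_conj (hK.mono hSJ hKS) hζl (by
        rw [ip_mul_lin (hl.inv.mono hKS)]; exact hζρ))
    obtain ⟨y, hy, e⟩ := hK.clifford_conj hα hρ hcρ (hρ.ringHom τ)
      (ip_ringHom_ne_zero (fun x hx => hατ x (hK.1 hx)) hcρ)
    have hyS := hI.twist_mem_stab hJ hα hK hτ hατ hρ hζ hcζ hζρ hζ₁
      (fun x hx hxσ => (hag x hx hxσ).trans (h1 x hx hxσ)) hy e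
    have hlK := hl.mono hKS
    have h2 : ∀ x ∈ K, (ρ * l⁻¹) x = (ρ * l⁻¹ * (l * l)) x := fun x hx => by
      have h3 := hsp.twist_eq hτ (hJ.mono hK.1) x hx
      have h4 : τ (ρ x) = ρ x := (e x hx).trans ((hK.mem_stab.1 hyS).2 x hx)
      obtain ⟨k, -, hk, hk1⟩ := hlo
      have h5 : τ (l x) = (l x)⁻¹ := hτ.2 _ k hk (hk1 x (hKS hx)) (by
        obtain ⟨c, e⟩ := orderOf_dvd_natCard x
        rw [e, pow_mul, hl.pow_orderOf (hKS hx), one_pow])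
      have h6 := hl.ne_zero (hKS hx)
      simp only [Pi.mul_apply, Pi.inv_apply, _root_.map_mul, map_inv₀, h4, h5, inv_inv] at h3 ⊢
      rw [mul_assoc, inv_mul_cancel_left₀ h6, h3]
    have hl1 := PiDet.twist_eq_one (hsp.piDet.congr h2) hsp.piDet hsp.1.one_ne_zero hsp.2.1
      (hlK.mul hlK) ((hlo.mul hlo).mono hKS)
    have hl2 : ∀ x ∈ K, l x = 1 := PiOrd.eq_one
      ⟨2, two_ne_zero, fun q hq h => (Nat.prime_dvd_prime_iff_eq hq Nat.prime_two).1 h ▸ h2σ,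
        fun x hx => by rw [sq]; exact hl1 x hx⟩ (hlo.mono hKS)
    exact Sp.of_conj hK hα (hsp.congr fun x hx => by
      rw [Pi.mul_apply, Pi.inv_apply, hl2 x hx, inv_one, mul_one]) hcρ

/-- A Galois-stable `σ`-lift of `σ`-degree lying over `σ`-special characters is `σ`-special. -/
theorem IPi.sp (hI : IPi σ J α) (h2σ : 2 ∈ σ) (hJ : Sep σ J) {τ : ℂ →+* ℂ}
    (hτ : Twist σ (Nat.card G) τ) (hN : NI N J) (hα : Irr J α) (hd : IsPiNumber σ (deg α))
    (hατ : ∀ x ∈ J, τ (α x) = α x) (hc : ∀ θ, Irr N θ → ip N α θ ≠ 0 → Sp σ N θ) : Sp σ J α :=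
  IPi.sp_aux h2σ hJ hτ hI hα hd hατ _ N rfl hN hc

end PiSep

namespace PiSep

variable {G : Type} [Group G] [Fintype G] {J H K N M L Z T P S R : Subgroup G}
  {f g χ ψ θ ρ κ η ν ν' l d D a c ω α α' β β' : G → ℂ} {σ : Set ℕ}

/-- `f` is the product of a `σ`-special and a `σᶜ`-special character of `J`. -/
def Fac (σ : Set ℕ) (J : Subgroup G) (f : G → ℂ) : Prop :=
  ∃ α β, Sp σ J α ∧ Sp σᶜ J β ∧ ∀ x ∈ J, f x = α x * β x

theorem NI.fac_const (h : NI N J) (hJ : Sep σ J) {a b μ : G → ℂ} (ha : Sp σ J a) (hb : Sp σᶜ J b)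
    (hμ : Irr N μ) (hc : ip N (a * b) μ ≠ 0) : ∃ a₀ b₀, Sp σ N a₀ ∧ ip N a a₀ ≠ 0 ∧ Sp σᶜ N b₀ ∧
      ip N b b₀ ≠ 0 ∧ ∀ x ∈ N, μ x = a₀ x * b₀ x := by
  obtain ⟨a₀, ha₀, hca, hc⟩ := ip_mul_expand (ha.1.cls.mono h.1) hc
  rw [mul_comm] at hc
  obtain ⟨b₀, hb₀, hcb, hc⟩ := ip_mul_expand (hb.1.cls.mono h.1) hc
  rw [mul_comm] at hc
  have h1 := ha.const h ha₀ hca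
  have h2 := hb.const h hb₀ hcb
  exact ⟨a₀, b₀, h1, hca, h2, hcb, fun x hx =>
    ((h1.irr_mul (hJ.mono h.1) h2).eqOn hμ hc x hx).symm⟩

theorem Fac.of_const (h : NI N J) (hJ : Sep σ J) (hf : Fac σ J θ) {μ : G → ℂ} (hμ : Irr N μ)
    (hc : ip N θ μ ≠ 0) : Fac σ N μ := by
  obtain ⟨a, b, ha, hb, e⟩ := hf
  rw [ip_congr (f' := a * b) (fun x hx => e x (h.1 hx)) fun _ _ => rfl] at hc
  obtain ⟨a₀, b₀, h1, -, h2, -, h3⟩ := h.fac_const hJ ha hb hμ hc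
  exact ⟨a₀, b₀, h1, h2, h3⟩

/-- Factored characters sharing a constituent over a normal subgroup have factors sharing
constituents there. -/
theorem fac_common (h : NI M J) (h' : NI M H) (hJ : Sep σ J) (hH : Sep σ H)
    {a b a' b' : G → ℂ} (ha : Sp σ J a) (hb : Sp σᶜ J b) (ha' : Sp σ H a') (hb' : Sp σᶜ H b')
    (hc : ip M (a * b) (a' * b') ≠ 0) : ∃ a₀ b₀, Sp σ M a₀ ∧ ip M a a₀ ≠ 0 ∧ ip M a' a₀ ≠ 0 ∧
      Sp σᶜ M b₀ ∧ ip M b b₀ ≠ 0 ∧ ip M b' b₀ ≠ 0 := by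
  obtain ⟨μ, hμ, h1, h2⟩ := exists_common ((ha.irr_mul hJ hb).ch.mono h.1)
    ((ha'.irr_mul hH hb').ch.mono h'.1) hc
  obtain ⟨a₀, b₀, h3, h4, h5, h6, h7⟩ := h.fac_const hJ ha hb hμ h1
  obtain ⟨a₁, b₁, k3, k4, k5, k6, k7⟩ := h'.fac_const hH ha' hb' hμ h2
  have hS := (hJ.mono h.1).orth
  obtain ⟨e1, e2⟩ := hS.unique h3 k3 h5 k5 (by
    rw [ip_congr (f := a₀ * b₀) (g := a₁ * b₁) (f' := μ) (g' := μ) (fun x hx => (h7 x hx).symm)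
      fun x hx => (k7 x hx).symm, hμ.ip_self]
    exact one_ne_zero)
  refine ⟨a₀, b₀, h3, h4, ?_, h5, h6, ?_⟩
  · rwa [ip_congr (fun _ _ => rfl) e1]
  · rwa [ip_congr (fun _ _ => rfl) e2]

/-- Common constituents persist on restriction. -/
theorem ip_ne_zero_mono (hf : Ch J f) (hg : Ch J g) (hM : M ≤ J) (h : ip J f g ≠ 0) :
    ip M f g ≠ 0 := by
  obtain ⟨ω, hω, h1, h2⟩ := exists_common hf hg h
  obtain ⟨θ, hθ, h3⟩ := hω.exists_const hM
  have h4 := const_trans hg hω h2 hM hθ.ch h3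
  rw [ip_comm] at h4
  exact const_trans (hf.mono hM) hθ (const_trans hf hω h1 hM hθ.ch h3) le_rfl (hg.mono hM) h4

theorem NI.extension_of_common (hN : NI M N) (hi : IsPiNumber σᶜ (M.relIndex N)) (hJ : Sep σ N)
    {D : Subgroup G} (hMD : M ≤ D) (hDN : D ≤ N) {a b c δ : G → ℂ} (ha : Sp σ N a)
    (hb : Sp σᶜ N b) (hc : Sp σ D c) (hδ : Sp σᶜ D δ) (h : ip D (c * δ) (a * b) ≠ 0) :
    ∀ x ∈ D, a x = c x := by
  have hMD' : NI M D := hN.mono hDN hMD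
  have hD := hJ.mono hDN
  have h1 := ip_ne_zero_mono (hc.irr_mul hD hδ).ch ((ha.irr_mul hJ hb).ch.mono hDN) hMD h
  obtain ⟨a₀, b₀, h2, h3, h4, -⟩ := fac_common hMD' hN hD hJ hc hδ ha hb h1
  have hiD : IsPiNumber σᶜ (M.relIndex D) := hi.dvd ⟨_, (Subgroup.relIndex_mul_relIndex M D N hMD hDN).symm⟩
  have haM := hN.irr_restrict ha.1 ha.2.1 hi
  have hcM := hMD'.irr_restrict hc.1 hc.2.1 hiD
  have e : ∀ x ∈ M, a x = c x := fun x hx =>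
    (haM.eqOn h2.1 h4 x hx).trans (hcM.eqOn h2.1 h3 x hx).symm
  have haD : Irr D a := haM.of_restrict (ha.1.ch.mono hDN) hMD
  exact hMD'.ext_unique haD hc.1 hiD haM e ha.2.1
    (ha.piDet.mono hDN) hc.piDet

end PiSep

namespace PiSep

variable {G : Type} [Group G] [Fintype G] {J H K N M L Z T P S R : Subgroup G}
  {f g χ ψ θ ρ κ η ν ν' l d D a c ω α α' β β' : G → ℂ} {σ : Set ℕ}

theorem Sup.eq_of_le (hs : Sup J N H) (hH : H ≤ J) (h : N ≤ H) : H = J :=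
  le_antisymm hH fun y hy => by
    obtain ⟨z, hz, h1⟩ := hs y hy
    have := H.mul_mem hz (h h1)
    rwa [mul_inv_cancel_left] at this

theorem ip_one_one : ip J (1 : G → ℂ) 1 = 1 := Lin.one.irr.ip_self

/-- A proper subgroup containing a normal subgroup of `σᶜ`-index affords a nontrivial
`σᶜ`-special constituent in the induced trivial character. -/
theorem NI.exists_sp_ind (h : NI M N) (hi : IsPiNumber σᶜ (M.relIndex N)) {D : Subgroup G}
    (hMD : M ≤ D) (hDN : D ≤ N) (hne : D ≠ N) :
    ∃ υ, Sp σᶜ N υ ∧ ip D υ 1 ≠ 0 ∧ ip N υ 1 = 0 := by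
  have h1 : Ch N (ind N D 1) := Ch.one.ind hDN
  have h2 : ip N (ind N D 1) 1 = 1 := by rw [ip_ind hDN Ch.one.cls, ip_one_one]
  have h3 : (ind N D 1 - 1 : G → ℂ) 1 ≠ 0 := by
    rw [Pi.sub_apply, ind_one, Pi.one_apply, mul_one, sub_ne_zero, Ne,
      div_eq_one_iff_eq card_ne_zero', Nat.cast_inj]
    exact fun e => hne (Subgroup.eq_of_le_of_card_ge hDN e.le)
  have h4 := h1.sub Lin.one.irr (by rw [h2]; exact one_ne_zero)
  obtain ⟨υ, hυ, hc⟩ := h4.exists_const h3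
  have h5 : ip N υ 1 = 0 := hυ.ip_eq_zero Lin.one.irr fun e => hc (by
    rw [ip_congr (fun _ _ => rfl) e, ip_sub_left, h2, ip_one_one, sub_self])
  rw [ip_sub_left, ip_comm 1 υ, h5, sub_zero, ip_ind hDN hυ.cls] at hc
  refine ⟨υ, Sp.over h hi (Sp.lin Lin.one PiOrd.one) hυ ?_, by rwa [ip_comm], h5⟩
  exact const_trans (hυ.ch.mono hDN) Lin.one.irr (by rwa [ip_comm]) hMD Ch.one (by
    rw [ip_one_one]; exact one_ne_zero)

theorem supplement_eq_of_compl (hJ : Sep σ J) (hN : NI N J) (hM : NI M J) (hMN : M ≤ N) (hH : H ≤ J)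
    (hMH : M ≤ H) (hs : Sup J N H) (hi : IsPiNumber σᶜ (M.relIndex N)) {γ δ : G → ℂ}
    (hγ : Sp σ H γ) (hδ : Lin H δ) (hδo : PiOrd σᶜ H δ) (hχ : ∀ x ∈ J, ind J H (γ * δ) x = χ x)
    (hI : IPi σ J χ) (hc : ∀ θ, Irr N θ → ip N χ θ ≠ 0 → Fac σ N θ) : H = J := by
  have hNS := hJ.mono hN.1
  by_contra hne
  have hDH : N ⊓ H ≤ H := inf_le_right
  have hDN : N ⊓ H ≤ N := inf_le_left
  have hD : N ⊓ H ≠ N := fun e => hne (hs.eq_of_le hH (by rw [← e]; exact hDH))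
  have hMN' := hM.mono hN.1 hMN
  have hMD : M ≤ N ⊓ H := le_inf hMN hMH
  have hDNI : NI (N ⊓ H) H := hN.inf hH
  obtain ⟨c, hcI, hcγ⟩ := hγ.1.exists_const hDH
  have hcs := hγ.const hDNI hcI hcγ
  have hδD := hδ.mono hDH
  have hcδ : Irr (N ⊓ H) (c * δ) := hcI.mul_lin hδD
  have hα : IPi σ J (ind J H γ) := hI.congr fun x hx hxσ => by
    rw [← hχ x hx]
    refine ind_congr_pi (fun y hy hyσ => ?_) hxσ
    rw [Pi.mul_apply, hδo.eq_one_of_pi hδ hy hyσ, mul_one]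
  have hαJ := hα.irr (hγ.1.ch.ind hH) (ind_one_ne_zero hγ.1.one_ne_zero)
  obtain ⟨a, ha, hac⟩ : ∃ a, Sp σ N a ∧ ∀ x ∈ N ⊓ H, a x = c x := by
    obtain ⟨θ, hθ, h1⟩ := (hcδ.ch.ind hDN).exists_const (ind_one_ne_zero hcδ.one_ne_zero)
    rw [ip_ind hDN hθ.cls] at h1
    obtain ⟨a, b, ha, hb, e⟩ := hc θ hθ (by
      rw [ip_congr (fun x hx => (hχ x (hN.1 hx)).symm) fun _ _ => rfl,
        ip_congr (mackey hs hN hH (hγ.1.mul_lin hδ).cls) fun _ _ => rfl, ip_ind hDN hθ.cls]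
      exact const_trans ((hγ.1.mul_lin hδ).ch.mono hDH) hcδ (by rwa [ip_mul_lin hδD]) le_rfl
        (hθ.ch.mono hDN) h1)
    refine ⟨a, ha, hMN'.extension_of_common hi hNS hMD hDN ha hb hcs
      (Sp.lin hδD (hδo.mono hDH)) ?_⟩
    rwa [ip_congr (g' := a * b) (fun _ _ => rfl) fun x hx => e x (hDN hx)] at h1
  obtain ⟨υ, hυ, hυ1, hυ0⟩ := hMN'.exists_sp_ind hi hMD hDN hD
  have key : ∀ θ, Irr N θ → ip (N ⊓ H) c θ ≠ 0 → ip N (ind J H γ) θ ≠ 0 := fun θ hθ h1 => by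
    rw [ip_congr (mackey hs hN hH hγ.1.cls) fun _ _ => rfl, ip_ind hDN hθ.cls]
    exact const_trans (hγ.1.ch.mono hDH) hcI hcγ le_rfl (hθ.ch.mono hDN) h1
  have haυ : Irr N (a * υ) := ha.irr_mul hNS hυ
  have h1 := key a ha.1 (by
    rw [ip_congr (fun _ _ => rfl) hac, hcI.ip_self]; exact one_ne_zero)
  have h2 := key _ haυ (by
    have h3 : Ch (N ⊓ H) (υ - 1) := (hυ.1.ch.mono hDN).sub Lin.one.irr hυ1
    have h4 : ∀ x ∈ N ⊓ H, (a * υ) x = (c + c * (υ - 1)) x := fun x hx => by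
      simp only [Pi.mul_apply, Pi.add_apply, Pi.sub_apply, Pi.one_apply, hac x hx]; ring
    rw [ip_congr (fun _ _ => rfl) h4, ip_comm]
    exact ip_add_ne_zero hcI.ch (hcI.ch.mul h3) hcI.ch (by rw [hcI.ip_self]; exact one_ne_zero))
  obtain ⟨y, hy, e⟩ := hN.clifford_conj hαJ ha.1 h1 haυ h2
  have h3 := hNS.orth.unique ha (ha.cj hN hy) hυ (Sp.lin Lin.one PiOrd.one) (by
    rw [mul_one, ← ip_congr (fun _ _ => rfl) e, haυ.ip_self]; exact one_ne_zero)
  rw [ip_congr (f' := 1) h3.2 fun _ _ => rfl, ip_one_one] at hυ0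
  exact one_ne_zero hυ0

end PiSep

namespace PiSep

variable {G : Type} [Group G] [Fintype G] {J H K N M L Z T P S R : Subgroup G}
  {f g χ ψ θ ρ κ η ν ν' l d D a c ω α α' β β' : G → ℂ} {σ : Set ℕ}

theorem Lin.eq_of_restrict (h : NI M N) (hi : IsPiNumber σ (M.relIndex N)) {l l' : G → ℂ}
    (hl : Lin N l) (hl' : Lin N l') (ho : PiOrd σᶜ N l) (ho' : PiOrd σᶜ N l')
    (e : ∀ x ∈ M, l x = l' x) : ∀ x ∈ N, l x = l' x := by
  have h1 : PiOrd σ N (l * l'⁻¹) := PiOrd.of_trivOn h (hl.mul hl'.inv) (fun x hx => by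
    rw [Pi.mul_apply, Pi.inv_apply, e x hx, mul_inv_cancel₀ (hl'.ne_zero (h.1 hx))]) hi
  intro x hx
  have h2 := h1.eq_one (ho.mul ho'.inv) x hx
  rwa [Pi.mul_apply, Pi.inv_apply, mul_inv_eq_one₀ (hl'.ne_zero hx)] at h2

/-- Compatible linear characters of a normal subgroup and a supplement glue. -/
theorem Lin.exists_glue (hs : Sup J N H) (hN : NI N J) (hH : H ≤ J) {b δ : G → ℂ} (hb : Lin N b)
    (hδ : Lin H δ) (e : ∀ x ∈ N ⊓ H, b x = δ x) (hi : ∀ y ∈ H, ∀ x ∈ N, b (y * x * y⁻¹) = b x) :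
    ∃ β, Lin J β ∧ ∀ y ∈ H, ∀ x ∈ N, β (y * x) = δ y * b x := by
  choose! F hF hFN using hs
  have key : ∀ y ∈ H, ∀ x ∈ N, δ (F (y * x)) * b ((F (y * x))⁻¹ * (y * x)) = δ y * b x := by
    intro y hy x hx
    have hyx : y * x ∈ J := J.mul_mem (hH hy) (hN.1 hx)
    have h1 := hF _ hyx
    have h2 := hFN _ hyx
    set z := F (y * x) with hz
    have h4 : z⁻¹ * y ∈ H := H.mul_mem (H.inv_mem h1) hy
    have h3 : z⁻¹ * y ∈ N := by
      have := N.mul_mem h2 (N.inv_mem hx)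
      rwa [← mul_assoc, mul_inv_cancel_right] at this
    rw [← mul_assoc, hb.2 _ h3 x hx, e _ (Subgroup.mem_inf.2 ⟨h3, h4⟩), ← mul_assoc,
      ← hδ.2 z h1 _ h4, mul_inv_cancel_left]
  refine ⟨fun y => δ (F y) * b ((F y)⁻¹ * y), ⟨?_, fun x hx y hy => ?_⟩, key⟩
  · have := key 1 H.one_mem 1 N.one_mem
    simpa only [mul_one, hδ.1, hb.1] using this
  · have h1 : x = F x * ((F x)⁻¹ * x) := by group
    have h2 : y = F y * ((F y)⁻¹ * y) := by group
    have hx1 := hF x hx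
    have hx2 := hFN x hx
    have hy1 := hF y hy
    have hy2 := hFN y hy
    set u := F x
    set v := (F x)⁻¹ * x
    set u' := F y
    set v' := (F y)⁻¹ * y
    have h3 : x * y = u * u' * (u'⁻¹ * v * u'⁻¹⁻¹ * v') := by rw [h1, h2]; group
    have h4 : u'⁻¹ * v * u'⁻¹⁻¹ ∈ N := hN.2 _ (hH (H.inv_mem hy1)) _ hx2
    show δ (F (x * y)) * b ((F (x * y))⁻¹ * (x * y)) = δ u * b v * (δ u' * b v')
    rw [h3, key _ (H.mul_mem hx1 hy1) _ (N.mul_mem h4 hy2), hδ.2 _ hx1 _ hy1, hb.2 _ h4 _ hy2,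
      hi _ (H.inv_mem hy1) _ hx2]
    ring

theorem ind_ringHom (τ : ℂ →+* ℂ) (f : G → ℂ) (x : G) :
    τ (ind J H f x) = ind J H (fun x => τ (f x)) x := by
  rw [ind, ind, _root_.map_mul, map_inv₀, map_natCast, sm, sm, map_sum]
  refine congrArg _ (Finset.sum_congr rfl fun y _ => ?_)
  split_ifs with h
  · rfl
  · exact map_zero τ

theorem exists_linear_factor (h2σ : 2 ∈ σ) (hJ : Sep σ J) {τ : ℂ →+* ℂ}
    (hτ : Twist σ (Nat.card G) τ) (hN : NI N J) (hM : NI M J) (hMN : M ≤ N) (hH : H ≤ J)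
    (hMH : M ≤ H) (hs : Sup J N H) (hi : IsPiNumber σ (M.relIndex N)) {γ δ : G → ℂ}
    (hγ : Sp σ H γ) (hδ : Lin H δ) (hδo : PiOrd σᶜ H δ) (hχ : ∀ x ∈ J, ind J H (γ * δ) x = χ x)
    (hI : IPi σ J χ) (hc : ∀ θ, Irr N θ → ip N χ θ ≠ 0 → Fac σ N θ) :
    ∃ β, Lin J β ∧ PiOrd σᶜ J β ∧ (∀ x ∈ H, β x = δ x) ∧ Sp σ J (χ * β⁻¹) := by
  have hNS := hJ.mono hN.1
  have hDH : N ⊓ H ≤ H := inf_le_right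
  have hDN : N ⊓ H ≤ N := inf_le_left
  have hMN' := hM.mono hN.1 hMN
  have hMH' := hM.mono hH hMH
  have hMD : M ≤ N ⊓ H := le_inf hMN hMH
  have hDNI : NI (N ⊓ H) H := hN.inf hH
  have hδs : Sp σᶜ H δ := Sp.lin hδ hδo
  have hγδ := hγ.irr_mul (hJ.mono hH) hδs
  have hχc : Ch J χ := (hγδ.ch.ind hH).congr hχ
  have hχI : Irr J χ := hI.irr hχc (by
    rw [← hχ 1 J.one_mem]; exact ind_one_ne_zero hγδ.one_ne_zero)
  have hb : ∀ θ a b, Irr N θ → ip N χ θ ≠ 0 → Sp σ N a → Sp σᶜ N b → (∀ x ∈ N, θ x = a x * b x) →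
      Lin N b ∧ PiOrd σᶜ N b ∧ ∀ x ∈ M, b x = δ x := by
    intro θ a b hθ h1 ha hb e
    rw [ip_congr (fun x hx => (hχ x (hN.1 hx)).symm) fun _ _ => rfl,
      ip_congr (mackey hs hN hH hγδ.cls) (fun _ _ => rfl), ip_ind hDN hθ.cls] at h1
    have h2 := ip_ne_zero_mono (hγδ.ch.mono hDH) (hθ.ch.mono hDN) hMD h1
    rw [ip_congr (g' := a * b) (fun _ _ => rfl) fun x hx => e x (hMN hx)] at h2
    obtain ⟨-, b₀, -, -, -, h3, h4, h5⟩ := fac_common hMH' hMN' (hJ.mono hH) hNS hγ hδs ha hb h2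
    have hbM := hMN'.irr_restrict hb.1 hb.2.1 (by rwa [compl_compl])
    have h6 := (hδ.mono hMH).irr.eqOn h3.1 h4
    have h7 := hbM.eqOn h3.1 h5
    have h8 : ∀ x ∈ M, b x = δ x := fun x hx => (h7 x hx).trans (h6 x hx).symm
    have h9 : Lin N b := hb.1.ch.lin_of_degree_one ((h8 1 M.one_mem).trans hδ.1)
    exact ⟨h9, hb.piDet.ord h9.hasDet, h8⟩
  obtain ⟨θ, hθ, hcθ⟩ := (hχc.mono hN.1).exists_const hχI.one_ne_zero
  obtain ⟨a, b, ha, hbs, e⟩ := hc θ hθ hcθ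
  obtain ⟨hbl, hbo, hbδ⟩ := hb θ a b hθ hcθ ha hbs e
  have hbD : ∀ x ∈ N ⊓ H, b x = δ x :=
    Lin.eq_of_restrict (hMN'.mono hDN hMD)
      (hi.dvd ⟨_, (Subgroup.relIndex_mul_relIndex M _ N hMD hDN).symm⟩)
      (hbl.mono hDN) (hδ.mono hDH) (hbo.mono hDN) (hδo.mono hDH) hbδ
  have hbi : ∀ y ∈ H, ∀ x ∈ N, b (y * x * y⁻¹) = b x := fun y hy => by
    have hcjs := hbs.cj hN (hH hy)
    have hcl : Lin N (cj y b) := hcjs.1.ch.lin_of_degree_one (by rw [cj_apply_one]; exact hbl.1)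
    exact Lin.eq_of_restrict hMN' hi hcl hbl (hcjs.piDet.ord hcl.hasDet) hbo fun x hx => by
      show b (y * x * y⁻¹) = b x
      rw [hbδ _ (hM.2 y (hH hy) x hx), hbδ x hx, hδ.cls y hy x (hMH hx)]
  obtain ⟨β, hβ, hβe⟩ := Lin.exists_glue hs hN hH hbl hδ hbD hbi
  have hβH : ∀ x ∈ H, β x = δ x := fun x hx => by
    have := hβe x hx 1 N.one_mem
    rwa [mul_one, hbl.1, mul_one] at this
  have hβN : ∀ x ∈ N, β x = b x := fun x hx => by
    have := hβe 1 H.one_mem x hx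
    rwa [one_mul, hδ.1, one_mul] at this
  have hβo : PiOrd σᶜ J β := by
    obtain ⟨m, hm0, hm, h1⟩ := hbo
    obtain ⟨k, hk0, hk, h2⟩ := hδo
    refine ⟨k * m, mul_ne_zero hk0 hm0, hk.mul hm, fun y hy => ?_⟩
    obtain ⟨z, hz, h3⟩ := hs y hy
    rw [show y = z * (z⁻¹ * y) by group, hβe z hz _ h3, mul_pow, pow_mul, h2 z hz, one_pow, one_mul,
      mul_comm k, pow_mul, h1 _ h3, one_pow]
  have hα : ∀ x ∈ J, (χ * β⁻¹) x = ind J H γ x := fun x hx => by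
    have h1 : ind J H (γ * δ) = ind J H (γ * β) := ind_congr fun y hy => by
      rw [Pi.mul_apply, Pi.mul_apply, hβH y hy]
    rw [Pi.mul_apply, Pi.inv_apply, ← hχ x hx, h1, ind_mul hβ.cls x hx,
      mul_inv_cancel_right₀ (hβ.ne_zero hx)]
  have hαI : Irr J (χ * β⁻¹) := hχI.mul_lin hβ.inv
  refine ⟨β, hβ, hβo, hβH, IPi.sp (hI.congr fun x hx hxσ => ?_) h2σ hJ hτ hN hαI ?_ ?_ ?_⟩
  · rw [Pi.mul_apply, Pi.inv_apply, hβo.eq_one_of_pi hβ hx hxσ, inv_one, mul_one]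
  · have h1 := hα 1 J.one_mem
    rw [ind_one, ← card_mul_relIndex hH, Nat.cast_mul, mul_div_cancel_left₀ _ card_ne_zero',
      hαI.ch.deg, hγ.1.ch.deg, ← hs.relIndex_eq hN.1 hH] at h1
    have h2 : deg (χ * β⁻¹) = (N ⊓ H).relIndex N * deg γ := by exact_mod_cast h1
    rw [h2]
    refine IsPiNumber.mul (hi.dvd ⟨M.relIndex (N ⊓ H), ?_⟩) hγ.2.1
    rw [mul_comm, Subgroup.relIndex_mul_relIndex M _ N hMD hDN]
  · intro x hx
    rw [hα x hx, ind_ringHom]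
    exact congrFun (ind_congr (hγ.twist_eq hτ (hJ.mono hH))) x
  · intro ξ hξ h1
    have h2 : Irr N (ξ * b) := hξ.mul_lin hbl
    have h3 : ip N χ (ξ * b) ≠ 0 := by
      rw [← ip_mul_lin hbl] at h1
      rwa [ip_congr (g' := ξ * b) (fun x hx => ?_) fun _ _ => rfl] at h1
      rw [Pi.mul_apply, Pi.mul_apply, Pi.inv_apply, hβN x hx,
        inv_mul_cancel_right₀ (hbl.ne_zero hx)]
    obtain ⟨a', b', ha', hb', e'⟩ := hc _ h2 h3
    obtain ⟨k1, k2, k3⟩ := hb _ a' b' h2 h3 ha' hb' e'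
    have h4 := Lin.eq_of_restrict hMN' hi k1 hbl k2 hbo fun x hx => (k3 x hx).trans (hbδ x hx).symm
    exact ha'.congr fun x hx => by
      have := e' x hx
      rw [Pi.mul_apply, h4 x hx] at this
      exact (mul_right_cancel₀ (hbl.ne_zero hx) this).symm

end PiSep

namespace PiSep

variable {G : Type} [Group G] [Fintype G] {J H K N M L Z T P S R : Subgroup G}
  {f g χ ψ θ ρ κ η ν ν' l d D a c ω α α' β β' : G → ℂ} {σ : Set ℕ}

theorem IPi.of_mul_left (h : IPi σ J (α * β)) (hα : Ch J α) (hα1 : α 1 ≠ 0) : IPi σ J β :=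
  fun x₁ x₂ h₁ h₂ n₁ n₂ e => h (α * x₁) (α * x₂) (hα.mul h₁) (hα.mul h₂) (mul_ne_zero hα1 n₁)
    (mul_ne_zero hα1 n₂) fun y hy hyσ => by
      rw [Pi.mul_apply, Pi.mul_apply, Pi.mul_apply, e y hy hyσ, mul_add]

/-- The complementary special factor of a factored lift is linear. -/
theorem IPi.lin_right (h : IPi σ J (α * β)) (h2 : 2 ∈ σ) (hJ : Sep σ J) (hα : Sp σ J α)
    (hβ : Sp σᶜ J β) : Lin J β ∧ PiOrd σᶜ J β := by
  have h1 := (h.of_mul_left hα.1.ch hα.1.one_ne_zero).deg_eq_one h2 hJ hβ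
  have hl : Lin J β := hβ.1.ch.lin_of_degree_one (by rw [hβ.1.ch.deg, h1, Nat.cast_one])
  exact ⟨hl, hβ.piDet.ord hl.hasDet⟩

theorem exists_linear_factor_of_supplement (h2 : 2 ∈ σ) {τ : ℂ →+* ℂ}
    (hτ : Twist σ (Nat.card G) τ) :
    ∀ (n m : ℕ) (J H N : Subgroup G) (γ δ χ : G → ℂ), H.relIndex J = n → Nat.card N = m →
      Sep σ J → NI N J → H ≤ J → Sup J N H → Sp σ H γ → Lin H δ → PiOrd σᶜ H δ →
      (∀ x ∈ J, ind J H (γ * δ) x = χ x) → IPi σ J χ →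
      (∀ θ, Irr N θ → ip N χ θ ≠ 0 → Fac σ N θ) →
      ∃ β, Lin J β ∧ PiOrd σᶜ J β ∧ (∀ x ∈ H, β x = δ x) ∧ Sp σ J (χ * β⁻¹) := by
  intro n
  induction n using Nat.strong_induction_on with
  | _ n ihn =>
  intro m
  induction m using Nat.strong_induction_on with
  | _ m ihm =>
  rintro J H N γ δ χ hn hm hJ hN hH hs hγ hδ hδo hχ hI hc
  have hγδ := hγ.irr_mul (hJ.mono hH) (Sp.lin hδ hδo)
  by_cases hHJ : H = J
  · subst hHJ
    refine ⟨δ, hδ, hδo, fun _ _ => rfl, hγ.congr fun x hx => ?_⟩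
    rw [Pi.mul_apply, Pi.inv_apply, ← hχ x hx, ind_self hγδ.cls x hx, Pi.mul_apply,
      mul_inv_cancel_right₀ (hδ.ne_zero hx)]
  have hN0 : N ≠ ⊥ := by
    rintro rfl
    exact hHJ (hs.eq_of_le hH bot_le)
  obtain ⟨M, hM, hMN, hne, hi⟩ := (hJ.mono hN.1).step_down hN0 hN
  have hχc : Ch J χ := (hγδ.ch.ind hH).congr hχ
  have hχI : Irr J χ := hI.irr hχc (by
    rw [← hχ 1 J.one_mem]; exact ind_one_ne_zero hγδ.one_ne_zero)
  by_cases hMH : M ≤ H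
  · rcases hi with hi | hi
    · exact exists_linear_factor h2 hJ hτ hN hM hMN hH hMH hs hi hγ hδ hδo hχ hI hc
    · exact absurd (supplement_eq_of_compl hJ hN hM hMN hH hMH hs hi hγ hδ hδo hχ hI hc) hHJ
  have hlt : Nat.card M < m := hm ▸ lt_of_le_of_ne (Subgroup.card_le_of_le hMN) fun h =>
    hne (Subgroup.eq_of_le_of_card_ge hMN h.ge)
  have hcM : ∀ μ, Irr M μ → ip M χ μ ≠ 0 → Fac σ M μ := by
    intro μ hμ h
    obtain ⟨θ, hθ, h1, h3⟩ := exists_over (hχc.mono hN.1).cls hMN h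
    exact Fac.of_const (hM.mono hN.1 hMN) (hJ.mono hN.1) (hc θ hθ h1) hμ h3
  by_cases hMHJ : M ⊔ H = J
  · exact ihm _ hlt J H M γ δ χ hn rfl hJ hM hH (hMHJ ▸ hM.sup_sup hH) hγ hδ hδo hχ hI hcM
  have hJ' : M ⊔ H ≤ J := _root_.sup_le hM.1 hH
  have hHJ' : H ≤ M ⊔ H := le_sup_right
  have hmul := Subgroup.relIndex_mul_relIndex H (M ⊔ H) J hHJ' hJ'
  have hpos : H.relIndex J ≠ 0 := Subgroup.index_ne_zero_of_finite
  have h1 : H.relIndex (M ⊔ H) ≠ 1 := fun h => hMH (le_sup_left.trans (Subgroup.relIndex_eq_one.1 h))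
  have h3 : (M ⊔ H).relIndex J ≠ 1 := fun h => hMHJ (le_antisymm hJ' (Subgroup.relIndex_eq_one.1 h))
  have hlt1 : H.relIndex (M ⊔ H) < n := by
    rw [← hn, ← hmul]
    have h4 : H.relIndex (M ⊔ H) ≠ 0 := fun h => hpos (by rw [← hmul, h, zero_mul])
    have h5 : (M ⊔ H).relIndex J ≠ 0 := fun h => hpos (by rw [← hmul, h, mul_zero])
    exact lt_mul_of_one_lt_right (by omega) (by omega)
  have hlt2 : (M ⊔ H).relIndex J < n := by
    rw [← hn, ← hmul]
    have h4 : H.relIndex (M ⊔ H) ≠ 0 := fun h => hpos (by rw [← hmul, h, zero_mul])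
    have h5 : (M ⊔ H).relIndex J ≠ 0 := fun h => hpos (by rw [← hmul, h, mul_zero])
    exact lt_mul_of_one_lt_left (by omega) (by omega)
  set χ' := ind (M ⊔ H) H (γ * δ) with hχ'
  have hχ'c : Ch (M ⊔ H) χ' := hγδ.ch.ind hHJ'
  have hind : ∀ x ∈ J, ind J (M ⊔ H) χ' x = χ x := fun x hx =>
    (ind_trans hHJ' hJ' _ x hx).trans (hχ x hx)
  have hI' : IPi σ (M ⊔ H) χ' := (hI.congr fun x hx _ => (hind x hx).symm).of_ind hJ'
  have hχ'I : Irr (M ⊔ H) χ' := hI'.irr hχ'c (ind_one_ne_zero hγδ.one_ne_zero)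
  have hχχ' : ip (M ⊔ H) χ χ' ≠ 0 := by
    rw [ip_comm, ← ip_ind hJ' hχI.cls, ip_congr hind (fun _ _ => rfl), hχI.ip_self]
    exact one_ne_zero
  have hM' : NI M (M ⊔ H) := hM.mono hJ' le_sup_left
  obtain ⟨β', hβ', hβ'o, hβ'δ, hγ'⟩ := ihn _ hlt1 _ (M ⊔ H) H M γ δ χ' rfl rfl (hJ.mono hJ')
    hM' hHJ' (hM.sup_sup hH) hγ hδ hδo (fun _ _ => rfl) hI' fun μ hμ h =>
      hcM μ hμ (const_trans (hχc.mono hJ') hχ'I hχχ' le_sup_left hμ.ch h)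
  obtain ⟨β, hβ, hβo, hββ', hα⟩ := ihn _ hlt2 _ J (M ⊔ H) N (χ' * β'⁻¹) β' χ rfl rfl hJ hN hJ'
    (fun y hy => by
      obtain ⟨h, hh, e⟩ := hs y hy
      exact ⟨h, hHJ' hh, e⟩) hγ' hβ' hβ'o (fun x hx => by
      rw [← hind x hx]
      refine congrFun (ind_congr fun y hy => ?_) x
      rw [Pi.mul_apply, Pi.mul_apply, Pi.inv_apply, inv_mul_cancel_right₀ (hβ'.ne_zero hy)]) hI hc
  exact ⟨β, hβ, hβo, fun x hx => (hββ' x (hHJ' hx)).trans (hβ'δ x hx), hα⟩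

/-- The theorem for class functions on subgroups of an ambient group. -/
theorem fac_of_supplement (h2 : 2 ∈ σ) (hJ : Sep σ J) (hN : NI N J) (hH : H ≤ J) (hs : Sup J N H)
    (hψ : Fac σ H ψ) (hχ : ∀ x ∈ J, ind J H ψ x = χ x) (hI : IPi σ J χ)
    (hc : ∀ θ, Irr N θ → ip N χ θ ≠ 0 → Fac σ N θ) :
    Fac σ J χ ∧ ∀ α β γ δ, Sp σ J α → Sp σᶜ J β → (∀ x ∈ J, χ x = α x * β x) →
      Sp σ H γ → Sp σᶜ H δ → (∀ x ∈ H, ψ x = γ x * δ x) → ∀ x ∈ H, β x = δ x := by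
  obtain ⟨τ, hτ⟩ := exists_isTwist σ (Nat.card_pos (α := G)).ne'
  have key : ∀ γ δ, Sp σ H γ → Sp σᶜ H δ → (∀ x ∈ H, ψ x = γ x * δ x) →
      ∃ β, Lin J β ∧ PiOrd σᶜ J β ∧ (∀ x ∈ H, β x = δ x) ∧ Sp σ J (χ * β⁻¹) := by
    intro γ δ hγ hδ e
    have hχ' : ∀ x ∈ J, ind J H (γ * δ) x = χ x := fun x hx =>
      (congrFun (ind_congr fun y hy => (e y hy).symm) x).trans (hχ x hx)
    have hI' : IPi σ H (γ * δ) := (hI.congr fun x hx _ => (hχ' x hx).symm).of_ind hH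
    obtain ⟨hl, ho⟩ := hI'.lin_right h2 (hJ.mono hH) hγ hδ
    exact exists_linear_factor_of_supplement h2 hτ _ _ J H N γ δ χ rfl rfl hJ hN hH hs hγ hl ho
      hχ' hI hc
  have hmul : ∀ β, Lin J β → ∀ x ∈ J, χ x = (χ * β⁻¹) x * β x := fun β hβ x hx => by
    rw [Pi.mul_apply, Pi.inv_apply, inv_mul_cancel_right₀ (hβ.ne_zero hx)]
  refine ⟨?_, fun α β γ δ hα hβ e hγ hδ e' => ?_⟩
  · obtain ⟨γ, δ, hγ, hδ, e⟩ := hψ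
    obtain ⟨β, hβ, hβo, -, hα⟩ := key γ δ hγ hδ e
    exact ⟨_, β, hα, Sp.lin hβ hβo, hmul β hβ⟩
  · obtain ⟨β', hβ', hβo, h1, hα'⟩ := key γ δ hγ hδ e'
    have hβs := Sp.lin hβ' hβo
    have h3 : ip J (α * β) ((χ * β'⁻¹) * β') ≠ 0 := by
      rw [ip_congr (g' := α * β) (fun _ _ => rfl) fun x hx => by
        rw [Pi.mul_apply, ← hmul β' hβ' x hx, e x hx, Pi.mul_apply], (hα.irr_mul hJ hβ).ip_self]
      exact one_ne_zero
    intro x hx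
    rw [← h1 x hx, (hJ.orth.unique hα hα' hβ hβs h3).2 x (hH hx)]

end PiSep

namespace PiSep

variable {G : Type} [Group G] [Fintype G] {J H K N M L Z T P S R : Subgroup G}
  {f g χ ψ θ ρ κ η ν ν' l d D a c ω α α' β β' : G → ℂ} {σ : Set ℕ}

omit [Fintype G] in
theorem ni_iff : NI N J ↔ N ≤ J ∧ (N.subgroupOf J).Normal := by
  refine and_congr_right fun hle => ⟨fun h => ⟨fun n hn g => ?_⟩, fun h g hg n hn => ?_⟩
  · exact h g g.2 n hn
  · exact h.conj_mem ⟨n, hle hn⟩ hn ⟨g, hg⟩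

omit [Fintype G] in
theorem isSubnormalSubgroup_iff : IsSubnormalSubgroup M ↔ SN M ⊤ := by
  constructor
  · rintro ⟨n, c, rfl, h1, h⟩
    rw [← h1]
    have key : ∀ i : Fin (n + 1), SN (c 0) (c i) := fun i => by
      induction i using Fin.induction with
      | zero => exact .refl _
      | succ i ih => exact ih.step (ni_iff.2 (h i))
    exact key _
  · have key : ∀ J, SN M J → ∃ (n : ℕ) (c : Fin (n + 1) → Subgroup G),
        c 0 = M ∧ c (Fin.last n) = J ∧
        ∀ i : Fin n, c i.castSucc ≤ c i.succ ∧ ((c i.castSucc).subgroupOf (c i.succ)).Normal := by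
      intro J h
      induction h with
      | refl => exact ⟨0, fun _ => M, rfl, rfl, fun i => i.elim0⟩
      | @step K J h1 h ih =>
        obtain ⟨n, c, h0, hl, hc⟩ := ih
        refine ⟨n + 1, Fin.snoc c J, ?_, ?_, fun i => ?_⟩
        · rw [← Fin.castSucc_zero, Fin.snoc_castSucc, h0]
        · rw [Fin.snoc_last]
        · induction i using Fin.lastCases with
          | last =>
            rw [Fin.snoc_castSucc, Fin.succ_last, Fin.snoc_last, hl]
            exact ni_iff.1 h
          | cast i =>
            rw [Fin.snoc_castSucc, Fin.succ_castSucc, Fin.snoc_castSucc]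
            exact hc i
    exact key ⊤

theorem _root_.IsPiSeparable.sep (h : IsPiSeparable σ G) : Sep σ (⊤ : Subgroup G) := by
  obtain ⟨n, c, h0, h1, h⟩ := h
  rw [← h1]
  have key : ∀ i : Fin (n + 1), Sep σ (c i) := fun i => by
    induction i using Fin.induction with
    | zero => rw [h0]; exact .bot
    | succ i ih =>
      obtain ⟨h2, h3, h4⟩ := h i
      exact ih.step (ni_iff.2 ⟨h2, h3⟩) h4
  exact key _

theorem isCharacter_iff : IsCharacter G f ↔ Ch (⊤ : Subgroup G) f :=
  ⟨fun h => isCharacter_comap (⊤ : Subgroup G).subtype h, fun h =>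
    isCharacter_comap (Subgroup.topEquiv (G := G)).symm.toMonoidHom h⟩

theorem ip_top : ip (⊤ : Subgroup G) f g = bip f g := by
  rw [ip_eq, Subgroup.card_top]
  simp [bip]

theorem isIrrChar_iff_irr : IsIrrChar G f ↔ Irr (⊤ : Subgroup G) f := by
  rw [isIrrChar_iff, irr_iff, isCharacter_iff, ip_top]

theorem isConstituent_iff (hχ : Ch J χ) :
    IsConstituent (fun x : J => f x) (fun x : J => χ x) ↔ Irr J f ∧ ip J χ f ≠ 0 := by
  refine and_congr_right fun hf => ⟨?_, fun h => ⟨_, Or.inr (hχ.sub hf h), ?_⟩⟩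
  · rintro ⟨ξ, hξ, e⟩
    have h1 : ip J χ f = 1 + bip ξ fun x : J => f x := by
      rw [← (show Irr J f from hf).ip_self, ip, e, bip_add_left]
      rfl
    have h2 : ∃ n : ℕ, bip ξ (fun x : J => f x) = n := by
      rcases hξ with rfl | hξ
      · exact ⟨0, by simp [bip]⟩
      · have h3 := isCharacter_iff.1 hξ
        have h4 := isCharacter_iff.1 (show Irr J f from hf).ch
        rw [← ip_top]
        exact h3.ip_nat h4
    obtain ⟨n, hn⟩ := h2
    rw [h1, hn]
    exact_mod_cast (by omega : 1 + n ≠ 0)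
  · funext x
    simp

theorem hasPiDetOrder_iff : HasPiDetOrder σ J (fun x : J => f x) ↔ PiDet σ J f := by
  constructor
  · rintro ⟨V, hV, ho⟩
    refine ⟨fun x => if h : x ∈ J then LinearMap.det (V.ρ ⟨x, h⟩) else 0, ?_,
      orderOf fun g : J => LinearMap.det (V.ρ g), ?_, ho, fun x hx => ?_⟩
    · obtain ⟨n, ρ, h1, h2⟩ := hasDetOn_of_rep V.ρ
      exact ⟨n, ρ, fun x => (hV x).trans (h1 x), fun x => by
        rw [← h2]
        exact dif_pos x.2⟩
    · refine (orderOf_pos_iff.2 (isOfFinOrder_iff_pow_eq_one.2 ⟨Nat.card J, Nat.card_pos, ?_⟩)).ne'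
      funext g
      rw [Pi.pow_apply, ← map_pow, ← map_pow, pow_card_eq_one', map_one, map_one, Pi.one_apply]
    · beta_reduce
      rw [dif_pos hx]
      exact congrFun (pow_orderOf_eq_one fun g : J => LinearMap.det (V.ρ g)) ⟨x, hx⟩
  · rintro ⟨d, ⟨n, ρ, h1, h2⟩, m, hm, hσ, h3⟩
    let s : Representation ℂ J (Fin n → ℂ) :=
      (Matrix.toLinAlgEquiv' :
        Matrix (Fin n) (Fin n) ℂ ≃ₐ[ℂ] _).toAlgHom.toRingHom.toMonoidHom.comp ρ
    refine ⟨FDRep.of s, fun x => (h1 x).trans (Matrix.trace_toLin'_eq (ρ x)).symm,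
      hσ.dvd (orderOf_dvd_of_pow_eq_one (funext fun x => ?_))⟩
    have h4 : LinearMap.det ((FDRep.of s).ρ x) = (ρ x).det := LinearMap.det_toLin' (ρ x)
    rw [Pi.pow_apply, h4, ← h2, h3 x x.2, Pi.one_apply]

omit [Fintype G] in
theorem exists_extension (θ : J → ℂ) : ∃ f : G → ℂ, θ = fun x : J => f x :=
  ⟨fun x => if h : x ∈ J then θ ⟨x, h⟩ else 0, funext fun x => by
    beta_reduce
    rw [dif_pos x.2]⟩

theorem isPiSpecial_iff : IsPiSpecial σ G f ↔ Sp σ (⊤ : Subgroup G) f := by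
  unfold IsPiSpecial Sp
  rw [isIrrChar_iff_irr]
  refine and_congr_right fun hf => and_congr ?_ ?_
  · constructor
    · rintro ⟨n, h1, h2⟩
      rw [hf.ch.deg] at h1
      rwa [Nat.cast_injective h1]
    · exact fun h => ⟨_, hf.ch.deg, h⟩
  · refine forall_congr' fun M => ?_
    rw [isSubnormalSubgroup_iff]
    refine forall_congr' fun _ => ⟨fun h θ hθ hc => ?_, fun h θ hc => ?_⟩
    · exact hasPiDetOrder_iff.1 (h _ ((isConstituent_iff (hf.ch.mono le_top)).2 ⟨hθ, hc⟩))
    · obtain ⟨θ', rfl⟩ := exists_extension θ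
      obtain ⟨h1, h2⟩ := (isConstituent_iff (hf.ch.mono le_top)).1 hc
      exact hasPiDetOrder_iff.2 (h θ' h1 h2)

theorem isPiSpecial_subgroup_iff : IsPiSpecial σ J (fun x : J => f x) ↔ Sp σ J f := by
  rw [isPiSpecial_iff]
  have h : (⊤ : Subgroup J).map J.subtype = J := by
    rw [← MonoidHom.range_eq_map, Subgroup.range_subtype]
  constructor
  · intro h1
    rw [← h]
    exact Sp.map (p := J.subtype) h1
  · intro h1
    rw [← h] at h1
    exact h1.of_map

theorem isPiFactored_iff : IsPiFactored σ J (fun x : J => f x) ↔ Fac σ J f := by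
  constructor
  · rintro ⟨α, β, hα, hβ, e⟩
    obtain ⟨α, rfl⟩ := exists_extension α
    obtain ⟨β, rfl⟩ := exists_extension β
    exact ⟨α, β, isPiSpecial_subgroup_iff.1 hα, isPiSpecial_subgroup_iff.1 hβ, fun x hx =>
      congrFun e ⟨x, hx⟩⟩
  · rintro ⟨α, β, hα, hβ, e⟩
    exact ⟨_, _, isPiSpecial_subgroup_iff.2 hα, isPiSpecial_subgroup_iff.2 hβ,
      funext fun x => e x x.2⟩

theorem isPiFactored_iff_top : IsPiFactored σ G f ↔ Fac σ (⊤ : Subgroup G) f := by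
  unfold IsPiFactored Fac
  simp only [isPiSpecial_iff, Subgroup.mem_top, true_imp_iff, funext_iff, Pi.mul_apply]

theorem indChar_eq : indChar H (fun x : H => f x) = ind ⊤ H f := by
  funext g
  rw [indChar, ind, sm_eq]
  simp

theorem _root_.IsLiftOfPi.ipi {φ : G → ℂ} (h : IsLiftOfPi σ G χ φ) (hφ : IsIPiChar σ G φ) :
    IPi σ (⊤ : Subgroup G) χ := by
  intro x₁ x₂ h₁ h₂ n₁ n₂ e
  refine hφ.2 ⟨piRestrict σ x₁, piRestrict σ x₂, ⟨x₁, isCharacter_iff.2 h₁, ?_, rfl⟩,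
    ⟨x₂, isCharacter_iff.2 h₂, ?_, rfl⟩, ?_⟩
  · rintro rfl; exact n₁ rfl
  · rintro rfl; exact n₂ rfl
  · rw [← h.2]
    funext y
    rw [Pi.add_apply]
    unfold piRestrict
    split_ifs with hy
    · exact e y (Subgroup.mem_top y) hy
    · rw [add_zero]

omit [Fintype G] in
theorem sup_of_sup_eq_top (hN : N.Normal) (h : N ⊔ H = ⊤) : Sup ⊤ N H := fun y _ => by
  have hy : y ∈ H ⊔ N := by rw [sup_comm, h]; exact Subgroup.mem_top y
  obtain ⟨a, ha, n, hn, rfl⟩ := Subgroup.mem_sup_of_normal_right.1 hy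
  exact ⟨a, ha, by simpa using hn⟩

end PiSep

/-- **Theorem (Statement 16).** Let `π` be a set of primes with `2 ∈ π` and let `G` be a
finite `π`-separable group.  Let `χ ∈ Irr(G)` be a lift of `φ ∈ I_π(G)`.  Suppose `ψ` is
a `π`-factored irreducible character of a subgroup `H` inducing `χ`, and suppose `N ⊴ G`
is such that all irreducible constituents of `χ_N` are `π`-factored and `G = NH`.  Then
`χ` is `π`-factored and the `π'`-special factor of `χ` restricts (irreducibly) to the
`π'`-special factor of `ψ`. -/
theorem factored_of_induced_from_supplement
    (π : Set ℕ) (h2 : 2 ∈ π)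
    (G : Type) [Group G] [Fintype G] (hG : IsPiSeparable π G)
    (χ φ : G → ℂ) (hφ : IsIPiChar π G φ) (hlift : IsLiftOfPi π G χ φ)
    (H : Subgroup G) (ψ : ↥H → ℂ) (hψirr : IsIrrChar ↥H ψ)
    (hψfac : IsPiFactored π ↥H ψ) (hind : indChar H ψ = χ)
    (N : Subgroup G) (hN : N.Normal)
    (hconst : ∀ θ : ↥N → ℂ, IsConstituent θ (resChar N χ) → IsPiFactored π ↥N θ)
    (hNH : N ⊔ H = ⊤) :
    IsPiFactored π G χ ∧
      ∀ α β : G → ℂ, IsPiSpecial π G α → IsPiSpecial πᶜ G β → χ = α * β →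
        ∀ γ δ : ↥H → ℂ, IsPiSpecial π ↥H γ → IsPiSpecial πᶜ ↥H δ → ψ = γ * δ →
          resChar H β = δ := by
  obtain ⟨ψ, rfl⟩ := PiSep.exists_extension ψ
  have hχ := (PiSep.isCharacter_iff.1 hlift.1.1).mono (H := N) le_top
  obtain ⟨h1, h3⟩ := PiSep.fac_of_supplement h2 hG.sep
    (PiSep.ni_iff.2 ⟨le_top, inferInstance⟩ : PiSep.NI N ⊤) le_top
    (PiSep.sup_of_sup_eq_top hN hNH) (PiSep.isPiFactored_iff.1 hψfac)
    (fun x _ => by rw [← PiSep.indChar_eq, hind]) (hlift.ipi hφ) fun θ hθ hc =>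
      PiSep.isPiFactored_iff.1 (hconst _ ((PiSep.isConstituent_iff hχ).2 ⟨hθ, hc⟩))
  refine ⟨PiSep.isPiFactored_iff_top.2 h1, fun α β hα hβ e γ δ hγ hδ e' => ?_⟩
  obtain ⟨γ, rfl⟩ := PiSep.exists_extension γ
  obtain ⟨δ, rfl⟩ := PiSep.exists_extension δ
  funext x
  exact h3 α β γ δ (PiSep.isPiSpecial_iff.1 hα) (PiSep.isPiSpecial_iff.1 hβ)
    (fun x _ => congrFun e x) (PiSep.isPiSpecial_subgroup_iff.1 hγ)
    (PiSep.isPiSpecial_subgroup_iff.1 hδ) (fun x hx => congrFun e' ⟨x, hx⟩) x x.2
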